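/- There exists a real number p₀ with 2.57 < p₀ < 2.58 such that for all real p: if 1 < p ≤ 2 or p ≥ p₀ then Δ(D_p) = 4^{−1/p}·(1 + τ_p)/(1 − τ_p), and if 2 ≤ p ≤ p₀ then Δ(D_p) = (1/2)·(2^p − 1)^{1/p}; here τ_p ∈ [0,1) is determined by 2(1 − τ_p)^p = 1 + τ_p^p. -/

import Mathlib

open scoped Pointwise

/-- The open Minkowski ball `D_p = {(x,y) : |x|^p + |y|^p < 1}` in `ℝ²`. -/
def ballD (p : ℝ) : Set (ℝ × ℝ) :=
  {v : ℝ × ℝ | |v.1| ^ p + |v.2| ^ p < 1}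

/-- The Minkowski curve `C_p = {(x,y) : |x|^p + |y|^p = 1}`, the boundary of `D_p`. -/
def curveC (p : ℝ) : Set (ℝ × ℝ) :=
  {v : ℝ × ℝ | |v.1| ^ p + |v.2| ^ p = 1}

/-- The lattice (ℤ-span) generated by two vectors `a b : ℝ²`. -/
def latticeSet (a b : ℝ × ℝ) : Set (ℝ × ℝ) :=
  {v : ℝ × ℝ | ∃ m n : ℤ, v = (m : ℝ) • a + (n : ℝ) • b}

/-- The determinant of the 2×2 matrix with rows `a` and `b`. -/
def det2 (a b : ℝ × ℝ) : ℝ := a.1 * b.2 - a.2 * b.1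

/-- A lattice with basis `a, b` is admissible for `D` if it meets `D` at most in `0`. -/
def IsAdmissible (D : Set (ℝ × ℝ)) (a b : ℝ × ℝ) : Prop :=
  latticeSet a b ∩ D ⊆ {0}

/-- The critical determinant `Δ(D)`: the infimum of covolumes `|det(a,b)|` over all
full-rank lattices `ℤa + ℤb` admissible for `D` (with value `∞` if none exists). -/
noncomputable def criticalDet (D : Set (ℝ × ℝ)) : ENNReal :=
  sInf {d : ENNReal | ∃ a b : ℝ × ℝ, LinearIndependent ℝ ![a, b] ∧
    IsAdmissible D a b ∧ d = ENNReal.ofReal |det2 a b|}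

noncomputable section

namespace Mk

/-! Fixed point scale factors `Kn = 2 ^ n`. -/
local notation "K37" => 137438953472
local notation "K39" => 549755813888
local notation "K44" => 17592186044416
local notation "K40" => 1099511627776
local notation "K41" => 2199023255552
local notation "K80" => 1208925819614629174706176

section
open Real

/-- the `p`-norm -/
def nrm (p : ℝ) (v : ℝ × ℝ) : ℝ := (|v.1| ^ p + |v.2| ^ p) ^ (1 / p)

lemma nrm_base_nonneg (p : ℝ) (v : ℝ × ℝ) : 0 ≤ |v.1| ^ p + |v.2| ^ p := by positivity

lemma nrm_nonneg (p : ℝ) (v : ℝ × ℝ) : 0 ≤ nrm p v := rpow_nonneg (nrm_base_nonneg p v) _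

lemma nrm_add {p : ℝ} (hp : 1 < p) (v w : ℝ × ℝ) : nrm p (v + w) ≤ nrm p v + nrm p w := by
  have := Lp_add_le (Finset.univ : Finset (Fin 2)) ![v.1, v.2] ![w.1, w.2] hp.le
  simpa [nrm, Fin.sum_univ_two] using this

lemma nrm_smul {p : ℝ} (hp : 1 < p) (c : ℝ) (v : ℝ × ℝ) : nrm p (c • v) = |c| * nrm p v := by
  have hp0 : p ≠ 0 := by linarith
  simp only [nrm, Prod.smul_fst, Prod.smul_snd, smul_eq_mul, abs_mul]
  rw [mul_rpow (abs_nonneg _) (abs_nonneg _), mul_rpow (abs_nonneg _) (abs_nonneg _),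
    ← mul_add, mul_rpow (by positivity) (by positivity), ← rpow_mul (abs_nonneg _)]
  rw [mul_one_div_cancel hp0, rpow_one]

lemma nrm_neg {p : ℝ} (hp : 1 < p) (v : ℝ × ℝ) : nrm p (-v) = nrm p v := by
  have := nrm_smul hp (-1) v
  simpa using this

lemma nrm_rpow {p : ℝ} (hp : 1 < p) (v : ℝ × ℝ) : nrm p v ^ p = |v.1| ^ p + |v.2| ^ p := by
  rw [nrm, ← rpow_mul (nrm_base_nonneg p v), one_div_mul_cancel (by linarith), rpow_one]

lemma nrm_eq_one {p : ℝ} (hp : 1 < p) (v : ℝ × ℝ) :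
    nrm p v = 1 ↔ |v.1| ^ p + |v.2| ^ p = 1 := by
  rw [← nrm_rpow hp v]
  constructor
  · intro h; rw [h, one_rpow]
  · intro h
    have := (rpow_left_inj (nrm_nonneg p v) zero_le_one (by linarith : p ≠ 0)).1
      (by rw [h, one_rpow])
    exact this

lemma nrm_lt_one {p : ℝ} (hp : 1 < p) (v : ℝ × ℝ) :
    nrm p v < 1 ↔ |v.1| ^ p + |v.2| ^ p < 1 := by
  rw [← nrm_rpow hp v]
  have := rpow_lt_rpow_iff (nrm_nonneg p v) zero_le_one (by linarith : 0 < p)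
  rw [one_rpow] at this
  exact this.symm

lemma abs_fst_le {p : ℝ} (hp : 1 < p) (v : ℝ × ℝ) : |v.1| ≤ nrm p v := by
  have h : |v.1| ^ p ≤ nrm p v ^ p := by
    rw [nrm_rpow hp]; have : 0 ≤ |v.2| ^ p := by positivity
    linarith
  exact (rpow_le_rpow_iff (abs_nonneg _) (nrm_nonneg p v) (by linarith)).1 h

lemma abs_snd_le {p : ℝ} (hp : 1 < p) (v : ℝ × ℝ) : |v.2| ≤ nrm p v := by
  have h : |v.2| ^ p ≤ nrm p v ^ p := by
    rw [nrm_rpow hp]; have : 0 ≤ |v.1| ^ p := by positivity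
    linarith
  exact (rpow_le_rpow_iff (abs_nonneg _) (nrm_nonneg p v) (by linarith)).1 h

lemma nrm_pos {p : ℝ} (hp : 1 < p) {v : ℝ × ℝ} (hv : v ≠ 0) : 0 < nrm p v := by
  rcases (nrm_nonneg p v).lt_or_eq with h | h
  · exact h
  · exfalso; apply hv
    have h1 := abs_fst_le hp v
    have h2 := abs_snd_le hp v
    rw [← h] at h1 h2
    ext
    · simpa using h1
    · simpa using h2

lemma continuous_nrm {p : ℝ} (hp : 1 < p) : Continuous (nrm p) := by
  unfold nrm
  have h0 : 0 ≤ p := by linarith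
  have h1 : (0:ℝ) ≤ 1 / p := by positivity
  refine Continuous.rpow_const ?_ (fun _ => Or.inr h1)
  refine Continuous.add ?_ ?_
  · exact Continuous.rpow_const (by fun_prop) (fun _ => Or.inr h0)
  · exact Continuous.rpow_const (by fun_prop) (fun _ => Or.inr h0)

/-- inscribed lattice hexagon -/
def Hex (p : ℝ) (a b : ℝ × ℝ) : Prop := nrm p a = 1 ∧ nrm p b = 1 ∧ nrm p (b - a) = 1

lemma Hex.step {p : ℝ} (hp : 1 < p) {a b : ℝ × ℝ} (h : Hex p a b) (m n : ℝ) (hn : 0 ≤ n)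
    (hmn : n ≤ m) : m ≤ nrm p (m • a + n • b) := by
  obtain ⟨ha, hb, hc⟩ := h
  have e : (m + n) • a = (m • a + n • b) + (-n) • (b - a) := by
    ext <;> simp <;> ring
  have h1 := nrm_add hp (m • a + n • b) ((-n) • (b - a))
  rw [← e, nrm_smul hp, nrm_smul hp, ha, hc, abs_of_nonneg (by linarith), abs_neg,
    abs_of_nonneg hn] at h1
  linarith

lemma Hex.swap {p : ℝ} (hp : 1 < p) {a b : ℝ × ℝ} (h : Hex p a b) : Hex p b a := by
  obtain ⟨ha, hb, hc⟩ := h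
  refine ⟨hb, ha, ?_⟩
  rw [← neg_sub, nrm_neg hp, hc]

lemma Hex.rot {p : ℝ} (hp : 1 < p) {a b : ℝ × ℝ} (h : Hex p a b) : Hex p b (b - a) := by
  obtain ⟨ha, hb, hc⟩ := h
  refine ⟨hb, hc, ?_⟩
  have : b - a - b = -a := by abel
  rw [this, nrm_neg hp, ha]

lemma Hex.quad {p : ℝ} (hp : 1 < p) {a b : ℝ × ℝ} (h : Hex p a b) (m n : ℝ) (hn : 0 ≤ n)
    (hm : 0 ≤ m) : max m n ≤ nrm p (m • a + n • b) := by
  rcases le_total n m with hh | hh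
  · rw [max_eq_left hh]; exact h.step hp m n hn hh
  · rw [max_eq_right hh, add_comm]; exact (h.swap hp).step hp n m hm hh

lemma Hex.adm {p : ℝ} (hp : 1 < p) {a b : ℝ × ℝ} (h : Hex p a b) (m n : ℤ)
    (hmn : ¬ (m = 0 ∧ n = 0)) : 1 ≤ nrm p ((m : ℝ) • a + (n : ℝ) • b) := by
  wlog hn : 0 ≤ n generalizing m n with H
  · have := H (-m) (-n) (by omega) (by omega)
    rw [← nrm_neg hp]
    convert this using 2
    push_cast
    simp only [neg_smul, neg_add]
  rcases le_or_gt 0 m with hm | hm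
  · refine le_trans ?_ (h.quad hp m n (by exact_mod_cast hn) (by exact_mod_cast hm))
    rcases Nat.eq_zero_or_pos m.toNat with h0 | h0
    · refine le_trans ?_ (le_max_right _ _)
      exact_mod_cast (by omega : (1:ℤ) ≤ n)
    · refine le_trans ?_ (le_max_left _ _)
      exact_mod_cast (by omega : (1:ℤ) ≤ m)
  · -- m < 0
    rcases le_or_gt (-m) n with h1 | h1
    · -- m a + n b = (-m)(b-a) + (n+m) b
      have e : (m : ℝ) • a + (n : ℝ) • b = ((n + m : ℤ) : ℝ) • b + ((-m : ℤ) : ℝ) • (b - a) := by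
        push_cast; ext <;> simp <;> ring
      rw [e]
      refine le_trans ?_ ((h.rot hp).quad hp _ _ (by exact_mod_cast (by omega : (0:ℤ) ≤ -m))
        (by exact_mod_cast (by omega : (0:ℤ) ≤ n + m)))
      refine le_trans ?_ (le_max_right _ _)
      exact_mod_cast (by omega : (1:ℤ) ≤ -m)
    · -- m a + n b = n (b-a) + (-(m+n)) (-a)
      have e : (m : ℝ) • a + (n : ℝ) • b
          = ((n : ℤ) : ℝ) • (b - a) + ((-(m + n) : ℤ) : ℝ) • (-a) := by
        push_cast; ext <;> simp <;> ring
      rw [e]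
      have hx : Hex p (b - a) (-a) := by
        have := (h.rot hp).rot hp
        have e2 : b - a - b = -a := by abel
        rwa [e2] at this
      refine le_trans ?_ (hx.quad hp _ _ (by exact_mod_cast (by omega : (0:ℤ) ≤ -(m+n)))
        (by exact_mod_cast hn))
      refine le_trans ?_ (le_max_right _ _)
      exact_mod_cast (by omega : (1:ℤ) ≤ -(m + n))

/-- existence of the hexagon through a given boundary point -/
lemma exists_hex {p : ℝ} (hp : 1 < p) (a : ℝ × ℝ) (ha : nrm p a = 1) :
    ∃ b, Hex p a b ∧ 0 < det2 a b := by
  set j : ℝ × ℝ := (-a.2, a.1) with hj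
  have ha0 : 0 < a.1 ^ 2 + a.2 ^ 2 := by
    by_contra hcon
    have h1 : a.1 = 0 := by nlinarith [sq_nonneg a.1, sq_nonneg a.2]
    have h2 : a.2 = 0 := by nlinarith [sq_nonneg a.1, sq_nonneg a.2]
    have : a = 0 := by ext <;> simp [h1, h2]
    rw [this] at ha
    have hz : nrm p (0 : ℝ × ℝ) = 0 := by
      have := nrm_smul hp 0 (0 : ℝ × ℝ)
      simpa using this
    rw [hz] at ha; norm_num at ha
  set g : ℝ → ℝ × ℝ := fun θ => cos θ • a + sin θ • j with hg
  have hg0 : ∀ θ, g θ ≠ 0 := by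
    intro θ h0
    have h1 : (g θ).1 = 0 := by rw [h0]; rfl
    have h2 : (g θ).2 = 0 := by rw [h0]; rfl
    simp only [hg, hj, Prod.fst_add, Prod.snd_add, Prod.smul_fst, Prod.smul_snd, smul_eq_mul] at h1 h2
    have hs := sin_sq_add_cos_sq θ
    have : (cos θ * a.1 + sin θ * -a.2) ^ 2 + (cos θ * a.2 + sin θ * a.1) ^ 2
      = (sin θ ^ 2 + cos θ ^ 2) * (a.1 ^ 2 + a.2 ^ 2) := by ring
    rw [h1, h2, hs] at this
    nlinarith
  have hgc : Continuous g := by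
    simp only [hg]; fun_prop
  set u : ℝ → ℝ × ℝ := fun θ => (nrm p (g θ))⁻¹ • g θ with hu
  have huc : Continuous u := by
    refine Continuous.smul (Continuous.inv₀ ((continuous_nrm hp).comp hgc) ?_) hgc
    intro θ; exact (nrm_pos hp (hg0 θ)).ne'
  have hu1 : ∀ θ, nrm p (u θ) = 1 := by
    intro θ
    have := nrm_pos hp (hg0 θ)
    simp only [hu]
    rw [nrm_smul hp, abs_of_pos (by positivity), inv_mul_cancel₀ this.ne']
  have hf : ContinuousOn (fun θ => nrm p (u θ - a)) (Set.Icc 0 Real.pi) :=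
    ((continuous_nrm hp).comp (huc.sub continuous_const)).continuousOn
  have hu0 : u 0 = a := by simp [hu, hg, ha]
  have hupi : u Real.pi = -a := by simp [hu, hg, nrm_neg hp, ha]
  have hiv := intermediate_value_Icc pi_pos.le hf
  have h1m : (1:ℝ) ∈ Set.Icc (nrm p (u 0 - a)) (nrm p (u Real.pi - a)) := by
    rw [hu0, hupi]
    have hz : nrm p (a - a) = 0 := by
      have := nrm_smul hp 0 (0 : ℝ × ℝ)
      simpa using this
    have h2 : nrm p (-a - a) = 2 := by
      have e : -a - a = (-2 : ℝ) • a := by ext <;> simp <;> ring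
      rw [e, nrm_smul hp, ha]; norm_num
    rw [hz, h2]; constructor <;> norm_num
  obtain ⟨θ, hθ, hθ1⟩ := hiv h1m
  refine ⟨u θ, ⟨ha, hu1 θ, hθ1⟩, ?_⟩
  have hne0 : θ ≠ 0 := by
    rintro rfl
    simp only [hu0] at hθ1
    have := nrm_smul hp 0 (0 : ℝ × ℝ)
    simp at this
    simp [this] at hθ1
  have hnepi : θ ≠ Real.pi := by
    rintro rfl
    simp only [hupi] at hθ1
    have e : -a - a = (-2 : ℝ) • a := by ext <;> simp <;> ring
    rw [e, nrm_smul hp, ha] at hθ1; norm_num at hθ1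
  have hs : 0 < sin θ := sin_pos_of_pos_of_lt_pi
    (lt_of_le_of_ne hθ.1 (Ne.symm hne0)) (lt_of_le_of_ne hθ.2 hnepi)
  have : det2 a (u θ) = (nrm p (g θ))⁻¹ * (sin θ * (a.1 ^ 2 + a.2 ^ 2)) := by
    simp only [det2, hu, hg, hj, Prod.fst_add, Prod.snd_add, Prod.smul_fst, Prod.smul_snd, smul_eq_mul]
    ring
  rw [this]
  have := nrm_pos hp (hg0 θ)
  positivity
end

section
open Real

lemma det2_add_right (a b c : ℝ × ℝ) : det2 a (b + c) = det2 a b + det2 a c := by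
  simp [det2]; ring
lemma det2_smul_right (a b : ℝ × ℝ) (t : ℝ) : det2 a (t • b) = t * det2 a b := by
  simp [det2]; ring
lemma det2_smul_left (a b : ℝ × ℝ) (t : ℝ) : det2 (t • a) b = t * det2 a b := by
  simp [det2]; ring
lemma det2_self (a : ℝ × ℝ) : det2 a a = 0 := by
  simp [det2]; ring

lemma det2_ne_zero_of_li {a b : ℝ × ℝ} (h : LinearIndependent ℝ ![a, b]) : det2 a b ≠ 0 := by
  intro h0
  rw [LinearIndependent.pair_iff] at h
  unfold det2 at h0
  have h1 := h b.2 (-a.2) (by ext <;> simp <;> linarith)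
  have h2 := h (-b.1) (a.1) (by ext <;> simp <;> linarith)
  have h3 := h 1 0 (by ext <;> simp <;> [linarith [h2.2]; linarith [h1.2]])
  exact one_ne_zero h3.1

lemma li_of_det2 {a b : ℝ × ℝ} (h : det2 a b ≠ 0) : LinearIndependent ℝ ![a, b] := by
  rw [LinearIndependent.pair_iff]
  intro s t hst
  have e1 : s * a.1 + t * b.1 = 0 := by simpa using congrArg Prod.fst hst
  have e2 : s * a.2 + t * b.2 = 0 := by simpa using congrArg Prod.snd hst
  unfold det2 at h
  constructor
  · have : s * (a.1 * b.2 - a.2 * b.1) = 0 := by linear_combination b.2 * e1 - b.1 * e2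
    exact (mul_eq_zero.1 this).resolve_right h
  · have : t * (a.1 * b.2 - a.2 * b.1) = 0 := by linear_combination a.1 * e2 - a.2 * e1
    exact (mul_eq_zero.1 this).resolve_right h

lemma lattice_lower {p : ℝ} (hp : 1 < p) (e f : ℝ × ℝ) (hli : LinearIndependent ℝ ![e, f])
    (hadm : IsAdmissible (ballD p) e f) :
    ∃ a b, Hex p a b ∧ 0 < det2 a b ∧ det2 a b ≤ |det2 e f| := by
  have hd := det2_ne_zero_of_li hli
  set d := det2 e f with hdd
  have hdpos : 0 < |d| := abs_pos.2 hd
  let V : ℤ × ℤ → ℝ × ℝ := fun mn => (mn.1 : ℝ) • e + (mn.2 : ℝ) • f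
  have hVdet1 : ∀ mn, det2 (V mn) f = mn.1 * d := by
    intro mn; simp [V, det2, hdd]; ring
  have hVdet2 : ∀ mn, det2 e (V mn) = mn.2 * d := by
    intro mn; simp [V, det2, hdd]; ring
  have hV0 : ∀ mn, mn ≠ 0 → V mn ≠ 0 := by
    intro mn h h0
    apply h
    have h1 := hVdet1 mn; have h2 := hVdet2 mn
    rw [h0] at h1 h2
    simp [det2, hd] at h1 h2
    ext <;> simp [h1, h2]
  have hV1 : ∀ mn, mn ≠ 0 → 1 ≤ nrm p (V mn) := by
    intro mn h
    by_contra hlt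
    push Not at hlt
    have : V mn ∈ ({0} : Set (ℝ × ℝ)) := hadm ⟨⟨mn.1, mn.2, rfl⟩, (nrm_lt_one hp _).1 hlt⟩
    exact hV0 mn h this
  have hdetle : ∀ u w : ℝ × ℝ, |det2 u w| ≤ 2 * nrm p u * nrm p w := by
    intro u w
    have a1 := abs_fst_le hp u; have a2 := abs_snd_le hp u
    have b1 := abs_fst_le hp w; have b2 := abs_snd_le hp w
    have := abs_sub (u.1 * w.2) (u.2 * w.1)
    rw [abs_mul, abs_mul] at this
    have h1 : |u.1| * |w.2| ≤ nrm p u * nrm p w :=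
      mul_le_mul a1 b2 (abs_nonneg _) (nrm_nonneg _ _)
    have h2 : |u.2| * |w.1| ≤ nrm p u * nrm p w :=
      mul_le_mul a2 b1 (abs_nonneg _) (nrm_nonneg _ _)
    unfold det2; linarith
  set R := nrm p (V (1, 0)) with hR
  let S : Set (ℤ × ℤ) := {mn | mn ≠ 0 ∧ nrm p (V mn) ≤ R}
  have hSfin : S.Finite := by
    obtain ⟨N, hN⟩ := exists_nat_gt (2 * R * (nrm p e + nrm p f) / |d|)
    have hN' : 2 * R * (nrm p e + nrm p f) < N * |d| := by
      rwa [div_lt_iff₀ hdpos] at hN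
    apply Set.Finite.subset (Set.finite_Icc ((-(N:ℤ), -(N:ℤ)) : ℤ × ℤ) ((N:ℤ), (N:ℤ)))
    intro mn hmn
    obtain ⟨-, hmn⟩ := hmn
    have hRn : 0 ≤ R := nrm_nonneg _ _
    have he := nrm_nonneg p e
    have hf := nrm_nonneg p f
    have h1 : |(mn.1:ℝ)| ≤ N := by
      have := hdetle (V mn) f
      rw [hVdet1, abs_mul] at this
      by_contra hc; push Not at hc
      have h3 : (N:ℝ) * |d| < |(mn.1:ℝ)| * |d| := mul_lt_mul_of_pos_right hc hdpos
      nlinarith [mul_le_mul_of_nonneg_right hmn hf, mul_nonneg hRn he]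
    have h2 : |(mn.2:ℝ)| ≤ N := by
      have := hdetle e (V mn)
      rw [hVdet2, abs_mul] at this
      by_contra hc; push Not at hc
      have h3 : (N:ℝ) * |d| < |(mn.2:ℝ)| * |d| := mul_lt_mul_of_pos_right hc hdpos
      nlinarith [mul_le_mul_of_nonneg_right hmn he, mul_nonneg hRn hf]
    rw [abs_le] at h1 h2
    obtain ⟨h1a, h1b⟩ := h1
    obtain ⟨h2a, h2b⟩ := h2
    refine ⟨⟨?_, ?_⟩, ⟨?_, ?_⟩⟩
    · exact_mod_cast h1a
    · exact_mod_cast h2a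
    · exact_mod_cast h1b
    · exact_mod_cast h2b
  have hSne : S.Nonempty := ⟨(1, 0), by simp, le_refl _⟩
  obtain ⟨mn, hmnS, hmin⟩ := Set.exists_min_image S (fun mn => nrm p (V mn)) hSfin hSne
  have hmin' : ∀ k, k ≠ 0 → nrm p (V mn) ≤ nrm p (V k) := by
    intro k hk
    by_cases hkR : nrm p (V k) ≤ R
    · exact hmin k ⟨hk, hkR⟩
    · push Not at hkR; exact hmnS.2.trans hkR.le
  obtain ⟨m, n⟩ := mn
  have hmn0 := hmnS.1
  have hg : IsCoprime m n := by
    rw [Int.isCoprime_iff_gcd_eq_one]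
    have hgpos : 0 < Int.gcd m n := by
      apply Nat.pos_of_ne_zero
      intro h
      rw [Int.gcd_eq_zero_iff] at h
      apply hmn0; ext <;> simp [h.1, h.2]
    obtain ⟨m', hm'⟩ := Int.gcd_dvd_left m n
    obtain ⟨n', hn'⟩ := Int.gcd_dvd_right m n
    set g := Int.gcd m n
    have hk0 : ((m', n') : ℤ × ℤ) ≠ 0 := by
      intro h
      apply hmn0
      rw [Prod.mk_eq_zero] at h
      rw [hm', hn', h.1, h.2]; simp
    have hs : V (m, n) = (g : ℝ) • V (m', n') := by
      have e1 : (m:ℝ) = g * m' := by exact_mod_cast hm'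
      have e2 : (n:ℝ) = g * n' := by exact_mod_cast hn'
      ext <;> simp [V, e1, e2] <;> ring
    have h1 := hmin' _ hk0
    rw [hs, nrm_smul hp] at h1
    have h2 := nrm_pos hp (hV0 _ hk0)
    rw [Nat.abs_cast] at h1
    have h3 : (g : ℝ) ≤ 1 := by
      by_contra hc; push Not at hc; nlinarith
    have h4 : g ≤ 1 := by exact_mod_cast h3
    omega
  obtain ⟨u, w, huw⟩ := hg
  obtain ⟨k, hk⟩ : ∃ k : ℤ × ℤ, det2 (V (m, n)) (V k) = |d| := by
    have huw' : (u:ℝ) * m + w * n = 1 := by exact_mod_cast huw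
    rcases abs_choice d with h | h
    · refine ⟨(-w, u), ?_⟩
      rw [h]; simp only [V, det2, hdd, Prod.fst_add, Prod.snd_add, Prod.smul_fst, Prod.smul_snd, smul_eq_mul]
      push_cast
      linear_combination (e.1 * f.2 - e.2 * f.1) * huw'
    · refine ⟨(w, -u), ?_⟩
      rw [h]; simp only [V, det2, hdd, Prod.fst_add, Prod.snd_add, Prod.smul_fst, Prod.smul_snd, smul_eq_mul]
      push_cast
      linear_combination -(e.1 * f.2 - e.2 * f.1) * huw'
  set v := V (m, n) with hv
  set μ := nrm p v with hμ
  have hμ1 : 1 ≤ μ := hV1 _ hmn0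
  have hμ0 : 0 < μ := by linarith
  set a : ℝ × ℝ := μ⁻¹ • v with ha
  have hna : nrm p a = 1 := by
    rw [ha, nrm_smul hp, abs_of_pos (by positivity)]
    exact inv_mul_cancel₀ hμ0.ne'
  have hva : v = μ • a := by rw [ha, smul_smul, mul_inv_cancel₀ hμ0.ne', one_smul]
  obtain ⟨b, hhex, hD⟩ := exists_hex hp a hna
  refine ⟨a, b, hhex, hD, ?_⟩
  set D := det2 a b
  by_contra hlt
  push Not at hlt
  set w1 : ℝ × ℝ := μ⁻¹ • V k with hw1
  have hdw : det2 a w1 = |d| / μ ^ 2 := by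
    rw [ha, hw1, det2_smul_left, det2_smul_right, hk]; field_simp
  set lam := |d| / μ ^ 2 / D with hlam
  have hlam0 : 0 < lam := by positivity
  have hlam1 : lam < 1 := by
    rw [hlam, div_lt_one hD]
    refine lt_of_le_of_lt ?_ hlt
    apply div_le_self (abs_nonneg d); nlinarith
  set mu0 := det2 w1 b / D with hmu0
  have hw1e : w1 = lam • b + mu0 • a := by
    have e1 : lam * D = det2 a w1 := by rw [hlam, hdw]; field_simp
    have e2 : mu0 * D = det2 w1 b := by rw [hmu0]; field_simp
    simp only [D, det2] at e1 e2
    have hD' : a.1 * b.2 - a.2 * b.1 ≠ 0 := hD.ne'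
    ext
    · simp only [Prod.fst_add, Prod.smul_fst, smul_eq_mul]
      apply mul_right_cancel₀ hD'
      linear_combination -b.1 * e1 - a.1 * e2
    · simp only [Prod.snd_add, Prod.smul_snd, smul_eq_mul]
      apply mul_right_cancel₀ hD'
      linear_combination -b.2 * e1 - a.2 * e2
  set j : ℤ := -⌊mu0 + lam⌋ with hj
  set t := mu0 + j with ht
  have ht1 : -lam ≤ t := by
    have := Int.floor_le (mu0 + lam)
    rw [ht, hj]; push_cast; linarith
  have ht2 : t < 1 - lam := by
    have := Int.lt_floor_add_one (mu0 + lam)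
    rw [ht, hj]; push_cast; linarith
  have hnrm : nrm p (lam • b + t • a) < 1 := by
    obtain ⟨ha1, hb1, hc1⟩ := hhex
    rcases le_total 0 t with h0 | h0
    · have := nrm_add hp (lam • b) (t • a)
      rw [nrm_smul hp, nrm_smul hp, hb1, ha1, abs_of_pos hlam0, abs_of_nonneg h0] at this
      linarith
    · have e1 : lam • b + t • a = (lam + t) • b + (-t) • (b - a) := by
        ext <;> simp <;> ring
      have := nrm_add hp ((lam + t) • b) ((-t) • (b - a))
      rw [nrm_smul hp, nrm_smul hp, hb1, hc1, abs_of_nonneg (by linarith),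
        abs_of_nonneg (by linarith), ← e1] at this
      linarith
  set K : ℤ × ℤ := k + (j * m, j * n) with hK
  have hVK : V K = μ • (lam • b + t • a) := by
    have e1 : V K = V k + (j : ℝ) • v := by
      ext <;> simp [V, hK, hv] <;> ring
    have e2 : V k = μ • w1 := by rw [hw1, smul_smul, mul_inv_cancel₀ hμ0.ne', one_smul]
    rw [e1, e2, hw1e, hva, ht]
    ext <;> simp <;> ring
  have hK0 : K ≠ 0 := by
    intro h
    have h1 : det2 v (V K) = |d| := by
      rw [hVK, det2_smul_right, hva, det2_smul_left, det2_add_right, det2_smul_right,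
        det2_smul_right, det2_self, hlam]
      change μ * (μ * (|d| / μ ^ 2 / D * D + _)) = _
      field_simp
      ring
    rw [h] at h1
    have : V 0 = 0 := by simp [V]
    rw [this] at h1
    simp [det2] at h1
    exact hdpos.ne h1
  have h1 := hmin' K hK0
  rw [hVK, nrm_smul hp, abs_of_pos hμ0] at h1
  have : μ * nrm p (lam • b + t • a) < μ * 1 := by
    apply mul_lt_mul_of_pos_left hnrm hμ0
  have h2 : μ ≤ μ * nrm p (lam • b + t • a) := h1
  linarith

lemma hex_admissible {p : ℝ} (hp : 1 < p) {a b : ℝ × ℝ} (h : Hex p a b) :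
    IsAdmissible (ballD p) a b := by
  rintro v ⟨⟨m, n, rfl⟩, hv⟩
  by_contra h0
  have hmn : ¬ (m = 0 ∧ n = 0) := by
    rintro ⟨rfl, rfl⟩; apply h0; simp
  have h1 := h.adm hp m n hmn
  have h2 := (nrm_lt_one hp _).2 hv
  linarith

/-- Reduction of the critical determinant to hexagonal configurations. -/
lemma criticalDet_eq {p Δ : ℝ} (hp : 1 < p)
    (hex : ∃ a b, Hex p a b ∧ 0 < det2 a b ∧ det2 a b = Δ)
    (hmin : ∀ a b, Hex p a b → 0 < det2 a b → Δ ≤ det2 a b) :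
    criticalDet (ballD p) = ENNReal.ofReal Δ := by
  apply le_antisymm
  · obtain ⟨a, b, hab, h0, h⟩ := hex
    apply sInf_le
    refine ⟨a, b, li_of_det2 h0.ne', hex_admissible hp hab, ?_⟩
    rw [abs_of_pos h0, h]
  · apply le_sInf
    rintro d ⟨e, f, hli, hadm, rfl⟩
    obtain ⟨a, b, hab, h0, hle⟩ := lattice_lower hp e f hli hadm
    exact ENNReal.ofReal_le_ofReal ((hmin a b hab h0).trans hle)
end

section
open Real

lemma hsd_abs {p : ℝ} (hp : 1 < p) (x : ℝ) :
    HasStrictDerivAt (fun x : ℝ => |x| ^ p) (p * |x| ^ (p - 2) * x) x := by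
  have h := (contDiff_norm_rpow (E := ℝ) hp).contDiffAt (x := x) |>.hasStrictDerivAt (by norm_num)
  have h2 := (hasDerivAt_norm_rpow x hp).deriv
  rw [h2] at h
  simpa using h

lemma abs_pow_mul {p x : ℝ} (hp : 1 < p) (hx : 0 ≤ x) : |x| ^ (p - 2) * x = x ^ (p - 1) := by
  rcases hx.eq_or_lt with rfl | h
  · rw [zero_rpow (by linarith)]; simp
  · rw [abs_of_pos h]
    have : p - 1 = (p - 2) + 1 := by ring
    rw [this, rpow_add h, rpow_one]

/-- minimality of a hexagonal configuration -/
def IsMin (p : ℝ) (a b : ℝ × ℝ) : Prop :=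
  Hex p a b ∧ 0 < det2 a b ∧ ∀ a' b', Hex p a' b' → 0 < det2 a' b' → det2 a b ≤ det2 a' b'

lemma lagrange {p : ℝ} (hp : 1 < p) {a b : ℝ × ℝ} (h : IsMin p a b)
    (ha1 : 0 ≤ a.1) (ha2 : 0 ≤ a.2) (hb1 : 0 ≤ b.1) (hb2 : 0 ≤ b.2) (hc1 : b.1 ≤ a.1)
    (hc2 : a.2 ≤ b.2) :
    (a.1 ^ (p-1) * (b.2 - a.2) ^ (p-1) + a.2 ^ (p-1) * (a.1 - b.1) ^ (p-1)) *
      (a.1 * b.1 ^ (p-1) + a.2 * b.2 ^ (p-1)) =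
    (b.1 ^ (p-1) * (b.2 - a.2) ^ (p-1) + b.2 ^ (p-1) * (a.1 - b.1) ^ (p-1)) *
      (b.1 * a.1 ^ (p-1) + b.2 * a.2 ^ (p-1)) := by
  obtain ⟨hex, h0, hmin⟩ := h
  let x0 : (ℝ × ℝ) × (ℝ × ℝ) := (a, b)
  let f : Fin 3 → (ℝ × ℝ) × (ℝ × ℝ) → ℝ := ![fun x => |x.1.1| ^ p + |x.1.2| ^ p,
    fun x => |x.2.1| ^ p + |x.2.2| ^ p,
    fun x => |x.1.1 - x.2.1| ^ p + |x.2.2 - x.1.2| ^ p]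
  let φ : (ℝ × ℝ) × (ℝ × ℝ) → ℝ := fun x => det2 x.1 x.2
  have d11 : HasStrictFDerivAt (fun x : (ℝ × ℝ) × (ℝ × ℝ) => x.1.1)
      ((ContinuousLinearMap.fst ℝ ℝ ℝ).comp (ContinuousLinearMap.fst ℝ (ℝ×ℝ) (ℝ×ℝ))) x0 :=
    ((ContinuousLinearMap.fst ℝ ℝ ℝ).comp (ContinuousLinearMap.fst ℝ (ℝ×ℝ) (ℝ×ℝ))).hasStrictFDerivAt
  have d12 : HasStrictFDerivAt (fun x : (ℝ × ℝ) × (ℝ × ℝ) => x.1.2)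
      ((ContinuousLinearMap.snd ℝ ℝ ℝ).comp (ContinuousLinearMap.fst ℝ (ℝ×ℝ) (ℝ×ℝ))) x0 :=
    ((ContinuousLinearMap.snd ℝ ℝ ℝ).comp (ContinuousLinearMap.fst ℝ (ℝ×ℝ) (ℝ×ℝ))).hasStrictFDerivAt
  have d21 : HasStrictFDerivAt (fun x : (ℝ × ℝ) × (ℝ × ℝ) => x.2.1)
      ((ContinuousLinearMap.fst ℝ ℝ ℝ).comp (ContinuousLinearMap.snd ℝ (ℝ×ℝ) (ℝ×ℝ))) x0 :=
    ((ContinuousLinearMap.fst ℝ ℝ ℝ).comp (ContinuousLinearMap.snd ℝ (ℝ×ℝ) (ℝ×ℝ))).hasStrictFDerivAt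
  have d22 : HasStrictFDerivAt (fun x : (ℝ × ℝ) × (ℝ × ℝ) => x.2.2)
      ((ContinuousLinearMap.snd ℝ ℝ ℝ).comp (ContinuousLinearMap.snd ℝ (ℝ×ℝ) (ℝ×ℝ))) x0 :=
    ((ContinuousLinearMap.snd ℝ ℝ ℝ).comp (ContinuousLinearMap.snd ℝ (ℝ×ℝ) (ℝ×ℝ))).hasStrictFDerivAt
  have g0 := ((hsd_abs hp (x0.1.1)).comp_hasStrictFDerivAt x0 d11).add
    ((hsd_abs hp (x0.1.2)).comp_hasStrictFDerivAt x0 d12)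
  have g1 := ((hsd_abs hp (x0.2.1)).comp_hasStrictFDerivAt x0 d21).add
    ((hsd_abs hp (x0.2.2)).comp_hasStrictFDerivAt x0 d22)
  have g2 := ((hsd_abs hp (x0.1.1 - x0.2.1)).comp_hasStrictFDerivAt x0 (d11.sub d21)).add
    ((hsd_abs hp (x0.2.2 - x0.1.2)).comp_hasStrictFDerivAt x0 (d22.sub d12))
  have gφ := (d11.mul d22).sub (d12.mul d21)
  have hextr : IsLocalExtrOn φ {x | ∀ i, f i x = f i x0} x0 := by
    left
    have hcont : Continuous φ := by
      unfold φ det2; fun_prop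
    have hev : ∀ᶠ x in nhds x0, 0 < φ x := hcont.continuousAt.eventually (lt_mem_nhds h0)
    have hev' := hev.filter_mono (nhdsWithin_le_nhds (s := {x | ∀ i, f i x = f i x0}))
    unfold IsMinFilter
    filter_upwards [hev', self_mem_nhdsWithin] with x hx hxS
    obtain ⟨e1, e2, e3⟩ := hex
    rw [nrm_eq_one hp] at e1 e2 e3
    refine hmin x.1 x.2 ⟨?_, ?_, ?_⟩ hx
    · rw [nrm_eq_one hp, ← e1]; exact hxS 0
    · rw [nrm_eq_one hp, ← e2]; exact hxS 1
    · rw [nrm_eq_one hp, ← e3]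
      have := hxS 2
      simp only [f, x0] at this
      simp only [Prod.fst_sub, Prod.snd_sub]
      rw [abs_sub_comm x.2.1, abs_sub_comm b.1]
      exact this
  obtain ⟨Λ, Λ0, hne, hsum⟩ := hextr.exists_multipliers_of_hasStrictFDerivAt
    (f' := ![_, _, _]) (by
      intro i; fin_cases i
      · exact g0
      · exact g1
      · exact g2) gφ
  have ev : ∀ v : (ℝ × ℝ) × (ℝ × ℝ), ((∑ i, Λ i • (![_, _, _] : Fin 3 → StrongDual ℝ ((ℝ × ℝ) × (ℝ × ℝ))) i) + Λ0 • _) v = (0 : StrongDual ℝ ((ℝ × ℝ) × (ℝ × ℝ))) v :=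
    fun v => congrArg (fun L : StrongDual ℝ ((ℝ × ℝ) × (ℝ × ℝ)) => L v) hsum
  have q1 := ev ((1, 0), (0, 0))
  have q2 := ev ((0, 1), (0, 0))
  have q3 := ev ((0, 0), (1, 0))
  have q4 := ev ((0, 0), (0, 1))
  simp [Fin.sum_univ_three, x0] at q1 q2 q3 q4
  have eA1 := abs_pow_mul hp ha1
  have eA2 := abs_pow_mul hp ha2
  have eB1 := abs_pow_mul hp hb1
  have eB2 := abs_pow_mul hp hb2
  have eC1 := abs_pow_mul hp (sub_nonneg.2 hc1)
  have eC2 := abs_pow_mul hp (sub_nonneg.2 hc2)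
  simp only [mul_assoc] at q1 q2 q3 q4
  rw [eA1, eC1] at q1
  rw [eA2, eC2] at q2
  rw [eB1, eC1] at q3
  rw [eB2, eC2] at q4
  have posA : a.1 ^ (p-1) ≠ 0 ∨ a.2 ^ (p-1) ≠ 0 := by
    by_contra hcon
    push Not at hcon
    have hq : p - 1 ≠ 0 := by linarith
    rw [rpow_eq_zero ha1 hq, rpow_eq_zero ha2 hq] at hcon
    simp [det2, hcon.1, hcon.2] at h0
  have posB : b.1 ^ (p-1) ≠ 0 ∨ b.2 ^ (p-1) ≠ 0 := by
    by_contra hcon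
    push Not at hcon
    have hq : p - 1 ≠ 0 := by linarith
    rw [rpow_eq_zero hb1 hq, rpow_eq_zero hb2 hq] at hcon
    simp [det2, hcon.1, hcon.2] at h0
  set A1 := a.1 ^ (p-1)
  set A2 := a.2 ^ (p-1)
  set B1 := b.1 ^ (p-1)
  set B2 := b.2 ^ (p-1)
  set C1 := (a.1 - b.1) ^ (p-1)
  set C2 := (b.2 - a.2) ^ (p-1)
  have hp0 : p ≠ 0 := by linarith
  have r1 : (Λ 2 * p) * (C1 * A2 + C2 * A1) + Λ0 * (b.2 * A2 + b.1 * A1) = 0 := by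
    linear_combination A2 * q1 - A1 * q2
  have r2 : (Λ 2 * p) * (C1 * B2 + C2 * B1) + Λ0 * (a.2 * B2 + a.1 * B1) = 0 := by
    linear_combination -B2 * q3 + B1 * q4
  by_cases hz : Λ 2 = 0 ∧ Λ0 = 0
  · exfalso
    obtain ⟨z1, z2⟩ := hz
    rw [z1, z2] at q1 q2 q3 q4
    simp [hp0] at q1 q2 q3 q4
    have hΛ0 : Λ 0 = 0 := by tauto
    have hΛ1 : Λ 1 = 0 := by tauto
    apply hne
    rw [Prod.mk_eq_zero]
    refine ⟨?_, z2⟩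
    ext i; fin_cases i <;> simp [hΛ0, hΛ1, z1]
  · have h1 : ∀ M : ℝ, Λ 2 * p * M = 0 → Λ0 * M = 0 → M = 0 := by
      intro M hM1 hM2
      by_contra hM
      apply hz
      constructor
      · have := (mul_eq_zero.1 hM1).resolve_right hM
        exact (mul_eq_zero.1 this).resolve_right hp0
      · exact (mul_eq_zero.1 hM2).resolve_right hM
    have := h1 ((A1 * C2 + A2 * C1) * (a.1 * B1 + a.2 * B2) - (B1 * C2 + B2 * C1) * (b.1 * A1 + b.2 * A2))
      (by linear_combination (a.1 * B1 + a.2 * B2) * r1 - (b.1 * A1 + b.2 * A2) * r2)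
      (by linear_combination -(C1 * B2 + C2 * B1) * r1 + (C1 * A2 + C2 * A1) * r2)
    linarith

lemma exists_min {p : ℝ} (hp : 1 < p) : ∃ a b, IsMin p a b := by
  let K : Set ((ℝ × ℝ) × (ℝ × ℝ)) := {x | Hex p x.1 x.2 ∧ 0 ≤ det2 x.1 x.2}
  have hn := continuous_nrm hp
  have hclosed : IsClosed K := by
    have h1 : IsClosed {x : (ℝ × ℝ) × (ℝ × ℝ) | nrm p x.1 = 1} :=
      isClosed_eq (hn.comp continuous_fst) continuous_const
    have h2 : IsClosed {x : (ℝ × ℝ) × (ℝ × ℝ) | nrm p x.2 = 1} :=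
      isClosed_eq (hn.comp continuous_snd) continuous_const
    have h3 : IsClosed {x : (ℝ × ℝ) × (ℝ × ℝ) | nrm p (x.2 - x.1) = 1} :=
      isClosed_eq (hn.comp (continuous_snd.sub continuous_fst)) continuous_const
    have h4 : IsClosed {x : (ℝ × ℝ) × (ℝ × ℝ) | 0 ≤ det2 x.1 x.2} := by
      apply isClosed_le continuous_const; unfold det2; fun_prop
    have : K = ({x : (ℝ × ℝ) × (ℝ × ℝ) | nrm p x.1 = 1} ∩ {x | nrm p x.2 = 1} ∩
      {x | nrm p (x.2 - x.1) = 1}) ∩ {x | 0 ≤ det2 x.1 x.2} := by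
      ext x; simp [K, Hex, and_assoc]
    rw [this]
    exact ((h1.inter h2).inter h3).inter h4
  have hbdd : K ⊆ Metric.closedBall 0 1 := by
    rintro ⟨⟨a1, a2⟩, ⟨b1, b2⟩⟩ ⟨⟨ha, hb, -⟩, -⟩
    simp only [mem_closedBall_zero_iff, Prod.norm_def, norm_eq_abs]
    have h1 := abs_fst_le hp (a1, a2)
    have h2 := abs_snd_le hp (a1, a2)
    have h3 := abs_fst_le hp (b1, b2)
    have h4 := abs_snd_le hp (b1, b2)
    simp only at ha hb h1 h2 h3 h4
    rw [ha] at h1 h2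
    rw [hb] at h3 h4
    simp [h1, h2, h3, h4]
  have hK : IsCompact K := (isCompact_closedBall 0 1).of_isClosed_subset hclosed hbdd
  have hne : K.Nonempty := by
    have h1 : nrm p ((1:ℝ), (0:ℝ)) = 1 := by
      rw [nrm_eq_one hp]; simp [zero_rpow (by linarith : p ≠ 0)]
    obtain ⟨b, hb, hd⟩ := exists_hex hp _ h1
    exact ⟨(_, b), hb, hd.le⟩
  have hcont : Continuous (fun x : (ℝ × ℝ) × (ℝ × ℝ) => det2 x.1 x.2) := by unfold det2; fun_prop
  obtain ⟨x, hxK, hx⟩ := hK.exists_isMinOn hne hcont.continuousOn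
  refine ⟨x.1, x.2, hxK.1, ?_, ?_⟩
  · rcases hxK.2.eq_or_lt with h | h
    · exfalso
      obtain ⟨⟨ha, hb, hc⟩, -⟩ := hxK
      obtain ⟨a, b⟩ := x
      simp only at ha hb hc h
      have hpar : ∃ t : ℝ, b = t • a := by
        unfold det2 at h
        by_cases h1 : a.1 = 0
        · have h2 : a.2 ≠ 0 := by
            intro h2
            have : a = 0 := by ext <;> simp [h1, h2]
            rw [this] at ha
            have := nrm_smul hp 0 (0 : ℝ × ℝ)
            simp at this; rw [this] at ha; norm_num at ha
          refine ⟨b.2 / a.2, ?_⟩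
          have : b.1 = 0 := by
            rw [h1] at h; simp at h; tauto
          ext
          · simp [this, h1]
          · simp; field_simp
        · refine ⟨b.1 / a.1, ?_⟩
          ext
          · simp; field_simp
          · simp; field_simp; linarith
      obtain ⟨t, rfl⟩ := hpar
      rw [nrm_smul hp, ha, mul_one] at hb
      have e : t • a - a = (t - 1) • a := by rw [sub_smul, one_smul]
      rw [e, nrm_smul hp, ha, mul_one] at hc
      rcases abs_eq (zero_le_one) |>.1 hb with h2 | h2 <;> rw [h2] at hc <;> norm_num at hc
    · exact h
  · intro a' b' hex h0
    exact hx (show (a', b') ∈ K from ⟨hex, h0.le⟩)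
end

section
open Real

lemma tangent_le {p x y : ℝ} (hp : 1 < p) (hx : 0 ≤ x) (hy : 0 < y) :
    p * y ^ (p - 1) * (x - y) ≤ x ^ p - y ^ p := by
  have h := one_add_mul_self_le_rpow_one_add (s := x / y - 1) (by
    have : 0 ≤ x / y := by positivity
    linarith) hp.le
  have e : (1 + (x / y - 1)) = x / y := by ring
  rw [e, div_rpow hx hy.le, le_div_iff₀ (by positivity)] at h
  have e2 : y ^ p = y ^ (p - 1) * y := by
    rw [← rpow_add_one hy.ne']; congr 1; ring
  have e3 : (1 + p * (x / y - 1)) * y ^ p = y ^ p + p * y ^ (p - 1) * (x - y) := by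
    rw [e2]; field_simp
  linarith

lemma superadd {p x y : ℝ} (hp : 1 < p) (hx : 0 ≤ x) (hy : 0 ≤ y) :
    x ^ p + y ^ p ≤ (x + y) ^ p := add_rpow_le_rpow_add hx hy hp.le

/-- canonical hexagonal configurations -/
structure Canon (p a1 a2 b1 b2 : ℝ) : Prop where
  a2_nonneg : 0 ≤ a2
  a2_le : a2 ≤ b1
  b1_le : b1 ≤ b2
  b2_le : b2 ≤ a1
  c_le : a1 - b1 ≤ b2 - a2
  na : a1 ^ p + a2 ^ p = 1
  nb : b1 ^ p + b2 ^ p = 1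
  nc : (a1 - b1) ^ p + (b2 - a2) ^ p = 1

lemma IsMin.rot {p : ℝ} (hp : 1 < p) {a b : ℝ × ℝ} (h : IsMin p a b) : IsMin p b (b - a) := by
  obtain ⟨h1, h2, h3⟩ := h
  have e : det2 b (b - a) = det2 a b := by simp [det2]; ring
  refine ⟨h1.rot hp, by rw [e]; exact h2, by rw [e]; exact h3⟩

lemma IsMin.quarter {p : ℝ} (hp : 1 < p) {a b : ℝ × ℝ} (h : IsMin p a b) :
    IsMin p (-a.2, a.1) (-b.2, b.1) := by
  obtain ⟨h1, h2, h3⟩ := h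
  have e : det2 (-a.2, a.1) (-b.2, b.1) = det2 a b := by simp [det2]; ring
  obtain ⟨u, v, w⟩ := h1
  rw [nrm_eq_one hp] at u v w
  refine ⟨⟨?_, ?_, ?_⟩, by rw [e]; exact h2, by rw [e]; exact h3⟩
  · rw [nrm_eq_one hp]; simp; linarith
  · rw [nrm_eq_one hp]; simp; linarith
  · rw [nrm_eq_one hp, ← w]; simp
    rw [abs_sub_comm b.2, add_comm]; congr 3; ring_nf

lemma IsMin.refl {p : ℝ} (hp : 1 < p) {a b : ℝ × ℝ} (h : IsMin p a b) :
    IsMin p (a.1, -a.2) (a.1 - b.1, -(a.2 - b.2)) := by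
  obtain ⟨h1, h2, h3⟩ := h
  have e : det2 (a.1, -a.2) (a.1 - b.1, -(a.2 - b.2)) = det2 a b := by simp [det2]; ring
  obtain ⟨u, v, w⟩ := h1
  rw [nrm_eq_one hp] at u v w
  refine ⟨⟨?_, ?_, ?_⟩, by rw [e]; exact h2, by rw [e]; exact h3⟩
  · rw [nrm_eq_one hp]; simp; linarith
  · rw [nrm_eq_one hp, ← w]; simp; rw [abs_sub_comm a.1]
  · rw [nrm_eq_one hp, ← v]; simp

/-- the largest coordinate -/
def mx (v : ℝ × ℝ) : ℝ := max |v.1| |v.2|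

/-- `a` has the largest coordinate -/
def Best (p : ℝ) (a b : ℝ × ℝ) : Prop := IsMin p a b ∧ mx b ≤ mx a ∧ mx (b - a) ≤ mx a

lemma mx_neg (v : ℝ × ℝ) : mx (-v) = mx v := by simp [mx]

lemma exists_best {p : ℝ} (hp : 1 < p) : ∃ a b, Best p a b := by
  obtain ⟨a, b, h⟩ := exists_min hp
  have h1 := h.rot hp
  have h2 := h1.rot hp
  have e1 : b - a - b = -a := by abel
  rw [e1] at h2
  by_cases u : mx b ≤ mx a ∧ mx (b - a) ≤ mx a
  · exact ⟨a, b, h, u⟩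
  by_cases v : mx (b - a) ≤ mx b ∧ mx a ≤ mx b
  · refine ⟨b, b - a, h1, v.1, ?_⟩
    rw [e1, mx_neg]; exact v.2
  · refine ⟨b - a, -a, h2, ?_, ?_⟩
    · rw [mx_neg]; grind
    · have : -a - (b - a) = -b := by abel
      rw [this, mx_neg]; grind

lemma Best.quarter {p : ℝ} (hp : 1 < p) {a b : ℝ × ℝ} (h : Best p a b) :
    Best p (-a.2, a.1) (-b.2, b.1) := by
  obtain ⟨h1, h2, h3⟩ := h
  refine ⟨h1.quarter hp, ?_, ?_⟩
  · simpa [mx, max_comm] using h2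
  · have : |(-b.2 + a.2)| = |b.2 - a.2| := by rw [← abs_neg]; congr 1; ring
    simpa [mx, max_comm, this] using h3

lemma Best.refl {p : ℝ} (hp : 1 < p) {a b : ℝ × ℝ} (h : Best p a b) :
    Best p (a.1, -a.2) (a.1 - b.1, -(a.2 - b.2)) := by
  obtain ⟨h1, h2, h3⟩ := h
  refine ⟨h1.refl hp, ?_, ?_⟩
  · simpa [mx, abs_sub_comm] using h3
  · simpa [mx] using h2

lemma exists_best' {p : ℝ} (hp : 1 < p) : ∃ a b, Best p a b ∧ 0 ≤ a.2 ∧ a.2 ≤ a.1 := by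
  have key : ∃ a b, Best p a b ∧ |a.2| ≤ a.1 := by
    obtain ⟨a, b, h⟩ := exists_best hp
    have h1 := h.quarter hp
    have h2 := h1.quarter hp
    have h3 := h2.quarter hp
    simp only [neg_neg] at h1 h2 h3
    rcases le_total |a.2| |a.1| with u | u
    · rcases le_total 0 a.1 with v | v
      · rw [abs_of_nonneg v] at u
        exact ⟨_, _, h, u⟩
      · rw [abs_of_nonpos v] at u
        exact ⟨_, _, h2, by simpa using u⟩
    · rcases le_total 0 a.2 with v | v
      · rw [abs_of_nonneg v] at u
        exact ⟨_, _, h3, by simpa using u⟩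
      · rw [abs_of_nonpos v] at u
        exact ⟨_, _, h1, by simpa using u⟩
  obtain ⟨a, b, h, hle⟩ := key
  rcases le_total 0 a.2 with v | v
  · exact ⟨a, b, h, v, by rwa [abs_of_nonneg v] at hle⟩
  · refine ⟨_, _, h.refl hp, by simpa using v, ?_⟩
    rw [abs_of_nonpos v] at hle; simpa using hle

lemma exists_canon {p : ℝ} (hp : 1 < p) : ∃ a1 a2 b1 b2, Canon p a1 a2 b1 b2 ∧
    0 < a1 * b2 - a2 * b1 ∧
    (∀ a' b', Hex p a' b' → 0 < det2 a' b' → a1 * b2 - a2 * b1 ≤ det2 a' b') ∧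
    (a1 ^ (p-1) * (b2 - a2) ^ (p-1) + a2 ^ (p-1) * (a1 - b1) ^ (p-1)) *
      (a1 * b1 ^ (p-1) + a2 * b2 ^ (p-1)) =
    (b1 ^ (p-1) * (b2 - a2) ^ (p-1) + b2 ^ (p-1) * (a1 - b1) ^ (p-1)) *
      (b1 * a1 ^ (p-1) + b2 * a2 ^ (p-1)) := by
  obtain ⟨a, b, ⟨hmin, hmb, hmc⟩, h2, h1⟩ := exists_best' hp
  have hp0 : (0:ℝ) < p := by linarith
  have ha1 : 0 ≤ a.1 := h2.trans h1
  have hmxa : mx a = a.1 := by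
    unfold mx; rw [abs_of_nonneg ha1, abs_of_nonneg h2, max_eq_left h1]
  rw [hmxa] at hmb hmc
  have hdet := hmin.2.1
  obtain ⟨na, nb, nc⟩ := hmin.1
  rw [nrm_eq_one hp] at na nb nc
  rw [abs_of_nonneg ha1, abs_of_nonneg h2] at na
  simp only [mx, max_le_iff, Prod.fst_sub, Prod.snd_sub] at hmb hmc
  obtain ⟨hb1, hb2⟩ := hmb
  obtain ⟨hc1, hc2⟩ := hmc
  have hb1n : 0 ≤ b.1 := by
    have := (abs_le.1 hc1).1; linarith
  have hb1a : b.1 ≤ a.1 := (abs_le.1 hb1).2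
  have ha1p : 0 < a.1 := by
    rcases ha1.eq_or_lt with h | h
    · have : a.2 = 0 := by linarith
      simp [det2, this, ← h] at hdet
    · exact h
  have hb2p : 0 < b.2 := by
    unfold det2 at hdet
    have : 0 < a.1 * b.2 := by nlinarith [mul_nonneg h2 hb1n]
    exact (mul_pos_iff_of_pos_left ha1p).1 this
  have hb2a : b.2 ≤ a.1 := (abs_le.1 hb2).2
  rw [abs_of_nonneg hb1n, abs_of_pos hb2p] at nb
  have hab : a.2 ≤ b.1 := by
    have h3 : b.2 ^ p ≤ a.1 ^ p := rpow_le_rpow hb2p.le hb2a hp0.le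
    exact (rpow_le_rpow_iff h2 hb1n hp0).1 (by linarith)
  have hc2n : a.2 ≤ b.2 := by
    by_contra hcon
    push Not at hcon
    simp only [Prod.fst_sub, Prod.snd_sub] at nc
    have h3 : |b.1 - a.1| ^ p ≤ a.1 ^ p := rpow_le_rpow (abs_nonneg _) hc1 hp0.le
    have h4 : |b.2 - a.2| ^ p < a.2 ^ p := by
      apply rpow_lt_rpow (abs_nonneg _) _ hp0
      rw [abs_lt]; constructor <;> linarith
    linarith
  have nc' : (a.1 - b.1) ^ p + (b.2 - a.2) ^ p = 1 := by
    rw [← nc]; simp only [Prod.fst_sub, Prod.snd_sub]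
    rw [abs_sub_comm, abs_of_nonneg (by linarith : 0 ≤ a.1 - b.1),
      abs_of_nonneg (by linarith : 0 ≤ b.2 - a.2)]
  have hb12 : b.1 ≤ b.2 := by
    have s1 := superadd hp hb1n (sub_nonneg.2 hb1a)
    have s2 := superadd hp h2 (sub_nonneg.2 hc2n)
    rw [add_sub_cancel] at s1 s2
    have : 0 ≤ a.2 ^ p := by positivity
    exact (rpow_le_rpow_iff hb1n hb2p.le hp0).1 (by linarith)
  have hcc : a.1 - b.1 ≤ b.2 - a.2 := by
    have t1 := tangent_le hp ha1 hb2p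
    by_cases hb10 : b.1 = 0
    · have : a.2 = 0 := by linarith
      rw [this, zero_rpow hp0.ne'] at na
      rw [hb10, zero_rpow hp0.ne'] at nb
      have : a.1 = b.2 := by
        have h5 : a.1 ^ p = b.2 ^ p := by linarith
        exact (rpow_left_inj ha1 hb2p.le hp0.ne').1 h5
      linarith
    · have hb1p : 0 < b.1 := lt_of_le_of_ne hb1n (Ne.symm hb10)
      have t2 := tangent_le hp h2 hb1p
      have hq : b.1 ^ (p-1) ≤ b.2 ^ (p-1) := rpow_le_rpow hb1n hb12 (by linarith)
      have hq2 : 0 < b.2 ^ (p-1) := by positivity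
      have h6 : p * b.2 ^ (p-1) * (a.1 - b.2) ≤ p * b.1 ^ (p-1) * (b.1 - a.2) := by linarith
      have h7 : p * b.1 ^ (p-1) * (b.1 - a.2) ≤ p * b.2 ^ (p-1) * (b.1 - a.2) := by
        apply mul_le_mul_of_nonneg_right _ (by linarith)
        exact mul_le_mul_of_nonneg_left hq hp0.le
      have h8 := le_of_mul_le_mul_left (h6.trans h7) (by positivity)
      linarith
  exact ⟨a.1, a.2, b.1, b.2, ⟨h2, hab, hb12, hb2a, hcc, na, nb, nc'⟩, hdet, hmin.2.2,
    lagrange hp hmin ha1 h2 hb1n hb2p.le hb1a hc2n⟩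
end

section
open Real

def delta0 (p : ℝ) : ℝ := (1 / 2) * ((2 : ℝ) ^ p - 1) ^ (1 / p)
def delta1 (p τ : ℝ) : ℝ := (4 : ℝ) ^ (-1 / p) * (1 + τ) / (1 - τ)

lemma two_rpow_gt {p : ℝ} (hp : 1 < p) : 2 < (2:ℝ) ^ p := by
  have := rpow_lt_rpow_of_exponent_lt (x := 2) (by norm_num) hp
  rwa [rpow_one] at this

lemma delta0_pow {p : ℝ} (hp : 1 < p) : delta0 p ^ p = 1 - (1/2) ^ p := by
  have h2 := two_rpow_gt hp
  have h3 : (0:ℝ) ≤ (2:ℝ) ^ p - 1 := by linarith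
  rw [delta0, mul_rpow (by norm_num) (by positivity), ← rpow_mul h3,
    one_div_mul_cancel (by linarith), rpow_one, div_rpow (by norm_num) (by norm_num),
    one_rpow]
  field_simp

lemma delta0_pos {p : ℝ} (hp : 1 < p) : 0 < delta0 p := by
  have h2 := two_rpow_gt hp
  have h3 : (0:ℝ) < (2:ℝ) ^ p - 1 := by linarith
  unfold delta0; positivity

lemma hex_axis {p : ℝ} (hp : 1 < p) : ∃ a b, Hex p a b ∧ 0 < det2 a b ∧ det2 a b = delta0 p := by
  have h := delta0_pow hp
  have h0 := delta0_pos hp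
  have hz : (0:ℝ) ^ p = 0 := zero_rpow (by linarith)
  refine ⟨(1, 0), (1/2, delta0 p), ⟨?_, ?_, ?_⟩, ?_, ?_⟩
  · rw [nrm_eq_one hp]; simp [hz]
  · rw [nrm_eq_one hp]
    simp only [abs_of_pos h0, h, abs_of_pos (by norm_num : (0:ℝ) < 1/2)]; ring
  · rw [nrm_eq_one hp]
    have e : ((1/2, delta0 p) : ℝ × ℝ) - (1, 0) = (-(1/2), delta0 p) := by ext <;> simp; norm_num
    rw [e]
    simp only [abs_neg, abs_of_pos h0, h, abs_of_pos (by norm_num : (0:ℝ) < 1/2)]; ring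
  · simpa [det2] using h0
  · simp [det2]

/-- defining equation of `τ` -/
def IsTau (p τ : ℝ) : Prop := 0 ≤ τ ∧ τ < 1 ∧ 2 * (1 - τ) ^ p = 1 + τ ^ p

lemma IsTau.unique {p s t : ℝ} (hp : 1 < p) (hs : IsTau p s) (ht : IsTau p t) : s = t := by
  wlog h : s < t generalizing s t with H
  · rcases lt_trichotomy s t with h1 | h1 | h1
    · exact absurd h1 h
    · exact h1
    · exact (H ht hs h1).symm
  exfalso
  obtain ⟨s0, s1, e1⟩ := hs
  obtain ⟨t0, t1, e2⟩ := ht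
  have h1 : (1 - t) ^ p < (1 - s) ^ p := rpow_lt_rpow (by linarith) (by linarith) (by linarith)
  have h2 : s ^ p ≤ t ^ p := rpow_le_rpow s0 h.le (by linarith)
  linarith

lemma diag_det {p τ g : ℝ} (hp : 1 < p) (ht : IsTau p τ) (hg : 0 < g) (h : g ^ p * (1 + τ ^ p) = 1) :
    g * g - (τ * g) * (τ * g) = delta1 p τ := by
  obtain ⟨t0, t1, e⟩ := ht
  have h1 : (g * (1 - τ)) ^ p = 1 / 2 := by
    rw [mul_rpow hg.le (by linarith)]; linear_combination h / 2 + g ^ p / 2 * e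
  have h2 : g * (1 - τ) = (1 / 2 : ℝ) ^ (1 / p) := by
    rw [← h1, ← rpow_mul (by nlinarith), mul_one_div_cancel (by linarith), rpow_one]
  have h3 : (4:ℝ) ^ (-1 / p) = (g * (1 - τ)) * (g * (1 - τ)) := by
    rw [h2, ← mul_rpow (by norm_num) (by norm_num)]
    have e4 : (1/2 * (1/2) : ℝ) = 4⁻¹ := by norm_num
    rw [e4, inv_rpow (by norm_num), ← rpow_neg (by norm_num)]
    congr 1; ring
  unfold delta1
  rw [h3]
  have : 1 - τ ≠ 0 := by linarith
  field_simp; ring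

lemma hex_diag {p τ : ℝ} (hp : 1 < p) (ht : IsTau p τ) :
    ∃ a b, Hex p a b ∧ 0 < det2 a b ∧ det2 a b = delta1 p τ := by
  have ht' := ht
  obtain ⟨t0, t1, e⟩ := ht
  set g : ℝ := ((1 + τ ^ p)⁻¹) ^ (1 / p) with hg
  have hpos : 0 < (1 + τ ^ p) := by positivity
  have hg0 : 0 < g := by positivity
  have hgp : g ^ p * (1 + τ ^ p) = 1 := by
    rw [hg, ← rpow_mul (by positivity), one_div_mul_cancel (by linarith), rpow_one]
    exact inv_mul_cancel₀ hpos.ne'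
  have hd := diag_det hp ht' hg0 hgp
  have hτg : 0 ≤ τ * g := by positivity
  have hτgp : (τ * g) ^ p = τ ^ p * g ^ p := mul_rpow t0 hg0.le
  refine ⟨(g, τ * g), (τ * g, g), ⟨?_, ?_, ?_⟩, ?_, ?_⟩
  · rw [nrm_eq_one hp]; simp only [abs_of_pos hg0, abs_of_nonneg hτg, hτgp]; linarith
  · rw [nrm_eq_one hp]; simp only [abs_of_pos hg0, abs_of_nonneg hτg, hτgp]; linarith
  · rw [nrm_eq_one hp]
    have e1 : ((τ * g, g) : ℝ × ℝ) - (g, τ * g) = (-(g * (1 - τ)), g * (1 - τ)) := by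
      ext <;> simp <;> ring
    have hh : 0 ≤ g * (1 - τ) := mul_nonneg hg0.le (by linarith)
    rw [e1]; simp only [abs_neg, abs_of_nonneg hh, mul_rpow hg0.le (by linarith : 0 ≤ 1 - τ)]
    linear_combination hgp + g ^ p * e
  · simp only [det2]
    have : 0 < g * g * ((1 - τ) * (1 + τ)) := by
      have : 0 < 1 - τ := by linarith
      positivity
    linarith
  · simp only [det2]; exact hd

lemma rpow_inj' {p x y : ℝ} (hp : 1 < p) (hx : 0 ≤ x) (hy : 0 ≤ y) (h : x ^ p = y ^ p) : x = y :=
  (rpow_left_inj hx hy (by linarith)).1 h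

lemma Canon.axis {p a1 a2 b1 b2 : ℝ} (hp : 1 < p) (h : Canon p a1 a2 b1 b2) (h0 : a2 = 0) :
    a1 * b2 - a2 * b1 = delta0 p := by
  obtain ⟨h1, h2, h3, h4, h5, na, nb, nc⟩ := h
  subst h0
  have hz : (0:ℝ) ^ p = 0 := zero_rpow (by linarith)
  rw [hz, add_zero] at na
  have ha : a1 = 1 := rpow_inj' hp (by linarith) zero_le_one (by rw [na, one_rpow])
  subst ha
  rw [sub_zero] at nc
  have hb : 1 - b1 = b1 := rpow_inj' hp (by linarith) h2 (by linarith)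
  have hb' : b1 = 1/2 := by linarith
  have : b2 = delta0 p := rpow_inj' hp (by linarith) (delta0_pos hp).le (by
    rw [delta0_pow hp, ← hb']; linarith)
  rw [this]; ring

lemma Canon.diag {p a1 a2 b1 b2 τ : ℝ} (hp : 1 < p) (h : Canon p a1 a2 b1 b2) (h0 : a2 = b1)
    (ht : IsTau p τ) : a1 * b2 - a2 * b1 = delta1 p τ := by
  obtain ⟨h1, h2, h3, h4, h5, na, nb, nc⟩ := h
  subst h0
  have hb : b2 = a1 := rpow_inj' hp (by linarith) (by linarith) (by linarith)
  subst hb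
  have hb0 : 0 < b2 := by
    rcases (h1.trans h3).eq_or_lt with h | h
    · have h7 : a2 = 0 := by linarith
      rw [← h, h7] at na
      have hz : (0:ℝ) ^ p = 0 := zero_rpow (by linarith)
      simp [hz] at na
    · exact h
  have hlt : a2 < b2 := by
    rcases h3.lt_or_eq with h | h
    · exact h
    · rw [h] at nc
      have hz : (0:ℝ) ^ p = 0 := zero_rpow (by linarith)
      simp [hz] at nc
  have e1 : a2 = (a2 / b2) * b2 := by field_simp
  have ht2 : IsTau p (a2 / b2) := by
    refine ⟨by positivity, by rwa [div_lt_one hb0], ?_⟩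
    have e2 : 1 - a2 / b2 = (b2 - a2) / b2 := by field_simp
    rw [e2, div_rpow (by linarith) hb0.le, div_rpow h1 hb0.le]
    have : b2 ^ p ≠ 0 := by positivity
    field_simp
    linarith
  rw [ht.unique hp ht2, ← diag_det hp ht2 hb0 ?_, ← e1]
  rw [div_rpow h1 hb0.le]
  have : b2 ^ p ≠ 0 := by positivity
  field_simp
  linarith

lemma Canon.two {a1 a2 b1 b2 : ℝ} (h : Canon 2 a1 a2 b1 b2) :
    delta0 2 ≤ a1 * b2 - a2 * b1 := by
  obtain ⟨h1, h2, h3, h4, h5, na, nb, nc⟩ := h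
  have e := delta0_pow (p := 2) (by norm_num)
  norm_num at e
  norm_cast at na nb nc e
  have h6 : (a1 * b2 - a2 * b1) ^ 2 = 3/4 := by
    have hd : a1 * b1 + a2 * b2 = 1/2 := by nlinarith
    have : (a1 * b2 - a2 * b1) ^ 2 = (a1^2+a2^2)*(b1^2+b2^2) - (a1 * b1 + a2 * b2)^2 := by ring
    rw [this, na, nb, hd]; norm_num
  have hd0 := delta0_pos (p := 2) (by norm_num)
  have h7 : 0 ≤ a1 * b2 - a2 * b1 := by nlinarith
  rw [← h6] at e
  exact ((sq_eq_sq₀ hd0.le h7).1 (by exact_mod_cast e)).le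
end

section
open Real

lemma rpow_lt' {p x y : ℝ} (hp : 1 < p) (hx : 0 ≤ x) (hxy : x < y) : x ^ p < y ^ p :=
  rpow_lt_rpow hx hxy (by linarith)

lemma lt_of_rpow {p x y : ℝ} (hp : 1 < p) (hy : 0 ≤ y) (h : x ^ p < y ^ p) : x < y := by
  by_contra hc
  push Not at hc
  have := rpow_le_rpow hy hc (by linarith : (0:ℝ) ≤ p)
  linarith

/-- strict facts for an interior canonical configuration -/
structure Strict (p a1 a2 b1 b2 c1 c2 : ℝ) : Prop where
  a2_pos : 0 < a2
  a2_lt : a2 < b1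
  b1_lt : b1 < c1
  c_lt : c1 < c2
  c2_lt : c2 < b2
  b2_lt : b2 < a1
  a1_eq : a1 = b1 + c1
  b2_eq : b2 = a2 + c2
  na : a1 ^ p + a2 ^ p = 1
  nb : b1 ^ p + b2 ^ p = 1
  nc : c1 ^ p + c2 ^ p = 1

lemma Canon.strict {p a1 a2 b1 b2 : ℝ} (hp : 1 < p) (h : Canon p a1 a2 b1 b2) (h0 : 0 < a2)
    (hlt : a2 < b1) : Strict p a1 a2 b1 b2 (a1 - b1) (b2 - a2) := by
  obtain ⟨h1, h2, h3, h4, h5, na, nb, nc⟩ := h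
  have hb1 : 0 < b1 := by linarith
  have c1n : 0 ≤ a1 - b1 := by linarith
  have c2n : 0 ≤ b2 - a2 := by linarith
  have s1 := superadd hp h1 c2n
  have e1 : a2 + (b2 - a2) = b2 := by ring
  rw [e1] at s1
  have pa : 0 < a2 ^ p := by positivity
  have pb : 0 < b1 ^ p := by positivity
  have b1c : b1 < a1 - b1 := lt_of_rpow hp c1n (by linarith)
  have c2b : b2 - a2 < b2 := by linarith
  have ba : b2 < a1 := by
    apply lt_of_rpow hp (by linarith)
    have := rpow_lt' hp h1 hlt
    linarith
  refine ⟨h0, hlt, b1c, ?_, c2b, ba, by ring, by ring, na, nb, nc⟩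
  rcases h5.lt_or_eq with h | h
  · exact h
  exfalso
  have t1 := tangent_le (x := a1) (y := b2) hp (by linarith) (by linarith)
  have t2 := tangent_le (x := a2) (y := b1) hp h1 hb1
  have e : a1 - b2 = b1 - a2 := by linarith
  rw [e] at t1
  have hq : b1 ^ (p - 1) < b2 ^ (p - 1) := rpow_lt_rpow hb1.le (by linarith) (by linarith)
  have : p * b1 ^ (p - 1) * (b1 - a2) < p * b2 ^ (p - 1) * (b1 - a2) := by
    have : 0 < b1 - a2 := by linarith
    gcongr
  nlinarith

/-- the criticality identity in hyperbolic form -/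
lemma star_ident (r s t k : ℝ) :
    sinh (k * (r + s)) * (sinh ((k+1) * s) * sinh (k * t) + sinh ((k+1) * t) * sinh (k * s)) -
      sinh (k * (s - t)) * (sinh ((k+1) * r) * sinh (k * s) - sinh ((k+1) * s) * sinh (k * r)) =
    2 * sinh (k * s) * (cosh ((s - t) / 2) * cosh ((2*k+1) * ((r + t) / 2)) * cosh ((r - (2*k+1) * s) / 2)
      - cosh ((r + t) / 2) * cosh ((2*k+1) * ((s - t) / 2)) * cosh (((2*k+1) * r - s) / 2)) := by
  have ex : ∀ u, exp u ≠ 0 := fun u => (exp_pos u).ne'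
  have k1 : exp (k * (r + s)) = exp (k * r) * exp (k * s) := by rw [← exp_add]; ring_nf
  have k2 : exp ((k+1) * s) = exp (k * s) * exp (s/2) * exp (s/2) := by
    rw [← exp_add, ← exp_add]; ring_nf
  have k3 : exp ((k+1) * t) = exp (k * t) * exp (t/2) * exp (t/2) := by
    rw [← exp_add, ← exp_add]; ring_nf
  have k4 : exp ((k+1) * r) = exp (k * r) * exp (r/2) * exp (r/2) := by
    rw [← exp_add, ← exp_add]; ring_nf
  have k5 : exp (k * (s - t)) = exp (k * s) / exp (k * t) := by rw [← exp_sub]; ring_nf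
  have k6 : exp ((s - t)/2) = exp (s/2) / exp (t/2) := by rw [← exp_sub]; ring_nf
  have k7 : exp ((2*k+1) * ((r + t) / 2)) = exp (k * r) * exp (k * t) * exp (r/2) * exp (t/2) := by
    rw [← exp_add, ← exp_add, ← exp_add]; ring_nf
  have k8 : exp ((r - (2*k+1) * s) / 2) = exp (r/2) / (exp (k * s) * exp (s/2)) := by
    rw [← exp_add, ← exp_sub]; ring_nf
  have k9 : exp ((r + t) / 2) = exp (r/2) * exp (t/2) := by rw [← exp_add]; ring_nf
  have k10 : exp ((2*k+1) * ((s - t) / 2)) = exp (k * s) * exp (s/2) / (exp (k * t) * exp (t/2)) := by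
    rw [← exp_add, ← exp_add, ← exp_sub]; ring_nf
  have k11 : exp (((2*k+1) * r - s) / 2) = exp (k * r) * exp (r/2) / exp (s/2) := by
    rw [← exp_add, ← exp_sub]; ring_nf
  simp only [sinh_eq, cosh_eq, exp_neg, k1, k2, k3, k4, k5, k6, k7, k8, k9, k10, k11]
  have h1 := ex (k * r)
  have h2 := ex (k * s)
  have h3 := ex (k * t)
  have h4 := ex (r / 2)
  have h5 := ex (s / 2)
  have h6 := ex (t / 2)
  clear k1 k2 k3 k4 k5 k6 k7 k8 k9 k10 k11 ex
  generalize exp (k * r) = U at *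
  generalize exp (k * s) = V at *
  generalize exp (k * t) = W at *
  generalize exp (r / 2) = X at *
  generalize exp (s / 2) = Y at *
  generalize exp (t / 2) = Z at *
  field_simp
  ring

/-- hyperbolic parametrization of an interior critical configuration -/
structure Hyp (p r s t : ℝ) : Prop where
  t_pos : 0 < t
  t_lt : t < s
  s_lt : s < r
  h1 : (1/p) * (log (cosh (p/2 * r)) - log (cosh (p/2 * s)))
        = log (cosh ((r + t) / 2)) - log (cosh ((s - t) / 2))
  h2 : (1/p) * (log (cosh (p/2 * s)) - log (cosh (p/2 * t)))
        = log (sinh ((r + s) / 2)) - log (cosh ((r + t) / 2))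
  star : sinh ((p/2-1) * (r + s)) * (sinh (p/2 * s) * sinh ((p/2-1) * t) + sinh (p/2 * t) * sinh ((p/2-1) * s))
     = sinh ((p/2-1) * (s - t)) * (sinh (p/2 * r) * sinh ((p/2-1) * s) - sinh (p/2 * s) * sinh ((p/2-1) * r))

lemma Strict.hyp {p a1 a2 b1 b2 c1 c2 : ℝ} (hp : 1 < p) (h : Strict p a1 a2 b1 b2 c1 c2)
    (E : (a1^(p-1)*c2^(p-1)+a2^(p-1)*c1^(p-1))*(a1*b1^(p-1)+a2*b2^(p-1)) =
      (b1^(p-1)*c2^(p-1)+b2^(p-1)*c1^(p-1))*(b1*a1^(p-1)+b2*a2^(p-1))) :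
    Hyp p (log (a1 / a2)) (log (b2 / b1)) (log (c2 / c1)) := by
  obtain ⟨a2_pos, a2_lt, b1_lt, c_lt, c2_lt, b2_lt, a1_eq, b2_eq, na, nb, nc⟩ := h
  have b1p : 0 < b1 := by linarith
  have b2p : 0 < b2 := by linarith
  have c1p : 0 < c1 := by linarith
  have c2p : 0 < c2 := by linarith
  have a1p : 0 < a1 := by linarith
  obtain ⟨A, r, e1, e2⟩ : ∃ A r : ℝ, a1 = exp (A + r / 2) ∧ a2 = exp (A - r / 2) :=
    ⟨(log a1 + log a2) / 2, log a1 - log a2, by ring_nf; exact (exp_log a1p).symm,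
      by ring_nf; exact (exp_log a2_pos).symm⟩
  obtain ⟨B, s, e3, e4⟩ : ∃ A r : ℝ, b1 = exp (A - r / 2) ∧ b2 = exp (A + r / 2) :=
    ⟨(log b2 + log b1) / 2, log b2 - log b1, by ring_nf; exact (exp_log b1p).symm,
      by ring_nf; exact (exp_log b2p).symm⟩
  obtain ⟨C, t, e5, e6⟩ : ∃ A r : ℝ, c1 = exp (A - r / 2) ∧ c2 = exp (A + r / 2) :=
    ⟨(log c2 + log c1) / 2, log c2 - log c1, by ring_nf; exact (exp_log c1p).symm,
      by ring_nf; exact (exp_log c2p).symm⟩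
  have er : log (a1 / a2) = r := by rw [e1, e2, ← exp_sub, log_exp]; ring
  have es : log (b2 / b1) = s := by rw [e3, e4, ← exp_sub, log_exp]; ring
  have et : log (c2 / c1) = t := by rw [e5, e6, ← exp_sub, log_exp]; ring
  have tpos : 0 < t := by
    rw [← et]; exact log_pos (by rw [lt_div_iff₀ c1p]; linarith)
  have tlt : t < s := by
    rw [← et, ← es]; apply log_lt_log (by positivity)
    rw [div_lt_div_iff₀ c1p b1p]; nlinarith
  have slt : s < r := by
    rw [← er, ← es]; apply log_lt_log (by positivity)
    rw [div_lt_div_iff₀ b1p a2_pos]; nlinarith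
  rw [er, es, et]
  clear er es et
  have two : ∀ u v : ℝ, exp (u + v) + exp (u - v) = 2 * exp u * cosh v := by
    intro u v; rw [cosh_eq, exp_add, sub_eq_add_neg, exp_add]; ring
  have q1 : exp A * cosh ((r + t) / 2) = exp B * cosh ((s - t) / 2) := by
    have h1 : a1 * exp (t/2) + a2 * exp (-(t/2)) = b1 * exp (t/2) + b2 * exp (-(t/2)) := by
      have : c1 * exp (t/2) = c2 * exp (-(t/2)) := by
        rw [e5, e6, ← exp_add, ← exp_add]; ring_nf
      rw [a1_eq, b2_eq]; linarith
    have h2 := two A ((r + t)/2)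
    have h3 := two B ((s - t)/2)
    rw [e1, e2, e3, e4, ← exp_add, ← exp_add, ← exp_add, ← exp_add] at h1
    have i1 : A + r/2 + t/2 = A + (r+t)/2 := by ring
    have i2 : A - r/2 + -(t/2) = A - (r+t)/2 := by ring
    have i3 : B - s/2 + t/2 = B - (s-t)/2 := by ring
    have i4 : B + s/2 + -(t/2) = B + (s-t)/2 := by ring
    rw [i1, i2, i3, i4] at h1
    linarith
  have q2 : exp B * sinh ((r + s) / 2) = exp C * cosh ((r + t) / 2) := by
    have h1 : b2 * exp (r/2) - b1 * exp (-(r/2)) = c2 * exp (r/2) + c1 * exp (-(r/2)) := by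
      have : a2 * exp (r/2) = a1 * exp (-(r/2)) := by
        rw [e1, e2, ← exp_add, ← exp_add]; ring_nf
      have h1 : c1 = a1 - b1 := by linarith
      have h2 : c2 = b2 - a2 := by linarith
      rw [h1, h2]; linarith
    have h2 := two C ((r + t)/2)
    have h3 : exp (B + (r+s)/2) - exp (B - (r+s)/2) = 2 * exp B * sinh ((r+s)/2) := by
      rw [sinh_eq, exp_add, sub_eq_add_neg B, exp_add]; ring
    rw [e3, e4, e5, e6, ← exp_add, ← exp_add, ← exp_add, ← exp_add] at h1
    have i1 : C + t/2 + r/2 = C + (r+t)/2 := by ring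
    have i2 : C - t/2 + -(r/2) = C - (r+t)/2 := by ring
    have i3 : B + s/2 + r/2 = B + (r+s)/2 := by ring
    have i4 : B - s/2 + -(r/2) = B - (r+s)/2 := by ring
    rw [i1, i2, i3, i4] at h1
    linarith
  have pw : ∀ u v : ℝ, exp u ^ v = exp (u * v) := fun u v => (exp_mul u v).symm
  have nrm' : ∀ u v : ℝ, exp (u + v/2) ^ p + exp (u - v/2) ^ p = 1 →
      p * u + log (cosh (p/2 * v)) = - log 2 := by
    intro u v h
    rw [pw, pw] at h
    have i1 : (u + v/2) * p = p * u + p/2 * v := by ring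
    have i2 : (u - v/2) * p = p * u - p/2 * v := by ring
    rw [i1, i2, two] at h
    have := congrArg log h
    rw [log_mul (by positivity) (cosh_pos _).ne', log_mul (by norm_num) (by positivity), log_exp, log_one] at this
    linarith
  have n1 := nrm' A r (by rw [← e1, ← e2]; exact na)
  have n2 := nrm' B s (by rw [← e3, ← e4]; linarith)
  have n3 := nrm' C t (by rw [← e5, ← e6]; linarith)
  have ms : 0 < sinh ((r + s)/2) := sinh_pos_iff.2 (by linarith)
  have l1 := congrArg log q1
  rw [log_mul (by positivity) (cosh_pos _).ne', log_mul (by positivity) (cosh_pos _).ne', log_exp, log_exp] at l1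
  have l2 := congrArg log q2
  rw [log_mul (by positivity) ms.ne', log_mul (by positivity) (cosh_pos _).ne', log_exp, log_exp] at l2
  have p0 : p ≠ 0 := by linarith
  refine ⟨tpos, tlt, slt, ?_, ?_, ?_⟩
  · field_simp
    have : p * (A - B) = p * (log (cosh ((s - t)/2)) - log (cosh ((r+t)/2))) := by
      rw [show A - B = log (cosh ((s - t)/2)) - log (cosh ((r+t)/2)) by linarith]
    have e7 : r * p / 2 = p / 2 * r := by ring
    have e8 : s * p / 2 = p / 2 * s := by ring
    have e9 : p * r / 2 = p / 2 * r := by ring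
    have e10 : p * s / 2 = p / 2 * s := by ring
    simp only [e7, e8, e9, e10]
    linarith
  · field_simp
    have : p * (B - C) = p * (log (cosh ((r + t)/2)) - log (sinh ((r+s)/2))) := by
      rw [show B - C = log (cosh ((r + t)/2)) - log (sinh ((r+s)/2)) by linarith]
    have e7 : t * p / 2 = p / 2 * t := by ring
    have e8 : s * p / 2 = p / 2 * s := by ring
    have e9 : p * t / 2 = p / 2 * t := by ring
    have e10 : p * s / 2 = p / 2 * s := by ring
    simp only [e7, e8, e9, e10]
    linarith
  · have id := star_ident r s t (p/2 - 1)
    have i1 : p/2 - 1 + 1 = p/2 := by ring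
    have i2 : 2 * (p/2 - 1) + 1 = p - 1 := by ring
    rw [i1, i2] at id
    suffices hR : cosh ((s - t) / 2) * cosh ((p-1) * ((r + t) / 2)) * cosh ((r - (p-1) * s) / 2)
      - cosh ((r + t) / 2) * cosh ((p-1) * ((s - t) / 2)) * cosh (((p-1) * r - s) / 2) = 0 by
      rw [hR, mul_zero] at id
      linarith
    have f1 : a1^(p-1)*c2^(p-1)+a2^(p-1)*c1^(p-1) = 2 * exp ((p-1)*(A + C)) * cosh ((p-1) * ((r+t)/2)) := by
      rw [← two, e1, e2, e5, e6, pw, pw, pw, pw, ← exp_add, ← exp_add]; ring_nf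
    have f2 : a1*b1^(p-1)+a2*b2^(p-1) = 2 * exp (A + (p-1)*B) * cosh ((r - (p-1)*s)/2) := by
      rw [← two, e1, e2, e3, e4, pw, pw, ← exp_add, ← exp_add]; ring_nf
    have f3 : b1^(p-1)*c2^(p-1)+b2^(p-1)*c1^(p-1) = 2 * exp ((p-1)*(B + C)) * cosh ((p-1) * ((s-t)/2)) := by
      rw [← two, e3, e4, e5, e6, pw, pw, pw, pw, ← exp_add, ← exp_add]; ring_nf
    have f4 : b1*a1^(p-1)+b2*a2^(p-1) = 2 * exp (B + (p-1)*A) * cosh (((p-1)*r - s)/2) := by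
      rw [← two, e1, e2, e3, e4, pw, pw, ← exp_add, ← exp_add]; ring_nf
    rw [f1, f2, f3, f4] at E
    have g1 : exp ((p-1)*(A + C)) * exp (A + (p-1)*B) = exp A * exp ((p-1)*(A+B+C)) := by
      rw [← exp_add, ← exp_add]; ring_nf
    have g2 : exp ((p-1)*(B + C)) * exp (B + (p-1)*A) = exp B * exp ((p-1)*(A+B+C)) := by
      rw [← exp_add, ← exp_add]; ring_nf
    have hG := exp_pos ((p-1)*(A+B+C))
    have E2 : exp A * (cosh ((p-1) * ((r+t)/2)) * cosh ((r - (p-1)*s)/2)) =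
        exp B * (cosh ((p-1) * ((s-t)/2)) * cosh (((p-1)*r - s)/2)) := by
      apply mul_left_cancel₀ hG.ne'
      linear_combination E / 4 - g1 * (cosh ((p-1) * ((r+t)/2)) * cosh ((r - (p-1)*s)/2)) + g2 * (cosh ((p-1) * ((s-t)/2)) * cosh (((p-1)*r - s)/2))
    apply mul_left_cancel₀ (exp_pos B).ne'
    rw [mul_zero]
    linear_combination (- cosh ((p-1) * ((r+t)/2)) * cosh ((r - (p-1)*s)/2)) * q1 + cosh ((r+t)/2) * E2
end

section
open Real

lemma mono_aux {f f' : ℝ → ℝ} {c : ℝ} (hf : ∀ x, c ≤ x → HasDerivAt f (f' x) x) (h : ∀ x, c < x → 0 ≤ f' x)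
    {a b : ℝ} (ha : c ≤ a) (hab : a ≤ b) : f a ≤ f b := by
  have : MonotoneOn f (Set.Ici c) := by
    apply monotoneOn_of_deriv_nonneg (convex_Ici c)
    · intro x hx; exact (hf x hx).continuousAt.continuousWithinAt
    · intro x hx; rw [interior_Ici] at hx; exact (hf x hx.le).differentiableAt.differentiableWithinAt
    · intro x hx; rw [interior_Ici] at hx; rw [(hf x hx.le).deriv]; exact h x hx
  exact this ha (ha.trans hab) hab

lemma hasDerivAt_lc (u : ℝ) : HasDerivAt (fun x => log (cosh x)) (tanh u) u := by
  have := (Real.hasDerivAt_cosh u).log (cosh_pos u).ne'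
  rwa [← tanh_eq_sinh_div_cosh] at this

lemma hasDerivAt_lc' (c u : ℝ) : HasDerivAt (fun x => log (cosh (c * x))) (c * tanh (c * u)) u := by
  have := (hasDerivAt_lc (c * u)).comp u ((hasDerivAt_id u).const_mul c)
  simpa [mul_comm, Function.comp_def] using this

lemma hasDerivAt_tanh (u : ℝ) : HasDerivAt tanh (1 / cosh u ^ 2) u := by
  have := (Real.hasDerivAt_sinh u).div (Real.hasDerivAt_cosh u) (cosh_pos u).ne'
  have e : (sinh / cosh : ℝ → ℝ) = tanh := by
    funext x; simp [tanh_eq_sinh_div_cosh]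
  rw [e] at this
  have e2 : 1 / cosh u ^ 2 = (cosh u * cosh u - sinh u * sinh u) / cosh u ^ 2 := by
    congr 1; nlinarith [cosh_sq u]
  rw [e2]; exact this

lemma tanh_concave : ConcaveOn ℝ (Set.Ici 0) tanh := by
  apply AntitoneOn.concaveOn_of_deriv (convex_Ici 0)
  · intro x _; exact (hasDerivAt_tanh x).continuousAt.continuousWithinAt
  · intro x _; exact (hasDerivAt_tanh x).differentiableAt.differentiableWithinAt
  · intro x hx y hy hxy
    rw [interior_Ici] at hx hy
    rw [(hasDerivAt_tanh x).deriv, (hasDerivAt_tanh y).deriv]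
    have : cosh x ≤ cosh y := cosh_le_cosh.2 (by rw [abs_of_pos hx, abs_of_pos hy]; exact hxy)
    have := cosh_pos x
    gcongr

lemma tanh_mono {x y : ℝ} (h : x ≤ y) : tanh x ≤ tanh y := by
  have := cosh_pos x
  have := cosh_pos y
  rw [tanh_eq_sinh_div_cosh, tanh_eq_sinh_div_cosh, div_le_div_iff₀ (cosh_pos x) (cosh_pos y)]
  have h1 : 0 ≤ sinh (y - x) := sinh_nonneg_iff.2 (by linarith)
  rw [sinh_sub] at h1; linarith

lemma tanh_pos' {x : ℝ} (h : 0 < x) : 0 < tanh x := by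
  rw [tanh_eq_sinh_div_cosh]; exact div_pos (sinh_pos_iff.2 h) (cosh_pos x)

lemma tanh_scale {l x : ℝ} (h0 : 0 ≤ l) (h1 : l ≤ 1) (hx : 0 ≤ x) : l * tanh x ≤ tanh (l * x) := by
  have := tanh_concave.2 (x := x) hx (y := 0) (by simp) h0 (by linarith : 0 ≤ 1 - l) (by ring)
  simpa using this

lemma tanh_mix {q u : ℝ} (h0 : 0 ≤ q) (h1 : q ≤ 1) (hu : 0 ≤ u) :
    (1 - q) * tanh (u / 2) + q * tanh u ≤ tanh ((q + 1) / 2 * u) := by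
  have := tanh_concave.2 (x := u/2) (by simp; linarith) (y := u) hu (by linarith : 0 ≤ 1 - q) h0 (by ring)
  simp only [smul_eq_mul] at this
  have e : (q + 1) / 2 * u = (1 - q) * (u / 2) + q * u := by ring
  rw [e]; exact this

lemma log_ratio {x y : ℝ} (hy : 0 < y) (h : y ≤ x) : 2 * (x - y) / (x + y) ≤ log x - log y := by
  have key := mono_aux (c := y) (f := fun x => (log x - log y) - 2 * (x - y) / (x + y))
    (f' := fun x => x⁻¹ - (2 * (x + y) - 2 * (x - y) * 1) / (x + y)^2) (a := y) (b := x) ?_ ?_ le_rfl h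
  · simp only [sub_self, mul_zero, zero_div] at key; linarith
  · intro x hx
    have hx0 : 0 < x := by linarith
    have h1 := (hasDerivAt_log hx0.ne').sub_const (log y)
    have h2 : HasDerivAt (fun x => 2 * (x - y)) 2 x := by
      simpa using ((hasDerivAt_id x).sub_const y).const_mul 2
    have h3 : HasDerivAt (fun x => x + y) 1 x := (hasDerivAt_id x).add_const y
    have h4 := h1.sub (h2.div h3 (by positivity))
    exact h4
  · intro x hx
    have hx0 : 0 < x := by linarith
    rw [← one_div, div_sub_div _ _ (by positivity) (by positivity)]
    apply div_nonneg _ (by positivity)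
    nlinarith [sq_nonneg (x - y)]

lemma tanh_add_tanh (x y : ℝ) : tanh x + tanh y = sinh (x + y) / (cosh x * cosh y) := by
  have := cosh_pos x
  have := cosh_pos y
  rw [tanh_eq_sinh_div_cosh, tanh_eq_sinh_div_cosh, sinh_add]
  field_simp

lemma lc_split {r s t : ℝ} (ht : 0 ≤ t) (hs : 0 ≤ s) (hr : s ≤ r) :
    log (cosh ((r + t) / 2)) - log (cosh ((s - t) / 2)) ≤
      log (cosh (r / 2)) - log (cosh (s / 2)) + t / 2 * (tanh (r/2) + tanh (s/2)) := by
  have key := mono_aux (c := 0)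
    (f := fun v => v / 2 * (tanh (r/2) + tanh (s/2)) - (log (cosh ((r + v) / 2)) - log (cosh ((s - v) / 2))))
    (f' := fun v => 1 / 2 * (tanh (r/2) + tanh (s/2)) - (tanh ((r + v)/2) * (1/2) - tanh ((s - v)/2) * (-1/2)))
    (a := 0) (b := t) ?_ ?_ le_rfl ht
  · simp only [add_zero, sub_zero, zero_div, zero_mul, zero_sub] at key; linarith
  · intro v _
    have h1 : HasDerivAt (fun v : ℝ => v / 2 * (tanh (r/2) + tanh (s/2))) (1 / 2 * (tanh (r/2) + tanh (s/2))) v :=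
      ((hasDerivAt_id v).div_const 2).mul_const _
    have h2 : HasDerivAt (fun v : ℝ => (r + v) / 2) (1/2) v := ((hasDerivAt_id v).const_add r).div_const 2
    have h3 : HasDerivAt (fun v : ℝ => (s - v) / 2) (-1/2) v := ((hasDerivAt_id v).const_sub s).div_const 2
    exact h1.sub (((hasDerivAt_lc _).comp v h2).sub ((hasDerivAt_lc _).comp v h3))
  · intro v hv
    suffices tanh ((r + v)/2) + tanh ((s - v)/2) ≤ tanh (r/2) + tanh (s/2) by linarith
    rw [tanh_add_tanh, tanh_add_tanh]
    have e1 : (r + v)/2 + (s - v)/2 = r/2 + s/2 := by ring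
    rw [e1]
    have h1 : 0 ≤ sinh (r/2 + s/2) := sinh_nonneg_iff.2 (by linarith)
    have c1 := cosh_pos (r/2)
    have c2 := cosh_pos (s/2)
    apply div_le_div_of_nonneg_left h1 (by positivity)
    have f1 : cosh (r/2) * cosh (s/2) = (cosh (r/2 + s/2) + cosh (r/2 - s/2)) / 2 := by
      rw [cosh_add, cosh_sub]; ring
    have f2 : cosh ((r+v)/2) * cosh ((s-v)/2) = (cosh (r/2 + s/2) + cosh (r/2 - s/2 + v)) / 2 := by
      have e2 : r/2 - s/2 + v = (r+v)/2 - (s-v)/2 := by ring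
      rw [← e1, e2, cosh_add, cosh_sub]; ring
    rw [f1, f2]
    have : cosh (r/2 - s/2) ≤ cosh (r/2 - s/2 + v) := by
      apply cosh_le_cosh.2
      rw [abs_of_nonneg (by linarith), abs_of_nonneg (by linarith)]; linarith
    linarith

lemma one_add_tanh_sq (u : ℝ) : log (1 + tanh (u/2) ^ 2) = log (cosh u) - 2 * log (cosh (u/2)) := by
  have h := cosh_pos (u/2)
  have e : 1 + tanh (u/2)^2 = cosh u / cosh (u/2)^2 := by
    rw [tanh_eq_sinh_div_cosh]
    have : cosh u = cosh (u/2)^2 + sinh (u/2)^2 := by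
      rw [← cosh_two_mul]; congr 1; ring
    rw [this]; field_simp
  rw [e, log_div (cosh_pos u).ne' (by positivity), log_pow]
  push_cast; ring

/-- lower bound for `t` -/
lemma Hyp.t_bound {p r s t : ℝ} (hp : 1 < p) (h : Hyp p r s t) {q' : ℝ} (hq0 : 0 ≤ q') (hq : q' ≤ p - 1) (hq1 : q' ≤ 1) :
    2 * q' * (tanh (r/2) - tanh (s/2)) ≤ t * (2 + tanh (r/2)^2 + tanh (s/2)^2) := by
  obtain ⟨tp, ts, sr, h1, h2, -⟩ := h
  have l1 := lc_split tp.le (by linarith) sr.le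
  have key := mono_aux (c := 0)
    (f := fun u => (1/p) * log (cosh (p/2 * u)) - log (cosh (1/2 * u)) - (q'/2) * (log (cosh u) - 2 * log (cosh (1/2 * u))))
    (f' := fun u => (1/p) * (p/2 * tanh (p/2 * u)) - (1/2 * tanh (1/2 * u)) - (q'/2) * (tanh u - 2 * (1/2 * tanh (1/2 * u))))
    (a := s) (b := r) ?_ ?_ (by linarith) sr.le
  · have i : ∀ u : ℝ, 1/2 * u = u/2 := fun u => by ring
    simp only [i] at key
    have o1 := one_add_tanh_sq r
    have o2 := one_add_tanh_sq s
    have al := tanh_pos' (by linarith : 0 < r/2)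
    have be := tanh_pos' (by linarith : 0 < s/2)
    have ab := tanh_mono (by linarith : s/2 ≤ r/2)
    have lr := log_ratio (x := 1 + tanh (r/2)^2) (y := 1 + tanh (s/2)^2) (by positivity) (by gcongr)
    rw [o1, o2] at lr
    have fin : q' * (2 * ((1 + tanh (r/2)^2) - (1 + tanh (s/2)^2)) / ((1 + tanh (r/2)^2) + (1 + tanh (s/2)^2)))
      ≤ t * (tanh (r/2) + tanh (s/2)) := by
      have := mul_le_mul_of_nonneg_left lr hq0
      linarith
    rw [← mul_div_assoc, div_le_iff₀ (by positivity)] at fin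
    have hs : 0 < tanh (r/2) + tanh (s/2) := by linarith
    refine le_of_mul_le_mul_right ?_ hs
    nlinarith
  · intro u _
    have a1 := (hasDerivAt_lc' (p/2) u).const_mul (1/p)
    have a2 := hasDerivAt_lc' (1/2) u
    have a3 := hasDerivAt_lc u
    exact (a1.sub a2).sub ((a3.sub (a2.const_mul 2)).const_mul (q'/2))
  · intro u hu
    have p0 : p ≠ 0 := by linarith
    have m := tanh_mix hq0 hq1 hu.le
    have m2 : tanh ((q' + 1)/2 * u) ≤ tanh (p/2 * u) := tanh_mono (by nlinarith)
    have i : 1/2 * u = u/2 := by ring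
    rw [i]
    have : (1/p) * (p/2 * tanh (p/2 * u)) = tanh (p/2*u) / 2 := by field_simp
    rw [this]
    linarith
end

section
open Real

lemma hsinh (c u : ℝ) : HasDerivAt (fun x => sinh (c * x)) (c * cosh (c * u)) u := by
  have := (hasDerivAt_sinh (c * u)).comp u ((hasDerivAt_id u).const_mul c)
  simpa [mul_comm, Function.comp_def] using this

lemma hcosh (c u : ℝ) : HasDerivAt (fun x => cosh (c * x)) (c * sinh (c * u)) u := by
  have := (hasDerivAt_cosh (c * u)).comp u ((hasDerivAt_id u).const_mul c)
  simpa [mul_comm, Function.comp_def] using this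

lemma sinh_scale {l x : ℝ} (h0 : 0 ≤ l) (h1 : l ≤ 1) (hx : 0 ≤ x) : sinh (l * x) ≤ l * sinh x := by
  have key := mono_aux (c := 0) (f := fun u => l * sinh u - sinh (l * u))
    (f' := fun u => l * cosh u - l * cosh (l * u)) (a := 0) (b := x) ?_ ?_ le_rfl hx
  · simp at key; linarith
  · intro u _; exact ((hasDerivAt_sinh u).const_mul l).sub (hsinh l u)
  · intro u hu
    have : cosh (l * u) ≤ cosh u := by
      apply cosh_le_cosh.2
      rw [abs_of_nonneg (by positivity), abs_of_pos hu]; nlinarith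
    nlinarith

lemma sinh_le_mul_cosh {x : ℝ} (hx : 0 ≤ x) : sinh x ≤ x * cosh x := by
  have key := mono_aux (c := 0) (f := fun u => u * cosh u - sinh u)
    (f' := fun u => (1 * cosh u + u * sinh u) - cosh u) (a := 0) (b := x) ?_ ?_ le_rfl hx
  · simp at key; linarith
  · intro u _; exact ((hasDerivAt_id u).mul (hasDerivAt_cosh u)).sub (hasDerivAt_sinh u)
  · intro u hu
    have := sinh_pos_iff.2 hu
    nlinarith

lemma self_le_sinh' {x : ℝ} (hx : 0 ≤ x) : x ≤ sinh x := self_le_sinh_iff.2 hx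

/-- first auxiliary inequality, `q < 1` -/
lemma J1 {q u : ℝ} (h0 : 0 ≤ q) (h1 : q ≤ 1) (hu : 0 ≤ u) :
    sinh (q * u) * cosh u - q * cosh (q * u) * sinh u ≤ q * (1 - q^2) / 3 * u * sinh u ^ 2 := by
  have key := mono_aux (c := 0)
    (f := fun u => q * (1 - q^2) / 3 * (u * sinh u ^ 2) - (sinh (q * u) * cosh u - q * (cosh (q * u) * sinh u)))
    (f' := fun u => q * (1 - q^2) / 3 * (1 * sinh u ^ 2 + u * (((2:ℕ):ℝ) * sinh u ^ (2-1) * cosh u)) -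
      ((q * cosh (q * u)) * cosh u + sinh (q * u) * sinh u - q * ((q * sinh (q * u)) * sinh u + cosh (q * u) * cosh u)))
     (a := 0) (b := u) ?_ ?_ le_rfl hu
  · simp at key; linarith
  · intro u _
    exact (((hasDerivAt_id u).mul ((hasDerivAt_sinh u).pow 2)).const_mul _).sub
      (((hsinh q u).mul (hasDerivAt_cosh u)).sub (((hcosh q u).mul (hasDerivAt_sinh u)).const_mul q))
  · intro u hu
    have a1 := sinh_scale h0 h1 hu.le
    have a2 := sinh_le_mul_cosh hu.le
    have a3 := sinh_pos_iff.2 hu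
    have : q * (1 - q^2) / 3 * (1 * sinh u ^ 2 + u * (((2:ℕ):ℝ) * sinh u ^ (2-1) * cosh u)) -
      ((q * cosh (q * u)) * cosh u + sinh (q * u) * sinh u - q * ((q * sinh (q * u)) * sinh u + cosh (q * u) * cosh u))
      = (1 - q^2) * sinh u * (q / 3 * (sinh u + 2 * (u * cosh u)) - sinh (q * u)) := by
      push_cast; ring
    rw [this]
    have b1 : 0 ≤ 1 - q^2 := by nlinarith
    have b2 : 0 ≤ q / 3 * (sinh u + 2 * (u * cosh u)) - sinh (q * u) := by nlinarith
    positivity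

/-- second auxiliary inequality, `q = 1 + 2k > 1` -/
lemma J2 {k u : ℝ} (h0 : 0 < k) (h1 : 2 * k ≤ 1) (hu : 0 ≤ u) :
    (1 + 2*k) * cosh ((1+2*k) * u) * sinh u - sinh ((1+2*k) * u) * cosh u ≤
      (1+2*k) * ((1+2*k)^2 - 1) / 3 / (2*k) * sinh (2*k*u) * sinh u ^ 2 := by
  have key := mono_aux (c := 0)
    (f := fun u => (1+2*k) * ((1+2*k)^2 - 1) / 3 / (2*k) * (sinh (2*k*u) * sinh u ^ 2)
      - ((1 + 2*k) * (cosh ((1+2*k) * u) * sinh u) - sinh ((1+2*k) * u) * cosh u))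
    (f' := fun u => (1+2*k) * ((1+2*k)^2 - 1) / 3 / (2*k) *
       ((2*k*cosh (2*k*u)) * sinh u ^ 2 + sinh (2*k*u) * (((2:ℕ):ℝ) * sinh u ^ (2-1) * cosh u)) -
      ((1+2*k) * (((1+2*k) * sinh ((1+2*k) * u)) * sinh u + cosh ((1+2*k) * u) * cosh u) -
        (((1+2*k) * cosh ((1+2*k) * u)) * cosh u + sinh ((1+2*k) * u) * sinh u)))
     (a := 0) (b := u) ?_ ?_ le_rfl hu
  · simp at key; linarith
  · intro u _
    exact (((hsinh (2*k) u).mul ((hasDerivAt_sinh u).pow 2)).const_mul _).sub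
      ((((hcosh (1+2*k) u).mul (hasDerivAt_sinh u)).const_mul (1+2*k)).sub ((hsinh (1+2*k) u).mul (hasDerivAt_cosh u)))
  · intro u hu
    have a1 := tanh_scale (l := 2*k) (by linarith) h1 hu.le
    have a3 := sinh_pos_iff.2 hu
    have e0 : (1 + 2*k) * u = u + 2*k*u := by ring
    have es : sinh ((1+2*k) * u) = sinh u * cosh (2*k*u) + cosh u * sinh (2*k*u) := by rw [e0, sinh_add]
    have c1 := cosh_pos u
    have c2 := cosh_pos (2*k*u)
    have a2 : 2 * k * (sinh u * cosh (2*k*u)) ≤ cosh u * sinh (2*k*u) := by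
      rw [tanh_eq_sinh_div_cosh, tanh_eq_sinh_div_cosh, ← mul_div_assoc, div_le_div_iff₀ c1 c2] at a1
      linarith
    have : (1+2*k) * ((1+2*k)^2 - 1) / 3 / (2*k) *
       ((2*k*cosh (2*k*u)) * sinh u ^ 2 + sinh (2*k*u) * (((2:ℕ):ℝ) * sinh u ^ (2-1) * cosh u)) -
      ((1+2*k) * (((1+2*k) * sinh ((1+2*k) * u)) * sinh u + cosh ((1+2*k) * u) * cosh u) -
        (((1+2*k) * cosh ((1+2*k) * u)) * cosh u + sinh ((1+2*k) * u) * sinh u))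
      = ((1+2*k)^2 - 1) * sinh u / (3*k) * ((1+2*k) * (k * (sinh u * cosh (2*k*u)) + cosh u * sinh (2*k*u))
         - 3 * k * sinh ((1+2*k) * u)) := by
      push_cast; field_simp; ring
    rw [this, es]
    have b1 : 0 ≤ (1+2*k)^2 - 1 := by nlinarith
    have b2 : 0 ≤ (1+2*k) * (k * (sinh u * cosh (2*k*u)) + cosh u * sinh (2*k*u))
         - 3 * k * (sinh u * cosh (2*k*u) + cosh u * sinh (2*k*u)) := by
      nlinarith
    positivity

lemma up1 {p r s : ℝ} (hp : 1 < p) (hp2 : p < 2) (hs : 0 < s) (hr : s < r) :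
    sinh (p/2 * r) * sinh ((1-p/2) * s) - sinh (p/2 * s) * sinh ((1-p/2) * r) ≤
      (p-1) * (1-p/2) * (p/2) / 3 * (r * s) * (cosh r - cosh s) := by
  set q := p - 1 with hq
  have hh : 0 < (r - s)/2 := by linarith
  have key := mono_aux (c := (r-s)/2)
    (f := fun u => sinh (q * u) / sinh u + q * (1 - q^2) / 6 * u^2)
    (f' := fun u => ((q * cosh (q * u)) * sinh u - sinh (q * u) * cosh u) / sinh u ^ 2 + q * (1 - q^2) / 6 * (((2:ℕ):ℝ) * u^(2-1)))
    (a := (r-s)/2) (b := (r+s)/2) ?_ ?_ le_rfl (by linarith)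
  · have m0 : 0 < sinh ((r+s)/2) := sinh_pos_iff.2 (by linarith)
    have h0 : 0 < sinh ((r-s)/2) := sinh_pos_iff.2 hh
    have e1 : sinh (p/2 * r) * sinh ((1-p/2) * s) - sinh (p/2 * s) * sinh ((1-p/2) * r)
        = sinh ((r+s)/2) * sinh (q * ((r-s)/2)) - sinh (q * ((r+s)/2)) * sinh ((r-s)/2) := by
      have i1 : ∀ x y : ℝ, sinh x * sinh y = (cosh (x+y) - cosh (x-y))/2 := by
        intro x y; rw [cosh_add, cosh_sub]; ring
      rw [i1, i1, i1, i1, hq]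
      have j1 : p/2*r + (1-p/2)*s = (r+s)/2 + (p-1)*((r-s)/2) := by ring
      have j2 : p/2*r - (1-p/2)*s = (p-1)*((r+s)/2) + (r-s)/2 := by ring
      have j3 : p/2*s + (1-p/2)*r = (r+s)/2 - (p-1)*((r-s)/2) := by ring
      have j4 : p/2*s - (1-p/2)*r = (p-1)*((r+s)/2) - (r-s)/2 := by ring
      rw [j1, j2, j3, j4]; ring
    have e2 : cosh r - cosh s = 2 * sinh ((r+s)/2) * sinh ((r-s)/2) := by
      have j1 : r = (r+s)/2 + (r-s)/2 := by ring
      have j2 : s = (r+s)/2 - (r-s)/2 := by ring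
      conv_lhs => rw [j1]
      conv_lhs => rw [show cosh s = cosh ((r+s)/2 - (r-s)/2) by rw [← j2]]
      rw [cosh_add, cosh_sub]; ring
    rw [e1, e2]
    have key2 := mul_le_mul_of_nonneg_left key (mul_pos m0 h0).le
    have e3 : sinh ((r+s)/2) * sinh ((r-s)/2) * (sinh (q * ((r-s)/2)) / sinh ((r-s)/2)) = sinh ((r+s)/2) * sinh (q * ((r-s)/2)) := by
      field_simp
    have e4 : sinh ((r+s)/2) * sinh ((r-s)/2) * (sinh (q * ((r+s)/2)) / sinh ((r+s)/2)) = sinh (q * ((r+s)/2)) * sinh ((r-s)/2) := by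
      field_simp
    simp only [mul_add, e3, e4] at key2
    have e5 : p = q + 1 := by rw [hq]; ring
    rw [e5]
    nlinarith
  · intro u hu
    have u0 : 0 < u := by linarith
    exact ((hsinh q u).div (hasDerivAt_sinh u) (sinh_pos_iff.2 u0).ne').add ((hasDerivAt_pow 2 u).const_mul _)
  · intro u hu
    have u0 : 0 < u := by linarith
    have := J1 (q := q) (by linarith) (by linarith) u0.le
    have s0 := sinh_pos_iff.2 u0
    have : -(q * (1 - q^2) / 3 * u) ≤ ((q * cosh (q * u)) * sinh u - sinh (q * u) * cosh u) / sinh u ^ 2 := by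
      rw [le_div_iff₀ (by positivity)]; linarith
    push_cast
    linarith

lemma up2 {p r s : ℝ} (hp : 2 < p) (hp2 : p ≤ 3) (hs : 0 < s) (hr : s < r) :
    (sinh (p/2 * r) * sinh ((p/2-1) * s) - sinh (p/2 * s) * sinh ((p/2-1) * r)) * (r + s) ≤
      (p-1) * (p/2) / 3 * (r * s) * sinh ((p/2-1) * (r+s)) * (cosh r - cosh s) := by
  set k := p/2 - 1 with hk
  have e5 : p/2 = 1 + k := by rw [hk]; ring
  have k0 : 0 < k := by rw [hk]; linarith
  have hh : 0 < (r - s)/2 := by linarith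
  set M := (1+2*k) * ((1+2*k)^2 - 1) / 3 / (2*k) with hM
  have key := mono_aux (c := (r-s)/2)
    (f := fun u => M / (2*k) * cosh (2*k*u) - sinh ((1+2*k) * u) / sinh u)
    (f' := fun u => M / (2*k) * (2*k*sinh (2*k*u)) - (((1+2*k) * cosh ((1+2*k) * u)) * sinh u - sinh ((1+2*k) * u) * cosh u) / sinh u ^ 2)
    (a := (r-s)/2) (b := (r+s)/2) ?_ ?_ le_rfl (by linarith)
  · have m0 : 0 < sinh ((r+s)/2) := sinh_pos_iff.2 (by linarith)
    have h0 : 0 < sinh ((r-s)/2) := sinh_pos_iff.2 hh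
    have i1 : ∀ x y : ℝ, sinh x * sinh y = (cosh (x+y) - cosh (x-y))/2 := by
      intro x y; rw [cosh_add, cosh_sub]; ring
    have e1 : sinh (p/2 * r) * sinh (k * s) - sinh (p/2 * s) * sinh (k * r)
        = sinh ((1+2*k) * ((r+s)/2)) * sinh ((r-s)/2) - sinh ((r+s)/2) * sinh ((1+2*k) * ((r-s)/2)) := by
      rw [i1, i1, i1, i1, e5]
      have j1 : (1+k)*r + k*s = (1+2*k) * ((r+s)/2) + (r-s)/2 := by ring
      have j2 : (1+k)*r - k*s = (r+s)/2 + (1+2*k) * ((r-s)/2) := by ring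
      have j3 : (1+k)*s + k*r = (1+2*k) * ((r+s)/2) - (r-s)/2 := by ring
      have j4 : (1+k)*s - k*r = (r+s)/2 - (1+2*k) * ((r-s)/2) := by ring
      rw [j1, j2, j3, j4]; ring
    have e2 : cosh r - cosh s = 2 * sinh ((r+s)/2) * sinh ((r-s)/2) := by
      rw [mul_assoc, i1]; ring_nf
    have key2 := mul_le_mul_of_nonneg_left key (mul_pos m0 h0).le
    have e3 : sinh ((r+s)/2) * sinh ((r-s)/2) * (sinh ((1+2*k) * ((r-s)/2)) / sinh ((r-s)/2)) = sinh ((r+s)/2) * sinh ((1+2*k) * ((r-s)/2)) := by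
      field_simp
    have e4 : sinh ((r+s)/2) * sinh ((r-s)/2) * (sinh ((1+2*k) * ((r+s)/2)) / sinh ((r+s)/2)) = sinh ((1+2*k) * ((r+s)/2)) * sinh ((r-s)/2) := by
      field_simp
    simp only [mul_sub, e3, e4] at key2
    have e6 : cosh (2*k*((r+s)/2)) - cosh (2*k*((r-s)/2)) = 2 * (sinh (k*r) * sinh (k*s)) := by
      rw [i1]; ring_nf
    have e7 : sinh (k*r) * sinh (k*s) * (r + s) ≤ k * (r * s) * sinh (k*(r+s)) := by
      have x0 : 0 < k * r := by nlinarith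
      have y0 : 0 < k * s := by positivity
      have a1 := sinh_le_mul_cosh x0.le
      have a2 := sinh_le_mul_cosh y0.le
      have a3 := sinh_pos_iff.2 x0
      have a4 := sinh_pos_iff.2 y0
      rw [mul_add k, sinh_add]
      have b1 := mul_le_mul_of_nonneg_right a1 (mul_pos a4 hs).le
      have b2 := mul_le_mul_of_nonneg_right a2 (mul_pos a3 (by linarith : 0 < r)).le
      nlinarith
    rw [e1, e2]
    have hM' : M / (2*k) * 2 = (1+2*k) * (1+k) * 2 / 3 / k := by
      rw [hM]; field_simp; ring
    have f1 : sinh ((1+2*k) * ((r+s)/2)) * sinh ((r-s)/2) - sinh ((r+s)/2) * sinh ((1+2*k) * ((r-s)/2)) ≤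
       sinh ((r+s)/2) * sinh ((r-s)/2) * ((1+2*k) * (1+k) * 2 / 3 / k) * (sinh (k*r) * sinh (k*s)) := by
      rw [← hM']
      linear_combination key2 + sinh ((r+s)/2) * sinh ((r-s)/2) * (M/(2*k)) * e6
    have rs0 : 0 < r + s := by linarith
    have f2 := mul_le_mul_of_nonneg_right f1 rs0.le
    refine f2.trans ?_
    have Cp : 0 ≤ sinh ((r+s)/2) * sinh ((r-s)/2) * ((1+2*k) * (1+k) * 2 / 3 / k) := by positivity
    have f3 := mul_le_mul_of_nonneg_left e7 Cp
    have e8 : p - 1 = 1 + 2*k := by linarith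
    rw [e8, e5]
    refine (le_of_eq (by ring)).trans (f3.trans (le_of_eq ?_))
    field_simp
  · intro u hu
    have u0 : 0 < u := by linarith
    exact ((hcosh (2*k) u).const_mul _).sub ((hsinh (1+2*k) u).div (hasDerivAt_sinh u) (sinh_pos_iff.2 u0).ne')
  · intro u hu
    have u0 : 0 < u := by linarith
    have := J2 (k := k) k0 (by linarith) u0.le
    have s0 := sinh_pos_iff.2 u0
    have : (((1+2*k) * cosh ((1+2*k) * u)) * sinh u - sinh ((1+2*k) * u) * cosh u) / sinh u ^ 2 ≤ M * sinh (2*k*u) := by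
      rw [div_le_iff₀ (by positivity)]; linarith
    have e : M / (2*k) * (2*k*sinh (2*k*u)) = M * sinh (2*k*u) := by field_simp
    rw [e]; linarith
end

section
open Real

/-- the data entering the final contradiction of the region near `p = 2` -/
structure Psi (α β D H r s : ℝ) : Prop where
  b0 : 0 < β
  ba : β < α
  a1 : α < 1
  D0 : 0 < D
  Db : D ≤ β
  r0 : 0 < r
  hu : α / √(1 + α ^ 2) + β / √(1 + β ^ 2) ≤ 1.0018
  ii : 2 * (α + β) * (1 - α * β) * D * (1 - β ^ 2) ≤ (1 + β ^ 2) * (1 - α ^ 2) * (1 - β ^ 2)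
    + 0.0125 * D * (1 + β ^ 2) * (1 + α * β) ^ 2
  Hs : H ≤ s / 2
  HD : H * (3 * (1 - D ^ 2)) ≤ D * (3 - 2 * D ^ 2)
  rα : r * (3 * (1 - α ^ 2)) ≤ 2 * α * (3 - 2 * α ^ 2)
  sβ : 2 * β ≤ s
  sβ' : s * (3 * (1 - β ^ 2)) ≤ 2 * β * (3 - 2 * β ^ 2)
  main : 3 * (r + s) * (1 - α ^ 2) * (1 - β ^ 2) ≤ 1.011 * H * r * (α + β) * (2 + α ^ 2 + β ^ 2)

lemma sqlt {x : ℝ} (h0 : 0 < x) (h : x < 1) : x ^ 2 < 1 := by nlinarith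

lemma sqle {x : ℝ} (h0 : 0 < x) (h : x ≤ 1) : x ^ 2 ≤ 1 := by nlinarith

lemma u_mono {x y : ℝ} (hx : 0 ≤ x) (h : x ≤ y) : x / √(1 + x ^ 2) ≤ y / √(1 + y ^ 2) := by
  have hy : 0 ≤ y := hx.trans h
  rw [div_le_div_iff₀ (by positivity) (by positivity)]
  apply le_of_sq_le_sq _ (by positivity)
  rw [mul_pow, mul_pow, sq_sqrt (by positivity), sq_sqrt (by positivity)]
  nlinarith

lemma u_lower {x w : ℝ} (hx : 0 ≤ x) (h : w ^ 2 * (1 + x ^ 2) ≤ x ^ 2) :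
    w ≤ x / √(1 + x ^ 2) := by
  rw [le_div_iff₀ (by positivity)]
  apply le_of_sq_le_sq _ (by positivity)
  rw [mul_pow, sq_sqrt (by positivity)]
  exact h

lemma Psi.bup {α β D H r s : ℝ} (h : Psi α β D H r s) (α0 β1 w w' : ℝ) (h0 : 0 ≤ α0) (ha : α0 ≤ α)
    (hb : 0 ≤ β1)
    (hw : w ^ 2 * (1 + α0 ^ 2) ≤ α0 ^ 2) (hw' : w' ^ 2 * (1 + β1 ^ 2) ≤ β1 ^ 2)
    (hs : 1.0018 < w + w') : β ≤ β1 := by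
  by_contra hc
  push Not at hc
  have h1 := u_lower h0 hw
  have h2 := u_mono h0 ha
  have h3 := u_lower hb hw'
  have h4 := u_mono hb hc.le
  linarith [h.hu]

set_option maxHeartbeats 1000000 in
lemma Psi.cellB {α β D H r s : ℝ} (h : Psi α β D H r s) (α0 α1 β0 β1 D1 e σ F h1 : ℝ)
    (ha0 : α0 ≤ α) (ha1 : α ≤ α1) (hb0 : β0 ≤ β) (hb1 : β ≤ β1)
    (n0 : 0 < α0) (n0' : 0 ≤ β0) (n1 : α1 ≤ 1) (n2 : β1 < 1)
    (ne : 0.0125 * (1 + β1 ^ 2) * (1 + α1 * β1) ^ 2 ≤ e * (1 - β1 ^ 2))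
    (nD : β1 ≤ D1 ∨ (1 + β1 ^ 2) * (1 - α0 ^ 2) < D1 * (2 * (α0 + β0) * (1 - α1 * β1) - e))
    (nD0 : 0 ≤ D1) (nD1 : D1 < 1)
    (nh : (3 * h1 - 2) * D1 ^ 2 ≤ 3 * h1 - 3) (nh1 : 1 ≤ h1) (nσ : 0 ≤ σ)
    (nσ' : σ * α1 * (3 - 2 * α0 ^ 2) ≤ 3 * β0 * (1 - α1 ^ 2))
    (nF : 0 < F) (nF' : F * (α0 + β0) ≤ 2 * (1 - α1 * β1) * (α0 + β0) - e)
    (fin : 1.011 * h1 * (2 + α1 ^ 2 + β1 ^ 2) * (1 + β1 ^ 2) < 3 * (1 + σ) * (1 - β1 ^ 2) * F) :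
    False := by
  obtain ⟨b0, ba, a1, D0, Db, r0, -, ii, Hs, HD, rα, sβ, -, main⟩ := h
  have α_pos : 0 < α := by linarith
  have α1p : 0 < α1 := by linarith
  have β1p : 0 < β1 := by linarith
  have αβ : α * β ≤ α1 * β1 := by gcongr
  have αβ0 : 0 < α * β := by positivity
  have bb : β ^ 2 ≤ β1 ^ 2 := by gcongr
  have b1s : β1 ^ 2 < 1 := sqlt β1p n2
  have aa : α ^ 2 ≤ α1 ^ 2 := by gcongr
  have aa0 : α0 ^ 2 ≤ α ^ 2 := by gcongr
  have as1 : α ^ 2 < 1 := sqlt α_pos a1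
  have e0 : 0 ≤ e := by
    have : 0 ≤ 0.0125 * (1 + β1 ^ 2) * (1 + α1 * β1) ^ 2 := by positivity
    exact nonneg_of_mul_nonneg_left (this.trans ne) (by linarith)
  have s1 : D * (2 * (α + β) * (1 - α * β) - e) ≤ (1 + β ^ 2) * (1 - α ^ 2) := by
    have h1 : 0.0125 * (1 + β ^ 2) * (1 + α * β) ^ 2 ≤ e * (1 - β ^ 2) := by
      calc 0.0125 * (1 + β ^ 2) * (1 + α * β) ^ 2 ≤ 0.0125 * (1 + β1 ^ 2) * (1 + α1 * β1) ^ 2 := by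
            gcongr
        _ ≤ e * (1 - β1 ^ 2) := ne
        _ ≤ e * (1 - β ^ 2) := by gcongr
    have h2 : 0 < 1 - β ^ 2 := by linarith
    have h3 := mul_le_mul_of_nonneg_left h1 D0.le
    refine le_of_mul_le_mul_right ?_ h2
    linarith
  have dle : D ≤ D1 := by
    rcases nD with h | h
    · linarith
    by_contra hc
    push Not at hc
    have h2 : 2 * (α0 + β0) * (1 - α1 * β1) ≤ 2 * (α + β) * (1 - α * β) := by
      have : 0 ≤ 1 - α1 * β1 := by linarith [mul_le_mul n1 n2.le β1p.le zero_le_one]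
      have : 0 ≤ 1 - α * β := by linarith
      gcongr
    have D1p : 0 < (1 + β1 ^ 2) * (1 - α0 ^ 2) := mul_pos (by positivity) (by linarith)
    have h3 : 0 < 2 * (α0 + β0) * (1 - α1 * β1) - e := by
      by_contra hc2
      push Not at hc2
      have h7 : 0 < -D1 := by
        by_contra hc3
        push Not at hc3
        linarith [mul_nonneg (by linarith : 0 ≤ D1) (by linarith : 0 ≤ -(2 * (α0 + β0) * (1 - α1 * β1) - e))]
      linarith
    have h4 : (1 + β ^ 2) * (1 - α ^ 2) ≤ (1 + β1 ^ 2) * (1 - α0 ^ 2) := by gcongr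
    have h5 : D1 * (2 * (α0 + β0) * (1 - α1 * β1) - e) < D * (2 * (α0 + β0) * (1 - α1 * β1) - e) := by
      gcongr
    have h6 := mul_le_mul_of_nonneg_left h2 D0.le
    linarith
  have dd : D ^ 2 ≤ D1 ^ 2 := by gcongr
  have d1 : D1 ^ 2 < 1 := sqlt (by linarith) nD1
  have s3 : H ≤ D * h1 := by
    have h2 : 3 - 2 * D ^ 2 ≤ h1 * (3 * (1 - D ^ 2)) := by
      nlinarith [mul_le_mul_of_nonneg_left dd (by linarith : 0 ≤ 3 * h1 - 2)]
    have h3 := mul_le_mul_of_nonneg_left h2 D0.le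
    have h4 : 0 < 3 * (1 - D ^ 2) := by linarith
    refine le_of_mul_le_mul_right ?_ h4
    linarith
  have sσ : σ * r ≤ s := by
    have h2 : σ * α * (3 - 2 * α ^ 2) ≤ 3 * β * (1 - α ^ 2) := by
      calc σ * α * (3 - 2 * α ^ 2) ≤ σ * α1 * (3 - 2 * α0 ^ 2) := by
            have : 0 ≤ 3 - 2 * α ^ 2 := by linarith
            gcongr
        _ ≤ 3 * β0 * (1 - α1 ^ 2) := nσ'
        _ ≤ 3 * β * (1 - α ^ 2) := by
            have : 0 ≤ 1 - α1 ^ 2 := by linarith [sqle α1p n1]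
            gcongr
    have h3 := mul_le_mul_of_nonneg_left rα nσ
    have h4 : 0 < 3 * (1 - α ^ 2) := by linarith
    refine le_of_mul_le_mul_right ?_ h4
    linarith [mul_le_mul_of_nonneg_right sβ h4.le]
  have P0 : 0 < α + β := by linarith
  have s4 : 3 * (1 + σ) * ((1 - α ^ 2) * (1 - β ^ 2)) ≤ 1.011 * (D * h1) * (α + β) * (2 + α ^ 2 + β ^ 2) := by
    refine le_of_mul_le_mul_right ?_ r0
    have h2 : 1.011 * H * r * (α + β) * (2 + α ^ 2 + β ^ 2) ≤ 1.011 * (D * h1) * r * (α + β) * (2 + α ^ 2 + β ^ 2) := by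
      gcongr
    have h3 : 0 ≤ (1 - α ^ 2) * (1 - β ^ 2) := by
      apply mul_nonneg <;> linarith
    have h4 := mul_le_mul_of_nonneg_right sσ h3
    linarith
  have s5 : D * (α + β) * F ≤ (1 + β ^ 2) * (1 - α ^ 2) := by
    refine le_trans ?_ s1
    have q0 : 0 < α0 + β0 := by linarith
    have h2 : (F - 2 * (1 - α * β)) * (α0 + β0) ≤ -e := by
      have := mul_le_mul_of_nonneg_right αβ q0.le
      linarith
    have h3 : F - 2 * (1 - α * β) ≤ 0 := by
      by_contra hc
      push Not at hc
      linarith [mul_pos hc q0]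
    have h4 : (F - 2 * (1 - α * β)) * (α + β) ≤ (F - 2 * (1 - α * β)) * (α0 + β0) := by
      apply mul_le_mul_of_nonpos_left _ h3
      linarith
    have h5 : (F - 2 * (1 - α * β)) * (α + β) ≤ -e := h4.trans h2
    have := mul_le_mul_of_nonneg_left h5 D0.le
    linarith
  have a2 : 0 < 1 - α ^ 2 := by linarith
  have s6 : 3 * (1 + σ) * (1 - β ^ 2) * F * (1 - α ^ 2) ≤
      1.011 * h1 * (2 + α ^ 2 + β ^ 2) * (1 + β ^ 2) * (1 - α ^ 2) := by
    have h2 := mul_le_mul_of_nonneg_right s4 nF.le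
    have h3 := mul_le_mul_of_nonneg_left s5 (by positivity : 0 ≤ 1.011 * h1 * (2 + α ^ 2 + β ^ 2))
    linarith
  have s7 := le_of_mul_le_mul_right s6 a2
  have s8 : 1.011 * h1 * (2 + α ^ 2 + β ^ 2) * (1 + β ^ 2) ≤ 1.011 * h1 * (2 + α1 ^ 2 + β1 ^ 2) * (1 + β1 ^ 2) := by
    gcongr
  have s9 : 3 * (1 + σ) * (1 - β1 ^ 2) * F ≤ 3 * (1 + σ) * (1 - β ^ 2) * F := by gcongr
  linarith

lemma g_le {x r : ℝ} {x1 g : ℝ} (hx : 0 < x) (h1 : x ≤ x1) (hx1 : x1 < 1)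
    (hr : r * (3 * (1 - x ^ 2)) ≤ 2 * x * (3 - 2 * x ^ 2))
    (hg : 0 < g) (h : g * (2 * x1 * (3 - 2 * x1 ^ 2)) ≤ 3 * (1 - x1 ^ 2)) : g * r ≤ 1 := by
  have xx : x ^ 2 ≤ x1 ^ 2 := by gcongr
  have x1s : x1 ^ 2 < 1 := by nlinarith
  have key : 2 * x * (3 - 2 * x ^ 2) * (1 - x1 ^ 2) ≤ 2 * x1 * (3 - 2 * x1 ^ 2) * (1 - x ^ 2) := by
    have e2 : 2 * x1 * (3 - 2 * x1 ^ 2) * (1 - x ^ 2) - 2 * x * (3 - 2 * x ^ 2) * (1 - x1 ^ 2)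
      = 2 * (x1 - x) * (3 * (1 + x * x1) - 2 * (x1 ^ 2 + x * x1 + x ^ 2) + 2 * (x * x1) ^ 2) := by ring
    have : 0 ≤ 3 * (1 + x * x1) - 2 * (x1 ^ 2 + x * x1 + x ^ 2) + 2 * (x * x1) ^ 2 := by
      nlinarith [mul_nonneg (by linarith : 0 ≤ 1 - x1 ^ 2) (by linarith : 0 ≤ 1 - x ^ 2),
        mul_pos hx (by linarith : 0 < x1), sq_nonneg (x1 - x)]
    have := mul_nonneg (by linarith : 0 ≤ x1 - x) this
    linarith
  have h2 : 0 < 3 * (1 - x ^ 2) := by linarith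
  have h3 : 0 < 1 - x1 ^ 2 := by linarith
  refine le_of_mul_le_mul_right ?_ (mul_pos h2 h3)
  have k1 := mul_le_mul_of_nonneg_left hr (mul_pos hg h3).le
  have k2 := mul_le_mul_of_nonneg_left key hg.le
  have k3 := mul_le_mul_of_nonneg_right h (by linarith : 0 ≤ 1 - x ^ 2)
  nlinarith

lemma Psi.cellA {α β D H r s : ℝ} (h : Psi α β D H r s) (α1 β1 ga gb : ℝ)
    (ha1 : α ≤ α1) (hb1 : β ≤ β1) (n1 : α1 < 1) (n2 : β1 < 1) (n3 : 0 < ga) (n4 : 0 < gb)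
    (hga : ga * (2 * α1 * (3 - 2 * α1 ^ 2)) ≤ 3 * (1 - α1 ^ 2))
    (hgb : gb * (2 * β1 * (3 - 2 * β1 ^ 2)) ≤ 3 * (1 - β1 ^ 2))
    (fin : 1.011 * (α1 + β1) * (2 + α1 ^ 2 + β1 ^ 2) < 6 * (ga + gb) * ((1 - α1 ^ 2) * (1 - β1 ^ 2))) :
    False := by
  obtain ⟨b0, ba, a1, D0, Db, r0, -, ii, Hs, HD, rα, sβ, sβ', main⟩ := h
  have α_pos : 0 < α := by linarith
  have s0 : 0 < s := by linarith
  have α1p : 0 < α1 := by linarith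
  have β1p : 0 < β1 := by linarith
  have gr := g_le α_pos ha1 n1 rα n3 hga
  have gs := g_le b0 hb1 n2 sβ' n4 hgb
  have bb : β ^ 2 ≤ β1 ^ 2 := by gcongr
  have b1s : β1 ^ 2 < 1 := sqlt β1p n2
  have aa : α ^ 2 ≤ α1 ^ 2 := by gcongr
  have as1 : α1 ^ 2 < 1 := sqlt α1p n1
  have P0 : 0 < α + β := by linarith
  have h1 : 1.011 * H * r * (α + β) * (2 + α ^ 2 + β ^ 2) ≤ 1.011 * (s / 2) * r * (α1 + β1) * (2 + α1 ^ 2 + β1 ^ 2) := by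
    gcongr
  have h2 : (ga + gb) * (r * s) ≤ r + s := by
    linarith [mul_le_mul_of_nonneg_right gr s0.le, mul_le_mul_of_nonneg_right gs r0.le]
  have h3 : (1 - α1 ^ 2) * (1 - β1 ^ 2) ≤ (1 - α ^ 2) * (1 - β ^ 2) := by
    have : 0 ≤ 1 - β1 ^ 2 := by linarith
    have : 0 ≤ 1 - α ^ 2 := by linarith
    gcongr
  have h30 : 0 < (1 - α1 ^ 2) * (1 - β1 ^ 2) := by
    apply mul_pos <;> linarith
  have h4 : 3 * ((ga + gb) * (r * s)) * ((1 - α1 ^ 2) * (1 - β1 ^ 2)) ≤ 3 * (r + s) * ((1 - α ^ 2) * (1 - β ^ 2)) := by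
    gcongr
  have h5 : 0 < r * s := by positivity
  have h6 := mul_lt_mul_of_pos_right fin h5
  linarith

lemma Psi.false {α β D H r s : ℝ} (h : Psi α β D H r s) : False := by
  have a1 := h.a1
  have b0 := h.b0
  have ba := h.ba
  rcases le_total α 0.58 with h1 | h1
  · apply h.cellA 0.58 0.58 0.7374 0.7374 h1 (by linarith) <;> norm_num
  rcases le_total α 0.6 with h2 | h1
  · have hb : β ≤ 0.578 := by apply h.bup 0.58 0.578 0.50171 0.50042 (ha := h1) <;> norm_num
    apply h.cellA 0.6 0.578 0.7017 0.7411 h2 hb <;> norm_num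
  rcases le_total α 0.62 with h2 | h1
  · have hb : β ≤ 0.559 := by apply h.bup 0.6 0.559 0.51449 0.48793 (ha := h1) <;> norm_num
    apply h.cellA 0.62 0.559 0.6675 0.7767 h2 hb <;> norm_num
  rcases le_total α 0.64 with h2 | h1
  · have hb : β ≤ 0.54 := by apply h.bup 0.62 0.54 0.52693 0.47514 (ha := h1) <;> norm_num
    apply h.cellA 0.64 0.54 0.6345 0.8142 h2 hb <;> norm_num
  rcases le_total α 0.66 with h2 | h1
  · have hb : β ≤ 0.523 := by apply h.bup 0.64 0.523 0.53905 0.46344 (ha := h1) <;> norm_num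
    apply h.cellA 0.66 0.523 0.6025 0.8494 h2 hb <;> norm_num
  rcases le_total α 0.68 with h2 | h1
  · have hb : β ≤ 0.506 := by apply h.bup 0.66 0.506 0.55084 0.45149 (ha := h1) <;> norm_num
    apply h.cellA 0.68 0.506 0.5714 0.8864 h2 hb <;> norm_num
  rcases le_total α 0.7 with h2 | h1
  · have hb : β ≤ 0.49 := by apply h.bup 0.68 0.49 0.56231 0.44001 (ha := h1) <;> norm_num
    apply h.cellA 0.7 0.49 0.541 0.9231 h2 hb <;> norm_num
  rcases le_total α 0.72 with h2 | h1
  · have hb : β ≤ 0.475 := by apply h.bup 0.7 0.475 0.57346 0.42905 (ha := h1) <;> norm_num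
    rcases le_total 0.356 β with hh | hb
    · apply h.cellB 0.7 0.72 0.356 0.475 0.462 0.0357 0.3536 1.2821 1.0905 h1 h2 hh hb <;> norm_num
    rcases le_total 0.237 β with hh | hb
    · apply h.cellB 0.7 0.72 0.237 0.356 0.356 0.0255 0.2354 1.4601 1.0484 h1 h2 hh hb <;> norm_num
    apply h.cellB 0.7 0.72 0 0.237 0.237 0.0192 0 1.6312 1.0199 h1 h2 b0.le hb <;> norm_num
  rcases le_total α 0.74 with h2 | h1
  · have hb : β ≤ 0.46 := by apply h.bup 0.72 0.46 0.5843 0.4179 (ha := h1) <;> norm_num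
    rcases le_total 0.345 β with hh | hb
    · apply h.cellB 0.72 0.74 0.345 0.46 0.426 0.0346 0.3223 1.2867 1.074 h1 h2 hh hb <;> norm_num
    rcases le_total 0.23 β with hh | hb
    · apply h.cellB 0.72 0.74 0.23 0.345 0.345 0.0251 0.2148 1.4629 1.0451 h1 h2 hh hb <;> norm_num
    apply h.cellB 0.72 0.74 0 0.23 0.23 0.0191 0 1.633 1.0187 h1 h2 b0.le hb <;> norm_num
  rcases le_total α 0.76 with h2 | h1
  · have hb : β ≤ 0.446 := by apply h.bup 0.74 0.446 0.59484 0.40732 (ha := h1) <;> norm_num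
    rcases le_total 0.223 β with hh | hb
    · apply h.cellB 0.74 0.76 0.223 0.446 0.438 0.0336 0.1952 1.2871 1.0792 h1 h2 hh hb <;> norm_num
    apply h.cellB 0.74 0.76 0 0.223 0.223 0.0189 0 1.6354 1.0175 h1 h2 b0.le hb <;> norm_num
  rcases le_total α 0.78 with h2 | h1
  · have hb : β ≤ 0.433 := by apply h.bup 0.76 0.433 0.60508 0.39734 (ha := h1) <;> norm_num
    rcases le_total 0.216 β with hh | hb
    · apply h.cellB 0.76 0.78 0.216 0.433 0.399 0.0327 0.1763 1.291 1.0632 h1 h2 hh hb <;> norm_num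
    apply h.cellB 0.76 0.78 0 0.216 0.216 0.0188 0 1.6383 1.0164 h1 h2 b0.le hb <;> norm_num
  rcases le_total α 0.8 with h2 | h1
  · have hb : β ≤ 0.42 := by apply h.bup 0.78 0.42 0.61503 0.38723 (ha := h1) <;> norm_num
    rcases le_total 0.21 β with hh | hb
    · apply h.cellB 0.78 0.8 0.21 0.42 0.36 0.0319 0.1589 1.2957 1.0497 h1 h2 hh hb <;> norm_num
    apply h.cellB 0.78 0.8 0 0.21 0.21 0.0187 0 1.64 1.0154 h1 h2 b0.le hb <;> norm_num
  rcases le_total α 0.825 with h2 | h1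
  · have hb : β ≤ 0.408 := by apply h.bup 0.8 0.408 0.62469 0.37776 (ha := h1) <;> norm_num
    rcases le_total 0.204 β with hh | hb
    · apply h.cellB 0.8 0.825 0.204 0.408 0.323 0.0313 0.1377 1.2956 1.0389 h1 h2 hh hb <;> norm_num
    apply h.cellB 0.8 0.825 0 0.204 0.204 0.0186 0 1.6401 1.0145 h1 h2 b0.le hb <;> norm_num
  rcases le_total α 0.85 with h2 | h1
  · have hb : β ≤ 0.393 := by apply h.bup 0.825 0.393 0.63638 0.36576 (ha := h1) <;> norm_num
    rcases le_total 0.197 β with hh | hb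
    · apply h.cellB 0.825 0.85 0.197 0.393 0.278 0.0304 0.1177 1.3021 1.028 h1 h2 hh hb <;> norm_num
    apply h.cellB 0.825 0.85 0 0.197 0.197 0.0185 0 1.6426 1.0135 h1 h2 b0.le hb <;> norm_num
  rcases le_total α 0.875 with h2 | h1
  · have hb : β ≤ 0.379 := by apply h.bup 0.85 0.379 0.64764 0.3544 (ha := h1) <;> norm_num
    rcases le_total 0.19 β with hh | hb
    · apply h.cellB 0.85 0.875 0.19 0.379 0.234 0.0297 0.0981 1.3081 1.0194 h1 h2 hh hb <;> norm_num
    apply h.cellB 0.85 0.875 0 0.19 0.19 0.0183 0 1.6459 1.0125 h1 h2 b0.le hb <;> norm_num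
  rcases le_total α 0.9 with h2 | h1
  · have hb : β ≤ 0.366 := by apply h.bup 0.875 0.366 0.6585 0.3437 (ha := h1) <;> norm_num
    rcases le_total 0.183 β with hh | hb
    · apply h.cellB 0.875 0.9 0.183 0.366 0.192 0.029 0.0789 1.3137 1.0128 h1 h2 hh hb <;> norm_num
    apply h.cellB 0.875 0.9 0 0.183 0.168 0.0182 0 1.6498 1.0097 h1 h2 b0.le hb <;> norm_num
  rcases le_total α 0.925 with h2 | h1
  · have hb : β ≤ 0.353 := by apply h.bup 0.9 0.353 0.66896 0.33286 (ha := h1) <;> norm_num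
    apply h.cellB 0.9 0.925 0 0.353 0.181 0.0283 0 1.3155 1.0113 h1 h2 b0.le hb <;> norm_num
  rcases le_total α 0.95 with h2 | h1
  · have hb : β ≤ 0.342 := by apply h.bup 0.925 0.342 0.67904 0.32359 (ha := h1) <;> norm_num
    apply h.cellB 0.925 0.95 0 0.342 0.133 0.0278 0 1.3201 1.0061 h1 h2 b0.le hb <;> norm_num
  rcases le_total α 0.975 with h2 | h1
  · have hb : β ≤ 0.33 := by apply h.bup 0.95 0.33 0.68874 0.31337 (ha := h1) <;> norm_num
    apply h.cellB 0.95 0.975 0 0.33 0.086 0.0272 0 1.3278 1.0025 h1 h2 b0.le hb <;> norm_num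
  have h2 := a1.le
  have hb : β ≤ 0.319 := by apply h.bup 0.975 0.319 0.6981 0.30391 (ha := h1) <;> norm_num
  apply h.cellB 0.975 1 0 0.319 0.042 0.0267 0 1.3346 1.0006 h1 h2 b0.le hb <;> norm_num
end

section
open Real

lemma tanh_half_log {a b : ℝ} (ha : 0 < a) (hb : 0 < b) :
    tanh (log (a / b) / 2) = (a - b) / (a + b) := by
  set E := exp (log (a / b) / 2) with hE
  have E0 : 0 < E := exp_pos _
  have e1 : E * E = a / b := by
    rw [hE, ← exp_add, add_halves, exp_log (by positivity)]
  have : tanh (log (a / b) / 2) = (E * E - 1) / (E * E + 1) := by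
    rw [tanh_eq_sinh_div_cosh, sinh_eq, cosh_eq, exp_neg, ← hE]
    field_simp
  rw [this, e1]
  field_simp

lemma artanh_up {x : ℝ} (hx : 0 ≤ x) : x * (3 * (1 - tanh x ^ 2)) ≤ tanh x * (3 - 2 * tanh x ^ 2) := by
  have key : x ≤ tanh x + 1/3 * sinh x ^ 2 * tanh x := by
    have := mono_aux (c := 0) (f := fun x => tanh x + 1/3 * sinh x ^ 2 * tanh x - x)
      (f' := fun x => 2/3 * sinh x ^ 2 * (1 - 1 / cosh x ^ 2)) ?_ ?_ le_rfl hx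
    · simp at this
      linarith
    · intro y _
      have h1 := hasDerivAt_tanh y
      have h2 := ((hasDerivAt_sinh y).pow 2).const_mul (1/3 : ℝ)
      have h3 := (h1.add (h2.mul h1)).sub (hasDerivAt_id y)
      refine HasDerivAt.congr_deriv h3 ?_
      have c0 := cosh_pos y
      rw [tanh_eq_sinh_div_cosh]
      simp only [Pi.pow_apply]
      norm_num
      field_simp
      linear_combination (-3:ℝ) * cosh_sq y
    · intro y _
      have c1 := one_le_cosh y
      have : 1 / cosh y ^ 2 ≤ 1 := by
        rw [div_le_one (by positivity)]
        nlinarith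
      have : 0 ≤ 1 - 1 / cosh y ^ 2 := by linarith
      positivity
  have c0 := cosh_pos x
  have e1 : 1 - tanh x ^ 2 = 1 / cosh x ^ 2 := by
    rw [tanh_eq_sinh_div_cosh]
    field_simp
    linarith [cosh_sq x]
  have e2 : sinh x ^ 2 * (1 - tanh x ^ 2) = tanh x ^ 2 := by
    rw [e1, tanh_eq_sinh_div_cosh]
    field_simp
  have p : 0 < 3 * (1 - tanh x ^ 2) := by rw [e1]; positivity
  have := mul_le_mul_of_nonneg_right key p.le
  calc _ ≤ _ := this
    _ = 3 * tanh x * (1 - tanh x ^ 2) + tanh x * (sinh x ^ 2 * (1 - tanh x ^ 2)) := by ring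
    _ = _ := by rw [e2]; ring

lemma tanh_le_self' {x : ℝ} (hx : 0 ≤ x) : tanh x ≤ x := by
  rw [tanh_eq_sinh_div_cosh, div_le_iff₀ (cosh_pos x)]
  exact sinh_le_mul_cosh hx

lemma cosh_tanh_half (r : ℝ) : cosh r * (1 - tanh (r/2) ^ 2) = 1 + tanh (r/2) ^ 2 := by
  have h : cosh r = cosh (r/2) ^ 2 + sinh (r/2) ^ 2 := by
    rw [← cosh_two_mul]; congr 1; ring
  have c0 := cosh_pos (r/2)
  rw [h, tanh_eq_sinh_div_cosh]
  field_simp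
  linear_combination cosh_sq (r/2)

lemma u_le_of {G a1 a2 b1 b2 α β : ℝ} (a20 : 0 < a2) (h2 : a2 < b1) (h3 : b1 < b2) (h4 : b2 < a1)
    (hα : α = (a1 - a2) / (a1 + a2)) (hβ : β = (b2 - b1) / (b2 + b1)) (G0 : 0 < G)
    (ha : G ^ 2 ≤ 2 * (a1 ^ 2 + a2 ^ 2)) (hb : G ^ 2 ≤ 2 * (b1 ^ 2 + b2 ^ 2))
    (hc : (a1 - b1) + (b2 - a2) ≤ 1.0018 * G) :
    α / √(1 + α ^ 2) + β / √(1 + β ^ 2) ≤ 1.0018 := by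
  have key : ∀ x y : ℝ, 0 < y → y < x → G ^ 2 ≤ 2 * (x ^ 2 + y ^ 2) →
      G * (((x - y) / (x + y)) / √(1 + ((x - y) / (x + y)) ^ 2)) ≤ x - y := by
    intro x y hy hxy hG
    have e : 1 + ((x - y) / (x + y)) ^ 2 = 2 * (x ^ 2 + y ^ 2) / (x + y) ^ 2 := by
      have : x + y ≠ 0 := by linarith
      field_simp; ring
    have hs : 0 < x + y := by linarith
    rw [e, sqrt_div (by positivity), sqrt_sq hs.le]
    have hr : G ≤ √(2 * (x ^ 2 + y ^ 2)) := le_sqrt_of_sq_le hG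
    have hr0 : 0 < √(2 * (x ^ 2 + y ^ 2)) := by linarith
    have : G * ((x - y) / (x + y) / (√(2 * (x ^ 2 + y ^ 2)) / (x + y))) = (x - y) * (G / √(2 * (x ^ 2 + y ^ 2))) := by
      field_simp
    rw [this]
    have : G / √(2 * (x ^ 2 + y ^ 2)) ≤ 1 := by rw [div_le_one hr0]; exact hr
    nlinarith
  have k1 := key a1 a2 a20 (by linarith) ha
  have k2 := key b2 b1 (by linarith) h3 (by linarith)
  rw [hα, hβ]
  refine le_of_mul_le_mul_left ?_ G0
  linarith

lemma pmean {p x y : ℝ} (hp : 1 ≤ p) (h1 : 0 ≤ x) (h2 : 0 ≤ y) :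
    (1 / 2 * x + 1 / 2 * y) ^ p ≤ 1 / 2 * x ^ p + 1 / 2 * y ^ p := by
  have := (convexOn_rpow hp).2 (Set.mem_Ici.2 h1) (Set.mem_Ici.2 h2) (by norm_num : (0:ℝ) ≤ 1/2)
    (by norm_num : (0:ℝ) ≤ 1/2) (by norm_num)
  simpa [smul_eq_mul] using this

lemma c_mean {p c1 c2 : ℝ} (hp : 1 < p) (h1 : 0 ≤ c1) (h2 : 0 ≤ c2) (h : c1 ^ p + c2 ^ p = 1) :
    ((c1 + c2) / 2) ^ p ≤ 1 / 2 := by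
  have := pmean hp.le h1 h2
  have e : 1 / 2 * c1 + 1 / 2 * c2 = (c1 + c2) / 2 := by ring
  rw [e] at this
  linarith

lemma Strict.hu1 {p a1 a2 b1 b2 c1 c2 : ℝ} (hp : 1 < p) (hp2 : p < 2) (h : Strict p a1 a2 b1 b2 c1 c2) :
    ∃ G : ℝ, 0 < G ∧ G ^ 2 ≤ 2 * (a1 ^ 2 + a2 ^ 2) ∧ G ^ 2 ≤ 2 * (b1 ^ 2 + b2 ^ 2) ∧
      (a1 - b1) + (b2 - a2) ≤ 1.0018 * G := by
  have p0 : p ≠ 0 := by linarith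
  obtain ⟨i1, i2, i3, i4, i5, i6, e1, e2, na, nb, nc⟩ := h
  have key : ∀ x y : ℝ, 0 < x → 0 < y → x ^ p + y ^ p = 1 →
      (2 * (1/2 : ℝ) ^ (1/p)) ^ 2 ≤ 2 * (x ^ 2 + y ^ 2) := by
    intro x y hx hy hn
    have := pmean (p := 2 / p) (x := x ^ p) (y := y ^ p) (by rw [le_div_iff₀ (by linarith)]; linarith)
      (by positivity) (by positivity)
    rw [← rpow_mul hx.le, ← rpow_mul hy.le, mul_div_cancel₀ _ p0, rpow_two, rpow_two] at this
    have e : 1 / 2 * x ^ p + 1 / 2 * y ^ p = 1 / 2 := by linarith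
    rw [e] at this
    have e2 : (2 * (1/2 : ℝ) ^ (1/p)) ^ 2 = 4 * (1/2) ^ (2/p) := by
      rw [mul_pow, ← rpow_natCast ((1/2 : ℝ) ^ (1/p)), ← rpow_mul (by norm_num)]
      norm_num
      congr 1
      ring
    rw [e2]
    linarith
  refine ⟨2 * (1/2 : ℝ) ^ (1/p), by positivity, key a1 a2 (by linarith) i1 na, key b1 b2 (by linarith) (by linarith) nb, ?_⟩
  have hm := c_mean hp (by linarith : 0 ≤ c1) (by linarith : 0 ≤ c2) nc
  have : (c1 + c2) / 2 ≤ (1/2 : ℝ) ^ (1/p) := by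
    rw [one_div p]
    exact (le_rpow_inv_iff_of_pos (by linarith) (by norm_num) (by linarith)).2 hm
  have g0 : 0 < (1/2 : ℝ) ^ (1/p) := by positivity
  nlinarith

lemma Strict.hu2 {p a1 a2 b1 b2 c1 c2 : ℝ} (hp : 2 < p) (hp2 : p ≤ 2.01) (h : Strict p a1 a2 b1 b2 c1 c2) :
    ∃ G : ℝ, 0 < G ∧ G ^ 2 ≤ 2 * (a1 ^ 2 + a2 ^ 2) ∧ G ^ 2 ≤ 2 * (b1 ^ 2 + b2 ^ 2) ∧
      (a1 - b1) + (b2 - a2) ≤ 1.0018 * G := by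
  have p0 : 0 < p := by linarith
  obtain ⟨i1, i2, i3, i4, i5, i6, e1, e2, na, nb, nc⟩ := h
  have key : ∀ x y : ℝ, 0 < x → 0 < y → x ^ p + y ^ p = 1 → (√2) ^ 2 ≤ 2 * (x ^ 2 + y ^ 2) := by
    intro x y hx hy hn
    have m : ∀ z : ℝ, 0 < z → z ^ p ≤ 1 → z ^ p ≤ z ^ 2 := by
      intro z hz h1
      have z1 : z ≤ 1 := by
        by_contra hc
        push Not at hc
        linarith [one_lt_rpow hc p0]
      rw [← rpow_two]
      exact rpow_le_rpow_of_exponent_ge hz z1 hp.le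
    have hx' : 0 < x ^ p := by positivity
    have hy' : 0 < y ^ p := by positivity
    have := m x hx (by linarith)
    have := m y hy (by linarith)
    rw [sq_sqrt (by norm_num)]
    linarith
  refine ⟨√2, by positivity, key a1 a2 (by linarith) i1 na, key b1 b2 (by linarith) (by linarith) nb, ?_⟩
  have hm := c_mean (by linarith) (by linarith : 0 ≤ c1) (by linarith : 0 ≤ c2) nc
  have g1 : (1:ℝ)/2 < (1.0018 * √2 / 2) ^ p := by
    have hs : 0 < √2 := by positivity
    have hl : log (1.0018 * √2 / 2) = log 1.0018 - log 2 / 2 := by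
      rw [log_div (by positivity) (by norm_num), log_mul (by norm_num) (by positivity), log_sqrt (by norm_num)]
      ring
    rw [← log_lt_log_iff (by norm_num) (by positivity), log_rpow (by positivity), hl]
    have h1 := one_sub_inv_le_log_of_pos (by norm_num : (0:ℝ) < 1.0018)
    have h2 := log_two_lt_d9
    have h3 := log_two_gt_d9
    have h4 : (0.0017967 : ℝ) ≤ log 1.0018 := by
      refine le_trans ?_ h1
      norm_num
    rw [one_div, log_inv]
    have : -0.3447769 ≤ log 1.0018 - log 2 / 2 := by linarith
    nlinarith
  have := lt_of_rpow (by linarith) (by positivity) (lt_of_le_of_lt hm g1)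
  linarith

lemma main1 {p r s t : ℝ} (hp : 1 < p) (hp2 : p < 2) (h : Hyp p r s t) :
    6 * t * (r + s) ≤ (s - t) * (p - 1) * r * (cosh r - cosh s) := by
  obtain ⟨t0, ts, sr, -, -, star⟩ := h
  set κ := 1 - p / 2 with hκ
  have κ0 : 0 < κ := by linarith
  have ek : p / 2 - 1 = -κ := by rw [hκ]; ring
  rw [ek] at star
  simp only [neg_mul, sinh_neg] at star
  have u := up1 hp hp2 (by linarith : 0 < s) sr
  rw [← hκ] at u
  have sc := sinh_scale (l := (s - t) / (r + s)) (x := κ * (r + s)) (div_nonneg (by linarith) (by linarith))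
    (by rw [div_le_one (by linarith)]; linarith) (by nlinarith)
  have rs : 0 < r + s := by linarith
  have e1 : (s - t) / (r + s) * (κ * (r + s)) = κ * (s - t) := by field_simp
  rw [e1] at sc
  set S := sinh (κ * (r + s)) with hS
  have S0 : 0 < S := sinh_pos_iff.2 (by positivity)
  have g1 := self_le_sinh' (x := p/2*s) (by nlinarith)
  have g2 := self_le_sinh' (x := κ*t) (by positivity)
  have g3 := self_le_sinh' (x := p/2*t) (by nlinarith)
  have g4 := self_le_sinh' (x := κ*s) (by nlinarith)
  have br : p * κ * s * t ≤ sinh (p/2*s) * sinh (κ*t) + sinh (p/2*t) * sinh (κ*s) := by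
    have h1 : (p/2*s) * (κ*t) ≤ sinh (p/2*s) * sinh (κ*t) := by
      apply mul_le_mul g1 g2 (by positivity)
      have : 0 < p/2*s := by nlinarith
      linarith
    have h2 : (p/2*t) * (κ*s) ≤ sinh (p/2*t) * sinh (κ*s) := by
      apply mul_le_mul g3 g4 (by nlinarith)
      have : 0 < p/2*t := by nlinarith
      linarith
    linarith
  have T0 : 0 ≤ sinh (κ * (s - t)) := sinh_nonneg_iff.2 (by nlinarith)
  set V := (p-1)*(1-p/2)*(p/2)/3*(r*s)*(cosh r - cosh s) with hV
  have cr : cosh s < cosh r := cosh_lt_cosh.2 (by rw [abs_of_pos (by linarith), abs_of_pos (by linarith)]; exact sr)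
  have V0 : 0 ≤ V := by
    rw [hV]
    have : 0 < 1 - p/2 := by linarith
    have : 0 < p - 1 := by linarith
    have : 0 < cosh r - cosh s := by linarith
    have : 0 < s := by linarith
    have : 0 < r := by linarith
    positivity
  have k1 : S * (p * κ * s * t) ≤ (s - t) / (r + s) * S * V := by
    calc S * (p * κ * s * t) ≤ S * (sinh (p/2*s) * sinh (κ*t) + sinh (p/2*t) * sinh (κ*s)) := by gcongr
      _ = sinh (κ * (s - t)) * (sinh (p/2*r)*sinh (κ*s) - sinh (p/2*s)*sinh (κ*r)) := by linarith
      _ ≤ sinh (κ * (s - t)) * V := by gcongr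
      _ ≤ _ := by gcongr
  have k2 : p * κ * s * t ≤ (s - t) / (r + s) * V := by
    refine le_of_mul_le_mul_left ?_ S0
    linarith
  rw [div_mul_eq_mul_div, le_div_iff₀ rs, hV] at k2
  have s0 : 0 < s := by linarith
  have w : 0 < p * κ * s / 6 := by positivity
  refine le_of_mul_le_mul_left ?_ w
  rw [← hκ] at k2
  linarith

lemma main2 {p r s t : ℝ} (hp : 2 < p) (hp2 : p ≤ 2.01) (h : Hyp p r s t) :
    6 * t * (r + s) ≤ (s - t) * cosh ((p/2-1) * (s-t)) * (p - 1) * r * (cosh r - cosh s) := by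
  obtain ⟨t0, ts, sr, -, -, star⟩ := h
  have u := up2 hp (by linarith) (by linarith : 0 < s) sr
  set κ := p / 2 - 1 with hκ
  have κ0 : 0 < κ := by linarith
  have s0 : 0 < s := by linarith
  have r0 : 0 < r := by linarith
  have rs : 0 < r + s := by linarith
  set S := sinh (κ * (r + s)) with hS
  have S0 : 0 < S := sinh_pos_iff.2 (by positivity)
  have g1 := self_le_sinh' (x := p/2*s) (by nlinarith)
  have g2 := self_le_sinh' (x := κ*t) (by positivity)
  have g3 := self_le_sinh' (x := p/2*t) (by nlinarith)
  have g4 := self_le_sinh' (x := κ*s) (by nlinarith)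
  have br : p * κ * s * t ≤ sinh (p/2*s) * sinh (κ*t) + sinh (p/2*t) * sinh (κ*s) := by
    have h1 : (p/2*s) * (κ*t) ≤ sinh (p/2*s) * sinh (κ*t) := by
      apply mul_le_mul g1 g2 (by positivity)
      have : 0 < p/2*s := by nlinarith
      linarith
    have h2 : (p/2*t) * (κ*s) ≤ sinh (p/2*t) * sinh (κ*s) := by
      apply mul_le_mul g3 g4 (by nlinarith)
      have : 0 < p/2*t := by nlinarith
      linarith
    linarith
  have T0 : 0 ≤ sinh (κ * (s - t)) := sinh_nonneg_iff.2 (by nlinarith)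
  have T1 := sinh_le_mul_cosh (x := κ * (s - t)) (by nlinarith)
  have cr : cosh s < cosh r := cosh_lt_cosh.2 (by rw [abs_of_pos (by linarith), abs_of_pos (by linarith)]; exact sr)
  have k1 : S * (p * κ * s * t) * (r + s) ≤ sinh (κ * (s - t)) * ((p-1)*(p/2)/3*(r*s)*S*(cosh r - cosh s)) := by
    calc S * (p * κ * s * t) * (r + s) ≤ S * (sinh (p/2*s) * sinh (κ*t) + sinh (p/2*t) * sinh (κ*s)) * (r + s) := by gcongr
      _ = sinh (κ * (s - t)) * ((sinh (p/2*r)*sinh (κ*s) - sinh (p/2*s)*sinh (κ*r)) * (r + s)) := by rw [star]; ring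
      _ ≤ _ := by gcongr
  have k2 : (p * κ * s * t) * (r + s) ≤ sinh (κ * (s - t)) * ((p-1)*(p/2)/3*(r*s)*(cosh r - cosh s)) := by
    refine le_of_mul_le_mul_left ?_ S0
    linarith
  have cc : 0 < cosh r - cosh s := by linarith
  have q0 : 0 < p - 1 := by linarith
  have k3 : (p * κ * s * t) * (r + s) ≤ (κ * (s - t) * cosh (κ * (s - t))) * ((p-1)*(p/2)/3*(r*s)*(cosh r - cosh s)) := by
    refine k2.trans ?_
    gcongr
  have w : 0 < p * κ * s / 6 := by positivity
  refine le_of_mul_le_mul_left ?_ w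
  linarith
end

section
open Real

lemma tanh_lt_one' (x : ℝ) : tanh x < 1 := by
  rw [tanh_eq_sinh_div_cosh, div_lt_one (cosh_pos x)]
  exact sinh_lt_cosh x

lemma lc_le1 {p s t : ℝ} (hp : 1 < p) (hp2 : p ≤ 2) (ht : 0 ≤ t) (hs : t ≤ s) :
    (1/p) * (log (cosh (p/2*s)) - log (cosh (p/2*t))) ≤ 1/2 * (log (cosh s) - log (cosh t)) := by
  have p0 : 0 < p := by linarith
  have := mono_aux (c := 0) (f := fun x => 1/2 * log (cosh x) - (1/p) * log (cosh (p/2*x)))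
    (f' := fun x => 1/2 * tanh x - (1/p) * (p/2 * tanh (p/2*x))) ?_ ?_ ht hs
  · linarith
  · intro x _
    exact ((hasDerivAt_lc x).const_mul (1/2)).sub ((hasDerivAt_lc' (p/2) x).const_mul (1/p))
  · intro x hx
    have e : (1/p) * (p/2 * tanh (p/2*x)) = 1/2 * tanh (p/2*x) := by field_simp
    rw [e]
    have := tanh_mono (x := p/2*x) (y := x) (by nlinarith)
    linarith

lemma lc_le2 {p s t : ℝ} (hp : 2 ≤ p) (ht : 0 ≤ t) (hs : t ≤ s) :
    (1/p) * (log (cosh (p/2*s)) - log (cosh (p/2*t))) ≤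
      1/2 * (log (cosh s) - log (cosh t)) + (p/2-1)*(s-t)/2 := by
  have p0 : 0 < p := by linarith
  have := mono_aux (c := 0) (f := fun x => 1/2 * log (cosh x) + (p/2-1)/2 * x - (1/p) * log (cosh (p/2*x)))
    (f' := fun x => 1/2 * tanh x + (p/2-1)/2 * 1 - (1/p) * (p/2 * tanh (p/2*x))) ?_ ?_ ht hs
  · linarith
  · intro x _
    exact (((hasDerivAt_lc x).const_mul (1/2)).add ((hasDerivAt_id x).const_mul ((p/2-1)/2))).sub
      ((hasDerivAt_lc' (p/2) x).const_mul (1/p))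
  · intro x hx
    have e : (1/p) * (p/2 * tanh (p/2*x)) = 1/2 * tanh (p/2*x) := by field_simp
    rw [e]
    have := tanh_scale (l := 2/p) (x := p/2*x) (by positivity) (by rw [div_le_one p0]; exact hp) (by positivity)
    have e2 : 2/p*(p/2*x) = x := by field_simp
    rw [e2] at this
    have h1 : tanh (p/2*x) ≤ p/2 * tanh x := by
      have := mul_le_mul_of_nonneg_left this (by linarith : 0 ≤ p/2)
      have e3 : p/2*(2/p*tanh (p/2*x)) = tanh (p/2*x) := by field_simp
      linarith
    have h2 := (tanh_lt_one' x).le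
    nlinarith

set_option maxHeartbeats 1000000 in
lemma ii_of {r s t L : ℝ} (t0 : 0 < t) (ts : t < s) (sr : s < r)
    (h : log (sinh ((r+s)/2)) - log (cosh ((r+t)/2)) ≤ 1/2 * (log (cosh s) - log (cosh t)) + L/2)
    (hL : exp L - 1 ≤ 0.0125 * tanh ((s-t)/2)) :
    2 * (tanh (r/2) + tanh (s/2)) * (1 - tanh (r/2) * tanh (s/2)) * tanh ((s-t)/2) * (1 - tanh (s/2) ^ 2) ≤
    (1 + tanh (s/2) ^ 2) * (1 - tanh (r/2) ^ 2) * (1 - tanh (s/2) ^ 2)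
    + 0.0125 * tanh ((s-t)/2) * (1 + tanh (s/2) ^ 2) * (1 + tanh (r/2) * tanh (s/2)) ^ 2 := by
  have S0 : 0 < sinh ((r+s)/2) := sinh_pos_iff.2 (by linarith)
  have C0 := cosh_pos ((r+t)/2)
  have s0 := cosh_pos s
  have t0' := cosh_pos t
  have k1 : sinh ((r+s)/2) ^ 2 * cosh t ≤ cosh ((r+t)/2) ^ 2 * cosh s * exp L := by
    rw [← log_le_log_iff (by positivity) (by positivity), log_mul (by positivity) (by positivity),
      log_mul (by positivity) (by positivity), log_mul (by positivity) (by positivity), log_exp, log_pow, log_pow]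
    push_cast
    linarith
  have er : sinh ((r+s)/2) = cosh (r/2) * cosh (s/2) * (tanh (r/2) + tanh (s/2)) := by
    have c1 := cosh_pos (r/2)
    have c2 := cosh_pos (s/2)
    rw [add_div, sinh_add, tanh_eq_sinh_div_cosh, tanh_eq_sinh_div_cosh]
    field_simp
  have ec : cosh ((r+t)/2) = cosh (r/2) * cosh (t/2) * (1 + tanh (r/2) * tanh (t/2)) := by
    have c1 := cosh_pos (r/2)
    have c2 := cosh_pos (t/2)
    rw [add_div, cosh_add, tanh_eq_sinh_div_cosh, tanh_eq_sinh_div_cosh]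
    field_simp
  have e2 : ∀ u : ℝ, cosh u = cosh (u/2) ^ 2 * (1 + tanh (u/2) ^ 2) := by
    intro u
    have c0 := cosh_pos (u/2)
    have h : cosh u = cosh (u/2) ^ 2 + sinh (u/2) ^ 2 := by
      rw [← cosh_two_mul]; congr 1; ring
    rw [h, tanh_eq_sinh_div_cosh]
    field_simp
  rw [er, ec, e2 s, e2 t] at k1
  have eD : tanh ((s-t)/2) * (1 - tanh (s/2) * tanh (t/2)) = tanh (s/2) - tanh (t/2) := by
    have c1 := cosh_pos (s/2)
    have c2 := cosh_pos (t/2)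
    have c3 := cosh_pos ((s-t)/2)
    have h1 : sinh ((s-t)/2) = sinh (s/2) * cosh (t/2) - cosh (s/2) * sinh (t/2) := by rw [sub_div, sinh_sub]
    have h2 : cosh ((s-t)/2) = cosh (s/2) * cosh (t/2) - sinh (s/2) * sinh (t/2) := by rw [sub_div, cosh_sub]
    have h3 : cosh (s/2) * cosh (t/2) - sinh (s/2) * sinh (t/2) ≠ 0 := by rw [← h2]; exact c3.ne'
    simp only [tanh_eq_sinh_div_cosh]
    rw [div_mul_eq_mul_div, div_eq_iff c3.ne', h1, h2]
    field_simp
  have hD0 := tanh_pos' (x := (s-t)/2) (by linarith)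
  have hD1 := tanh_lt_one' ((s-t)/2)
  have ha0 := tanh_pos' (x := r/2) (by linarith)
  have ha1 := tanh_lt_one' (r/2)
  have hb0 := tanh_pos' (x := s/2) (by linarith)
  have hb1 := tanh_lt_one' (s/2)
  have hw0 := tanh_pos' (x := t/2) (by linarith)
  have c1 := cosh_pos (r/2)
  have c2 := cosh_pos (s/2)
  have c3 := cosh_pos (t/2)
  generalize tanh (r/2) = α at *
  generalize tanh (s/2) = β at *
  generalize tanh (t/2) = w at *
  generalize tanh ((s-t)/2) = D at *
  generalize cosh (r/2) = A at *
  generalize cosh (s/2) = B at *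
  generalize cosh (t/2) = C at *
  generalize exp L = K at *
  have k2 : (α+β)^2*(1+w^2) ≤ (1+α*w)^2*(1+β^2)*K := by
    refine le_of_mul_le_mul_left ?_ (by positivity : 0 < (A*B*C)^2)
    linarith
  have ew : w * (1 - β * D) = β - D := by linarith
  have k3 : (α+β)^2*((1-β*D)^2+(β-D)^2) ≤ (1+α*β-(α+β)*D)^2*(1+β^2)*K := by
    have := mul_le_mul_of_nonneg_right k2 (sq_nonneg (1 - β*D))
    rw [← ew]
    have e : 1+α*β-(α+β)*D = (1 - β*D) + α * (w * (1 - β*D)) := by rw [ew]; ring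
    rw [e]
    linarith
  have k4 : (1+α*β-(α+β)*D)^2*(1+β^2)*(K-1) ≤ (1+α*β)^2*(1+β^2)*(0.0125*D) := by
    have h0 : 0 ≤ 1+α*β-(α+β)*D := by linarith [mul_pos (sub_pos.2 ha1) (sub_pos.2 hb1), mul_pos (add_pos ha0 hb0) (sub_pos.2 hD1)]
    have h1 : 1+α*β-(α+β)*D ≤ 1 + α*β := by linarith [mul_pos (add_pos ha0 hb0) hD0]
    calc (1+α*β-(α+β)*D)^2*(1+β^2)*(K-1) ≤ (1+α*β-(α+β)*D)^2*(1+β^2)*(0.0125*D) := by gcongr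
      _ ≤ _ := by gcongr
  linarith

set_option maxHeartbeats 1000000 in
lemma Psi.of {p a1 a2 b1 b2 c1 c2 : ℝ} (hp : 1 < p) (hp2 : p ≠ 2) (hp3 : p ≤ 2.01)
    (h : Strict p a1 a2 b1 b2 c1 c2)
    (hy : Hyp p (log (a1/a2)) (log (b2/b1)) (log (c2/c1))) : False := by
  have hG : ∃ G : ℝ, 0 < G ∧ G ^ 2 ≤ 2 * (a1 ^ 2 + a2 ^ 2) ∧ G ^ 2 ≤ 2 * (b1 ^ 2 + b2 ^ 2) ∧
      (a1 - b1) + (b2 - a2) ≤ 1.0018 * G := by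
    rcases lt_or_gt_of_ne hp2 with h' | h'
    · exact h.hu1 hp h'
    · exact h.hu2 h' hp3
  obtain ⟨G, G0, g1, g2, g3⟩ := hG
  have i1 := h.a2_pos
  have i2 := h.a2_lt
  have i3 := h.b1_lt
  have i4 := h.c_lt
  have i5 := h.c2_lt
  have i6 := h.b2_lt
  have hu := u_le_of i1 i2 (by linarith) i6 (tanh_half_log (by linarith) i1)
    (tanh_half_log (a := b2) (b := b1) (by linarith) (by linarith)) G0 g1 g2 g3
  clear g1 g2 g3 i1 i2 i3 i4 i5 i6 h
  set r := log (a1/a2)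
  set s := log (b2/b1)
  set t := log (c2/c1)
  have t0 := hy.t_pos
  have ts := hy.t_lt
  have sr := hy.s_lt
  have s0 : 0 < s := by linarith
  have r0 : 0 < r := by linarith
  have H0 : 0 < (s-t)/2 := by linarith
  have b0 := tanh_pos' (x := s/2) (by linarith)
  have a1 := tanh_lt_one' (r/2)
  have ba : tanh (s/2) < tanh (r/2) := by
    have hl := tanh_add_tanh (r/2) (-(s/2))
    rw [tanh_neg] at hl
    have : 0 < sinh (r/2 + -(s/2)) / (cosh (r/2) * cosh (-(s/2))) :=
      div_pos (sinh_pos_iff.2 (by linarith)) (mul_pos (cosh_pos _) (cosh_pos _))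
    linarith
  have D0 := tanh_pos' H0
  have Db := tanh_mono (x := (s-t)/2) (y := s/2) (by linarith)
  have b58 : tanh (s/2) ≤ 0.58 := by
    by_contra hc
    push Not at hc
    have h1 := u_mono b0.le ba.le
    have h2 := u_mono (by norm_num) hc.le
    have h3 := u_lower (x := 0.58) (w := 0.5015) (by norm_num) (by norm_num)
    linarith
  have HD := artanh_up H0.le
  have Hb : (s-t)/2 ≤ 1.17 * tanh ((s-t)/2) := by
    have hd : tanh ((s-t)/2) ^ 2 ≤ 0.3364 := by nlinarith
    have h2 : 0 < 3 * (1 - tanh ((s-t)/2) ^ 2) := by linarith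
    refine le_of_mul_le_mul_right (HD.trans ?_) h2
    nlinarith
  have tb : ∃ q' : ℝ, 0 < q' ∧ 2*q'*(tanh (r/2) - tanh (s/2)) ≤ t*(2+tanh (r/2)^2+tanh (s/2)^2) ∧
      6 * t * (r + s) ≤ (s - t) * 1.011 * q' * r * (cosh r - cosh s) := by
    have cr : cosh s < cosh r := cosh_lt_cosh.2 (by rw [abs_of_pos (by linarith), abs_of_pos (by linarith)]; exact sr)
    have cc : 0 < cosh r - cosh s := by linarith
    have st : 0 < s - t := by linarith
    rcases lt_or_gt_of_ne hp2 with h' | h'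
    · refine ⟨p - 1, by linarith, hy.t_bound hp (by linarith) le_rfl (by linarith), (main1 hp h' hy).trans ?_⟩
      have q0 : 0 < p - 1 := by linarith
      have : (s-t) * (p-1) * r * (cosh r - cosh s) = (s-t) * 1 * (p-1) * r * (cosh r - cosh s) := by ring
      rw [this]
      gcongr
      norm_num
    · refine ⟨1, by linarith, hy.t_bound hp (by norm_num) (by linarith) le_rfl, (main2 h' hp3 hy).trans ?_⟩
      have q0 : 0 < p - 1 := by linarith
      have hc : cosh ((p/2-1)*(s-t)) ≤ 1.0001 := by
        have h1 := cosh_le_exp_half_sq ((p/2-1)*(s-t))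
        have h2 : (p/2-1)*(s-t) ≤ 0.005 * 2 := by
          apply mul_le_mul <;> linarith
        have h20 : 0 ≤ (p/2-1)*(s-t) := mul_nonneg (by linarith) st.le
        have h3 : ((p/2-1)*(s-t))^2/2 ≤ 0.00005 := by nlinarith
        have h4 : exp (((p/2-1)*(s-t))^2/2) ≤ 1 / (1 - 0.00005) := by
          have := exp_le_exp.2 h3
          have h5 := add_one_le_exp (-0.00005 : ℝ)
          rw [exp_neg] at h5
          have h6 : exp 0.00005 ≤ 1 / (1 - 0.00005) := by
            rw [le_div_iff₀ (by norm_num)]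
            have := exp_pos 0.00005
            have : exp 0.00005 * (exp 0.00005)⁻¹ = 1 := by field_simp
            nlinarith
          linarith
        have : (1:ℝ) / (1 - 0.00005) ≤ 1.0001 := by norm_num
        linarith
      have hq : cosh ((p/2-1)*(s-t)) * (p-1) ≤ 1.011 := by
        have := cosh_pos ((p/2-1)*(s-t))
        nlinarith
      calc (s-t) * cosh ((p/2-1)*(s-t)) * (p-1) * r * (cosh r - cosh s)
          = (s-t) * (cosh ((p/2-1)*(s-t)) * (p-1)) * 1 * r * (cosh r - cosh s) := by ring
        _ ≤ _ := by gcongr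
  have ii : ∃ L : ℝ, log (sinh ((r+s)/2)) - log (cosh ((r+t)/2)) ≤ 1/2 * (log (cosh s) - log (cosh t)) + L/2
      ∧ exp L - 1 ≤ 0.0125 * tanh ((s-t)/2) := by
    rcases lt_or_gt_of_ne hp2 with h' | h'
    · refine ⟨0, ?_, ?_⟩
      · rw [← hy.h2]
        have := lc_le1 hp h'.le t0.le ts.le
        linarith
      · rw [exp_zero]
        linarith
    · refine ⟨(p/2-1)*(s-t), ?_, ?_⟩
      · rw [← hy.h2]
        have := lc_le2 h'.le t0.le ts.le
        linarith
      · have h2 : (p/2-1)*(s-t) ≤ 0.0117 * tanh ((s-t)/2) := by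
          have : (p/2-1)*(s-t) ≤ 0.005 * (s-t) := by
            apply mul_le_mul_of_nonneg_right <;> linarith
          linarith
        have h20 : 0 ≤ (p/2-1)*(s-t) := mul_nonneg (by linarith) (by linarith)
        generalize (p/2-1)*(s-t) = x at *
        have h5 := add_one_le_exp (-x)
        rw [exp_neg] at h5
        have e0 := exp_pos x
        have e1 : exp x * (exp x)⁻¹ = 1 := by field_simp
        have x1 : x ≤ 0.0117 := by linarith [tanh_lt_one' ((s-t)/2)]
        have h6 : exp x * (1 - x) ≤ 1 := by
          have := mul_le_mul_of_nonneg_left h5 e0.le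
          linarith
        have h61 := mul_le_mul_of_nonneg_left x1 e0.le
        have h7 : exp x ≤ 1.05 := by linarith
        have h8 := mul_le_mul_of_nonneg_right h7 h20
        linarith
  obtain ⟨L, hL1, hL2⟩ := ii
  obtain ⟨q', q0, tb1, tb2⟩ := tb
  have hii := ii_of t0 ts sr hL1 hL2
  have ra := artanh_up (x := r/2) (by linarith)
  have sb := artanh_up (x := s/2) (by linarith)
  have sb2 := tanh_le_self' (x := s/2) (by linarith)
  refine Psi.false (α := tanh (r/2)) (β := tanh (s/2)) (D := tanh ((s-t)/2)) (H := (s-t)/2) (r := r) (s := s)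
    ⟨b0, ba, a1, D0, Db, r0, hu, hii, by linarith, HD, by linarith, by linarith, by linarith, ?_⟩
  have er := cosh_tanh_half r
  have es := cosh_tanh_half s
  clear HD ra sb sb2 hii hL1 hL2 hu Hb D0 Db
  generalize tanh (r/2) = α at *
  generalize tanh (s/2) = β at *
  have A0 : 0 < 1 - α^2 := by nlinarith
  have B0 : 0 < 1 - β^2 := by nlinarith
  have ed : (cosh r - cosh s) * ((1-α^2)*(1-β^2)) = 2 * (α - β) * (α + β) := by
    linear_combination (1-β^2) * er - (1-α^2) * es
  have w : 0 < 2 * q' * (α - β) := mul_pos (by linarith) (by linarith)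
  refine le_of_mul_le_mul_left ?_ w
  have m1 := mul_le_mul_of_nonneg_right tb1 (by positivity : 0 ≤ 3 * (r+s) * (1-α^2) * (1-β^2))
  have m2 := mul_le_mul_of_nonneg_right tb2 (by positivity : 0 ≤ (2+α^2+β^2) * ((1-α^2)*(1-β^2)))
  have m3 : (s - t) * 1.011 * q' * r * (cosh r - cosh s) * ((2+α^2+β^2) * ((1-α^2)*(1-β^2)))
    = (s - t) * 1.011 * q' * r * (2+α^2+β^2) * (2 * (α - β) * (α + β)) := by rw [← ed]; ring
  rw [m3] at m2
  linarith
end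

/-! ### Certified fixed-point slope arithmetic
All quantities are scaled by `K = 2^40`. -/

/-- Forces the evaluation of a natural number before passing it on. -/
def frn {α : Type} (x : Nat) (k : Nat → α) : α :=
  @Nat.casesOn (fun _ => α) x (k 0) (fun n => k (Nat.succ n))

lemma frn_eq {α : Type} (x : Nat) (k : Nat → α) : frn x k = k x := by
  unfold frn
  rcases x with (_ | m) <;> rfl

/-- Forces the evaluation of an integer before passing it on. -/
def frc {α : Type} (x : Int) (k : Int → α) : α :=
  @Int.casesOn (fun _ => α) x (fun n => frn n fun n => k (Int.ofNat n))
    (fun n => frn n fun n => k (Int.negSucc n))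

lemma frc_eq {α : Type} (x : Int) (k : Int → α) : frc x k = k x := by
  unfold frc
  rcases x with (n | n) <;> simp [frn_eq]

/-- A ball: `|s K - m| ≤ r`. -/
structure Bl where
  m : Int
  r : Nat

/-- A slope form. -/
structure Fm where
  c : Int
  rc : Nat
  rv : Nat
  s0 : Bl
  s1 : Bl
  s2 : Bl

/-- Bounds for the three displacements. -/
structure Hs where
  h0 : Nat
  h1 : Nat
  h2 : Nat

def Bl.mag (a : Bl) : Nat := Nat.add (Int.natAbs a.m) a.r

/-- Product of balls. -/
def Bl.mul (a b : Bl) : Bl :=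
  ⟨Int.ediv (Int.mul a.m b.m) (Int.ofNat K40),
    Nat.add (Nat.div (Nat.add (Nat.mul (Int.natAbs a.m) b.r)
      (Nat.mul a.r (Nat.add (Int.natAbs b.m) b.r))) K40) 2⟩

/-- `a * b + c * d` for balls. -/
def Bl.dot (a b c d : Bl) : Bl :=
  ⟨Int.ediv (Int.add (Int.mul a.m b.m) (Int.mul c.m d.m)) (Int.ofNat K40),
    Nat.add (Nat.div (Nat.add (Nat.add (Nat.mul (Int.natAbs a.m) b.r)
      (Nat.mul a.r (Nat.add (Int.natAbs b.m) b.r))) (Nat.add (Nat.mul (Int.natAbs c.m) d.r)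
      (Nat.mul c.r (Nat.add (Int.natAbs d.m) d.r)))) K40) 2⟩

/-- The ball containing the interval `[lo, hi]`. -/
def Bl.ofLH (lo hi : Nat) : Bl :=
  ⟨Int.ofNat (Nat.div (Nat.add lo hi) 2), Nat.add (Nat.div (Nat.sub hi lo) 2) 1⟩

def mkB {α : Type} (b : Bl) (k : Bl → α) : α := frc b.m fun m => frn b.r fun r => k ⟨m, r⟩

lemma mkB_eq {α : Type} (b : Bl) (k : Bl → α) : mkB b k = k b := by
  simp [mkB, frc_eq, frn_eq]

def nmin (a b : Nat) : Nat := @Bool.casesOn (fun _ => Nat) (Nat.ble a b) b a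

/-- Radius for the second point, from the slopes. -/
def fin (H : Hs) (rc : Nat) (s0 s1 s2 : Bl) : Nat :=
  Nat.add (Nat.add rc (Nat.div (Nat.add (Nat.mul s0.mag H.h0)
    (Nat.add (Nat.mul s1.mag H.h1) (Nat.mul s2.mag H.h2))) K40)) 1

/-- Strict constructor that computes the second radius. -/
def mkG (H : Hs) (w : Bl) (alt : Nat) (s0 s1 s2 : Bl) : Fm :=
  mkB w fun w => mkB s0 fun s0 => mkB s1 fun s1 => mkB s2 fun s2 =>
  frn (nmin alt (fin H w.r s0 s1 s2)) fun rv => ⟨w.m, w.r, rv, s0, s1, s2⟩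

def mkN (H : Hs) (w : Bl) (s0 s1 s2 : Bl) : Fm :=
  mkB w fun w => mkB s0 fun s0 => mkB s1 fun s1 => mkB s2 fun s2 =>
  frn (fin H w.r s0 s1 s2) fun rv => ⟨w.m, w.r, rv, s0, s1, s2⟩

def Bl.add (a b : Bl) : Bl := ⟨Int.add a.m b.m, Nat.add a.r b.r⟩
def Bl.sub (a b : Bl) : Bl := ⟨Int.sub a.m b.m, Nat.add a.r b.r⟩
def Bl.neg (a : Bl) : Bl := ⟨Int.neg a.m, a.r⟩

def Fm.add (H : Hs) (a b : Fm) : Fm :=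
  mkG H ⟨Int.add a.c b.c, Nat.add a.rc b.rc⟩ (Nat.add a.rv b.rv)
    (a.s0.add b.s0) (a.s1.add b.s1) (a.s2.add b.s2)

def Fm.sub (H : Hs) (a b : Fm) : Fm :=
  mkG H ⟨Int.sub a.c b.c, Nat.add a.rc b.rc⟩ (Nat.add a.rv b.rv)
    (a.s0.sub b.s0) (a.s1.sub b.s1) (a.s2.sub b.s2)

def Fm.mul (H : Hs) (a b : Fm) : Fm :=
  mkN H (Bl.mul ⟨a.c, a.rc⟩ ⟨b.c, b.rc⟩) (Bl.dot ⟨a.c, a.rv⟩ b.s0 ⟨b.c, b.rc⟩ a.s0)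
    (Bl.dot ⟨a.c, a.rv⟩ b.s1 ⟨b.c, b.rc⟩ a.s1) (Bl.dot ⟨a.c, a.rv⟩ b.s2 ⟨b.c, b.rc⟩ a.s2)

def Fm.chain (H : Hs) (a : Fm) (w d : Bl) : Fm :=
  mkB d fun d => mkN H w (d.mul a.s0) (d.mul a.s1) (d.mul a.s2)

/-- One Horner step for the exponential series at `x / 16`. -/
def hs (x : Int) (n : Nat) (acc : Int) : Int :=
  Int.add (Int.ofNat K40)
    (Int.ediv (Int.mul x acc) (Int.ofNat (Nat.mul K44 n)))

def hor (x : Int) : Int :=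
  hs x 1 (hs x 2 (hs x 3 (hs x 4 (hs x 5 (hs x 6 (hs x 7 (hs x 8 (hs x 9 (hs x 10 (hs x 11
    (hs x 12 (hs x 13 (Int.ofNat K40)))))))))))))

/-- Squaring of `m ± r`, natural numbers. -/
def sqN {α : Type} (m r : Nat) (k : Nat → Nat → α) : α :=
  frn (Nat.div (Nat.mul m m) K40) fun m' =>
  frn (Nat.add (Nat.div (Nat.mul r (Nat.add (Nat.add m m) r)) K40) 2) fun q => k m' q

def expc {α : Type} (x : Int) (k : Nat → Nat → α) : α :=
  frn (Int.toNat (hor x)) fun m => sqN m 5 fun m r => sqN m r fun m r => sqN m r fun m r =>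
    sqN m r k

/-- Untrusted approximation to the logarithm. -/
def lognorm {α : Type} : Nat → Nat → Int → (Nat → Int → α) → α
  | 0, x, j, k => k x j
  | n + 1, x, j, k => frn x fun x => frc j fun j =>
    match Nat.ble x 777472127993 with
    | true => lognorm n (Nat.mul 2 x) (Int.sub j 762123384786) k
    | false =>
      match Nat.ble 1554944255988 x with
      | true => lognorm n (Nat.div x 2) (Int.add j 762123384786) k
      | false => k x j

def log0 (x : Nat) : Int :=
  lognorm 8 x 0 fun m j =>
    frc (Int.ediv (Int.mul (Int.subNatNat m K40) K40)
      (Int.ofNat (Nat.add m K40))) fun y =>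
    frn (Nat.div (Nat.mul y.natAbs y.natAbs) K40) fun y2 =>
    let f := fun (n : Nat) (acc : Nat) =>
      Nat.add (Nat.div K40 n) (Nat.div (Nat.mul y2 acc) K40)
    Int.add j (Int.mul 2 (Int.ediv (Int.mul y (Int.ofNat (f 1 (f 3 (f 5 (f 7 (f 9 (f 11 (f 13 0)))))))))
      K40))

/-- Enclosure of `log (x / K) * K`. -/
def logc (x : Nat) : Option Bl :=
  frc (log0 x) fun y =>
  match Nat.ble y.natAbs 10995116277760 with
  | true => expc y fun m r =>
      frn (nmin x (Nat.sub m r)) fun mn =>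
      match mn with
      | 0 => none
      | _ + 1 => some ⟨y, Nat.add (Nat.div (Nat.mul
          (Nat.add (Nat.add (Nat.sub x m) (Nat.sub m x)) r) K40) mn) 1⟩
  | false => none

def Fm.exp (H : Hs) (a : Fm) : Option Fm :=
  match Nat.ble a.c.natAbs 10995116277760 && (Nat.ble a.rc K40 &&
      Nat.ble a.rv K40) with
  | true => some (expc a.c fun m r => frn (Nat.add m r) fun mr =>
    a.chain H ⟨Int.ofNat m, Nat.add (Nat.add r (Nat.div (Nat.mul mr (Nat.add a.rc
        (Nat.add (Nat.div (Nat.mul a.rc a.rc) K40) 1))) K40)) 1⟩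
      (Bl.ofLH (Nat.div (Nat.mul (Nat.sub m r) (Nat.sub K41 (Nat.add a.rc a.rv)))
          K41)
        (Nat.add (Nat.div (Nat.mul mr (Nat.add (Nat.add K41 (Nat.add a.rc a.rv))
          (Nat.add (Nat.div (Nat.add (Nat.mul a.rc a.rc) (Nat.mul a.rv a.rv)) K40) 1)))
          K41) 1)))
  | false => none

def Fm.log (H : Hs) (a : Fm) : Option Fm :=
  frn a.c.toNat fun c =>
  match Nat.ble c a.rc || Nat.ble c a.rv with
  | true => none
  | false =>
    match logc c with
    | none => none
    | some ⟨m, r⟩ =>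
    some (a.chain H ⟨m, Nat.add (Nat.add r (Nat.div (Nat.mul a.rc K40) (Nat.sub c a.rc))) 1⟩
      (Bl.ofLH (Nat.div 2417851639229258349412352 (Nat.add (Nat.add c c) (Nat.add a.rc a.rv)))
        (Nat.add (Nat.div (Nat.add (Nat.div K80 (Nat.sub c a.rc))
          (Nat.div K80 (Nat.sub c a.rv))) 2) 2)))

/-- Enclosure of reciprocals. -/
def invc (c r : Nat) : Bl :=
  ⟨Int.ofNat (Nat.div K80 c),
    Nat.add (Nat.div (Nat.mul K80 r) (Nat.mul c (Nat.sub c r))) 2⟩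

def Fm.inv (H : Hs) (a : Fm) : Option Fm :=
  frn a.c.toNat fun c =>
  match Nat.ble c a.rc || Nat.ble c a.rv with
  | true => none
  | false => some (mkB (invc c a.rc) fun i => mkB (invc c a.rv) fun j => a.chain H i (i.mul j).neg)

def Fm.cst (n : Int) : Fm := ⟨n, 0, 0, ⟨0, 0⟩, ⟨0, 0⟩, ⟨0, 0⟩⟩

inductive Ins
  | cst (n : Int)
  | add (i j : Nat)
  | sub (i j : Nat)
  | mul (i j : Nat)
  | exp (i : Nat)
  | log (i : Nat)
  | inv (i : Nat)

def lk (l : List Fm) : Nat → Fm :=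
  @List.rec Fm (fun _ => Nat → Fm) (fun _ => Fm.cst 0)
    (fun a _ ih n => @Nat.casesOn (fun _ => Fm) n a ih) l

def step (H : Hs) (l : List Fm) : Ins → Option Fm
  | .cst n => some (Fm.cst n)
  | .add i j => some ((lk l i).add H (lk l j))
  | .sub i j => some ((lk l i).sub H (lk l j))
  | .mul i j => some ((lk l i).mul H (lk l j))
  | .exp i => (lk l i).exp H
  | .log i => (lk l i).log H
  | .inv i => (lk l i).inv H

def run (H : Hs) (is : List Ins) : List Fm → Option (List Fm) :=
  @List.rec Ins (fun _ => List Fm → Option (List Fm)) (fun l => some l)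
    (fun i _ ih l => @Option.casesOn Fm (fun _ => Option (List Fm)) (step H l i) none
      (fun f => @Fm.casesOn (fun _ => Option (List Fm)) f
        (fun c rc rv s0 s1 s2 => ih (⟨c, rc, rv, s0, s1, s2⟩ :: l)))) is

section
/-- `b` encloses `s`. -/
def BE (b : Bl) (s : ℝ) : Prop := |s * K40 - (b.m : ℝ)| ≤ (b.r : ℝ)

lemma ediv_err (x : Int) (n : Nat) (hn : 0 < n) :
    |((Int.ediv x (Int.ofNat n) : Int) : ℝ) - (x : ℝ) / n| ≤ 1 := by
  have hn' : (0 : ℝ) < n := by exact_mod_cast hn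
  have h1 : Int.ediv x (Int.ofNat n) = x / (n : Int) := rfl
  rw [h1]
  have h2 := Int.emod_add_mul_ediv x (n : Int)
  have h3 := Int.emod_nonneg x (b := (n : Int)) (by omega)
  have h4 := Int.emod_lt_of_pos x (b := (n : Int)) (by omega)
  have h2' : ((x % (n : Int) : Int) : ℝ) + n * ((x / (n : Int) : Int) : ℝ) = x := by exact_mod_cast h2
  have h3' : (0 : ℝ) ≤ ((x % (n : Int) : Int) : ℝ) := by exact_mod_cast h3
  have h4' : ((x % (n : Int) : Int) : ℝ) < n := by exact_mod_cast h4
  have h5 : (x : ℝ) / n = ((x / (n : Int) : Int) : ℝ) + ((x % (n : Int) : Int) : ℝ) / n := by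
    rw [← h2']; field_simp; push_cast; ring
  rw [h5, abs_le]
  have h6 : ((x % (n : Int) : Int) : ℝ) / n ≤ 1 := by rw [div_le_one hn']; exact h4'.le
  have h7 : 0 ≤ ((x % (n : Int) : Int) : ℝ) / n := by positivity
  constructor <;> linarith

lemma ndiv_up (a b : Nat) (hb : 0 < b) : (a : ℝ) / b ≤ ((Nat.div a b : Nat) : ℝ) + 1 := by
  have hb' : (0 : ℝ) < b := by exact_mod_cast hb
  have h1 : Nat.div a b = a / b := rfl
  rw [h1, div_le_iff₀ hb']
  have h2 := Nat.lt_mul_div_succ a hb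
  have h3 : (a : ℝ) < b * ((a / b : Nat) + 1) := by exact_mod_cast h2
  linarith [mul_comm (b : ℝ) (((a / b : Nat) : ℝ) + 1)]

lemma ndiv_low (a b : Nat) : ((Nat.div a b : Nat) : ℝ) ≤ (a : ℝ) / b := by
  have h1 : Nat.div a b = a / b := rfl
  rw [h1]; exact Nat.cast_div_le

lemma natAbs_cast' (x : Int) : ((x.natAbs : Nat) : ℝ) = |(x : ℝ)| := by
  rw [← Int.cast_abs, Int.abs_eq_natAbs]; simp

lemma prod_err {S T m n ra rb : ℝ} (h1 : |S - m| ≤ ra) (h2 : |T - n| ≤ rb) :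
    |S * T - m * n| ≤ |m| * rb + ra * (|n| + rb) := by
  have e : S * T - m * n = (S - m) * T + m * (T - n) := by ring
  have hT : |T| ≤ |n| + rb := by
    have : T = n + (T - n) := by ring
    calc |T| = |n + (T - n)| := by rw [← this]
      _ ≤ |n| + |T - n| := abs_add_le _ _
      _ ≤ _ := by linarith
  rw [e]
  calc |(S - m) * T + m * (T - n)| ≤ |(S - m) * T| + |m * (T - n)| := abs_add_le _ _
    _ = |S - m| * |T| + |m| * |T - n| := by rw [abs_mul, abs_mul]
    _ ≤ ra * (|n| + rb) + |m| * rb := by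
        have a1 : |S - m| * |T| ≤ ra * (|n| + rb) :=
          mul_le_mul h1 hT (abs_nonneg _) (le_trans (abs_nonneg _) h1)
        have a2 : |m| * |T - n| ≤ |m| * rb := mul_le_mul_of_nonneg_left h2 (abs_nonneg _)
        linarith
    _ = _ := by ring

lemma BE.mul {a b : Bl} {s t : ℝ} (ha : BE a s) (hb : BE b t) : BE (a.mul b) (s * t) := by
  unfold BE at *
  have h := prod_err ha hb
  have e1 := ediv_err (Int.mul a.m b.m) K40 (by norm_num)
  have e2 := ndiv_up (Nat.add (Nat.mul (Int.natAbs a.m) b.r)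
      (Nat.mul a.r (Nat.add (Int.natAbs b.m) b.r))) K40 (by norm_num)
  have c1 : ((Int.mul a.m b.m : Int) : ℝ) = a.m * b.m := by
    rw [← Int.cast_mul]; rfl
  have c2 : ((Nat.add (Nat.mul (Int.natAbs a.m) b.r)
      (Nat.mul a.r (Nat.add (Int.natAbs b.m) b.r)) : Nat) : ℝ) =
      |(a.m : ℝ)| * b.r + a.r * (|(b.m : ℝ)| + b.r) := by
    rw [← natAbs_cast', ← natAbs_cast']; simp only [Nat.add_eq, Nat.mul_eq]; push_cast; ring
  have c3 : (((a.mul b).r : Nat) : ℝ) = ((Nat.div (Nat.add (Nat.mul (Int.natAbs a.m) b.r)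
      (Nat.mul a.r (Nat.add (Int.natAbs b.m) b.r))) K40 : Nat) : ℝ) + 2 := by
    simp only [Bl.mul, Nat.add_eq]; push_cast; rfl
  have c4 : (a.mul b).m = Int.ediv (Int.mul a.m b.m) (Int.ofNat K40) := rfl
  rw [c1] at e1
  rw [c2] at e2
  rw [c3, c4]
  generalize ((Int.ediv (Int.mul a.m b.m) (Int.ofNat K40) : Int) : ℝ) = M at *
  generalize ((Nat.div (Nat.add (Nat.mul (Int.natAbs a.m) b.r)
      (Nat.mul a.r (Nat.add (Int.natAbs b.m) b.r))) K40 : Nat) : ℝ) = R at *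
  generalize |(a.m : ℝ)| * b.r + a.r * (|(b.m : ℝ)| + b.r) = Q at *
  rw [abs_le] at *
  push_cast at e1 e2
  constructor <;> linarith [e1.1, e1.2, h.1, h.2]

lemma BE.dot {a b c d : Bl} {s t s' t' : ℝ} (ha : BE a s) (hb : BE b t) (hc : BE c s')
    (hd : BE d t') : BE (Bl.dot a b c d) (s * t + s' * t') := by
  unfold BE at *
  have h := prod_err ha hb
  have h' := prod_err hc hd
  have e1 := ediv_err (Int.add (Int.mul a.m b.m) (Int.mul c.m d.m)) K40 (by norm_num)
  have e2 := ndiv_up (Nat.add (Nat.add (Nat.mul (Int.natAbs a.m) b.r)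
      (Nat.mul a.r (Nat.add (Int.natAbs b.m) b.r))) (Nat.add (Nat.mul (Int.natAbs c.m) d.r)
      (Nat.mul c.r (Nat.add (Int.natAbs d.m) d.r)))) K40 (by norm_num)
  have c1 : ((Int.add (Int.mul a.m b.m) (Int.mul c.m d.m) : Int) : ℝ) = a.m * b.m + c.m * d.m := by
    rw [← Int.cast_mul, ← Int.cast_mul, ← Int.cast_add]; rfl
  have c2 : ((Nat.add (Nat.add (Nat.mul (Int.natAbs a.m) b.r)
      (Nat.mul a.r (Nat.add (Int.natAbs b.m) b.r))) (Nat.add (Nat.mul (Int.natAbs c.m) d.r)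
      (Nat.mul c.r (Nat.add (Int.natAbs d.m) d.r))) : Nat) : ℝ) =
      (|(a.m : ℝ)| * b.r + a.r * (|(b.m : ℝ)| + b.r)) +
      (|(c.m : ℝ)| * d.r + c.r * (|(d.m : ℝ)| + d.r)) := by
    rw [← natAbs_cast', ← natAbs_cast', ← natAbs_cast', ← natAbs_cast']
    simp only [Nat.add_eq, Nat.mul_eq]; push_cast; ring
  have c3 : (((Bl.dot a b c d).r : Nat) : ℝ) = ((Nat.div (Nat.add (Nat.add (Nat.mul (Int.natAbs a.m) b.r)
      (Nat.mul a.r (Nat.add (Int.natAbs b.m) b.r))) (Nat.add (Nat.mul (Int.natAbs c.m) d.r)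
      (Nat.mul c.r (Nat.add (Int.natAbs d.m) d.r)))) K40 : Nat) : ℝ) + 2 := by
    simp only [Bl.dot, Nat.add_eq]; push_cast; rfl
  have c4 : (Bl.dot a b c d).m =
    Int.ediv (Int.add (Int.mul a.m b.m) (Int.mul c.m d.m)) (Int.ofNat K40) := rfl
  rw [c1] at e1
  rw [c2] at e2
  rw [c3, c4]
  generalize ((Int.ediv (Int.add (Int.mul a.m b.m) (Int.mul c.m d.m)) (Int.ofNat K40) : Int) : ℝ) = M at *
  generalize ((Nat.div (Nat.add (Nat.add (Nat.mul (Int.natAbs a.m) b.r)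
      (Nat.mul a.r (Nat.add (Int.natAbs b.m) b.r))) (Nat.add (Nat.mul (Int.natAbs c.m) d.r)
      (Nat.mul c.r (Nat.add (Int.natAbs d.m) d.r)))) K40 : Nat) : ℝ) = R at *
  generalize |(a.m : ℝ)| * b.r + a.r * (|(b.m : ℝ)| + b.r) = Q at *
  generalize |(c.m : ℝ)| * d.r + c.r * (|(d.m : ℝ)| + d.r) = Q' at *
  rw [abs_le] at *
  push_cast at e1 e2
  constructor <;> linarith [e1.1, e1.2, h.1, h.2, h'.1, h'.2]

lemma BE.add {a b : Bl} {s t : ℝ} (ha : BE a s) (hb : BE b t) : BE (a.add b) (s + t) := by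
  unfold BE at *
  have c1 : (((a.add b).m : Int) : ℝ) = a.m + b.m := by rw [← Int.cast_add]; rfl
  have c2 : (((a.add b).r : Nat) : ℝ) = a.r + b.r := by rw [← Nat.cast_add]; rfl
  rw [c1, c2]
  rw [abs_le] at *
  constructor <;> linarith [ha.1, ha.2, hb.1, hb.2]

lemma BE.sub {a b : Bl} {s t : ℝ} (ha : BE a s) (hb : BE b t) : BE (a.sub b) (s - t) := by
  unfold BE at *
  have c1 : (((a.sub b).m : Int) : ℝ) = a.m - b.m := by rw [← Int.cast_sub]; rfl
  have c2 : (((a.sub b).r : Nat) : ℝ) = a.r + b.r := by rw [← Nat.cast_add]; rfl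
  rw [c1, c2]
  rw [abs_le] at *
  constructor <;> linarith [ha.1, ha.2, hb.1, hb.2]

lemma BE.neg {a : Bl} {s : ℝ} (ha : BE a s) : BE a.neg (-s) := by
  unfold BE at *
  have c1 : (((a.neg).m : Int) : ℝ) = -a.m := by rw [← Int.cast_neg]; rfl
  have c2 : (a.neg).r = a.r := rfl
  rw [c1, c2]
  rw [abs_le] at *
  constructor <;> linarith [ha.1, ha.2]

lemma BE.ofLH {lo hi : Nat} {s : ℝ} (h1 : (lo : ℝ) ≤ s * K40)
    (h2 : s * K40 ≤ hi) : BE (Bl.ofLH lo hi) s := by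
  unfold BE
  have hlh : lo ≤ hi := by exact_mod_cast h1.trans h2
  have c1 : (((Bl.ofLH lo hi).m : Int) : ℝ) = ((Nat.div (Nat.add lo hi) 2 : Nat) : ℝ) := by
    simp [Bl.ofLH]
  have c2 : (((Bl.ofLH lo hi).r : Nat) : ℝ) = ((Nat.div (Nat.sub hi lo) 2 : Nat) : ℝ) + 1 := by
    simp [Bl.ofLH]
  have d1 := ndiv_up (Nat.add lo hi) 2 (by norm_num)
  have d2 := ndiv_low (Nat.add lo hi) 2
  have d3 := ndiv_up (Nat.sub hi lo) 2 (by norm_num)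
  have e1 : ((Nat.add lo hi : Nat) : ℝ) = lo + hi := by rw [← Nat.cast_add]; rfl
  have e2 : ((Nat.sub hi lo : Nat) : ℝ) = hi - lo := by rw [← Nat.cast_sub hlh]; rfl
  rw [c1, c2]
  have w1 : ((Nat.div (Nat.add lo hi) 2 : Nat) : ℝ) ≥ ((lo : ℝ) + hi) / 2 - 1/2 := by
    have : lo + hi < 2 * ((lo + hi) / 2) + 2 := by omega
    have h : lo + hi ≤ 2 * ((lo + hi) / 2) + 1 := by omega
    have h' : ((lo : ℝ) + hi) ≤ 2 * (((lo + hi) / 2 : Nat) : ℝ) + 1 := by exact_mod_cast h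
    have : ((Nat.div (Nat.add lo hi) 2 : Nat) : ℝ) = (((lo + hi) / 2 : Nat) : ℝ) := rfl
    linarith
  have w2 : ((Nat.div (Nat.sub hi lo) 2 : Nat) : ℝ) ≥ ((hi : ℝ) - lo) / 2 - 1/2 := by
    have h : hi ≤ lo + (2 * ((hi - lo) / 2) + 1) := by omega
    have h' : (hi : ℝ) ≤ lo + (2 * (((hi - lo) / 2 : Nat) : ℝ) + 1) := by exact_mod_cast h
    have : ((Nat.div (Nat.sub hi lo) 2 : Nat) : ℝ) = (((hi - lo) / 2 : Nat) : ℝ) := rfl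
    linarith
  rw [e1] at d2
  push_cast at d2
  rw [abs_le]
  constructor <;> linarith

lemma BE.mag {a : Bl} {s : ℝ} (ha : BE a s) : |s| * K40 ≤ (a.mag : ℝ) := by
  unfold BE at ha
  have c : ((a.mag : Nat) : ℝ) = |(a.m : ℝ)| + a.r := by
    rw [← natAbs_cast', ← Nat.cast_add]; rfl
  rw [c]
  have h1 : |s| * K40 = |s * K40| := by
    rw [abs_mul, abs_of_pos (by norm_num : (0:ℝ) < K40)]
  rw [h1]
  calc |s * K40| = |(a.m : ℝ) + (s * K40 - a.m)| := by ring_nf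
    _ ≤ |(a.m : ℝ)| + |s * K40 - a.m| := abs_add_le _ _
    _ ≤ _ := by linarith

/-- Bounds on displacements. -/
structure HB (H : Hs) (d0 d1 d2 : ℝ) : Prop where
  h0 : |d0| * K40 ≤ H.h0
  h1 : |d1| * K40 ≤ H.h1
  h2 : |d2| * K40 ≤ H.h2

/-- `F` encloses the pair of values `u` (reference point) and `v`. -/
structure Enc (d0 d1 d2 : ℝ) (F : Fm) (u v : ℝ) : Prop where
  hu : BE ⟨F.c, F.rc⟩ u
  hv : BE ⟨F.c, F.rv⟩ v
  hs : ∃ s0 s1 s2 : ℝ, BE F.s0 s0 ∧ BE F.s1 s1 ∧ BE F.s2 s2 ∧ v - u = s0 * d0 + s1 * d1 + s2 * d2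

lemma fin_ok {H : Hs} {d0 d1 d2 u v s0 s1 s2 : ℝ} (hH : HB H d0 d1 d2) {w b0 b1 b2 : Bl}
    (hu : BE w u) (h0 : BE b0 s0) (h1 : BE b1 s1) (h2 : BE b2 s2)
    (h : v - u = s0 * d0 + s1 * d1 + s2 * d2) : BE ⟨w.m, fin H w.r b0 b1 b2⟩ v := by
  have aux : ∀ (b : Bl) (s d : ℝ) (n : Nat), BE b s → |d| * K40 ≤ n →
      |s * d| * (K40 * K40) ≤ (b.mag : ℝ) * n := by
    intro b s d n hb hd
    have := hb.mag
    rw [abs_mul]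
    calc |s| * |d| * (K40 * K40)
        = (|s| * K40) * (|d| * K40) := by ring
      _ ≤ _ := mul_le_mul this hd (by positivity) (by positivity)
  have a0 := aux _ _ _ _ h0 hH.h0
  have a1 := aux _ _ _ _ h1 hH.h1
  have a2 := aux _ _ _ _ h2 hH.h2
  have e := ndiv_up (Nat.add (Nat.mul b0.mag H.h0)
    (Nat.add (Nat.mul b1.mag H.h1) (Nat.mul b2.mag H.h2))) K40 (by norm_num)
  have c : ((Nat.add (Nat.mul b0.mag H.h0)
    (Nat.add (Nat.mul b1.mag H.h1) (Nat.mul b2.mag H.h2)) : Nat) : ℝ) =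
    (b0.mag : ℝ) * H.h0 + ((b1.mag : ℝ) * H.h1 + (b2.mag : ℝ) * H.h2) := by
    simp only [Nat.add_eq, Nat.mul_eq]; push_cast; ring
  have c2 : ((fin H w.r b0 b1 b2 : Nat) : ℝ) = w.r + ((Nat.div (Nat.add (Nat.mul b0.mag H.h0)
    (Nat.add (Nat.mul b1.mag H.h1) (Nat.mul b2.mag H.h2))) K40 : Nat) : ℝ) + 1 := by
    unfold fin; simp only [Nat.add_eq, Nat.mul_eq]; push_cast; rfl
  unfold BE at *
  simp only at *
  rw [c2]
  rw [c] at e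
  push_cast at e
  generalize ((Nat.div (Nat.add (Nat.mul b0.mag H.h0)
    (Nat.add (Nat.mul b1.mag H.h1) (Nat.mul b2.mag H.h2))) K40 : Nat) : ℝ) = R at *
  have hv : v = u + (s0 * d0 + s1 * d1 + s2 * d2) := by linarith
  have b0' := abs_le.1 (le_refl |s0 * d0|)
  have b1' := abs_le.1 (le_refl |s1 * d1|)
  have b2' := abs_le.1 (le_refl |s2 * d2|)
  rw [abs_le] at hu ⊢
  rw [hv]
  constructor <;> linarith [hu.1, hu.2, b0'.1, b0'.2, b1'.1, b1'.2, b2'.1, b2'.2]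

lemma mkN_ok {H : Hs} {d0 d1 d2 u v s0 s1 s2 : ℝ} (hH : HB H d0 d1 d2) {w b0 b1 b2 : Bl}
    (hu : BE w u) (h0 : BE b0 s0) (h1 : BE b1 s1) (h2 : BE b2 s2)
    (h : v - u = s0 * d0 + s1 * d1 + s2 * d2) : Enc d0 d1 d2 (mkN H w b0 b1 b2) u v := by
  simp only [mkN, mkB_eq, frn_eq]
  exact ⟨hu, fin_ok hH hu h0 h1 h2 h, s0, s1, s2, h0, h1, h2, h⟩

lemma mkG_ok {H : Hs} {d0 d1 d2 u v s0 s1 s2 : ℝ} (hH : HB H d0 d1 d2) {w b0 b1 b2 : Bl} {alt : Nat}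
    (hu : BE w u) (h0 : BE b0 s0) (h1 : BE b1 s1) (h2 : BE b2 s2)
    (h : v - u = s0 * d0 + s1 * d1 + s2 * d2) (ha : BE ⟨w.m, alt⟩ v) :
    Enc d0 d1 d2 (mkG H w alt b0 b1 b2) u v := by
  simp only [mkG, mkB_eq, frn_eq]
  refine ⟨hu, ?_, s0, s1, s2, h0, h1, h2, h⟩
  simp only
  unfold nmin
  cases Nat.ble alt (fin H w.r b0 b1 b2)
  · exact fin_ok hH hu h0 h1 h2 h
  · exact ha

section ops
variable {H : Hs} {d0 d1 d2 : ℝ} {a b : Fm} {u v u' v' : ℝ}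

lemma Enc.add (hH : HB H d0 d1 d2) (ha : Enc d0 d1 d2 a u v) (hb : Enc d0 d1 d2 b u' v') :
    Enc d0 d1 d2 (a.add H b) (u + u') (v + v') := by
  obtain ⟨s0, s1, s2, i0, i1, i2, i3⟩ := ha.hs
  obtain ⟨t0, t1, t2, j0, j1, j2, j3⟩ := hb.hs
  exact mkG_ok hH (ha.hu.add hb.hu) (i0.add j0) (i1.add j1) (i2.add j2)
    (by linear_combination i3 + j3) (ha.hv.add hb.hv)

set_option maxHeartbeats 1000000 in
lemma Enc.sub (hH : HB H d0 d1 d2) (ha : Enc d0 d1 d2 a u v) (hb : Enc d0 d1 d2 b u' v') :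
    Enc d0 d1 d2 (a.sub H b) (u - u') (v - v') := by
  obtain ⟨s0, s1, s2, i0, i1, i2, i3⟩ := ha.hs
  obtain ⟨t0, t1, t2, j0, j1, j2, j3⟩ := hb.hs
  exact mkG_ok hH (ha.hu.sub hb.hu) (i0.sub j0) (i1.sub j1) (i2.sub j2)
    (by linear_combination i3 - j3) (ha.hv.sub hb.hv)

lemma Enc.mul (hH : HB H d0 d1 d2) (ha : Enc d0 d1 d2 a u v) (hb : Enc d0 d1 d2 b u' v') :
    Enc d0 d1 d2 (a.mul H b) (u * u') (v * v') := by
  obtain ⟨s0, s1, s2, i0, i1, i2, i3⟩ := ha.hs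
  obtain ⟨t0, t1, t2, j0, j1, j2, j3⟩ := hb.hs
  exact mkN_ok hH (ha.hu.mul hb.hu) (ha.hv.dot j0 hb.hu i0) (ha.hv.dot j1 hb.hu i1)
    (ha.hv.dot j2 hb.hu i2) (by linear_combination u' * i3 + v * j3)

lemma Enc.chain (hH : HB H d0 d1 d2) (ha : Enc d0 d1 d2 a u v) {w d : Bl} {U V s : ℝ}
    (hw : BE w U) (hd : BE d s) (hs : V - U = s * (v - u)) : Enc d0 d1 d2 (a.chain H w d) U V := by
  obtain ⟨s0, s1, s2, i0, i1, i2, i3⟩ := ha.hs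
  simp only [Fm.chain, mkB_eq]
  exact mkN_ok hH hw (hd.mul i0) (hd.mul i1) (hd.mul i2) (by rw [hs, i3]; ring)

end ops
end

section
open Real

lemma hs_err {x : Int} {n : Nat} (hn : 1 ≤ n) {acc : Int} {t A : ℝ}
    (ht : (x : ℝ) = t * K44) (ht1 : |t| ≤ 0.625)
    (h : |(acc : ℝ) - A * K40| ≤ 3) :
    |((hs x n acc : Int) : ℝ) - (1 + t * A / n) * K40| ≤ 3 := by
  have e := ediv_err (Int.mul x acc) (Nat.mul K44 n)
    (by have : Nat.mul K44 n = K44 * n := rfl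
        omega)
  have hn' : (1 : ℝ) ≤ n := by exact_mod_cast hn
  have hn0 : (0 : ℝ) < n := by linarith
  have c1 : ((hs x n acc : Int) : ℝ) = K40 +
      ((Int.ediv (Int.mul x acc) (Int.ofNat (Nat.mul K44 n)) : Int) : ℝ) := by
    have : hs x n acc = K40 + Int.ediv (Int.mul x acc) (Int.ofNat (Nat.mul K44 n)) := rfl
    rw [this]; push_cast; ring
  have c2 : ((Int.mul x acc : Int) : ℝ) / ((Nat.mul K44 n : Nat) : ℝ) = t * acc / n := by
    have a1 : ((Int.mul x acc : Int) : ℝ) = x * acc := by rw [← Int.cast_mul]; rfl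
    have a2 : ((Nat.mul K44 n : Nat) : ℝ) = K44 * n := by
      have : Nat.mul K44 n = K44 * n := rfl
      rw [this]; push_cast; ring
    rw [a1, a2, ht]; field_simp
  rw [c2] at e
  rw [c1]
  generalize ((Int.ediv (Int.mul x acc) (Int.ofNat (Nat.mul K44 n)) : Int) : ℝ) = M at *
  have h2 : |t * acc / n - t * A / n * K40| ≤ 1.875 := by
    have : t * acc / n - t * A / n * K40 = t * (acc - A * K40) / n := by
      field_simp
    rw [this, abs_div, abs_mul, abs_of_pos hn0, div_le_iff₀ hn0]
    have : |t| * |(acc : ℝ) - A * K40| ≤ 0.625 * 3 :=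
      mul_le_mul ht1 h (abs_nonneg _) (by norm_num)
    linarith
  rw [abs_le] at *
  constructor <;> linarith [e.1, e.2, h2.1, h2.2]

lemma hor_ok {x : Int} (hx : x.natAbs ≤ 10995116277760) :
    |((hor x : Int) : ℝ) - exp ((x : ℝ) / K44) * K40| ≤ 4 := by
  set t : ℝ := (x : ℝ) / K44 with htd
  have ht : (x : ℝ) = t * K44 := by rw [htd]; field_simp
  have hxr : |(x : ℝ)| ≤ 10995116277760 := by
    rw [← natAbs_cast']; exact_mod_cast hx
  have ht1 : |t| ≤ 0.625 := by
    rw [htd, abs_div, abs_of_pos (by norm_num : (0:ℝ) < K44), div_le_iff₀ (by norm_num)]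
    linarith
  have b := Real.exp_bound (x := t) (by linarith) (n := 14) (by norm_num)
  have h0 : |((Int.ofNat K40 : Int) : ℝ) - 1 * K40| ≤ 3 := by
    norm_num
  have h13 := hs_err (n := 13) (by norm_num) ht ht1 h0
  have h12 := hs_err (n := 12) (by norm_num) ht ht1 h13
  have h11 := hs_err (n := 11) (by norm_num) ht ht1 h12
  have h10 := hs_err (n := 10) (by norm_num) ht ht1 h11
  have h9 := hs_err (n := 9) (by norm_num) ht ht1 h10
  have h8 := hs_err (n := 8) (by norm_num) ht ht1 h9
  have h7 := hs_err (n := 7) (by norm_num) ht ht1 h8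
  have h6 := hs_err (n := 6) (by norm_num) ht ht1 h7
  have h5 := hs_err (n := 5) (by norm_num) ht ht1 h6
  have h4 := hs_err (n := 4) (by norm_num) ht ht1 h5
  have h3 := hs_err (n := 3) (by norm_num) ht ht1 h4
  have h2 := hs_err (n := 2) (by norm_num) ht ht1 h3
  have h1 := hs_err (n := 1) (by norm_num) ht ht1 h2
  clear h13 h12 h11 h10 h9 h8 h7 h6 h5 h4 h3 h2 h0
  change |((hor x : Int) : ℝ) - _| ≤ 3 at h1
  generalize ((hor x : Int) : ℝ) = M at *
  have hp : |t| ^ 14 ≤ 0.625 ^ 14 := pow_le_pow_left₀ (abs_nonneg _) ht1 _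
  have hsum : ∑ m ∈ Finset.range 14, t ^ m / (m.factorial : ℝ) =
    (1 + t * (1 + t * (1 + t * (1 + t * (1 + t * (1 + t * (1 + t * (1 + t * (1 + t * (1 + t * (1 + t * (1 + t * (1 + t * 1 / (13 : ℕ)) / (12 : ℕ)) / (11 : ℕ)) / (10 : ℕ)) / (9 : ℕ)) / (8 : ℕ)) / (7 : ℕ)) / (6 : ℕ)) / (5 : ℕ)) / (4 : ℕ)) / (3 : ℕ)) / (2 : ℕ)) / (1 : ℕ)) := by
    simp only [Finset.sum_range_succ, Finset.sum_range_zero, Nat.factorial]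
    push_cast
    ring
  rw [hsum] at b
  generalize (1 + t * (1 + t * (1 + t * (1 + t * (1 + t * (1 + t * (1 + t * (1 + t * (1 + t * (1 + t * (1 + t * (1 + t * (1 + t * 1 / (13 : ℕ)) / (12 : ℕ)) / (11 : ℕ)) / (10 : ℕ)) / (9 : ℕ)) / (8 : ℕ)) / (7 : ℕ)) / (6 : ℕ)) / (5 : ℕ)) / (4 : ℕ)) / (3 : ℕ)) / (2 : ℕ)) / (1 : ℕ)) = P at *
  have hb2 : |exp t - P| ≤ 1 / K40 := by
    refine b.trans ?_
    calc |t| ^ 14 * (((14 : ℕ).succ : ℝ) / (((14 : ℕ).factorial : ℝ) * ((14 : ℕ) : ℝ)))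
        ≤ 0.625 ^ 14 * (((14 : ℕ).succ : ℝ) / (((14 : ℕ).factorial : ℝ) * ((14 : ℕ) : ℝ))) :=
          mul_le_mul_of_nonneg_right hp (by positivity)
      _ ≤ _ := by norm_num [Nat.factorial]
  rw [abs_le] at *
  constructor <;> linarith [hb2.1, hb2.2, h1.1, h1.2]

lemma sqN_ok {α : Type} {m r : Nat} {s : ℝ} (h : |s * K40 - (m : ℝ)| ≤ (r : ℝ)) (k : Nat → Nat → α) :
    ∃ m' r' : Nat, sqN m r k = k m' r' ∧ |s ^ 2 * K40 - (m' : ℝ)| ≤ (r' : ℝ) := by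
  refine ⟨Nat.div (Nat.mul m m) K40,
    Nat.add (Nat.div (Nat.mul r (Nat.add (Nat.add m m) r)) K40) 2, ?_, ?_⟩
  · unfold sqN; rw [frn_eq, frn_eq]
  · have e := prod_err h h
    have e1 := ndiv_up (Nat.mul m m) K40 (by norm_num)
    have e2 := ndiv_low (Nat.mul m m) K40
    have e3 := ndiv_up (Nat.mul r (Nat.add (Nat.add m m) r)) K40 (by norm_num)
    have c1 : ((Nat.mul m m : Nat) : ℝ) = m * m := by simp
    have c2 : ((Nat.mul r (Nat.add (Nat.add m m) r) : Nat) : ℝ) = r * (m + m + r) := by simp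
    have c3 : ((Nat.add (Nat.div (Nat.mul r (Nat.add (Nat.add m m) r)) K40) 2 : Nat) : ℝ)
      = ((Nat.div (Nat.mul r (Nat.add (Nat.add m m) r)) K40 : Nat) : ℝ) + 2 := by
      simp only [Nat.add_eq]; push_cast; rfl
    rw [c3]
    rw [c1] at e1 e2
    rw [c2] at e3
    generalize ((Nat.div (Nat.mul m m) K40 : Nat) : ℝ) = M at *
    generalize ((Nat.div (Nat.mul r (Nat.add (Nat.add m m) r)) K40 : Nat) : ℝ) = R at *
    rw [abs_of_nonneg (Nat.cast_nonneg m : (0:ℝ) ≤ (m:ℝ))] at e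
    push_cast at e1 e2 e3
    rw [abs_le] at *
    constructor <;> linarith [e.1, e.2]

lemma expc_ok {α : Type} {x : Int} (hx : x.natAbs ≤ 10995116277760) (k : Nat → Nat → α) :
    ∃ m r : Nat, expc x k = k m r ∧ |exp ((x : ℝ) / K40) * K40 - (m : ℝ)| ≤ (r : ℝ) := by
  have h := hor_ok hx
  have hxr : |(x : ℝ)| ≤ 10995116277760 := by
    rw [← natAbs_cast']; exact_mod_cast hx
  have h0 : (0 : ℝ) ≤ (hor x : ℝ) := by
    have : (0.375 : ℝ) ≤ exp ((x : ℝ) / K44) := by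
      have h1 := Real.add_one_le_exp ((x : ℝ) / K44)
      have h2 : -0.625 ≤ (x : ℝ) / K44 := by
        rw [le_div_iff₀ (by norm_num)]; linarith [(abs_le.1 hxr).1]
      linarith
    rw [abs_le] at h
    linarith [h.1]
  have h0' : 0 ≤ hor x := by exact_mod_cast h0
  have hm : |exp ((x : ℝ) / K44) * K40 - ((Int.toNat (hor x) : Nat) : ℝ)| ≤ ((5 : Nat) : ℝ) := by
    have : ((Int.toNat (hor x) : Nat) : ℝ) = (hor x : ℝ) := by
      have := Int.toNat_of_nonneg h0'
      exact_mod_cast this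
    rw [this, abs_sub_comm]
    exact h.trans (by norm_num)
  unfold expc
  rw [frn_eq]
  obtain ⟨m1, r1, q1, i1⟩ := sqN_ok hm (fun m r => sqN m r fun m r => sqN m r fun m r => sqN m r k)
  obtain ⟨m2, r2, q2, i2⟩ := sqN_ok i1 (fun m r => sqN m r fun m r => sqN m r k)
  obtain ⟨m3, r3, q3, i3⟩ := sqN_ok i2 (fun m r => sqN m r k)
  obtain ⟨m4, r4, q4, i4⟩ := sqN_ok i3 k
  refine ⟨m4, r4, by rw [q1, q2, q3, q4], ?_⟩
  have : exp ((x : ℝ) / K40) = (((exp ((x : ℝ) / K44) ^ 2) ^ 2) ^ 2) ^ 2 := by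
    rw [← Real.exp_nat_mul, ← Real.exp_nat_mul, ← Real.exp_nat_mul, ← Real.exp_nat_mul]
    congr 1; push_cast; ring
  rw [this]; exact i4

lemma exp_slope (u v : ℝ) : ∃ s, exp v - exp u = s * (v - u) ∧ exp ((u + v) / 2) ≤ s ∧
    s ≤ (exp u + exp v) / 2 := by
  have key : ∀ u v : ℝ, u < v → ∃ s, exp v - exp u = s * (v - u) ∧ exp ((u + v) / 2) ≤ s ∧
    s ≤ (exp u + exp v) / 2 := by
    intro u v huv
    have hh : 0 < (v - u) / 2 := by linarith
    have e1 : exp v = exp ((u + v) / 2) * exp ((v - u) / 2) := by rw [← exp_add]; congr 1; ring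
    have e2 : exp u = exp ((u + v) / 2) * exp (-((v - u) / 2)) := by rw [← exp_add]; congr 1; ring
    have s1 := self_le_sinh' hh.le
    have s2 := sinh_le_mul_cosh hh.le
    rw [Real.sinh_eq] at s1 s2
    rw [Real.cosh_eq] at s2
    have hp := exp_pos ((u + v) / 2)
    refine ⟨(exp v - exp u) / (v - u), ?_, ?_, ?_⟩
    · field_simp [sub_ne_zero.2 huv.ne']
    · rw [le_div_iff₀ (by linarith)]
      have := mul_le_mul_of_nonneg_left s1 hp.le
      rw [e1, e2]; linarith
    · rw [div_le_iff₀ (by linarith)]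
      have := mul_le_mul_of_nonneg_left s2 hp.le
      rw [e1, e2]
      generalize exp ((u + v) / 2) = E at *
      generalize exp ((v - u) / 2) = F at *
      generalize exp (-((v - u) / 2)) = G at *
      linarith
  rcases lt_trichotomy u v with h | h | h
  · exact key u v h
  · subst h
    refine ⟨exp u, by ring, ?_, by linarith⟩
    apply le_of_eq; congr 1; ring
  · obtain ⟨s, h1, h2, h3⟩ := key v u h
    exact ⟨s, by linarith, by rwa [add_comm u v], by linarith⟩

lemma log_slope {u v : ℝ} (hu : 0 < u) (hv : 0 < v) : ∃ s, log v - log u = s * (v - u) ∧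
    2 / (u + v) ≤ s ∧ s ≤ (1 / u + 1 / v) / 2 := by
  have key : ∀ u v : ℝ, 0 < u → u < v → ∃ s, log v - log u = s * (v - u) ∧
    2 / (u + v) ≤ s ∧ s ≤ (1 / u + 1 / v) / 2 := by
    intro u v hu huv
    have hv : 0 < v := hu.trans huv
    refine ⟨(log v - log u) / (v - u), ?_, ?_, ?_⟩
    · field_simp [sub_ne_zero.2 huv.ne']
    · have := log_ratio hu huv.le
      rw [le_div_iff₀ (by linarith)]
      refine le_trans (le_of_eq ?_) this
      rw [add_comm v u]; ring
    · rw [div_le_iff₀ (by linarith)]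
      have h0 : 0 ≤ log (v / u) := Real.log_nonneg (by rw [le_div_iff₀ hu]; linarith)
      have h1 := self_le_sinh' h0
      rw [Real.sinh_log (by positivity), Real.log_div hv.ne' hu.ne'] at h1
      refine h1.trans (le_of_eq ?_)
      field_simp
      ring
  rcases lt_trichotomy u v with h | h | h
  · exact key u v hu h
  · subst h
    refine ⟨1 / u, by ring, ?_, by linarith⟩
    apply le_of_eq; field_simp; ring
  · obtain ⟨s, h1, h2, h3⟩ := key v u hv h
    exact ⟨s, by linarith, by rwa [add_comm u v], by linarith⟩
end

section
open Real

lemma beN {m r : Nat} {s : ℝ} (h : |s * K40 - (m : ℝ)| ≤ (r : ℝ)) : BE ⟨Int.ofNat m, r⟩ s := by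
  simpa [BE] using h

lemma logc_ok {x : Nat} {b : Bl} (hx : 0 < x) (h : logc x = some b) :
    BE b (log ((x : ℝ) / K40)) := by
  unfold logc at h
  rw [frc_eq] at h
  generalize log0 x = y at h
  cases hy : Nat.ble y.natAbs 10995116277760 with
  | false => rw [hy] at h; simp at h
  | true =>
    rw [hy] at h
    simp only at h
    obtain ⟨m, r, q, i⟩ := expc_ok (Nat.le_of_ble_eq_true hy) (fun m r =>
      frn (nmin x (Nat.sub m r)) fun mn =>
      match mn with
      | 0 => none
      | _ + 1 => some (⟨y, Nat.add (Nat.div (Nat.mul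
          (Nat.add (Nat.add (Nat.sub x m) (Nat.sub m x)) r) K40) mn) 1⟩ : Bl))
    replace h := q.symm.trans h
    simp only [frn_eq] at h
    cases hm : nmin x (Nat.sub m r) with
    | zero => rw [hm] at h; simp at h
    | succ n =>
      rw [hm] at h
      simp only [Option.some.injEq] at h
      have hle1 : n + 1 ≤ x := by
        rw [← hm]; unfold nmin
        cases hb : Nat.ble x (Nat.sub m r) with
        | true => exact le_rfl
        | false =>
          have : ¬ (x ≤ Nat.sub m r) := fun hc => by
            rw [Nat.ble_eq_true_of_le hc] at hb; cases hb
          exact (not_le.1 this).le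
      have hle2 : n + 1 ≤ m - r := by
        rw [← hm]; unfold nmin
        cases hb : Nat.ble x (Nat.sub m r) with
        | true => exact Nat.le_of_ble_eq_true hb
        | false => exact le_rfl
      have hr : r ≤ m := by omega
      have hxr : ((n + 1 : Nat) : ℝ) ≤ x := by exact_mod_cast hle1
      have hmr : ((n + 1 : Nat) : ℝ) ≤ (m : ℝ) - r := by
        rw [← Nat.cast_sub hr]; exact_mod_cast hle2
      have hn0 : (0 : ℝ) < ((n + 1 : Nat) : ℝ) := by positivity
      have e3 := ndiv_up (Nat.mul (Nat.add (Nat.add (Nat.sub x m) (Nat.sub m x)) r) K40)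
        (n + 1) (by omega)
      have c1 : ((Nat.mul (Nat.add (Nat.add (Nat.sub x m) (Nat.sub m x)) r) K40 : Nat) : ℝ)
          = (|(x : ℝ) - m| + r) * K40 := by
        have a1 : ((Nat.sub x m + Nat.sub m x : Nat) : ℝ) = |(x : ℝ) - m| := by
          rcases le_total x m with h | h
          · have e : Nat.sub x m + Nat.sub m x = m - x := by
              have : Nat.sub x m = 0 := Nat.sub_eq_zero_of_le h
              rw [this, zero_add]; rfl
            rw [e, Nat.cast_sub h, abs_sub_comm, abs_of_nonneg]
            have : (x : ℝ) ≤ m := by exact_mod_cast h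
            linarith
          · have e : Nat.sub x m + Nat.sub m x = x - m := by
              have : Nat.sub m x = 0 := Nat.sub_eq_zero_of_le h
              rw [this, add_zero]; rfl
            rw [e, Nat.cast_sub h, abs_of_nonneg]
            have : (m : ℝ) ≤ x := by exact_mod_cast h
            linarith
        rw [← a1]
        simp only [Nat.mul_eq, Nat.add_eq]; push_cast; ring
      rw [← h]
      unfold BE
      simp only [Nat.add_eq] at *
      rw [c1] at e3
      push_cast
      generalize ((Nat.div (Nat.mul (Nat.sub x m + Nat.sub m x + r) K40)
        (n + 1) : Nat) : ℝ) = R at *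
      have hx0 : (0 : ℝ) < x := by exact_mod_cast hx
      set E := exp ((y : ℝ) / K40) with hE
      have hE0 : 0 < E := exp_pos _
      have hlogE : log (E * K40) = (y : ℝ) / K40 + log K40 := by
        rw [Real.log_mul hE0.ne' (by norm_num), hE, Real.log_exp]
      have hlx : log ((x : ℝ) / K40) = log x - log K40 :=
        Real.log_div hx0.ne' (by norm_num)
      have hEm : ((n + 1 : Nat) : ℝ) ≤ E * K40 := by linarith [(abs_le.1 i).1]
      have hd : |(x : ℝ) - E * K40| ≤ |(x : ℝ) - m| + r := by
        calc |(x : ℝ) - E * K40| = |((x : ℝ) - m) - (E * K40 - m)| := by ring_nf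
          _ ≤ |(x : ℝ) - m| + |E * K40 - m| := abs_sub _ _
          _ ≤ _ := by linarith
      set Z := E * K40 with hZ
      have hZ0 : 0 < Z := by positivity
      have key : |log x - log Z| ≤ |(x : ℝ) - Z| / ((n + 1 : Nat) : ℝ) := by
        have aux : ∀ a b : ℝ, ((n + 1 : Nat) : ℝ) ≤ a → a ≤ b → |log b - log a| ≤ |b - a| / ((n + 1 : Nat) : ℝ) := by
          intro a b ha hab
          have ha0 : 0 < a := lt_of_lt_of_le hn0 ha
          rw [abs_of_nonneg (by linarith [Real.log_le_log ha0 hab]), abs_of_nonneg (by linarith)]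
          rw [← Real.log_div (by linarith) ha0.ne']
          have := Real.log_le_sub_one_of_pos (x := b / a) (div_pos (lt_of_lt_of_le ha0 hab) ha0)
          refine this.trans ?_
          have : b / a - 1 = (b - a) / a := by field_simp
          rw [this]
          exact div_le_div_of_nonneg_left (by linarith) hn0 ha
        rcases le_total (x : ℝ) Z with h | h
        · rw [abs_sub_comm, abs_sub_comm (x : ℝ)]; exact aux _ _ hxr h
        · exact aux _ _ hEm h
      have k2 : |log x - log Z| ≤ (|(x : ℝ) - m| + r) / ((n + 1 : Nat) : ℝ) :=
        key.trans (div_le_div_of_nonneg_right hd hn0.le)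
      rw [hlx, show (log (x : ℝ) - log K40) * K40 - (y : ℝ) =
        (log x - log Z) * K40 by rw [hlogE]; ring, abs_mul,
        abs_of_pos (by norm_num : (0:ℝ) < K40)]
      have : (|(x : ℝ) - m| + r) * K40 / ((n + 1 : Nat) : ℝ) =
        (|(x : ℝ) - m| + r) / ((n + 1 : Nat) : ℝ) * K40 := by ring
      linarith

section ops
variable {H : Hs} {d0 d1 d2 : ℝ} {a b : Fm} {u v : ℝ}

lemma exp_dev {c : Int} {m r rr : Nat} {t : ℝ} (hrr : rr ≤ K40)
    (he : |exp ((c : ℝ) / K40) * K40 - (m : ℝ)| ≤ (r : ℝ))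
    (ht : BE ⟨c, rr⟩ t) :
    |exp t - exp ((c : ℝ) / K40)| * (K40 * K40 * K40) ≤
      ((m : ℝ) + r) * (rr * K40 + rr * rr) := by
  unfold BE at ht
  simp only at ht
  set E := exp ((c : ℝ) / K40) with hE
  set δ := t - (c : ℝ) / K40 with hδ
  have e1 : exp t = E * exp δ := by rw [hE, ← exp_add]; congr 1; rw [hδ]; ring
  have hδK : |δ| * K40 ≤ rr := by
    have : |δ| * K40 = |t * K40 - (c : ℝ)| := by
      rw [← abs_of_pos (by norm_num : (0:ℝ) < K40), ← abs_mul, abs_of_pos (by norm_num : (0:ℝ) < K40)]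
      congr 1; rw [hδ]; ring
    rw [this]; exact ht
  have hrr' : (rr : ℝ) ≤ K40 := by exact_mod_cast hrr
  have hδ1 : |δ| ≤ 1 := by
    have : |δ| * K40 ≤ 1 * K40 := by linarith
    exact le_of_mul_le_mul_right this (by norm_num)
  have h1 := Real.abs_exp_sub_one_sub_id_le hδ1
  have h2 : |exp δ - 1| ≤ |δ| + |δ| ^ 2 := by
    calc |exp δ - 1| = |(exp δ - 1 - δ) + δ| := by ring_nf
      _ ≤ |exp δ - 1 - δ| + |δ| := abs_add_le _ _
      _ ≤ _ := by rw [sq_abs]; linarith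
  have hE0 : 0 < E := exp_pos _
  have hEm : E * K40 ≤ (m : ℝ) + r := by linarith [(abs_le.1 he).2]
  have e2 : |exp t - E| = E * |exp δ - 1| := by
    rw [e1, show E * exp δ - E = E * (exp δ - 1) by ring, abs_mul, abs_of_pos hE0]
  rw [e2]
  have h3 : |exp δ - 1| * (K40 * K40) ≤ rr * K40 + rr * rr := by
    have a1 : (|δ| * K40) * (|δ| * K40) ≤ rr * rr :=
      mul_le_mul hδK hδK (by positivity) (by positivity)
    have := mul_le_mul_of_nonneg_right h2 (by norm_num : (0:ℝ) ≤ K40 * K40)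
    linarith
  calc E * |exp δ - 1| * (K40 * K40 * K40)
      = (E * K40) * (|exp δ - 1| * (K40 * K40)) := by ring
    _ ≤ _ := mul_le_mul hEm h3 (by positivity) (by positivity)

lemma Enc.exp (hH : HB H d0 d1 d2) (ha : Enc d0 d1 d2 a u v) {F : Fm} (h : a.exp H = some F) :
    Enc d0 d1 d2 F (Real.exp u) (Real.exp v) := by
  unfold Fm.exp at h
  cases hc : (Nat.ble a.c.natAbs 10995116277760 && (Nat.ble a.rc K40 &&
      Nat.ble a.rv K40)) with
  | false => rw [hc] at h; simp at h
  | true =>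
    rw [hc] at h
    simp only [Bool.and_eq_true] at hc
    obtain ⟨hc1, hc2, hc3⟩ := hc
    have hc1 := Nat.le_of_ble_eq_true hc1
    have hc2 := Nat.le_of_ble_eq_true hc2
    have hc3 := Nat.le_of_ble_eq_true hc3
    simp only [Option.some.injEq, frn_eq] at h
    obtain ⟨m, r, q, i⟩ := expc_ok hc1 (fun m r =>
      a.chain H ⟨Int.ofNat m, Nat.add (Nat.add r (Nat.div (Nat.mul (Nat.add m r) (Nat.add a.rc
        (Nat.add (Nat.div (Nat.mul a.rc a.rc) K40) 1))) K40)) 1⟩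
      (Bl.ofLH (Nat.div (Nat.mul (Nat.sub m r) (Nat.sub K41 (Nat.add a.rc a.rv)))
          K41)
        (Nat.add (Nat.div (Nat.mul (Nat.add m r) (Nat.add (Nat.add K41 (Nat.add a.rc a.rv))
          (Nat.add (Nat.div (Nat.add (Nat.mul a.rc a.rc) (Nat.mul a.rv a.rv)) K40) 1)))
          K41) 1)))
    rw [q] at h
    rw [← h]
    clear h q
    have D1 := exp_dev hc2 i ha.hu
    have D2 := exp_dev hc3 i ha.hv
    have hE0 : 0 < Real.exp ((a.c : ℝ) / K40) := exp_pos _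
    have hmid : Real.exp ((a.c : ℝ) / K40) * (1 - ((a.rc : ℝ) + a.rv) / K41) ≤
        Real.exp ((u + v) / 2) := by
      have e : Real.exp ((u + v) / 2) = Real.exp ((a.c : ℝ) / K40) *
          Real.exp ((u + v) / 2 - (a.c : ℝ) / K40) := by
        rw [← exp_add]; congr 1; ring
      rw [e]
      refine mul_le_mul_of_nonneg_left ?_ hE0.le
      have := Real.add_one_le_exp ((u + v) / 2 - (a.c : ℝ) / K40)
      have h1 := (abs_le.1 ha.hu).1
      have h2 := (abs_le.1 ha.hv).1
      simp only at h1 h2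
      linarith
    set E := Real.exp ((a.c : ℝ) / K40) with hE
    obtain ⟨s, hs1, hs2, hs3⟩ := exp_slope u v
    have i' := abs_le.1 i
    have D1' : |Real.exp u - E| * K40 ≤ ((m : ℝ) + r) * (a.rc + a.rc * a.rc / K40) / K40 := by
      rw [le_div_iff₀ (by norm_num)]
      linarith
    have D2' : |Real.exp v - E| * K40 ≤ ((m : ℝ) + r) * (a.rv + a.rv * a.rv / K40) / K40 := by
      rw [le_div_iff₀ (by norm_num)]
      linarith
    have mr0 : (0 : ℝ) ≤ (m : ℝ) + r := by positivity
    refine Enc.chain (s := s) hH ha ?_ ?_ hs1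
    · apply beN
      have e1 := ndiv_up (Nat.mul a.rc a.rc) K40 (by norm_num)
      have e2 := ndiv_up (Nat.mul (Nat.add m r) (Nat.add a.rc
        (Nat.add (Nat.div (Nat.mul a.rc a.rc) K40) 1))) K40 (by norm_num)
      have c2 : ((Nat.mul (Nat.add m r) (Nat.add a.rc
        (Nat.add (Nat.div (Nat.mul a.rc a.rc) K40) 1)) : Nat) : ℝ) = ((m : ℝ) + r) *
        (a.rc + (((Nat.div (Nat.mul a.rc a.rc) K40 : Nat) : ℝ) + 1)) := by
        simp only [Nat.add_eq, Nat.mul_eq]; push_cast; ring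
      have c1 : ((Nat.mul a.rc a.rc : Nat) : ℝ) = a.rc * a.rc := by simp
      have c3 : ((Nat.add (Nat.add r (Nat.div (Nat.mul (Nat.add m r) (Nat.add a.rc
        (Nat.add (Nat.div (Nat.mul a.rc a.rc) K40) 1))) K40)) 1 : Nat) : ℝ) =
        r + ((Nat.div (Nat.mul (Nat.add m r) (Nat.add a.rc
        (Nat.add (Nat.div (Nat.mul a.rc a.rc) K40) 1))) K40 : Nat) : ℝ) + 1 := by
        simp only [Nat.add_eq, Nat.mul_eq]; push_cast; ring
      rw [c3]
      rw [c2] at e2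
      rw [c1] at e1
      push_cast at e1 e2
      generalize ((Nat.div (Nat.mul (Nat.add m r) (Nat.add a.rc
        (Nat.add (Nat.div (Nat.mul a.rc a.rc) K40) 1))) K40 : Nat) : ℝ) = R at *
      generalize ((Nat.div (Nat.mul a.rc a.rc) K40 : Nat) : ℝ) = R1 at *
      have e3 : ((m : ℝ) + r) * (a.rc + a.rc * a.rc / K40) / K40 ≤
          ((m : ℝ) + r) * (a.rc + (R1 + 1)) / K40 := by
        apply div_le_div_of_nonneg_right _ (by norm_num)
        exact mul_le_mul_of_nonneg_left (by linarith) mr0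
      have D3 := abs_le.1 (le_refl |Real.exp u - E|)
      rw [abs_le]
      constructor <;> linarith [i'.1, i'.2, D3.1, D3.2]
    · apply BE.ofLH
      · refine (ndiv_low _ _).trans ?_
        rw [div_le_iff₀ (by norm_num)]
        rcases Nat.lt_or_ge m r with hmr | hmr
        · have z : Nat.sub m r = 0 := Nat.sub_eq_zero_of_le hmr.le
          have : Nat.mul 0 (Nat.sub K41 (Nat.add a.rc a.rv)) = 0 := Nat.zero_mul _
          rw [z, this]
          have : 0 ≤ s := (exp_pos _).le.trans hs2
          push_cast
          positivity
        · have hle : a.rc + a.rv ≤ K41 := by omega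
          have c : ((Nat.mul (Nat.sub m r) (Nat.sub K41 (Nat.add a.rc a.rv)) : Nat) : ℝ) =
              ((m : ℝ) - r) * (K41 - (a.rc + a.rv)) := by
            have : Nat.mul (Nat.sub m r) (Nat.sub K41 (Nat.add a.rc a.rv)) =
              (m - r) * (K41 - (a.rc + a.rv)) := rfl
            rw [this, Nat.cast_mul, Nat.cast_sub hmr, Nat.cast_sub hle]; push_cast; ring
          rw [c]
          have hle' : (a.rc : ℝ) + a.rv ≤ K41 := by exact_mod_cast hle
          have h5 : ((m : ℝ) - r) * (K41 - (a.rc + a.rv)) ≤ (E * K40) * (K41 - (a.rc + a.rv)) :=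
            mul_le_mul_of_nonneg_right (by linarith [i'.1, i'.2]) (by linarith)
          have h6 := hmid.trans hs2
          push_cast
          linarith
      · have e1 := ndiv_up (Nat.add (Nat.mul a.rc a.rc) (Nat.mul a.rv a.rv)) K40 (by norm_num)
        have e2 := ndiv_up (Nat.mul (Nat.add m r) (Nat.add (Nat.add K41 (Nat.add a.rc a.rv))
          (Nat.add (Nat.div (Nat.add (Nat.mul a.rc a.rc) (Nat.mul a.rv a.rv)) K40) 1)))
          K41 (by norm_num)
        have c1 : ((Nat.add (Nat.mul a.rc a.rc) (Nat.mul a.rv a.rv) : Nat) : ℝ) = a.rc * a.rc + a.rv * a.rv := by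
          simp
        have c2 : ((Nat.mul (Nat.add m r) (Nat.add (Nat.add K41 (Nat.add a.rc a.rv))
          (Nat.add (Nat.div (Nat.add (Nat.mul a.rc a.rc) (Nat.mul a.rv a.rv)) K40) 1)) : Nat) : ℝ) =
          ((m : ℝ) + r) * (K41 + (a.rc + a.rv) + (((Nat.div (Nat.add (Nat.mul a.rc a.rc) (Nat.mul a.rv a.rv)) K40 : Nat) : ℝ) + 1)) := by
          simp only [Nat.add_eq, Nat.mul_eq]; push_cast; ring
        have c3 : ((Nat.add (Nat.div (Nat.mul (Nat.add m r) (Nat.add (Nat.add K41 (Nat.add a.rc a.rv))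
          (Nat.add (Nat.div (Nat.add (Nat.mul a.rc a.rc) (Nat.mul a.rv a.rv)) K40) 1)))
          K41) 1 : Nat) : ℝ) = ((Nat.div (Nat.mul (Nat.add m r) (Nat.add (Nat.add K41 (Nat.add a.rc a.rv))
          (Nat.add (Nat.div (Nat.add (Nat.mul a.rc a.rc) (Nat.mul a.rv a.rv)) K40) 1)))
          K41 : Nat) : ℝ) + 1 := by simp only [Nat.add_eq]; push_cast; rfl
        rw [c3]
        rw [c1] at e1
        rw [c2] at e2
        push_cast at e1 e2
        generalize ((Nat.div (Nat.mul (Nat.add m r) (Nat.add (Nat.add K41 (Nat.add a.rc a.rv))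
          (Nat.add (Nat.div (Nat.add (Nat.mul a.rc a.rc) (Nat.mul a.rv a.rv)) K40) 1)))
          K41 : Nat) : ℝ) = R at *
        generalize ((Nat.div (Nat.add (Nat.mul a.rc a.rc) (Nat.mul a.rv a.rv)) K40 : Nat) : ℝ) = R1 at *
        have e3 : ((m : ℝ) + r) * (K41 + (a.rc + a.rv) + (a.rc * a.rc + a.rv * a.rv) / K40) / K41 ≤
          ((m : ℝ) + r) * (K41 + (a.rc + a.rv) + (R1 + 1)) / K41 := by
          apply div_le_div_of_nonneg_right _ (by norm_num)
          exact mul_le_mul_of_nonneg_left (by linarith) mr0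
        have D3 := abs_le.1 (le_refl |Real.exp u - E|)
        have D4 := abs_le.1 (le_refl |Real.exp v - E|)
        have e4 : ((m : ℝ) + r) * (K41 + (a.rc + a.rv) + (a.rc * a.rc + a.rv * a.rv) / K40) / K41 =
          ((m : ℝ) + r) + (((m : ℝ) + r) * (a.rc + a.rc * a.rc / K40) / K40 +
            ((m : ℝ) + r) * (a.rv + a.rv * a.rv / K40) / K40) / 2 := by ring
        linarith [i'.1, i'.2, D3.1, D3.2, D4.1, D4.2]

end ops
end

section
open Real

lemma toNat_cast {c : Int} {n : Nat} (h : n < c.toNat) : ((c.toNat : Nat) : ℝ) = (c : ℝ) := by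
  have h0 : (c.toNat : Int) = c := Int.toNat_of_nonneg (by omega)
  have : ((c.toNat : Int) : ℝ) = (c : ℝ) := by rw [h0]
  rw [← this]; exact (Int.cast_natCast _).symm

section ops
variable {H : Hs} {d0 d1 d2 : ℝ} {a b : Fm} {u v : ℝ}

lemma ble_false {a b : Nat} (h : Nat.ble a b = false) : b < a := by
  by_contra hc
  rw [Nat.ble_eq_true_of_le (not_lt.1 hc)] at h; cases h

lemma sub_cast {a b : Nat} (h : a < b) : ((Nat.sub b a : Nat) : ℝ) = (b : ℝ) - a :=
  Nat.cast_sub h.le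

lemma Enc.log (hH : HB H d0 d1 d2) (ha : Enc d0 d1 d2 a u v) {F : Fm} (h : a.log H = some F) :
    Enc d0 d1 d2 F (Real.log u) (Real.log v) := by
  unfold Fm.log at h
  rw [frn_eq] at h
  cases hc : (Nat.ble a.c.toNat a.rc || Nat.ble a.c.toNat a.rv) with
  | true => rw [hc] at h; simp at h
  | false =>
    rw [hc] at h
    simp only [Bool.or_eq_false_iff] at hc
    obtain ⟨hc1, hc2⟩ := hc
    have hc1 := ble_false hc1
    have hc2 := ble_false hc2
    simp only at h
    cases hl : logc a.c.toNat with
    | none => rw [hl] at h; simp at h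
    | some b =>
      obtain ⟨m, r⟩ := b
      rw [hl] at h
      simp only [Option.some.injEq] at h
      rw [← h]; clear h
      have hcc := toNat_cast hc1
      have hL := logc_ok (by omega) hl
      have hu := ha.hu
      have hv := ha.hv
      unfold BE at hu hv hL
      simp only at hu hv hL
      have s1 := sub_cast hc1
      have s2 := sub_cast hc2
      have q1 : (a.rc : ℝ) < (a.c.toNat : ℝ) := by exact_mod_cast hc1
      have q2 : (a.rv : ℝ) < (a.c.toNat : ℝ) := by exact_mod_cast hc2
      rw [← hcc] at hu hv
      generalize a.c.toNat = c at *
      have hu1 := abs_le.1 hu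
      have hv1 := abs_le.1 hv
      have hc0 : (0 : ℝ) < c := by
        have : (0 : ℝ) ≤ a.rc := by positivity
        linarith
      have u0 : 0 < u := by linarith
      have v0 : 0 < v := by linarith
      obtain ⟨s, hs1, hs2, hs3⟩ := log_slope u0 v0
      have d1p : (0 : ℝ) < (c : ℝ) - a.rc := by linarith
      have d2p : (0 : ℝ) < (c : ℝ) - a.rv := by linarith
      refine Enc.chain (s := s) hH ha ?_ ?_ hs1
      · have e := ndiv_up (Nat.mul a.rc K40) (Nat.sub c a.rc) (by
          have : (0:ℝ) < ((Nat.sub c a.rc : Nat) : ℝ) := by rw [s1]; exact d1p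
          exact_mod_cast this)
        have c3 : ((Nat.add (Nat.add r (Nat.div (Nat.mul a.rc K40) (Nat.sub c a.rc))) 1 : Nat) : ℝ)
          = r + ((Nat.div (Nat.mul a.rc K40) (Nat.sub c a.rc) : Nat) : ℝ) + 1 := by
          simp only [Nat.add_eq]; push_cast; ring
        unfold BE
        simp only
        rw [c3]
        rw [s1] at e
        have c4 : ((Nat.mul a.rc K40 : Nat) : ℝ) = a.rc * K40 := by simp
        rw [c4] at e
        generalize ((Nat.div (Nat.mul a.rc K40) (Nat.sub c a.rc) : Nat) : ℝ) = R at *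
        have aux : ∀ x y : ℝ, 0 < x → 0 < y → (c : ℝ) - a.rc ≤ x * K40 →
            |y - x| * K40 ≤ a.rc → Real.log y - Real.log x ≤ a.rc / ((c : ℝ) - a.rc) := by
          intro x y hx hy h1 h2
          rw [← Real.log_div hy.ne' hx.ne']
          refine (Real.log_le_sub_one_of_pos (div_pos hy hx)).trans ?_
          have : y / x - 1 = (y - x) / x := by field_simp
          rw [this, div_le_div_iff₀ hx d1p]
          have h3 := mul_le_mul_of_nonneg_left h1 (abs_nonneg (y - x))
          have h4 := mul_le_mul_of_nonneg_right h2 hx.le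
          have h5 := mul_le_mul_of_nonneg_right (le_abs_self (y - x)) d1p.le
          nlinarith
        have hck : (0:ℝ) < (c : ℝ) / K40 := by positivity
        have ee : |u - (c : ℝ) / K40| * K40 ≤ a.rc := by
          have : |u - (c : ℝ) / K40| * K40 = |u * K40 - c| := by
            rw [← abs_of_pos (by norm_num : (0:ℝ) < K40), ← abs_mul,
              abs_of_pos (by norm_num : (0:ℝ) < K40)]
            congr 1; ring
          rw [this]; exact hu
        have a1 := aux _ _ hck u0 (by
          have : (c : ℝ) / K40 * K40 = c := by field_simp
          rw [this]; have : (0 : ℝ) ≤ a.rc := by positivity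
          linarith) ee
        have a2 := aux _ _ u0 hck (by linarith) (by rw [abs_sub_comm]; exact ee)
        have e' : a.rc / ((c : ℝ) - a.rc) * K40 ≤ R + 1 := by
          refine le_trans (le_of_eq ?_) e
          ring
        have hL1 := abs_le.1 hL
        rw [abs_le]
        constructor <;> linarith
      · apply BE.ofLH
        · refine (ndiv_low _ _).trans ?_
          have c5 : ((Nat.add (Nat.add c c) (Nat.add a.rc a.rv) : Nat) : ℝ) = c + c + (a.rc + a.rv) := by
            simp only [Nat.add_eq]; push_cast; ring
          rw [c5]
          have : 2417851639229258349412352 / ((c : ℝ) + c + (a.rc + a.rv)) ≤ 2 / (u + v) * K40 := by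
            rw [div_mul_eq_mul_div, div_le_div_iff₀ (by positivity) (by linarith)]
            linarith
          push_cast
          exact this.trans (mul_le_mul_of_nonneg_right hs2 (by norm_num))
        · have e1 := ndiv_up K80 (Nat.sub c a.rc) (by
            have : (0:ℝ) < ((Nat.sub c a.rc : Nat) : ℝ) := by rw [s1]; exact d1p
            exact_mod_cast this)
          have e2 := ndiv_up K80 (Nat.sub c a.rv) (by
            have : (0:ℝ) < ((Nat.sub c a.rv : Nat) : ℝ) := by rw [s2]; exact d2p
            exact_mod_cast this)
          have e3 := ndiv_up (Nat.add (Nat.div K80 (Nat.sub c a.rc))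
            (Nat.div K80 (Nat.sub c a.rv))) 2 (by norm_num)
          have c6 : ((Nat.add (Nat.div (Nat.add (Nat.div K80 (Nat.sub c a.rc))
            (Nat.div K80 (Nat.sub c a.rv))) 2) 2 : Nat) : ℝ) =
            ((Nat.div (Nat.add (Nat.div K80 (Nat.sub c a.rc))
            (Nat.div K80 (Nat.sub c a.rv))) 2 : Nat) : ℝ) + 2 := by
            simp only [Nat.add_eq]; push_cast; rfl
          have c7 : ((Nat.add (Nat.div K80 (Nat.sub c a.rc))
            (Nat.div K80 (Nat.sub c a.rv)) : Nat) : ℝ) =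
            ((Nat.div K80 (Nat.sub c a.rc) : Nat) : ℝ) +
            ((Nat.div K80 (Nat.sub c a.rv) : Nat) : ℝ) := by
            simp only [Nat.add_eq]; push_cast; rfl
          rw [c6]
          rw [c7] at e3
          rw [s1] at e1
          rw [s2] at e2
          push_cast at e1 e2 e3
          generalize ((Nat.div (Nat.add (Nat.div K80 (Nat.sub c a.rc))
            (Nat.div K80 (Nat.sub c a.rv))) 2 : Nat) : ℝ) = R3 at *
          generalize ((Nat.div K80 (Nat.sub c a.rc) : Nat) : ℝ) = R1 at *
          generalize ((Nat.div K80 (Nat.sub c a.rv) : Nat) : ℝ) = R2 at *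
          have f1 : 1 / u * K40 ≤ K80 / ((c : ℝ) - a.rc) := by
            rw [div_mul_eq_mul_div, div_le_div_iff₀ u0 d1p]; linarith
          have f2 : 1 / v * K40 ≤ K80 / ((c : ℝ) - a.rv) := by
            rw [div_mul_eq_mul_div, div_le_div_iff₀ v0 d2p]; linarith
          have := mul_le_mul_of_nonneg_right hs3 (by norm_num : (0:ℝ) ≤ K40)
          linarith

lemma invc_ok {c r : Nat} (h : r < c) {t : ℝ} (ht : |t * K40 - (c : ℝ)| ≤ (r : ℝ)) :
    BE (invc c r) t⁻¹ := by
  unfold BE invc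
  simp only
  have hr : (r : ℝ) < c := by exact_mod_cast h
  have hr0 : (0 : ℝ) ≤ r := by positivity
  have hc0 : (0 : ℝ) < c := by linarith
  have hd : (0 : ℝ) < (c : ℝ) - r := by linarith
  have s1 := sub_cast h
  have c1 : ((Nat.mul c (Nat.sub c r) : Nat) : ℝ) = c * ((c : ℝ) - r) := by
    rw [← s1]; simp only [Nat.mul_eq]; push_cast; ring
  have c2 : ((Nat.mul K80 r : Nat) : ℝ) = K80 * r := by
    simp only [Nat.mul_eq]; push_cast; ring
  have e1 := ndiv_up (Nat.mul K80 r) (Nat.mul c (Nat.sub c r)) (by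
    have : (0:ℝ) < ((Nat.mul c (Nat.sub c r) : Nat) : ℝ) := by rw [c1]; positivity
    exact_mod_cast this)
  have e2 := ndiv_up K80 c (by omega)
  have e3 := ndiv_low K80 c
  rw [c1, c2] at e1
  have c3 : ((Nat.add (Nat.div (Nat.mul K80 r) (Nat.mul c (Nat.sub c r))) 2 : Nat) : ℝ)
    = ((Nat.div (Nat.mul K80 r) (Nat.mul c (Nat.sub c r)) : Nat) : ℝ) + 2 := by
    simp only [Nat.add_eq]; push_cast; rfl
  rw [c3]
  have c4 : ((Int.ofNat (Nat.div K80 c) : Int) : ℝ) =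
    ((Nat.div K80 c : Nat) : ℝ) := by simp
  rw [c4]
  push_cast at e2 e3
  generalize ((Nat.div (Nat.mul K80 r) (Nat.mul c (Nat.sub c r)) : Nat) : ℝ) = R1 at *
  generalize ((Nat.div K80 c : Nat) : ℝ) = R2 at *
  have h1 := abs_le.1 ht
  have ht0 : 0 < t := by linarith
  have key : |t⁻¹ * K40 - K80 / (c : ℝ)| ≤
      K80 * r / (c * ((c : ℝ) - r)) := by
    have : t⁻¹ * K40 - K80 / (c : ℝ) =
      -(K80 * (t * K40 - c)) / (c * (t * K40)) := by
      field_simp; ring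
    rw [this, abs_div, abs_neg, abs_mul, abs_of_pos (by norm_num : (0:ℝ) < K80),
      abs_of_pos (by positivity : 0 < (c : ℝ) * (t * K40))]
    refine div_le_div₀ (by positivity) ?_ (by positivity) ?_
    · exact mul_le_mul_of_nonneg_left ht (by norm_num)
    · exact mul_le_mul_of_nonneg_left (by linarith) hc0.le
  have k := abs_le.1 key
  rw [abs_le]
  constructor <;> linarith

lemma Enc.inv (hH : HB H d0 d1 d2) (ha : Enc d0 d1 d2 a u v) {F : Fm} (h : a.inv H = some F) :
    Enc d0 d1 d2 F u⁻¹ v⁻¹ := by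
  unfold Fm.inv at h
  rw [frn_eq] at h
  cases hc : (Nat.ble a.c.toNat a.rc || Nat.ble a.c.toNat a.rv) with
  | true => rw [hc] at h; simp at h
  | false =>
    rw [hc] at h
    simp only [Bool.or_eq_false_iff] at hc
    obtain ⟨hc1, hc2⟩ := hc
    have hc1 := ble_false hc1
    have hc2 := ble_false hc2
    simp only [Option.some.injEq, mkB_eq] at h
    rw [← h]; clear h
    have hcc := toNat_cast hc1
    have hu := ha.hu
    have hv := ha.hv
    unfold BE at hu hv
    simp only at hu hv
    rw [← hcc] at hu hv
    have i1 := invc_ok hc1 hu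
    have i2 := invc_ok hc2 hv
    have q1 : (a.rc : ℝ) < (a.c.toNat : ℝ) := by exact_mod_cast hc1
    have q2 : (a.rv : ℝ) < (a.c.toNat : ℝ) := by exact_mod_cast hc2
    have u0 : 0 < u := by linarith [(abs_le.1 hu).1]
    have v0 : 0 < v := by linarith [(abs_le.1 hv).1]
    refine Enc.chain hH ha i1 (i1.mul i2).neg ?_
    field_simp; ring

end ops

/-! ### Programs -/

/-- Real semantics of one instruction. -/
def stepR (l : List ℝ) : Ins → ℝ
  | .cst n => n / K40
  | .add i j => l.getD i 0 + l.getD j 0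
  | .sub i j => l.getD i 0 - l.getD j 0
  | .mul i j => l.getD i 0 * l.getD j 0
  | .exp i => Real.exp (l.getD i 0)
  | .log i => Real.log (l.getD i 0)
  | .inv i => (l.getD i 0)⁻¹

def runR : List Ins → List ℝ → List ℝ
  | [], l => l
  | i :: is, l => runR is (stepR l i :: l)

/-- Pointwise enclosure of environments. -/
def EncL (d0 d1 d2 : ℝ) (F : List Fm) (l m : List ℝ) : Prop :=
  ∀ i, Enc d0 d1 d2 (lk F i) (l.getD i 0) (m.getD i 0)

lemma Enc.cst (d0 d1 d2 : ℝ) (n : Int) :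
    Enc d0 d1 d2 (Fm.cst n) ((n : ℝ) / K40) ((n : ℝ) / K40) := by
  refine ⟨?_, ?_, 0, 0, 0, ?_, ?_, ?_, by ring⟩ <;> simp [BE, Fm.cst]

lemma EncL.nil (d0 d1 d2 : ℝ) : EncL d0 d1 d2 [] [] [] := by
  intro i
  have := Enc.cst d0 d1 d2 0
  simpa [lk] using this

lemma EncL.cons {d0 d1 d2 : ℝ} {F : List Fm} {l m : List ℝ} {f : Fm} {x y : ℝ}
    (hf : Enc d0 d1 d2 f x y) (h : EncL d0 d1 d2 F l m) : EncL d0 d1 d2 (f :: F) (x :: l) (y :: m) := by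
  intro i
  rcases i with _ | i
  · simpa [lk] using hf
  · simpa [lk] using h i

lemma step_ok {H : Hs} {d0 d1 d2 : ℝ} (hH : HB H d0 d1 d2) {F : List Fm} {l m : List ℝ}
    (h : EncL d0 d1 d2 F l m) (i : Ins) {f : Fm} (hf : step H F i = some f) :
    Enc d0 d1 d2 f (stepR l i) (stepR m i) := by
  cases i with
  | cst n => simp only [step, Option.some.injEq] at hf; rw [← hf]; exact Enc.cst d0 d1 d2 n
  | add i j => simp only [step, Option.some.injEq] at hf; rw [← hf]; exact (h i).add hH (h j)
  | sub i j => simp only [step, Option.some.injEq] at hf; rw [← hf]; exact (h i).sub hH (h j)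
  | mul i j => simp only [step, Option.some.injEq] at hf; rw [← hf]; exact (h i).mul hH (h j)
  | exp i => exact (h i).exp hH hf
  | log i => exact (h i).log hH hf
  | inv i => exact (h i).inv hH hf

lemma run_ok {H : Hs} {d0 d1 d2 : ℝ} (hH : HB H d0 d1 d2) (is : List Ins) : ∀ {F : List Fm}
    {l m : List ℝ} {F' : List Fm}, EncL d0 d1 d2 F l m → run H is F = some F' →
    EncL d0 d1 d2 F' (runR is l) (runR is m) := by
  induction is with
  | nil => intro F l m F' h hr; simp only [run, Option.some.injEq] at hr; rw [← hr]; exact h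
  | cons i is ih =>
    intro F l m F' h hr
    have e : run H (i :: is) F = @Option.casesOn Fm (fun _ => Option (List Fm)) (step H F i) none
      (fun f => run H is (f :: F)) := rfl
    rw [e] at hr
    cases hs : step H F i with
    | none => rw [hs] at hr; simp at hr
    | some f =>
      rw [hs] at hr
      exact ih (EncL.cons (step_ok hH h i hs) h) hr
end

/-! ### Programs and the cell checker -/

/-- The base program: `b2, c2, a1, a2` and the constraint. -/
def PB : List Ins :=
  [.cst K40, .inv 3, .log 3, .mul 5 0, .exp 0, .log 5, .mul 8 0, .exp 0, .sub 7 3,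
  .sub 8 1, .log 1, .mul 9 0, .exp 0, .log 3, .mul 12 0, .exp 0, .add 17 16, .sub 4 1, .log 1,
  .log 1, .mul 22 1, .exp 0, .sub 24 21, .mul 0 3, .exp 0, .mul 0 7, .add 4 0, .sub 0 26]

/-- The critical point equation. -/
def PE : List Ins :=
  [.inv 29, .mul 24 0, .inv 17, .mul 22 0, .inv 32, .mul 25 0, .inv 18, .mul 25 0, .sub 16 17,
  .mul 14 0, .exp 0, .mul 9 3, .mul 8 6, .sub 41 42, .add 2 1, .mul 1 0, .sub 12 8, .sub 1 0,
  .mul 30 5, .mul 34 7, .add 1 0, .mul 19 15, .mul 33 0, .sub 2 0, .mul 13 0, .sub 7 0]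

/-- Comparison with the axis lattice. -/
def P2 : List Ins :=
  [.mul 29 12, .mul 29 16, .add 1 0, .add 0 0, .log 0, .mul 35 0, .exp 0, .cst K41,
  .log 0, .mul 39 0, .exp 0, .add 4 38, .sub 0 1]

/-- Comparison with the diagonal lattice. -/
def P3 : List Ins :=
  [.mul 29 12, .mul 29 16, .add 1 0, .cst K41, .log 0, .mul 35 0, .exp 0, .add 2 2,
  .mul 34 0, .exp 0, .mul 7 0, .add 0 38, .log 0, .mul 43 0, .exp 0, .sub 4 42, .log 0,
  .mul 47 0, .exp 0, .add 4 0, .add 13 13, .sub 1 0]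

/-- The test near the diagonal. -/
def P4 : List Ins :=
  [.sub 5 27, .sub 9 10, .sub 27 18, .sub 16 25, .mul 3 2, .exp 0, .mul 5 3, .exp 0, .mul 7 4,
  .exp 0, .mul 15 8, .exp 0, .exp 9, .mul 0 0, .mul 44 11, .exp 0, .sub 43 8, .mul 4 5,
  .add 45 0, .mul 2 0, .sub 47 6, .mul 20 15, .mul 0 1, .sub 3 0, .mul 53 12, .add 40 0,
  .mul 54 0, .mul 19 17, .sub 55 0, .mul 2 0, .mul 0 6, .mul 61 60, .mul 22 15, .mul 1 0,
  .sub 61 18, .mul 34 50, .mul 0 1, .add 3 0, .mul 32 30, .sub 66 0, .sub 67 28, .mul 0 51,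
  .mul 4 2, .mul 1 0, .sub 13 0]

/-- The test near the axis. -/
def PN : List Ins :=
  [.cst K40, .inv 3, .log 3, .mul 5 0, .exp 0, .log 5, .mul 8 0, .exp 0, .sub 7 3,
  .sub 8 1, .log 1, .mul 9 0, .exp 0, .log 3, .mul 12 0, .exp 0, .add 17 16, .inv 4, .inv 2,
  .inv 20, .inv 20, .mul 16 1, .mul 13 4, .mul 15 2, .mul 14 5, .mul 3 0, .mul 3 2, .mul 11 0,
  .mul 15 2, .add 1 0, .mul 8 6, .mul 14 0, .sub 2 0, .inv 8, .mul 10 0, .sub 37 34, .sub 0 35,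
  .mul 14 19, .mul 0 3, .mul 3 0, .inv 23, .mul 6 0, .log 0, .mul 7 0, .log 47, .mul 8 0,
  .add 2 0, .exp 0, .mul 0 15, .add 23 22, .sub 0 10, .sub 0 2]

/-- Comparison with the diagonal lattice near the axis. -/
def PX : List Ins :=
  [.cst K40, .inv 3, .log 3, .mul 5 0, .exp 0, .log 5, .mul 8 0, .exp 0, .sub 7 3,
  .sub 8 1, .log 1, .mul 9 0, .exp 0, .log 3, .mul 12 0, .exp 0, .mul 17 0, .mul 17 4,
  .add 1 0, .cst K41, .log 0, .mul 23 0, .exp 0, .add 2 2, .mul 22 0, .exp 0,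
  .mul 7 0, .add 0 26, .log 0, .mul 31 0, .exp 0, .sub 4 30, .log 0, .mul 35 0, .exp 0,
  .add 4 0, .add 13 13, .sub 1 0]

/-- Forces a form. -/
def mkf {α : Type} (f : Fm) (k : Fm → α) : α :=
  @Fm.casesOn (fun _ => α) f (fun c rc rv s0 s1 s2 => k ⟨c, rc, rv, s0, s1, s2⟩)

lemma mkf_eq {α : Type} (f : Fm) (k : Fm → α) : mkf f k = k f := by
  cases f; rfl

/-- The input environment. -/
def inp {α : Type} (H : Hs) (pc bc cc k1 k2 : Int) (rest : List Fm) (k : List Fm → α) : α :=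
  mkf (mkN H ⟨pc, 0⟩ ⟨K40, 0⟩ ⟨0, 0⟩ ⟨0, 0⟩) fun f =>
  mkf (mkN H ⟨bc, 0⟩ ⟨0, 0⟩ ⟨K40, 0⟩ ⟨0, 0⟩) fun g =>
  mkf (mkN H ⟨cc, 0⟩ ⟨k1, 0⟩ ⟨k2, 0⟩ ⟨K40, 0⟩) fun h =>
  k (h :: g :: f :: rest)

def tpos (f : Fm) : Bool := Nat.blt f.rv f.c.toNat

/-- Is the output of the program certainly positive? -/
def posT (H : Hs) (is : List Ins) (l : List Fm) : Bool :=
  match run H is l with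
  | none => false
  | some l => tpos (lk l 0)

def phiT (H : Hs) (f : Fm) : Bool :=
  Nat.blt (Nat.add (Nat.mul (Nat.add (Int.natAbs f.c) f.rc) K40)
    (Nat.add (Nat.mul f.s0.mag H.h0) (Nat.mul f.s1.mag H.h1)))
    (Nat.mul (Nat.sub f.s2.m.toNat f.s2.r) H.h2)

/-- Sign test for the critical point equation. -/
def neT (H : Hs) (is : List Ins) (l : List Fm) : Bool :=
  match run H is l with
  | none => false
  | some l => Nat.blt (lk l 0).rv (Int.natAbs (lk l 0).c)

def discT (f : Fm) : Bool := Nat.ble K40 (Nat.mul 2 (Nat.sub f.c.toNat f.rv))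

def leafT (H : Hs) (t : Nat) (l : List Fm) : Bool :=
  match Nat.beq t 2 with
  | true => discT (lk l 20)
  | false => match Nat.beq t 3 with
    | true => neT H PE l
    | false => match Nat.beq t 4 with
      | true => posT H P2 l
      | false => match Nat.beq t 5 with
        | true => posT H P3 l
        | false => posT H P4 l

/-- An ordinary cell. -/
def cellT (t : Nat) (pc hp bc hb cc : Nat) (k1 k2 : Int) (eta : Nat) : Bool :=
  inp ⟨hp, hb, eta⟩ (Int.ofNat pc) (Int.ofNat bc) (Int.ofNat cc) k1 k2 [] fun l =>
  match run ⟨hp, hb, eta⟩ PB l with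
  | none => false
  | some l => phiT ⟨hp, hb, eta⟩ (lk l 0) && leafT ⟨hp, hb, eta⟩ t l

/-- A cell next to the axis. -/
def axisT (t : Nat) (pc hp bc hb d0 eta : Nat) : Bool :=
  inp ⟨hp, hb, eta⟩ (Int.ofNat pc) (Int.ofNat bc) (Int.subNatNat K40 (Nat.add bc eta))
    0 (-K40) [Fm.cst (Int.ofNat d0)] fun l =>
  match Nat.beq t 7 with
  | true => posT ⟨hp, hb, eta⟩ PN l
  | false => posT ⟨hp, hb, eta⟩ PX l

/-- Reads the data of a leaf, checks the leaf and returns the remaining data. -/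
def leafD (t pl ph bl bh d : Nat) : Option Nat :=
  frn (Nat.div (Nat.add pl ph) 2) fun pc => frn (Nat.sub ph pc) fun hp =>
  frn (Nat.div (Nat.add bl bh) 2) fun bc => frn (Nat.sub bh bc) fun hb =>
  match Nat.ble 7 t with
  | true =>
    frn (Nat.sub K40 (Nat.mul 2 bl)) fun d0 =>
    frn (Nat.add (Nat.div (Nat.mul d0 d0) K41) 1) fun eta =>
    match axisT t pc hp bc hb d0 eta with
    | true => some d
    | false => none
  | false =>
    frn (Nat.mul (Nat.mod d 16777216) 65536) fun cc => frn (Nat.div d 16777216) fun d =>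
    frc (Int.mul (Int.subNatNat (Nat.mod d 65536) 32768) 268435456) fun k1 =>
    frn (Nat.div d 65536) fun d =>
    frc (Int.mul (Int.subNatNat (Nat.mod d 65536) 32768) 268435456) fun k2 =>
    frn (Nat.div d 65536) fun d =>
    frn (Nat.mul (Nat.mod d 16777216) 65536) fun eta => frn (Nat.div d 16777216) fun d =>
    match cellT t pc hp bc hb cc k1 k2 eta with
    | true => some d
    | false => none

/-- The tree of cells, packed into a number. -/
def tree : Nat → Nat → Nat → Nat → Nat → Nat → Option Nat
  | 0, _, _, _, _, _ => none
  | n + 1, pl, ph, bl, bh, d =>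
    frn (Nat.mod d 16) fun t => frn (Nat.div d 16) fun d =>
    match Nat.beq t 0 with
    | true => frn (Nat.div (Nat.add pl ph) 2) fun m =>
      match tree n pl m bl bh d with
      | none => none
      | some d => tree n m ph bl bh d
    | false => match Nat.beq t 1 with
      | true => frn (Nat.div (Nat.add bl bh) 2) fun m =>
        match tree n pl ph bl m d with
        | none => none
        | some d => tree n pl ph m bh d
      | false => leafD t pl ph bl bh d

def okT (x : Option Nat) : Bool :=
  match x with
  | none => false
  | some _ => true

/-! ### Soundness of the cell checker -/

/-- The arguments of logarithms and reciprocals are positive. -/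
def okR (l : List ℝ) : Ins → Prop
  | .log i => 0 < l.getD i 0
  | .inv i => 0 < l.getD i 0
  | _ => True

def Val : List Ins → List ℝ → Prop
  | [], _ => True
  | i :: is, l => okR l i ∧ Val is (stepR l i :: l)

lemma pos_of_be {c : Int} {r : Nat} {u : ℝ} (h : BE ⟨c, r⟩ u) (hc : Nat.ble c.toNat r = false) :
    0 < u := by
  have h1 := abs_le.1 h
  simp only at h1
  have h2 : r < c.toNat := by
    by_contra hh
    rw [Nat.ble_eq_true_of_le (not_lt.1 hh)] at hc
    simp at hc
  have h3 : ((c.toNat : ℕ) : ℝ) = (c : ℝ) := by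
    have : ((c.toNat : ℕ) : ℤ) = c := Int.toNat_of_nonneg (by omega)
    exact_mod_cast this
  have h4 : (r : ℝ) < (c.toNat : ℝ) := by exact_mod_cast h2
  nlinarith [h1.1]

lemma step_val {H : Hs} {d0 d1 d2 : ℝ} {F : List Fm} {l m : List ℝ}
    (h : EncL d0 d1 d2 F l m) (i : Ins) {f : Fm} (hf : step H F i = some f) :
    okR l i ∧ okR m i := by
  cases i with
  | cst n => exact ⟨trivial, trivial⟩
  | add i j => exact ⟨trivial, trivial⟩
  | sub i j => exact ⟨trivial, trivial⟩
  | mul i j => exact ⟨trivial, trivial⟩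
  | exp i => exact ⟨trivial, trivial⟩
  | log i =>
    simp only [step, Fm.log, frn_eq] at hf
    cases hc : (Nat.ble (lk F i).c.toNat (lk F i).rc || Nat.ble (lk F i).c.toNat (lk F i).rv) with
    | true => rw [hc] at hf; simp at hf
    | false =>
      simp only [Bool.or_eq_false_iff] at hc
      exact ⟨pos_of_be (h i).hu hc.1, pos_of_be (h i).hv hc.2⟩
  | inv i =>
    simp only [step, Fm.inv, frn_eq] at hf
    cases hc : (Nat.ble (lk F i).c.toNat (lk F i).rc || Nat.ble (lk F i).c.toNat (lk F i).rv) with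
    | true => rw [hc] at hf; simp at hf
    | false =>
      simp only [Bool.or_eq_false_iff] at hc
      exact ⟨pos_of_be (h i).hu hc.1, pos_of_be (h i).hv hc.2⟩

lemma run_val {H : Hs} {d0 d1 d2 : ℝ} (hH : HB H d0 d1 d2) (is : List Ins) : ∀ {F : List Fm}
    {l m : List ℝ} {F' : List Fm}, EncL d0 d1 d2 F l m → run H is F = some F' →
    Val is l ∧ Val is m := by
  induction is with
  | nil => intro F l m F' h hr; exact ⟨trivial, trivial⟩
  | cons i is ih =>
    intro F l m F' h hr
    have e : run H (i :: is) F = @Option.casesOn Fm (fun _ => Option (List Fm)) (step H F i) none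
      (fun f => run H is (f :: F)) := rfl
    rw [e] at hr
    cases hs : step H F i with
    | none => rw [hs] at hr; simp at hr
    | some f =>
      rw [hs] at hr
      have h1 := ih (EncL.cons (step_ok hH h i hs) h) hr
      have h2 := step_val h i hs
      exact ⟨⟨h2.1, h1.1⟩, ⟨h2.2, h1.2⟩⟩

/-- The value of a program. -/
def val (is : List Ins) (l : List ℝ) : ℝ := (runR is l).getD 0 0

lemma blt_lt {a b : Nat} (h : Nat.blt a b = true) : a < b := Nat.le_of_ble_eq_true h

lemma tpos_ok {d0 d1 d2 : ℝ} {f : Fm} {u v : ℝ} (h : Enc d0 d1 d2 f u v) (ht : tpos f = true) : 0 < v := by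
  have h1 := blt_lt ht
  refine pos_of_be h.hv ?_
  cases hc : Nat.ble f.c.toNat f.rv with
  | false => rfl
  | true => have := Nat.le_of_ble_eq_true hc; omega

lemma posT_ok {H : Hs} {d0 d1 d2 : ℝ} (hH : HB H d0 d1 d2) {is : List Ins} {F : List Fm}
    {l m : List ℝ} (h : EncL d0 d1 d2 F l m) (ht : posT H is F = true) : 0 < val is m ∧ Val is m := by
  unfold posT at ht
  cases hr : run H is F with
  | none => rw [hr] at ht; simp at ht
  | some F' =>
    rw [hr] at ht
    exact ⟨tpos_ok (run_ok hH is h hr 0) ht, (run_val hH is h hr).2⟩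

lemma neT_ok {H : Hs} {d0 d1 d2 : ℝ} (hH : HB H d0 d1 d2) {is : List Ins} {F : List Fm}
    {l m : List ℝ} (h : EncL d0 d1 d2 F l m) (ht : neT H is F = true) : val is m ≠ 0 := by
  unfold neT at ht
  cases hr : run H is F with
  | none => rw [hr] at ht; simp at ht
  | some F' =>
    rw [hr] at ht
    have h1 := run_ok hH is h hr 0
    have h2 := blt_lt ht
    have h3 := h1.hv
    intro h0
    have h0' : (runR is m).getD 0 0 = 0 := h0
    rw [h0'] at h3
    unfold BE at h3
    simp only [zero_mul, zero_sub, abs_neg] at h3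
    rw [← natAbs_cast'] at h3
    have h4 : (lk F' 0).c.natAbs ≤ (lk F' 0).rv := by exact_mod_cast h3
    omega

lemma discT_ok {d0 d1 d2 : ℝ} {f : Fm} {u v : ℝ} (h : Enc d0 d1 d2 f u v) (ht : discT f = true) :
    1 / 2 ≤ v := by
  have h1 : K40 ≤ 2 * (f.c.toNat - f.rv) := Nat.le_of_ble_eq_true ht
  have h2 := abs_le.1 h.hv
  simp only at h2
  have h3 : (f.c.toNat : ℤ) = f.c := by omega
  have h4 : (K40 : ℤ) ≤ 2 * (f.c - f.rv) := by omega
  have h5 : (K40 : ℝ) ≤ 2 * ((f.c : ℝ) - (f.rv : ℝ)) := by exact_mod_cast h4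
  linarith [h2.1]

/-- The constraint test: at a displacement with third component `± eta`. -/
lemma phiT_ok {H : Hs} {d0 d1 d2 : ℝ} (hH : HB H d0 d1 d2) {f : Fm} {u v : ℝ}
    (h : Enc d0 d1 d2 f u v) (ht : phiT H f = true) (hd : |d2| * K40 = H.h2) :
    0 < v * d2 := by
  have h1 := blt_lt ht
  obtain ⟨s0, s1, s2, e0, e1, e2, e⟩ := h.hs
  have hu := h.hu
  have q0 := e0.mag
  have q1 := e1.mag
  have g0 : ((f.c.natAbs + f.rc : ℕ) : ℝ) * K40 + ((f.s0.mag : ℝ) * H.h0 + (f.s1.mag : ℝ) * H.h1)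
      < (((f.s2.m.toNat - f.s2.r : ℕ)) : ℝ) * H.h2 := by exact_mod_cast h1
  have g1 : f.s2.r < f.s2.m.toNat := by
    by_contra hh
    have : Nat.sub f.s2.m.toNat f.s2.r = 0 := Nat.sub_eq_zero_of_le (not_lt.1 hh)
    rw [this] at h1
    simp at h1
  have g2 : (((f.s2.m.toNat - f.s2.r : ℕ)) : ℝ) = (f.s2.m : ℝ) - f.s2.r := by
    have : (((f.s2.m.toNat - f.s2.r : ℕ)) : ℤ) = f.s2.m - f.s2.r := by omega
    exact_mod_cast this
  have g3 : (f.s2.m : ℝ) - f.s2.r ≤ s2 * K40 := by linarith [(abs_le.1 e2).1]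
  have g4 : |u| * K40 ≤ ((f.c.natAbs + f.rc : ℕ) : ℝ) := by
    have := BE.mag hu
    exact_mod_cast this
  have k0 : |s0 * d0| * (K40 * K40) ≤ (f.s0.mag : ℝ) * H.h0 := by
    rw [abs_mul]
    have := mul_le_mul q0 hH.h0 (by positivity) (by positivity)
    linarith
  have k1 : |s1 * d1| * (K40 * K40) ≤ (f.s1.mag : ℝ) * H.h1 := by
    rw [abs_mul]
    have := mul_le_mul q1 hH.h1 (by positivity) (by positivity)
    linarith
  have k2 : ((f.s2.m : ℝ) - f.s2.r) * H.h2 ≤ s2 * |d2| * (K40 * K40) := by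
    rw [← hd]
    have : 0 ≤ |d2| * K40 := by positivity
    have := mul_le_mul_of_nonneg_right g3 this
    linarith
  rw [g2] at g0
  have k3 : |u| + |s0 * d0| + |s1 * d1| < s2 * |d2| := by
    have : (|u| + |s0 * d0| + |s1 * d1|) * (K40 * K40)
        < s2 * |d2| * (K40 * K40) := by nlinarith
    exact lt_of_mul_lt_mul_right this (by norm_num)
  have e' : v = u + s0 * d0 + s1 * d1 + s2 * d2 := by linarith
  rcases lt_trichotomy d2 0 with hn | hz | hp
  · rw [abs_of_neg hn] at k3
    have : v < 0 := by
      linarith [le_abs_self u, le_abs_self (s0 * d0), le_abs_self (s1 * d1)]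
    exact mul_pos_of_neg_of_neg this hn
  · rw [hz] at k3
    simp at k3
    linarith [abs_nonneg u, abs_nonneg s0, abs_nonneg s1, abs_nonneg (s0 * d0),
      abs_nonneg (s1 * d1), mul_nonneg (abs_nonneg s0) (abs_nonneg d0),
      mul_nonneg (abs_nonneg s1) (abs_nonneg d1)]
  · rw [abs_of_pos hp] at k3
    have : 0 < v := by
      linarith [neg_abs_le u, neg_abs_le (s0 * d0), neg_abs_le (s1 * d1)]
    exact mul_pos this hp

/-! ### Soundness of the tree -/

lemma be_exact (n : Int) : BE ⟨n, 0⟩ ((n : ℝ) / K40) := by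
  unfold BE
  rw [div_mul_cancel₀ _ (by norm_num)]
  simp

lemma inp_eq {α : Type} (H : Hs) (pc bc cc k1 k2 : Int) (rest : List Fm) (k : List Fm → α) :
    inp H pc bc cc k1 k2 rest k = k (mkN H ⟨cc, 0⟩ ⟨k1, 0⟩ ⟨k2, 0⟩ ⟨K40, 0⟩ ::
      mkN H ⟨bc, 0⟩ ⟨0, 0⟩ ⟨K40, 0⟩ ⟨0, 0⟩ ::
      mkN H ⟨pc, 0⟩ ⟨K40, 0⟩ ⟨0, 0⟩ ⟨0, 0⟩ :: rest) := by
  simp only [inp, mkf_eq]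

lemma inp_enc {H : Hs} {d0 d1 d2 : ℝ} (hH : HB H d0 d1 d2) {pc bc cc k1 k2 : Int} {p b c : ℝ}
    (hp : p = (pc : ℝ) / K40 + d0) (hb : b = (bc : ℝ) / K40 + d1)
    (hc : c = (cc : ℝ) / K40 + (k1 : ℝ) / K40 * d0
      + (k2 : ℝ) / K40 * d1 + d2) {F : List Fm} {l m : List ℝ}
    (h : EncL d0 d1 d2 F l m) :
    EncL d0 d1 d2 (mkN H ⟨cc, 0⟩ ⟨k1, 0⟩ ⟨k2, 0⟩ ⟨K40, 0⟩ ::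
      mkN H ⟨bc, 0⟩ ⟨0, 0⟩ ⟨K40, 0⟩ ⟨0, 0⟩ ::
      mkN H ⟨pc, 0⟩ ⟨K40, 0⟩ ⟨0, 0⟩ ⟨0, 0⟩ :: F)
      ((cc : ℝ) / K40 :: (bc : ℝ) / K40 :: (pc : ℝ) / K40 :: l)
      (c :: b :: p :: m) := by
  have z : BE ⟨0, 0⟩ 0 := by simp [BE]
  have o : BE ⟨K40, 0⟩ 1 := by simp [BE]
  refine EncL.cons (mkN_ok hH (be_exact _) (be_exact _) (be_exact _) o ?_)
    (EncL.cons (mkN_ok hH (be_exact _) z o z ?_) (EncL.cons (mkN_ok hH (be_exact _) o z z ?_) h))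
  · rw [hc]; ring
  · rw [hb]; ring
  · rw [hp]; ring

/-- The information on a point that the checker uses. -/
structure Pt (p b c : ℝ) : Prop where
  le : b + c ≤ 1
  ge : 1 - b - c ≤ (1 - 2 * b) ^ 2
  b_lt : b < 1 / 2
  phiU : ∀ c', c' < c → Val PB [c', b, p] → val PB [c', b, p] ≤ 0
  phiL : ∀ c', c < c' → Val PB [c', b, p] → 0 ≤ val PB [c', b, p]

/-- One of the tests succeeded at the point. -/
def Kil (p b c : ℝ) : Prop :=
  (Val PB [c, b, p] ∧ (1 / 2 ≤ (runR PB [c, b, p]).getD 20 0 ∨ val PE (runR PB [c, b, p]) ≠ 0 ∨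
    0 < val P2 (runR PB [c, b, p]) ∨ 0 < val P3 (runR PB [c, b, p]) ∨
    0 < val P4 (runR PB [c, b, p]))) ∨
  (∃ d0, 1 - 2 * b ≤ d0 ∧ 0 < val PN [c, b, p, d0]) ∨ 0 < val PX [c, b, p]

lemma leafT_ok {H : Hs} {d0 d1 d2 : ℝ} (hH : HB H d0 d1 d2) {t : Nat} {F : List Fm}
    {l m : List ℝ} (h : EncL d0 d1 d2 F l m) (ht : leafT H t F = true) :
    1 / 2 ≤ m.getD 20 0 ∨ val PE m ≠ 0 ∨ 0 < val P2 m ∨ 0 < val P3 m ∨ 0 < val P4 m := by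
  unfold leafT at ht
  cases e2 : Nat.beq t 2 with
  | true => rw [e2] at ht; exact Or.inl (discT_ok (h 20) ht)
  | false =>
    rw [e2] at ht
    cases e3 : Nat.beq t 3 with
    | true => rw [e3] at ht; exact Or.inr (Or.inl (neT_ok hH h ht))
    | false =>
      rw [e3] at ht
      cases e4 : Nat.beq t 4 with
      | true => rw [e4] at ht; exact Or.inr (Or.inr (Or.inl (posT_ok hH h ht).1))
      | false =>
        rw [e4] at ht
        cases e5 : Nat.beq t 5 with
        | true => rw [e5] at ht; exact Or.inr (Or.inr (Or.inr (Or.inl (posT_ok hH h ht).1)))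
        | false => rw [e5] at ht; exact Or.inr (Or.inr (Or.inr (Or.inr (posT_ok hH h ht).1)))

lemma cellT_ok {t pc hp bc hb cc : Nat} {k1 k2 : Int} {eta : Nat} {p b c : ℝ}
    (ht : cellT t pc hp bc hb cc k1 k2 eta = true)
    (hP : |p - (pc : ℝ) / K40| * K40 ≤ hp)
    (hB : |b - (bc : ℝ) / K40| * K40 ≤ hb) (pt : Pt p b c) : Kil p b c := by
  unfold cellT at ht
  rw [inp_eq] at ht
  have K0 : (0 : ℝ) < K40 := by norm_num
  obtain ⟨d0, h0⟩ : ∃ d0, d0 = p - (pc : ℝ) / K40 := ⟨_, rfl⟩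
  obtain ⟨d1, h1⟩ : ∃ d1, d1 = b - (bc : ℝ) / K40 := ⟨_, rfl⟩
  obtain ⟨r, hr⟩ : ∃ r, r = (cc : ℝ) / K40 + (k1 : ℝ) / K40 * d0
      + (k2 : ℝ) / K40 * d1 := ⟨_, rfl⟩
  rw [← h0] at hP
  rw [← h1] at hB
  have key : ∀ d2 c', c' = r + d2 → |d2| * K40 ≤ (eta : ℝ) →
      HB ⟨hp, hb, eta⟩ d0 d1 d2 ∧
      EncL d0 d1 d2 _ _ [c', b, p] := fun d2 c' hc' hd =>
    ⟨⟨hP, hB, hd⟩, inp_enc (pc := Int.ofNat pc) (bc := Int.ofNat bc) (cc := Int.ofNat cc)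
      (k1 := k1) (k2 := k2) (⟨hP, hB, hd⟩ : HB ⟨hp, hb, eta⟩ d0 d1 d2)
      (by rw [h0]; simp) (by rw [h1]; simp) (by rw [hc', hr]; simp) (EncL.nil d0 d1 d2)⟩
  cases hrun : run ⟨hp, hb, eta⟩ PB (mkN ⟨hp, hb, eta⟩ ⟨Int.ofNat cc, 0⟩ ⟨k1, 0⟩ ⟨k2, 0⟩
      ⟨K40, 0⟩ ::
      mkN ⟨hp, hb, eta⟩ ⟨Int.ofNat bc, 0⟩ ⟨0, 0⟩ ⟨K40, 0⟩ ⟨0, 0⟩ ::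
      mkN ⟨hp, hb, eta⟩ ⟨Int.ofNat pc, 0⟩ ⟨K40, 0⟩ ⟨0, 0⟩ ⟨0, 0⟩ :: []) with
  | none => rw [hrun] at ht; simp at ht
  | some F =>
    rw [hrun] at ht
    simp only [Bool.and_eq_true] at ht
    obtain ⟨hphi, hleaf⟩ := ht
    have e0 : (0 : ℝ) ≤ eta := by positivity
    have sgn : ∀ d2 : ℝ, |d2| * K40 = eta → 0 < val PB [r + d2, b, p] * d2 ∧
        Val PB [r + d2, b, p] := by
      intro d2 hd
      obtain ⟨hH, hE⟩ := key d2 (r + d2) rfl hd.le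
      exact ⟨phiT_ok hH (run_ok hH PB hE hrun 0) hphi hd, (run_val hH PB hE hrun).2⟩
    have hc : |c - r| * K40 ≤ eta := by
      by_contra hcon
      push Not at hcon
      rcases le_total 0 (c - r) with hs | hs
      · rw [abs_of_nonneg hs] at hcon
        have hd : |(eta : ℝ) / K40| * K40 = eta := by
          rw [abs_of_nonneg (by positivity), div_mul_cancel₀ _ K0.ne']
        obtain ⟨s1, s2⟩ := sgn _ hd
        have hlt : r + (eta : ℝ) / K40 < c := by
          have : (eta : ℝ) / K40 < c - r := by rw [div_lt_iff₀ K0]; exact hcon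
          linarith
        have := pt.phiU _ hlt s2
        have hnn : (0 : ℝ) ≤ (eta : ℝ) / K40 := by positivity
        linarith [mul_nonneg_of_nonpos_of_nonpos this (neg_nonpos.2 hnn)]
      · rw [abs_of_nonpos hs] at hcon
        have hd : |-((eta : ℝ) / K40)| * K40 = eta := by
          rw [abs_neg, abs_of_nonneg (by positivity), div_mul_cancel₀ _ K0.ne']
        obtain ⟨s1, s2⟩ := sgn _ hd
        have hlt : c < r + -((eta : ℝ) / K40) := by
          have : (eta : ℝ) / K40 < -(c - r) := by rw [div_lt_iff₀ K0]; exact hcon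
          linarith
        have := pt.phiL _ hlt s2
        have hnn : (0 : ℝ) ≤ (eta : ℝ) / K40 := by positivity
        linarith [mul_nonneg this hnn]
    obtain ⟨hH, hE⟩ := key (c - r) c (by ring) hc
    exact Or.inl ⟨(run_val hH PB hE hrun).2, leafT_ok hH (run_ok hH PB hE hrun) hleaf⟩

lemma axisT_ok {t pc hp bc hb d e : Nat} {p b c : ℝ}
    (ht : axisT t pc hp bc hb d e = true)
    (hP : |p - (pc : ℝ) / K40| * K40 ≤ hp)
    (hB : |b - (bc : ℝ) / K40| * K40 ≤ hb)
    (hd : 1 - 2 * b ≤ (d : ℝ) / K40)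
    (he : ((d : ℝ) / K40) ^ 2 * K40 ≤ 2 * e) (pt : Pt p b c) : Kil p b c := by
  unfold axisT at ht
  rw [inp_eq] at ht
  have hcc : (((Int.subNatNat K40 (Nat.add bc e) : ℤ)) : ℝ) = K40 - (bc + e) := by
    rw [Int.subNatNat_eq_coe]; simp only [Nat.add_eq]; push_cast; ring
  have hd2 : |c - (1 - b - (e : ℝ) / K40)| * K40 ≤ e := by
    have q1 := pt.ge
    have q2 : (1 - 2 * b) ^ 2 ≤ ((d : ℝ) / K40) ^ 2 :=
      pow_le_pow_left₀ (by linarith [pt.b_lt]) hd 2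
    have q3 := pt.le
    have q4 : (1 - b - c) * K40 ≤ 2 * e := by
      refine le_trans ?_ he
      exact mul_le_mul_of_nonneg_right (q1.trans q2) (by norm_num)
    have q5 : (e : ℝ) / K40 * K40 = e := div_mul_cancel₀ _ (by norm_num)
    rcases abs_cases (c - (1 - b - (e : ℝ) / K40)) with h | h <;> rw [h.1] <;> nlinarith
  have hH : HB ⟨hp, hb, e⟩ (p - (pc : ℝ) / K40) (b - (bc : ℝ) / K40)
      (c - (1 - b - (e : ℝ) / K40)) := ⟨hP, hB, hd2⟩
  have hE := inp_enc (pc := Int.ofNat pc) (bc := Int.ofNat bc)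
      (cc := Int.subNatNat K40 (Nat.add bc e)) (k1 := 0) (k2 := -K40) hH
      (p := p) (b := b) (c := c) (by simp) (by simp) (by rw [hcc]; push_cast; ring)
      (EncL.cons (Enc.cst _ _ _ (Int.ofNat d)) (EncL.nil _ _ _))
  cases e7 : Nat.beq t 7 with
  | true =>
    rw [e7] at ht
    refine Or.inr (Or.inl ⟨(d : ℝ) / K40, hd, ?_⟩)
    simpa using (posT_ok hH hE ht).1
  | false =>
    rw [e7] at ht
    refine Or.inr (Or.inr ?_)
    have hE' := inp_enc (pc := Int.ofNat pc) (bc := Int.ofNat bc)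
      (cc := Int.subNatNat K40 (Nat.add bc e)) (k1 := 0) (k2 := -K40) hH
      (p := p) (b := b) (c := c) (by simp) (by simp) (by rw [hcc]; push_cast; ring)
      (EncL.nil _ _ _)
    have h1 := (posT_ok hH hE ht).1
    have h2 : val PX [c, b, p, (((Int.ofNat d : ℤ)) : ℝ) / K40] = val PX [c, b, p] := by
      simp [val, PX, runR, stepR]
    rwa [h2] at h1

lemma mid_ok {l h : Nat} {x : ℝ} (h1 : (l : ℝ) ≤ x * K40)
    (h2 : x * K40 ≤ h) : |x - ((Nat.div (Nat.add l h) 2 : Nat) : ℝ) / K40|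
      * K40 ≤ ((Nat.sub h (Nat.div (Nat.add l h) 2) : Nat) : ℝ) := by
  have hlh : l ≤ h := by exact_mod_cast h1.trans h2
  obtain ⟨m, hm⟩ : ∃ m, m = (l + h) / 2 := ⟨_, rfl⟩
  have e1 : Nat.div (Nat.add l h) 2 = m := hm.symm
  rw [e1]
  have e2 : Nat.sub h m = h - m := rfl
  rw [e2]
  have e3 : m ≤ h := by omega
  rw [Nat.cast_sub e3]
  have e4 : 2 * m ≤ l + h := by omega
  have e5 : (2 : ℝ) * m ≤ l + h := by exact_mod_cast e4
  have e6 : |x - (m : ℝ) / K40| * K40 = |x * K40 - m| := by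
    rw [← abs_of_pos (show (0 : ℝ) < K40 by norm_num), ← abs_mul, sub_mul,
      abs_of_pos (show (0 : ℝ) < K40 by norm_num), div_mul_cancel₀ _ (by norm_num)]
  rw [e6, abs_le]
  constructor <;> linarith

lemma natsub_le (a b : Nat) : (a : ℝ) - b ≤ ((Nat.sub a b : Nat) : ℝ) := by
  have h1 : (a : ℤ) - b ≤ ((a - b : Nat) : ℤ) := by omega
  exact_mod_cast h1

lemma natmul_two (b : Nat) : ((Nat.mul 2 b : Nat) : ℝ) = 2 * b := by
  simp only [Nat.mul_eq]; push_cast; ring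

lemma eta_ok (d0 : Nat) : ((d0 : ℝ) / K40) ^ 2 * K40 ≤
    2 * ((Nat.add (Nat.div (Nat.mul d0 d0) K41) 1 : Nat) : ℝ) := by
  have := ndiv_up (Nat.mul d0 d0) K41 (by norm_num)
  have e2 : ((Nat.add (Nat.div (Nat.mul d0 d0) K41) 1 : Nat) : ℝ) =
    ((Nat.div (Nat.mul d0 d0) K41 : Nat) : ℝ) + 1 := by
    generalize Nat.div (Nat.mul d0 d0) K41 = x
    simp only [Nat.add_eq]; push_cast; ring
  have e3 : ((Nat.mul d0 d0 : Nat) : ℝ) = d0 * d0 := by simp only [Nat.mul_eq]; push_cast; ring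
  rw [e3] at this
  rw [e2]
  have e : ((d0 : ℝ) / K40) ^ 2 * K40 = 2 * ((d0 : ℝ) * d0 / K41) := by
    ring
  rw [e]
  push_cast at this
  linarith

lemma dz_ok {bl : ℕ} {b : ℝ} (hb1 : (bl : ℝ) ≤ b * K40) :
    1 - 2 * b ≤ ((Nat.sub K40 (Nat.mul 2 bl) : Nat) : ℝ) / K40 := by
  have h2 := natsub_le K40 (Nat.mul 2 bl)
  generalize Nat.sub K40 (Nat.mul 2 bl) = x at h2 ⊢
  rw [natmul_two] at h2
  rw [le_div_iff₀ (by norm_num)]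
  push_cast at h2
  linarith

lemma leafD_ok {t pl ph bl bh d d' : Nat} {p b c : ℝ} (ht : leafD t pl ph bl bh d = some d')
    (hp1 : (pl : ℝ) ≤ p * K40) (hp2 : p * K40 ≤ ph)
    (hb1 : (bl : ℝ) ≤ b * K40) (hb2 : b * K40 ≤ bh) (pt : Pt p b c) :
    Kil p b c := by
  unfold leafD at ht
  rw [frn_eq, frn_eq, frn_eq, frn_eq] at ht
  cases e7 : Nat.ble 7 t with
  | true =>
    rw [e7] at ht
    have hd := dz_ok hb1
    generalize Nat.sub K40 (Nat.mul 2 bl) = d0 at ht hd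
    replace ht := (frn_eq _ _).symm.trans ht
    replace ht := (frn_eq _ _).symm.trans ht
    have he := eta_ok d0
    generalize Nat.add (Nat.div (Nat.mul d0 d0) K41) 1 = eta at ht he
    generalize hx : axisT _ _ _ _ _ _ _ = x at ht
    cases x with
    | false => simp at ht
    | true => exact axisT_ok hx (mid_ok hp1 hp2) (mid_ok hb1 hb2) hd he pt
  | false =>
    rw [e7] at ht
    replace ht := (frn_eq _ _).symm.trans ht
    replace ht := (frn_eq _ _).symm.trans ht
    replace ht := (frc_eq _ _).symm.trans ht
    replace ht := (frn_eq _ _).symm.trans ht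
    replace ht := (frc_eq _ _).symm.trans ht
    replace ht := (frn_eq _ _).symm.trans ht
    replace ht := (frn_eq _ _).symm.trans ht
    replace ht := (frn_eq _ _).symm.trans ht
    generalize hx : cellT _ _ _ _ _ _ _ _ _ = x at ht
    cases x with
    | false => simp at ht
    | true => exact cellT_ok hx (mid_ok hp1 hp2) (mid_ok hb1 hb2) pt

lemma tree_ok (n : Nat) : ∀ {pl ph bl bh d d' : Nat} {p b c : ℝ},
    tree n pl ph bl bh d = some d' →
    (pl : ℝ) ≤ p * K40 → p * K40 ≤ ph →
    (bl : ℝ) ≤ b * K40 → b * K40 ≤ bh → Pt p b c → Kil p b c := by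
  induction n with
  | zero => intro pl ph bl bh d d' p b c h; simp [tree] at h
  | succ n ih =>
    intro pl ph bl bh d d' p b c ht hp1 hp2 hb1 hb2 pt
    simp only [tree, frn_eq] at ht
    cases e0 : Nat.beq (Nat.mod d 16) 0 with
    | true =>
      rw [e0] at ht
      simp only at ht
      split at ht
      case h_1 => exact absurd ht (by simp)
      case h_2 d1 hd1 =>
        rcases le_total (p * K40) ((Nat.div (Nat.add pl ph) 2 : Nat) : ℝ) with h | h
        · exact ih hd1 hp1 h hb1 hb2 pt
        · exact ih ht h hp2 hb1 hb2 pt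
    | false =>
      rw [e0] at ht
      simp only at ht
      cases e1 : Nat.beq (Nat.mod d 16) 1 with
      | true =>
        rw [e1] at ht
        simp only at ht
        split at ht
        case h_1 => exact absurd ht (by simp)
        case h_2 d1 hd1 =>
          rcases le_total (b * K40) ((Nat.div (Nat.add bl bh) 2 : Nat) : ℝ) with h | h
          · exact ih hd1 hp1 hp2 hb1 h pt
          · exact ih ht hp1 hp2 h hb2 pt
      | false =>
        rw [e1] at ht
        simp only at ht
        exact leafD_ok ht hp1 hp2 hb1 hb2 pt

section
open Real

/-! ### Interpretation of the programs -/

lemma runR_step {i : Ins} {is : List Ins} {l : List ℝ} (x : ℝ) (h : stepR l i = x) :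
    runR (i :: is) l = runR is (x :: l) := by
  rw [← h]; rfl

lemma runR_tr {i : Ins} {is : List Ins} {l R : List ℝ} (x : ℝ) (h : stepR l i = x)
    (h2 : runR is (x :: l) = R) : runR (i :: is) l = R := (runR_step x h).trans h2

lemma exp_mul_log {x : ℝ} (hx : 0 < x) (y : ℝ) : exp (y * log x) = x ^ y := by
  rw [rpow_def_of_pos hx, mul_comm]

/-- The output of the base program. -/
def outB (p b c b2 c2 a1 a2 : ℝ) : List ℝ :=
  [a1 ^ p + a2 ^ p - 1, a1 ^ p + a2 ^ p, a2 ^ p, a2 ^ (p - 1), (p - 1) * log a2, p - 1, a1 ^ p,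
    p * log a1, log a2, log a1, a2, a1, c2, p⁻¹ * log (1 - c ^ p), log (1 - c ^ p), b2,
    p⁻¹ * log (1 - b ^ p), log (1 - b ^ p), 1 - c ^ p, 1 - b ^ p, c ^ p, p * log c, log c,
    b ^ p, p * log b, log b, p⁻¹, 1, c, b, p]

lemma cst_one : (((K40 : ℤ)) : ℝ) / K40 = 1 := by norm_num

lemma cst_two : (((K41 : ℤ)) : ℝ) / K40 = 2 := by norm_num

lemma PB_value {p b c : ℝ} (hb : 0 < b) (hc : 0 < c) (h1 : 0 < 1 - b ^ p)
    (h2 : 0 < 1 - c ^ p) (h3 : 0 < (1 - b ^ p) ^ p⁻¹ - (1 - c ^ p) ^ p⁻¹) :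
    runR PB [c, b, p] = outB p b c ((1 - b ^ p) ^ p⁻¹) ((1 - c ^ p) ^ p⁻¹) (b + c)
      ((1 - b ^ p) ^ p⁻¹ - (1 - c ^ p) ^ p⁻¹) := by
  have ha : 0 < b + c := by linarith
  unfold PB
  refine runR_tr 1 (by exact cst_one) ?_
  refine runR_tr p⁻¹ rfl ?_
  refine runR_tr (log b) rfl ?_
  refine runR_tr (p * log b) rfl ?_
  refine runR_tr (b ^ p) (by exact (exp_mul_log hb p)) ?_
  refine runR_tr (log c) rfl ?_
  refine runR_tr (p * log c) rfl ?_
  refine runR_tr (c ^ p) (by exact (exp_mul_log hc p)) ?_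
  refine runR_tr (1 - b ^ p) rfl ?_
  refine runR_tr (1 - c ^ p) rfl ?_
  refine runR_tr (log (1 - b ^ p)) rfl ?_
  refine runR_tr (p⁻¹ * log (1 - b ^ p)) rfl ?_
  refine runR_tr ((1 - b ^ p) ^ p⁻¹) (by exact (exp_mul_log h1 _)) ?_
  refine runR_tr (log (1 - c ^ p)) rfl ?_
  refine runR_tr (p⁻¹ * log (1 - c ^ p)) rfl ?_
  refine runR_tr ((1 - c ^ p) ^ p⁻¹) (by exact (exp_mul_log h2 _)) ?_
  refine runR_tr (b + c) rfl ?_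
  refine runR_tr ((1 - b ^ p) ^ p⁻¹ - (1 - c ^ p) ^ p⁻¹) rfl ?_
  refine runR_tr (log (b + c)) rfl ?_
  refine runR_tr (log ((1 - b ^ p) ^ p⁻¹ - (1 - c ^ p) ^ p⁻¹)) rfl ?_
  refine runR_tr (p * log (b + c)) rfl ?_
  refine runR_tr ((b + c) ^ p) (by exact (exp_mul_log ha _)) ?_
  refine runR_tr (p - 1) rfl ?_
  refine runR_tr ((p - 1) * log ((1 - b ^ p) ^ p⁻¹ - (1 - c ^ p) ^ p⁻¹)) rfl ?_
  refine runR_tr (((1 - b ^ p) ^ p⁻¹ - (1 - c ^ p) ^ p⁻¹) ^ (p - 1))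
    (by exact (exp_mul_log h3 _)) ?_
  refine runR_tr (((1 - b ^ p) ^ p⁻¹ - (1 - c ^ p) ^ p⁻¹) ^ p) ?_ ?_
  · show ((1 - b ^ p) ^ p⁻¹ - (1 - c ^ p) ^ p⁻¹) ^ (p - 1) *
      ((1 - b ^ p) ^ p⁻¹ - (1 - c ^ p) ^ p⁻¹) = _
    rw [← rpow_add_one h3.ne']; ring_nf
  refine runR_tr _ rfl ?_
  refine runR_tr _ rfl ?_
  rfl

lemma PB_val {p b c : ℝ} (h : Val PB [c, b, p]) : 0 < b ∧ 0 < c ∧ 0 < 1 - b ^ p ∧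
    0 < 1 - c ^ p ∧ 0 < (1 - b ^ p) ^ p⁻¹ - (1 - c ^ p) ^ p⁻¹ := by
  unfold PB at h
  obtain ⟨-, -, hb, -, -, hc, -, -, -, -, h1, -, -, h2, -, -, -, -, -, h3, -⟩ := h
  have hb : 0 < b := hb
  have hc : 0 < c := hc
  replace h1 : 0 < (((K40 : ℤ)) : ℝ) / K40 - exp (p * log b) := h1
  replace h2 : 0 < (((K40 : ℤ)) : ℝ) / K40 - exp (p * log c) := h2
  replace h3 : 0 < exp (p⁻¹ * log ((((K40 : ℤ)) : ℝ) / K40 - exp (p * log b)))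
    - exp (p⁻¹ * log ((((K40 : ℤ)) : ℝ) / K40 - exp (p * log c))) := h3
  rw [cst_one] at h1 h2 h3
  rw [exp_mul_log hb] at h1 h3
  rw [exp_mul_log hc] at h2 h3
  rw [exp_mul_log h1, exp_mul_log h2] at h3
  exact ⟨hb, hc, h1, h2, h3⟩

variable {p a1 a2 b c b2 c2 : ℝ}

lemma Strict.pos (h : Strict p a1 a2 b b2 c c2) : 0 < a2 ∧ 0 < b ∧ 0 < c ∧ 0 < c2 ∧ 0 < b2 ∧ 0 < a1 := by
  obtain ⟨h1, h2, h3, h4, h5, h6, -⟩ := h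
  refine ⟨h1, ?_, ?_, ?_, ?_, ?_⟩ <;> linarith

lemma root_eq {p x y : ℝ} (hp : 1 < p) (hx : 0 ≤ x) (h : x ^ p = y) : y ^ p⁻¹ = x := by
  rw [← h, ← rpow_mul hx, mul_inv_cancel₀ (by linarith), rpow_one]

lemma Strict.b2_root (hp : 1 < p) (h : Strict p a1 a2 b b2 c c2) : (1 - b ^ p) ^ p⁻¹ = b2 :=
  root_eq hp h.pos.2.2.2.2.1.le (by linarith [h.nb])

lemma Strict.c2_root (hp : 1 < p) (h : Strict p a1 a2 b b2 c c2) : (1 - c ^ p) ^ p⁻¹ = c2 :=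
  root_eq hp h.pos.2.2.2.1.le (by linarith [h.nc])

lemma Strict.PB (hp : 1 < p) (h : Strict p a1 a2 b b2 c c2) :
    runR PB [c, b, p] = outB p b c b2 c2 a1 a2 := by
  obtain ⟨pa, pb, pc, pc2, pb2, pa1⟩ := h.pos
  have n1 : 0 < b2 ^ p := by positivity
  have n2 : 0 < c2 ^ p := by positivity
  have e := PB_value (p := p) pb pc (by linarith [h.nb]) (by linarith [h.nc])
    (by rw [h.b2_root hp, h.c2_root hp]; linarith [h.c2_lt])
  rw [e, h.b2_root hp, h.c2_root hp]
  have e1 : b + c = a1 := by linarith [h.a1_eq]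
  have e2 : b2 - c2 = a2 := by linarith [h.b2_eq]
  rw [e1, e2]

lemma val_PB {p b c : ℝ} (h : Val PB [c, b, p]) : val PB [c, b, p] =
    (b + c) ^ p + ((1 - b ^ p) ^ p⁻¹ - (1 - c ^ p) ^ p⁻¹) ^ p - 1 := by
  obtain ⟨h1, h2, h3, h4, h5⟩ := PB_val h
  unfold val
  rw [PB_value h1 h2 h3 h4 h5]
  rfl

lemma Strict.lt_one (hp : 1 < p) (h : Strict p a1 a2 b b2 c c2) : a1 < 1 := by
  obtain ⟨pa, pb, pc, pc2, pb2, pa1⟩ := h.pos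
  refine lt_of_rpow hp zero_le_one ?_
  have : 0 < a2 ^ p := by positivity
  rw [one_rpow]; linarith [h.na]

/-- `a2 ≤ (c1/c2)^(p-1) (c1-b1)`. -/
lemma Strict.a2_le (hp : 1 < p) (h : Strict p a1 a2 b b2 c c2) :
    a2 * c2 ^ (p - 1) ≤ c ^ (p - 1) * (c - b) := by
  obtain ⟨pa, pb, pc, pc2, pb2, pa1⟩ := h.pos
  have t1 := tangent_le (x := b2) (y := c2) hp pb2.le pc2
  have t2 := tangent_le (x := b) (y := c) hp pb.le pc
  have e2 : b2 - c2 = a2 := by linarith [h.b2_eq]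
  rw [e2] at t1
  have := h.nb
  have := h.nc
  have : 0 < p := by linarith
  have : p * (a2 * c2 ^ (p - 1)) ≤ p * (c ^ (p - 1) * (c - b)) := by linarith
  exact le_of_mul_le_mul_left this (by assumption)

lemma Strict.pt (hp : 2 ≤ p) (h : Strict p a1 a2 b b2 c c2) : Pt p b c := by
  have hp1 : 1 < p := by linarith
  obtain ⟨pa, pb, pc, pc2, pb2, pa1⟩ := h.pos
  have l1 := h.lt_one hp1
  have ea := h.a1_eq
  have hb := h.b1_lt
  have eb : b2 - c2 = a2 := by linarith [h.b2_eq]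
  refine ⟨by linarith, ?_, by linarith, ?_, ?_⟩
  · -- a2 ≤ c - b, and 1 - a1 ≤ a2^2
    have h1 := h.a2_le hp1
    have h2 : c ^ (p - 1) ≤ c2 ^ (p - 1) := rpow_le_rpow pc.le h.c_lt.le (by linarith)
    have h3 : 0 < c2 ^ (p - 1) := by positivity
    have h4 : a2 ≤ c - b := by
      have : a2 * c2 ^ (p - 1) ≤ (c - b) * c2 ^ (p - 1) := by
        have := mul_le_mul_of_nonneg_left h2 (by linarith : 0 ≤ c - b)
        linarith
      exact le_of_mul_le_mul_right this h3
    have h5 : a2 ^ p ≤ a2 ^ (2:ℝ) := by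
      refine rpow_le_rpow_of_exponent_ge pa ?_ hp
      linarith
    have h6 : a1 ^ p ≤ a1 ^ (1:ℝ) := rpow_le_rpow_of_exponent_ge pa1 l1.le (by linarith)
    rw [rpow_one] at h6
    rw [rpow_two] at h5
    have h7 := h.na
    have h8 : a2 ^ 2 ≤ (1 - 2 * b) ^ 2 := pow_le_pow_left₀ pa.le (by linarith) 2
    linarith
  · intro c' hc' hv
    rw [val_PB hv]
    obtain ⟨v1, v2, v3, v4, v5⟩ := PB_val hv
    rw [h.b2_root hp1] at v5 ⊢
    have e1 : (b + c') ^ p ≤ a1 ^ p := rpow_le_rpow (by linarith) (by linarith) (by linarith)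
    have e2 : c2 ≤ (1 - c' ^ p) ^ p⁻¹ := by
      rw [← h.c2_root hp1]
      have n2 : 0 < c2 ^ p := by positivity
      refine rpow_le_rpow (by linarith [h.nc]) ?_ (by positivity)
      have := rpow_le_rpow v2.le hc'.le (by linarith : 0 ≤ p)
      linarith
    have e3 : (b2 - (1 - c' ^ p) ^ p⁻¹) ^ p ≤ a2 ^ p :=
      rpow_le_rpow v5.le (by linarith) (by linarith)
    linarith [h.na]
  · intro c' hc' hv
    rw [val_PB hv]
    obtain ⟨v1, v2, v3, v4, v5⟩ := PB_val hv
    rw [h.b2_root hp1] at v5 ⊢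
    have e1 : a1 ^ p ≤ (b + c') ^ p := rpow_le_rpow (by linarith) (by linarith) (by linarith)
    have e2 : (1 - c' ^ p) ^ p⁻¹ ≤ c2 := by
      rw [← h.c2_root hp1]
      refine rpow_le_rpow v4.le ?_ (by positivity)
      have := rpow_le_rpow pc.le hc'.le (by linarith : 0 ≤ p)
      linarith
    have e3 : a2 ^ p ≤ (b2 - (1 - c' ^ p) ^ p⁻¹) ^ p :=
      rpow_le_rpow pa.le (by linarith) (by linarith)
    linarith [h.na]
end

section
open Real

variable {p a1 a2 b c b2 c2 : ℝ}

lemma Strict.det (h : Strict p a1 a2 b b2 c c2) : a1 * b2 - a2 * b = b * c2 + c * b2 := by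
  have e1 := h.a1_eq
  have e2 := h.b2_eq
  have e3 : a2 = b2 - c2 := by linarith
  rw [e1, e3]; ring

lemma P2_val : val P2 (outB p b c b2 c2 a1 a2) =
    exp (p * log ((b * c2 + c * b2) + (b * c2 + c * b2))) + 1
      - exp (p * log ((((K41 : ℤ)) : ℝ) / K40)) := rfl

lemma Strict.P2_le (hp : 1 < p) (h : Strict p a1 a2 b b2 c c2)
    (hd : a1 * b2 - a2 * b ≤ delta0 p) : val P2 (outB p b c b2 c2 a1 a2) ≤ 0 := by
  obtain ⟨pa, pb, pc, pc2, pb2, pa1⟩ := h.pos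
  rw [h.det] at hd
  rw [P2_val, cst_two, exp_mul_log (by positivity), exp_mul_log (by norm_num)]
  have h1 : ((b * c2 + c * b2) + (b * c2 + c * b2)) ^ p ≤ (2 * delta0 p) ^ p :=
    rpow_le_rpow (by positivity) (by linarith) (by linarith)
  rw [mul_rpow (by norm_num) (delta0_pos hp).le, delta0_pow hp, mul_sub, mul_one,
    ← mul_rpow (by norm_num) (by norm_num)] at h1
  norm_num at h1
  linarith

/-- The function of `T = D 4^(1/p)` used for comparison with the diagonal lattice. -/
def fT (p D : ℝ) : ℝ :=
  (D * 4 ^ p⁻¹ + 1) ^ p + (D * 4 ^ p⁻¹ - 1) ^ p - 2 * 2 ^ p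

lemma delta1_T {τ : ℝ} : delta1 p τ * 4 ^ p⁻¹ = (1 + τ) / (1 - τ) := by
  unfold delta1
  have : (4 : ℝ) ^ (-1 / p) * 4 ^ p⁻¹ = 1 := by
    rw [← rpow_add (by norm_num)]
    have : -1 / p + p⁻¹ = 0 := by ring
    rw [this, rpow_zero]
  calc _ = ((4 : ℝ) ^ (-1 / p) * 4 ^ p⁻¹) * ((1 + τ) / (1 - τ)) := by ring
    _ = _ := by rw [this, one_mul]

lemma fT_delta1 {τ : ℝ} (ht : IsTau p τ) : fT p (delta1 p τ) = 0 := by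
  obtain ⟨t0, t1, e⟩ := ht
  have h1 : 0 < 1 - τ := by linarith
  unfold fT
  rw [delta1_T]
  have e1 : (1 + τ) / (1 - τ) + 1 = 2 / (1 - τ) := by field_simp; ring
  have e2 : (1 + τ) / (1 - τ) - 1 = 2 * τ / (1 - τ) := by field_simp; ring
  rw [e1, e2, div_rpow (by norm_num) h1.le, div_rpow (by positivity) h1.le,
    mul_rpow (by norm_num) t0]
  have h2 : 0 < (1 - τ) ^ p := by positivity
  field_simp
  linear_combination (-(2:ℝ)^p) * e

lemma fT_mono {p D E : ℝ} (hp : 1 < p) (h1 : 1 ≤ D * 4 ^ p⁻¹) (h : D ≤ E) : fT p D ≤ fT p E := by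
  unfold fT
  have h2 : D * 4 ^ p⁻¹ ≤ E * 4 ^ p⁻¹ := mul_le_mul_of_nonneg_right h (by positivity)
  have h3 : (D * 4 ^ p⁻¹ + 1) ^ p ≤ (E * 4 ^ p⁻¹ + 1) ^ p :=
    rpow_le_rpow (by linarith) (by linarith) (by linarith)
  have h4 : (D * 4 ^ p⁻¹ - 1) ^ p ≤ (E * 4 ^ p⁻¹ - 1) ^ p :=
    rpow_le_rpow (by linarith) (by linarith) (by linarith)
  linarith

lemma Strict.T_gt (hp : 1 < p) (h : Strict p a1 a2 b b2 c c2) :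
    1 < (b * c2 + c * b2) * 4 ^ p⁻¹ := by
  obtain ⟨pa, pb, pc, pc2, pb2, pa1⟩ := h.pos
  obtain ⟨w, hw⟩ : ∃ w : ℝ, w = (1 / 2) ^ p⁻¹ := ⟨_, rfl⟩
  have w0 : 0 < w := by rw [hw]; positivity
  have wp : w ^ p = 1 / 2 := by
    rw [hw, ← rpow_mul (by norm_num), inv_mul_cancel₀ (by linarith), rpow_one]
  have k1 : w < c2 := by
    refine lt_of_rpow hp pc2.le ?_
    have := rpow_lt' hp pc.le h.c_lt
    linarith [h.nc]
  have k2 : w < b2 := by linarith [h.c2_lt]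
  have k3 : w < a1 := by linarith [h.b2_lt]
  have w4 : w * w * 4 ^ p⁻¹ = 1 := by
    rw [hw, ← mul_rpow (by norm_num) (by norm_num), ← mul_rpow (by norm_num) (by norm_num)]
    norm_num
  rw [← w4]
  refine mul_lt_mul_of_pos_right ?_ (by positivity)
  have := h.a1_eq
  have m1 := mul_lt_mul_of_pos_left k1 pb
  have m2 := mul_lt_mul_of_pos_left k2 pc
  have m3 := mul_lt_mul_of_pos_left k3 w0
  rw [this] at m3
  linarith

lemma Strict.fT_le (hp : 1 < p) (h : Strict p a1 a2 b b2 c c2) {τ : ℝ} (ht : IsTau p τ)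
    (hd : a1 * b2 - a2 * b ≤ delta1 p τ) : fT p (b * c2 + c * b2) ≤ 0 := by
  rw [h.det] at hd
  have := fT_mono hp (h.T_gt hp).le hd
  rwa [fT_delta1 ht] at this

lemma T_value {T' : ℝ} {k D one two : ℝ} (h1 : one = 1) (h2 : two = 2) (hk : k = p⁻¹)
    (hT : T' = D * exp (k * (log two + log two))) (hT1 : 1 < D * 4 ^ p⁻¹) :
    exp (p * log (T' + one)) + exp (p * log (T' - one)) -
      (exp (p * log two) + exp (p * log two)) = fT p D := by
  subst h1 h2 hk
  have e : exp (p⁻¹ * (log 2 + log 2)) = 4 ^ p⁻¹ := by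
    rw [← log_mul (by norm_num) (by norm_num), exp_mul_log (by norm_num)]; norm_num
  rw [e] at hT
  subst hT
  rw [exp_mul_log (by linarith), exp_mul_log (by linarith), exp_mul_log (by norm_num)]
  unfold fT
  ring

lemma P3_val : val P3 (outB p b c b2 c2 a1 a2) =
    exp (p * log ((b * c2 + c * b2) * exp (p⁻¹ *
      (log ((((K41 : ℤ)) : ℝ) / K40) +
       log ((((K41 : ℤ)) : ℝ) / K40))) + 1)) +
    exp (p * log ((b * c2 + c * b2) * exp (p⁻¹ *
      (log ((((K41 : ℤ)) : ℝ) / K40) +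
       log ((((K41 : ℤ)) : ℝ) / K40))) - 1)) -
    (exp (p * log ((((K41 : ℤ)) : ℝ) / K40)) +
      exp (p * log ((((K41 : ℤ)) : ℝ) / K40))) := rfl

lemma Strict.P3_le (hp : 1 < p) (h : Strict p a1 a2 b b2 c c2) {τ : ℝ} (ht : IsTau p τ)
    (hd : a1 * b2 - a2 * b ≤ delta1 p τ) : val P3 (outB p b c b2 c2 a1 a2) ≤ 0 := by
  rw [P3_val, T_value rfl cst_two rfl rfl (h.T_gt hp)]
  exact h.fT_le hp ht hd

lemma PX_val {one two be ga b2 c2 : ℝ} (h1 : one = (((K40 : ℤ)) : ℝ) / K40)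
    (h2 : two = (((K41 : ℤ)) : ℝ) / K40)
    (h3 : be = exp (p * log b)) (h4 : ga = exp (p * log c))
    (h5 : b2 = exp (p⁻¹ * log (one - be))) (h6 : c2 = exp (p⁻¹ * log (one - ga))) :
    val PX [c, b, p] =
    exp (p * log ((b * c2 + c * b2) * exp (p⁻¹ * (log two + log two)) + one)) +
    exp (p * log ((b * c2 + c * b2) * exp (p⁻¹ * (log two + log two)) - one)) -
    (exp (p * log two) + exp (p * log two)) := by
  subst h5 h6
  subst h3 h4
  subst h1 h2
  rfl

lemma Strict.raw (hp : 1 < p) (h : Strict p a1 a2 b b2 c c2) :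
    b2 = exp (p⁻¹ * log ((((K40 : ℤ)) : ℝ) / K40 - b ^ p)) ∧
    c2 = exp (p⁻¹ * log ((((K40 : ℤ)) : ℝ) / K40 - c ^ p)) := by
  obtain ⟨pa, pb, pc, pc2, pb2, pa1⟩ := h.pos
  have n1 : 0 < b2 ^ p := by positivity
  have n2 : 0 < c2 ^ p := by positivity
  have n3 := h.nb
  have n4 := h.nc
  rw [cst_one, exp_mul_log (by linarith), exp_mul_log (by linarith)]
  exact ⟨(h.b2_root hp).symm, (h.c2_root hp).symm⟩

lemma Strict.PX_le (hp : 1 < p) (h : Strict p a1 a2 b b2 c c2) {τ : ℝ} (ht : IsTau p τ)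
    (hd : a1 * b2 - a2 * b ≤ delta1 p τ) : val PX [c, b, p] ≤ 0 := by
  obtain ⟨pa, pb, pc, pc2, pb2, pa1⟩ := h.pos
  rw [PX_val rfl rfl (exp_mul_log pb p).symm (exp_mul_log pc p).symm (h.raw hp).1 (h.raw hp).2,
    T_value cst_one cst_two rfl rfl (h.T_gt hp)]
  exact h.fT_le hp ht hd

/-! ### The critical point equation -/

/-- `E` in terms of the powers. -/
def EE (b c b2 c2 a1 B1 B2 C1 C2 X : ℝ) : ℝ :=
  (c - b) * (B1 * C2 + B2 * C1) - (B2 - C2)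
    - X * (c2 * (B2 * C1) + b2 * (B1 * C2) - a1 * (B1 * C1))

lemma PE_val : val PE (outB p b c b2 c2 a1 a2) =
    EE b c b2 c2 a1 (b ^ p * b⁻¹) ((1 - b ^ p) * b2⁻¹) (c ^ p * c⁻¹) ((1 - c ^ p) * c2⁻¹)
      (exp ((p - 1) * (log a2 - log a1))) := rfl

lemma pow_inv {x p : ℝ} (hx : 0 < x) : x ^ p * x⁻¹ = x ^ (p - 1) := by
  rw [rpow_sub_one hx.ne', div_eq_mul_inv]

/-- The equation coming from criticality. -/
def EqE (p a1 a2 b b2 c c2 : ℝ) : Prop :=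
  (a1^(p-1)*c2^(p-1)+a2^(p-1)*c^(p-1))*(a1*b^(p-1)+a2*b2^(p-1)) =
      (b^(p-1)*c2^(p-1)+b2^(p-1)*c^(p-1))*(b*a1^(p-1)+b2*a2^(p-1))

lemma Strict.EE_zero (h : Strict p a1 a2 b b2 c c2) (E : EqE p a1 a2 b b2 c c2) :
    EE b c b2 c2 a1 (b ^ (p-1)) (b2 ^ (p-1)) (c ^ (p-1)) (c2 ^ (p-1)) ((a2 / a1) ^ (p - 1)) = 0 := by
  obtain ⟨pa, pb, pc, pc2, pb2, pa1⟩ := h.pos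
  have pw : ∀ {x : ℝ}, 0 < x → x * x ^ (p - 1) = x ^ p := by
    intro x hx; rw [rpow_sub_one hx.ne']; field_simp
  have hb : b * b ^ (p-1) + b2 * b2 ^ (p-1) = 1 := by rw [pw pb, pw pb2]; exact h.nb
  have hc : c * c ^ (p-1) + c2 * c2 ^ (p-1) = 1 := by rw [pw pc, pw pc2]; exact h.nc
  have E' : (c2^(p-1)+(a2 / a1)^(p-1)*c^(p-1))*(a1*b^(p-1)+a2*b2^(p-1)) =
      (b^(p-1)*c2^(p-1)+b2^(p-1)*c^(p-1))*(b+b2*(a2/a1)^(p-1)) := by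
    rw [div_rpow pa.le pa1.le]
    have : 0 < a1 ^ (p - 1) := by positivity
    unfold EqE at E
    field_simp
    linarith
  have e1 := h.a1_eq
  have e2 : a2 = b2 - c2 := by linarith [h.b2_eq]
  generalize (a2 / a1) ^ (p - 1) = X at *
  generalize b ^ (p - 1) = B1 at *
  generalize b2 ^ (p - 1) = B2 at *
  generalize c ^ (p - 1) = C1 at *
  generalize c2 ^ (p - 1) = C2 at *
  unfold EE
  rw [e1, e2] at E'
  rw [e1]
  linear_combination E' - C2 * hb + B2 * hc

lemma Strict.PE_zero (h : Strict p a1 a2 b b2 c c2) (E : EqE p a1 a2 b b2 c c2) :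
    val PE (outB p b c b2 c2 a1 a2) = 0 := by
  obtain ⟨pa, pb, pc, pc2, pb2, pa1⟩ := h.pos
  have n3 := h.nb
  have n4 := h.nc
  have e1 : 1 - b ^ p = b2 ^ p := by linarith
  have e2 : 1 - c ^ p = c2 ^ p := by linarith
  have e3 : exp ((p - 1) * (log a2 - log a1)) = (a2 / a1) ^ (p - 1) := by
    rw [← log_div pa.ne' pa1.ne', exp_mul_log (by positivity)]
  rw [PE_val, e1, e2, e3, pow_inv pb, pow_inv pb2, pow_inv pc, pow_inv pc2]
  exact h.EE_zero E

/-! ### The test near the axis -/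

def NN (p a1 b2 c2 B1 B2 C1 C2 q q1 d0 : ℝ) : ℝ :=
  (B1 * C2 + B2 * C1) - q * ((B2 * b2⁻¹) * (C1 * C2⁻¹))
    - exp (q * log ((C1 * C2⁻¹) * a1⁻¹) + q1 * log d0) *
      (c2 * (B2 * C1) + b2 * (B1 * C2) - a1 * (B1 * C1))

lemma PN_val {one be ga b2 c2 d0 : ℝ}
    (h1 : one = (((K40 : ℤ)) : ℝ) / K40)
    (h3 : be = exp (p * log b)) (h4 : ga = exp (p * log c))
    (h5 : b2 = exp (p⁻¹ * log (one - be))) (h6 : c2 = exp (p⁻¹ * log (one - ga))) :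
    val PN [c, b, p, d0] = NN p (b + c) b2 c2 (be * b⁻¹) ((one - be) * b2⁻¹) (ga * c⁻¹)
      ((one - ga) * c2⁻¹) (p - one) (p - one - one) d0 := by
  subst h5 h6
  subst h3 h4
  subst h1
  rfl

lemma Strict.PN_le (hp : 2 ≤ p) (h : Strict p a1 a2 b b2 c c2) (E : EqE p a1 a2 b b2 c c2)
    {d0 : ℝ} (hd : 1 - 2 * b ≤ d0) : val PN [c, b, p, d0] ≤ 0 := by
  have hp1 : 1 < p := by linarith
  obtain ⟨pa, pb, pc, pc2, pb2, pa1⟩ := h.pos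
  have n3 := h.nb
  have n4 := h.nc
  have l1 := h.lt_one hp1
  have ea := h.a1_eq
  have hbc := h.b1_lt
  have hc2 := h.c_lt
  have hb2 := h.c2_lt
  have e1 : 1 - b ^ p = b2 ^ p := by linarith
  have e2 : 1 - c ^ p = c2 ^ p := by linarith
  have ea2 : b2 - c2 = a2 := by linarith [h.b2_eq]
  have dpos : 0 < d0 := by linarith
  have dle : c - b ≤ d0 := by linarith
  rw [PN_val rfl (exp_mul_log pb p).symm (exp_mul_log pc p).symm (h.raw hp1).1 (h.raw hp1).2,
    cst_one, e1, e2, pow_inv pb, pow_inv pb2, pow_inv pc, pow_inv pc2, ← ea]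
  have hE := h.EE_zero E
  have f1 : b2 ^ (p-1) - c2 ^ (p-1) ≤ (p - 1) * (b2 ^ (p-1) * b2⁻¹) * a2 := by
    rcases hp.eq_or_lt with h2 | h2
    · rw [← h2]; norm_num; field_simp; linarith
    · have := tangent_le (p := p - 1) (x := c2) (y := b2) (by linarith) pc2.le pb2
      rw [pow_inv pb2, ← ea2]
      linarith
  have f2 : a2 ≤ (c ^ (p-1) * (c2 ^ (p-1))⁻¹) * (c - b) := by
    have := h.a2_le hp1
    have h0 : 0 < c2 ^ (p - 1) := by positivity
    calc a2 = (a2 * c2 ^ (p-1)) * (c2 ^ (p-1))⁻¹ := by field_simp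
      _ ≤ (c ^ (p - 1) * (c - b)) * (c2 ^ (p-1))⁻¹ := by gcongr
      _ = _ := by ring
  have dd : 0 < c - b := by linarith
  have f3 : (a2 / a1) ^ (p - 1) ≤
      exp ((p - 1) * log ((c ^ (p-1) * (c2 ^ (p-1))⁻¹) * a1⁻¹) + (p - 1 - 1) * log d0) * (c - b) := by
    rw [exp_add, exp_mul_log (by positivity), exp_mul_log dpos]
    have g1 : a2 / a1 ≤ ((c ^ (p-1) * (c2 ^ (p-1))⁻¹) * a1⁻¹) * (c - b) := by
      rw [div_eq_mul_inv]
      calc a2 * a1⁻¹ ≤ ((c ^ (p-1) * (c2 ^ (p-1))⁻¹) * (c - b)) * a1⁻¹ := by gcongr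
        _ = _ := by ring
    have g2 := rpow_le_rpow (by positivity) g1 (by linarith : 0 ≤ p - 1)
    rw [mul_rpow (by positivity) dd.le] at g2
    have g3 : (c - b) ^ (p - 1) ≤ d0 ^ (p - 1 - 1) * (c - b) := by
      have : (c - b) ^ (p - 1) = (c - b) ^ (p - 1 - 1) * (c - b) := by
        rw [rpow_sub_one dd.ne' (p - 1)]; field_simp
      rw [this]
      gcongr
      linarith
    have g4 := mul_le_mul_of_nonneg_left g3 (by positivity :
      0 ≤ ((c ^ (p-1) * (c2 ^ (p-1))⁻¹) * a1⁻¹) ^ (p - 1))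
    linarith
  have hC : c ^ (p-1) ≤ c2 ^ (p-1) := rpow_le_rpow pc.le hc2.le (by linarith)
  have hB : b ^ (p-1) ≤ b2 ^ (p-1) := rpow_le_rpow pb.le (by linarith) (by linarith)
  have pB1 : 0 < b ^ (p-1) := by positivity
  have pC1 : 0 < c ^ (p-1) := by positivity
  have pB2 : 0 < b2 ^ (p-1) := by positivity
  have pC2 : 0 < c2 ^ (p-1) := by positivity
  unfold NN
  generalize exp ((p - 1) * log ((c ^ (p-1) * (c2 ^ (p-1))⁻¹) * a1⁻¹) + (p - 1 - 1) * log d0) = Y at *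
  generalize (a2 / a1) ^ (p - 1) = X at *
  unfold EE at hE
  generalize b ^ (p - 1) = B1 at *
  generalize b2 ^ (p - 1) = B2 at *
  generalize c ^ (p - 1) = C1 at *
  generalize c2 ^ (p - 1) = C2 at *
  have hM : 0 ≤ c2 * (B2 * C1) + b2 * (B1 * C2) - a1 * (B1 * C1) := by
    have m1 : b * B1 ≤ c2 * B2 := mul_le_mul (by linarith) hB pB1.le pc2.le
    have m2 : c * C1 ≤ b2 * C2 := mul_le_mul (by linarith) hC pC1.le pb2.le
    have m3 := mul_le_mul_of_nonneg_left m1 pC1.le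
    have m4 := mul_le_mul_of_nonneg_left m2 pB1.le
    rw [ea]
    linarith
  generalize c2 * (B2 * C1) + b2 * (B1 * C2) - a1 * (B1 * C1) = M at *
  have k1 : (p - 1) * (B2 * b2⁻¹) * a2 ≤ (p - 1) * (B2 * b2⁻¹) * (C1 * C2⁻¹ * (c - b)) := by
    have : 0 ≤ p - 1 := by linarith
    gcongr
  have k2 := mul_le_mul_of_nonneg_right f3 hM
  by_contra hcon
  push Not at hcon
  have := mul_pos hcon dd
  linarith

lemma outB_disc : (outB p b c b2 c2 a1 a2).getD 20 0 = c ^ p := rfl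
end

section
open Real

variable {p a1 a2 b c b2 c2 : ℝ}

/-! ### The critical point equation in multiplicative form -/

lemma Strict.starA (h : Strict p a1 a2 b b2 c c2) (E : EqE p a1 a2 b b2 c c2)
    {x y z : ℝ} (hx : x = a2 / a1) (hy : y = b / b2) (hz : z = c2 / c) :
    (1 - x ^ (p - 2) * y ^ (p - 2)) * (x * z * (1 - y ^ 2 * y ^ (p - 2)) * (z ^ (p - 2) - 1)
      + x * y * (z ^ 2 * z ^ (p - 2) - 1) * (1 - y ^ (p - 2))) =
    (1 - y ^ (p - 2) * z ^ (p - 2)) * (y * z * (1 - x ^ 2 * x ^ (p - 2)) * (1 - y ^ (p - 2))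
      - x * z * (1 - y ^ 2 * y ^ (p - 2)) * (1 - x ^ (p - 2))) := by
  obtain ⟨pa, pb, pc, pc2, pb2, pa1⟩ := h.pos
  have x0 : 0 < x := by rw [hx]; positivity
  have y0 : 0 < y := by rw [hy]; positivity
  have z0 : 0 < z := by rw [hz]; positivity
  have ex : a2 = x * a1 := by rw [hx]; field_simp
  have ey : b = y * b2 := by rw [hy]; field_simp
  have ez : c2 = z * c := by rw [hz]; field_simp
  have pw : ∀ {t : ℝ}, 0 < t → t ^ (p - 1) = t * t ^ (p - 2) := by
    intro t ht
    rw [show p - 2 = (p - 1) - 1 by ring, rpow_sub_one ht.ne' (p - 1)]; field_simp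
  have l1 := h.a1_eq
  have l2 := h.b2_eq
  unfold EqE at E
  rw [ex, ey, ez, mul_rpow x0.le pa1.le, mul_rpow y0.le pb2.le, mul_rpow z0.le pc.le,
    pw x0, pw y0, pw z0] at E
  rw [ey] at l1
  rw [ex, ez] at l2
  have gA : 0 < a1 ^ (p - 1) := by positivity
  have gB : 0 < b2 ^ (p - 1) := by positivity
  have gC : 0 < c ^ (p - 1) := by positivity
  generalize x ^ (p - 2) = u at *
  generalize y ^ (p - 2) = v at *
  generalize z ^ (p - 2) = w at *
  generalize a1 ^ (p - 1) = A at *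
  generalize b2 ^ (p - 1) = B at *
  generalize c ^ (p - 1) = C at *
  have E1 : (z * w + x * u) * (a1 * (y * v) + x * a1) = (y * v * (z * w) + 1) * (y * b2 + b2 * (x * u)) := by
    apply mul_left_cancel₀ (mul_pos (mul_pos gA gB) gC).ne'
    linear_combination E
  have d1 : a1 * (1 - x * y) = (1 + y * z) * c := by linear_combination l1 + y * l2
  have d2 : b2 * (1 - x * y) = (x + z) * c := by linear_combination l2 + x * l1
  have E2 : (z * w + x * u) * (1 + y * z) * (x + y * v) = (y * z * v * w + 1) * (x + z) * (y + x * u) := by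
    apply mul_left_cancel₀ pc.ne'
    linear_combination (1 - x * y) * E1 - (z * w + x * u) * (y * v + x) * d1
      + (y * v * (z * w) + 1) * (y + x * u) * d2
  linear_combination (1 - v) * E2

lemma Strict.xyz (_hp : 1 < p) (h : Strict p a1 a2 b b2 c c2)
    {x y z : ℝ} (hx : x = a2 / a1) (hy : y = b / b2) (hz : z = c2 / c) :
    0 < x ∧ x < y ∧ y < 1 ∧ 1 < z ∧ y * z < 1 := by
  obtain ⟨pa, pb, pc, pc2, pb2, pa1⟩ := h.pos
  have e1 := h.a1_eq
  have e2 := h.b2_eq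
  have h1 := h.a2_lt
  have h2 := h.b1_lt
  have h3 := h.c_lt
  have h4 := h.c2_lt
  have h5 := h.b2_lt
  refine ⟨by rw [hx]; positivity, ?_, ?_, ?_, ?_⟩
  · rw [hx, hy, div_lt_div_iff₀ pa1 pb2]
    exact mul_lt_mul h1 h5.le pb2 pb.le
  · rw [hy, div_lt_one pb2]; linarith
  · rw [hz, one_lt_div pc]; exact h3
  · rw [hy, hz, div_mul_div_comm, div_lt_one (by positivity)]
    have m1 := mul_lt_mul_of_pos_left h2 pc2
    have m2 := mul_lt_mul_of_pos_right h4 pc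
    linarith

/-- `(a2/a1)^(p-1) (b1-a2) ≤ a1-b2`. -/
lemma Strict.X_le (hp : 1 < p) (h : Strict p a1 a2 b b2 c c2) :
    (a2 / a1) ^ (p - 1) * (b - a2) ≤ a1 - b2 := by
  obtain ⟨pa, pb, pc, pc2, pb2, pa1⟩ := h.pos
  have t1 := tangent_le (x := b2) (y := a1) hp pb2.le pa1
  have t2 := tangent_le (x := b) (y := a2) hp pb.le pa
  have n1 := h.na
  have n2 := h.nb
  have p0 : 0 < p := by linarith
  have hA : 0 < a1 ^ (p - 1) := by positivity
  rw [div_rpow pa.le pa1.le, div_mul_eq_mul_div, div_le_iff₀ hA]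
  refine le_of_mul_le_mul_left ?_ p0
  linarith

def FF (p k b c b2 a2 y u v w X yp : ℝ) : ℝ :=
  (c * (b2 + b * X) * (1 - v * w)) * ((1 - v) * (1 + y * X) - (k * u) * (1 - y * y))
    - ((1 - X) * a2) * (((p * b) * (w * (1 - v)) + (k * b2) * (1 - yp)) * (1 - u * v))

lemma P4_val : val P4 (outB p b c b2 c2 a1 a2) = FF p (p - 1 - 1) b c b2 a2
    (exp (log b - p⁻¹ * log (1 - b ^ p)))
    (exp ((p - 1 - 1) * (log a2 - log a1)))
    (exp ((p - 1 - 1) * (log b - p⁻¹ * log (1 - b ^ p))))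
    (exp ((p - 1 - 1) * (p⁻¹ * log (1 - c ^ p) - log c)))
    (exp ((p - 1) * (log a2 - log a1)))
    (exp (p * (log b - p⁻¹ * log (1 - b ^ p)))) := rfl

lemma Strict.FF_le (hp : 2 < p) (hp3 : p ≤ 3) (h : Strict p a1 a2 b b2 c c2)
    (E : EqE p a1 a2 b b2 c c2)
    {x y z : ℝ} (hx : x = a2 / a1) (hy : y = b / b2) (hz : z = c2 / c) :
    FF p (p - 2) b c b2 a2 y (x ^ (p - 2)) (y ^ (p - 2)) (z ^ (p - 2)) (x ^ (p - 1)) (y ^ p) ≤ 0 := by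
  have hp1 : 1 < p := by linarith
  obtain ⟨pa, pb, pc, pc2, pb2, pa1⟩ := h.pos
  obtain ⟨x0, xy, y1, z1, yz⟩ := h.xyz hp1 hx hy hz
  have y0 : 0 < y := by linarith
  have z0 : 0 < z := by linarith
  have ex : a2 = x * a1 := by rw [hx]; field_simp
  have ey : b = y * b2 := by rw [hy]; field_simp
  have ez : c2 = z * c := by rw [hz]; field_simp
  have S := h.starA E hx hy hz
  have k0 : 0 < p - 2 := by linarith
  have k1 : p - 2 ≤ 1 := by linarith
  have hw : z ^ (p - 2) - 1 ≤ (p - 2) * (z - 1) := by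
    have := rpow_one_add_le_one_add_mul_self (s := z - 1) (by linarith) k0.le k1
    rw [add_sub_cancel] at this
    linarith
  have hzp : z ^ 2 * z ^ (p - 2) = z ^ p := by
    rw [← rpow_two, ← rpow_add z0]; congr 1; ring
  have hyp : y ^ 2 * y ^ (p - 2) = y ^ p := by
    rw [← rpow_two, ← rpow_add y0]; congr 1; ring
  have hX : x ^ (p - 1) = x * x ^ (p - 2) := by
    rw [show p - 2 = (p - 1) - 1 by ring, rpow_sub_one x0.ne' (p - 1)]; field_simp
  have hwz : z ^ 2 * z ^ (p - 2) - 1 ≤ p * (z * z ^ (p - 2)) * (z - 1) := by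
    have t := tangent_le (x := 1) (y := z) hp1 zero_le_one z0
    have e : z ^ (p - 1) = z * z ^ (p - 2) := by
      rw [show p - 2 = (p - 1) - 1 by ring, rpow_sub_one z0.ne' (p - 1)]; field_simp
    rw [e, one_rpow] at t
    rw [hzp]; linarith
  have hvu : x * (y ^ (p - 2) - x ^ (p - 2)) ≤ (p - 2) * x ^ (p - 2) * (y - x) := by
    have := rpow_one_add_le_one_add_mul_self (s := y / x - 1) (by
      have : 0 < y / x := by positivity
      linarith) k0.le k1
    rw [add_sub_cancel, div_rpow y0.le x0.le, div_le_iff₀ (by positivity)] at this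
    have e := mul_le_mul_of_nonneg_left this x0.le
    have e2 : x * ((1 + (p - 2) * (y / x - 1)) * x ^ (p - 2)) =
      x * x ^ (p - 2) + (p - 2) * x ^ (p - 2) * (y - x) := by field_simp
    linarith
  have hXl := h.X_le hp1
  rw [← hx] at hXl
  have hv : y ^ (p - 2) ≤ 1 := rpow_le_one y0.le y1.le k0.le
  have hu : x ^ (p - 2) ≤ 1 := rpow_le_one x0.le (by linarith) k0.le
  have hvw : y ^ (p - 2) * z ^ (p - 2) ≤ 1 := by
    rw [← mul_rpow y0.le z0.le]
    exact rpow_le_one (by positivity) yz.le k0.le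
  have hX1 : x ^ (p - 1) ≤ 1 := rpow_le_one x0.le (by linarith) (by linarith)
  have hX0 : 0 < x ^ (p - 1) := by positivity
  have u0 : 0 < x ^ (p - 2) := by positivity
  have v0 : 0 < y ^ (p - 2) := by positivity
  have w0 : 0 < z ^ (p - 2) := by positivity
  have hyp1 : y ^ p ≤ 1 := rpow_le_one y0.le y1.le (by linarith)
  have huv : x ^ (p - 2) * y ^ (p - 2) ≤ 1 := mul_le_one₀ hu v0.le hv
  rw [hyp] at S
  unfold FF
  have l1 := h.a1_eq
  have l2 := h.b2_eq
  generalize x ^ (p - 2) = u at *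
  generalize y ^ (p - 2) = v at *
  generalize z ^ (p - 2) = w at *
  generalize x ^ (p - 1) = X at *
  generalize y ^ p = yp at *
  generalize hk : p - 2 = k at *
  have Z : (z - 1) * (c * (b2 + b * X)) ≤ (y - x) * ((1 - X) * a1 * b2) := by
    have := mul_le_mul_of_nonneg_right hXl (by linarith : 0 ≤ b + b2)
    have e1 : (z - 1) * c = c2 - c := by rw [ez]; ring
    have e2 : (y - x) * (a1 * b2) = b * a1 - a2 * b2 := by rw [ex, ey]; ring
    have e3 : (z - 1) * (c * (b2 + b * X)) = (c2 - c) * (b2 + b * X) := by rw [← e1]; ring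
    have e4 : (y - x) * ((1 - X) * a1 * b2) = (1 - X) * (b * a1 - a2 * b2) := by rw [← e2]; ring
    rw [e3, e4]
    have e5 : c2 = b2 - a2 := by linarith
    have e6 : c = a1 - b := by linarith
    rw [e5, e6]
    linarith
  obtain ⟨Q, hQ⟩ : ∃ Q, Q = k * (1 - yp) + p * y * w * (1 - v) := ⟨_, rfl⟩
  obtain ⟨G, hG⟩ : ∃ G, G = (1 - v) * (1 + y * X) - (k * u) * (1 - y * y) := ⟨_, rfl⟩
  have Q0 : 0 ≤ Q := by
    rw [hQ]
    have : 0 ≤ 1 - yp := by linarith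
    have : 0 ≤ 1 - v := by linarith
    positivity
  have L : x * z * (1 - yp) * (w - 1) + x * y * (z ^ 2 * w - 1) * (1 - v) ≤ x * z * (z - 1) * Q := by
    have m1 := mul_le_mul_of_nonneg_left hw (mul_nonneg (mul_pos x0 z0).le (by linarith : 0 ≤ 1 - yp))
    have m2 := mul_le_mul_of_nonneg_left hwz (mul_nonneg (mul_pos x0 y0).le (by linarith : 0 ≤ 1 - v))
    rw [hQ]; linarith
  have R : z * ((y - x) * G) ≤ y * z * (1 - x ^ 2 * u) * (1 - v) - x * z * (1 - yp) * (1 - u) := by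
    have m1 := mul_le_mul_of_nonneg_left hvu
      (mul_nonneg z0.le (by linarith [mul_le_one₀ y1.le y0.le y1.le] : 0 ≤ 1 - y * y))
    rw [hG, ← hyp, hX]
    linarith
  have m1 := mul_le_mul_of_nonneg_left L (by linarith : 0 ≤ 1 - u * v)
  have m2 := mul_le_mul_of_nonneg_left R (by linarith : 0 ≤ 1 - v * w)
  have m3 : (1 - v * w) * ((y - x) * G) ≤ (1 - u * v) * (x * (z - 1) * Q) := by
    refine le_of_mul_le_mul_left ?_ z0
    linarith
  have m4 := mul_le_mul_of_nonneg_left m3 (by positivity : 0 ≤ c * (b2 + b * X))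
  have m5 := mul_le_mul_of_nonneg_left Z
    (mul_nonneg (mul_nonneg (by linarith : 0 ≤ 1 - u * v) x0.le) Q0)
  have yx : 0 < y - x := by linarith
  rw [← hG]
  refine le_of_mul_le_mul_left ?_ yx
  have e : (y - x) * ((1 - X) * a2 * ((p * b * (w * (1 - v)) + k * b2 * (1 - yp)) * (1 - u * v)))
      = (1 - u * v) * x * Q * ((y - x) * ((1 - X) * a1 * b2)) := by
    rw [hQ, ex, ey]; ring
  rw [mul_sub, e, mul_zero]
  linarith

lemma Strict.P4_le (hp : 2 < p) (hp3 : p ≤ 3) (h : Strict p a1 a2 b b2 c c2)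
    (E : EqE p a1 a2 b b2 c c2) : val P4 (outB p b c b2 c2 a1 a2) ≤ 0 := by
  have hp1 : 1 < p := by linarith
  obtain ⟨pa, pb, pc, pc2, pb2, pa1⟩ := h.pos
  have n1 : 0 < b2 ^ p := by positivity
  have n2 : 0 < c2 ^ p := by positivity
  have n3 := h.nb
  have n4 := h.nc
  have lg : ∀ {t : ℝ}, 0 < t → p⁻¹ * log (t ^ p) = log t := by
    intro t ht; rw [log_rpow ht]; field_simp
  have e1 : p⁻¹ * log (1 - b ^ p) = log b2 := by
    rw [← lg pb2]; congr 2; linarith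
  have e2 : p⁻¹ * log (1 - c ^ p) = log c2 := by
    rw [← lg pc2]; congr 2; linarith
  have e3 : p - 1 - 1 = p - 2 := by ring
  rw [P4_val, e1, e2, e3, ← log_div pa.ne' pa1.ne', ← log_div pb.ne' pb2.ne',
    ← log_div pc2.ne' pc.ne', exp_log (by positivity), exp_mul_log (by positivity),
    exp_mul_log (by positivity), exp_mul_log (by positivity), exp_mul_log (by positivity),
    exp_mul_log (by positivity)]
  exact h.FF_le hp hp3 E rfl rfl rfl
end

/-! ### The cells for `2.01 ≤ p ≤ 3` -/

lemma slab0 : okT (tree 16 2210018371829 2221013488108 K37 K39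
  1006152304513797344663440014813846126830676967228242871996900128086228310412122884850347728076361268332413506641792626078369607816313971377201367695003516118611563947753329061601345829448875758217227841125655991167143562305367501642944270097625047620048028473737469437770729713331807286474704471774552986037989446402087711903302525655996165744479684096641469961530065845412111502001395802738613326816361788027481919247278299588162355834156574070178311671519396444384923622416378411381630850798307488134600083823887143574030295865272460467576670934024170321810976195161052355633633395475312106352650117963575814444555141433603076390353779847796815057332319184191480371838604332814016574263243588214692033639487479204367122748815386908699271269550199290213304050479324707415188766286160206093753437884424347172181857598205039724040432738388600732125401536463373572358029848680295395545328110312043034748954717156513478410673278366344295311135643638155878412547441106370140280964676312102397619958028375789231015579861242202327895401374201852313486453485901680918384168664809124469033667283026656507508009383186664688358028287024151712717366437253658135118995714988603779318794775103702818617679978942140303149705389370616778618477248291745062938464467382668838800579489060720487229803482292575484931636740984677871274031420286424574062904678674972053829766413661552256360316478337548883731581683155810931264335090787131165605848550234922093377468287188026519351604879697821994183739546849822810745370844251308347623988277445772658846668841585981310636647038804449105914750145749140228423073504748945225755048260676465103283063765217154883187917686907613960520566497758277490772053316847389133866429657626469073698956352531581694917479156285685177591541184069810633481659220564499297409502060992345347115842252966361967064479977540230402582954002173024470565530830708943058311313177938664379649531740893168302387843751041285617542884396116941868479888888486213103790867578600545468243976560104560844575687438047176601609136433628831755441633568998191735985335315956406875917590578801888972464772472980466028493495758287049023308865704926762807716311621569531885533187165481659087509870450573548034534503091647951457621667518938272283245340793286360230562846061696888318759859437166636198892179163356701014802955153902654513560695724830012492927227966475877539623031433775827058236820496657)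 = true := by
  decide +kernel

lemma slab1 : okT (tree 16 2221013488108 2243003720663 K37 K39
  142046293312733938683796385129292864050684249690491835176768625845660369510534863277515694230624717701118555453374686991113554059145107521226147543395086307211467245201639778024407120668956799018797059708421065908570591529284036796608415348851854174016231147597553471031152696394236173322180866412587523156532486066523307751146411317941770010554399954150341891187541244669228276535328089331361150195048949180022408583277469332696070138762085167026415264129041836521111247011385582105863833942797394906565211285618673034853630971442485672887257489513837761725056923631414443004029650853550628934491857914574233935101405573567357563045104345710843246511593905742685483854619457805491768882899057413796648580545156389256597191651289927530051027423216103946895655857035628551607697623172503703598774155430923093874966574638629392434316689791283348211059200444276784167098346171066377334760022433225998527179100872111093103027470782713080399873643916513331498402634620872053300672846715812642998940514050034099871301120917677238663464239168740215672105691646167627997382954883032746957225398536326644829969726713334055311585684483291048263297613205580680784168242854892649337837028342550009400789423286010325907031720313542400607091806896858101300526826283295717251284520815112062202982917442622384914600783943048759895573094830425733128406684049296704685639751382315097525727063869308385484446010485488493874612240639793903896879839730196519201305275247115506862531917598469368055032804748031926765214565035102816472243603080312600932827417943469950158121952969200062278741176320407417060662545261555248701542869652571512786226998295021195035217504634242006472432561086081794713491880437841185845467803299751318303083396527325444478782650409313928816777691342693483167719577333621197148092815548710065521358648242448967935539130544300209195046087548609297654461555275107531464915339117114251577885788080588958263435003635216756929850699937641833709687166812383158545)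 = true := by
  decide +kernel

lemma slab2 : okT (tree 16 2243003720663 2308974418330 K37 K39
  29831435136672040930250550846019267306287039111777449013831570034655654778031967382163169255269698286053058185592698631852094603637025002277842370507077276127092641874670591834955592546987658769215947065683994678230839251710351075803475894548646739661730556179765668303889410881404594631728004504442724037432796589235661673623272326321312738728068550653032741535739604662133794622529231051012148622241880820870303227488758859523819344107714641221249286866222368228898204287370556404250564878779976682606344509704527244118635538921301408070942663793896434045357516418868031206854067422915570119421513891080362478493050361986583870307538129908796854102221136506358633465844085545006523999234141199549314815030750303170029522515146293218589312163942387153346327626493904964819446535987897909848409772507351790915847846465276945335041115609020360732195512497539584950148178370145352081456361676313297060017418618868370645367624976687945146501879044249250060199790842522249185803485698663880780777350559929022253517966042148195820559233019546701965846869532868753428692556362952380422429044503113443638212807087595400775862882095699225658952074679551826256628960098516931306775906991760271187675584620599940099368771585354730234477169749834688724736698265616123021574966711648739022924568982134649021028153949545093561061300765330821970583473672739586843638589592142496634186097816141066745585457082579832846325454477458400660215852992540864893860435995616629440962740063704506859117249509359338340155314068606412894232583449966554547331289750842454308845143861312983654767391294300730977122568019986044037275279172845951289207957565154646608373466145404868050347354662231271576176524664390397577089817446407549692812916965304745671918053915676872802831967603105372629032050647394191016272970246066695007776005577866030945201214010132719465903795996347153121466951622595242375194639520494144024005914491422134734801567696144856592233939211059293289169541795382713365482258864748399685793684834059545879373184895151305368084961328071359831555617006907466965557466733751269216118360763312110540844894336091514857653502216782050706850760364923172041671481645273581400897257124803558598693324410090490401209467526992323991918175801856890563086554486718592196084044073631282030278817701306641)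 = true := by
  decide +kernel

lemma slab3 : okT (tree 16 2308974418330 2418925581107 K37 K39
  3482970256564614252660687625420009996022454480105339739074389551425461863577621076111124130304053706135720108282166822889295214450753954928451536107171537746015347101847276546024322919874611942728748448227246318037287371377235526398658585313971478288549719136630306188250309598213092012989206369525052622414180944574508036321499073100275916627471301386931269794947601327910413852423617961439021649336660236072342996949798683590243284985077582598643016885668386799622502914192950655202301054263303163497704788632892817032291146984849824057140813022836381593401754554714973663714506837845908163127469790948251703814191606191593043832148695703849547747597802396160027416961225309732825174438826691607027179948322383845524900994931172572665164828272221221299289518775319007127649060491529177588263848486095779196136266721236241670949862466370416756476452355159519577964950609999576103118154310348651655008121702290610353464673408485376076191745494221258597599206147439072586129445696403040409231948204016881555819034582162218477341350427559286562534828342828796583001127894299776330458081870818698663012796901135967548186433511622204534383482214606047861997927772123797199099520451394072347575622726208809719283547268142222370454480322275756539839307456829874253807826746982538517865747011280487391743057941220940147740960351610656120053940721744935492144101441047620265237399841365104353509395821408330797411955376391141478221666193691407130302611310990025542219011593255660492360119509095619391859527565172332935289200604186440077960448010272568844891386042610443314201197625829162738425353666052674924663850515188762680343490034992997761239638690931111186572352815886488497717322903611348764085455967814228188581939308739745647197517511596884814928402576696982047371460260961678358066774864082410408532095088471581215875023087587159385130956729028197901101435747116499962322523599618442271898705985036233361222037391238460192447692747193634977616836631615049078679538859722092687137831832683162371049548562789297561873)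 = true := by
  decide +kernel

lemma slab4 : okT (tree 16 2418925581107 2528876743885 K37 K39
  1808165903801622451446245734461320405412298828202369885169022471236316438408356375949660590952598281113013065611516954228977776678161489601961482460825095406636682187152437875407183037649408658092304484261021570780885039721184625426692889604413563845834912009951976887588902539313722222531990062325143979540114044321839349260403966394827378669693953738902260994242978296101348259001215305166817563874765846844116957184961388999020854689450776380327213349151858122884154671294013339582041564187612568554471635474901649872643623246605227337271099600539382453981751215567159106332444556556038859700456336457886856354605758856105326088859478535189199067565525987771410116921043617613067829089943279304426626533513908732312004742766432780887488970371460140187162688880895208189909480133056378964687580335246639710756878268613407346354891484837824673106993570360699573718976260875528963687352285418174749512581057359389087987071602486611618284742314761061488222958570186914652142087986174493345981123524972254745788894580842792772052398252736681768260698526993630871249511361967737748497255505551079027932214951189246426479589933305353714729064930811368239637839741219401577490871412110121634044912716871143579758397701651970945483772816074670728238223859967020406031498972435209715644753065141231162548942809592150465747970107311479807226672686678063677381245903361121969683063281464760128830519010623962103619857) = true := by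
  decide +kernel

lemma slab5 : okT (tree 16 2528876743885 2638827906662 K37 K39
  559600023307893808128047159748641687397465808716267358729283874869347639728714290201755544070456230815741846378688901605393427212126724750321753885644174214805650734029062437253286288688424790515496244824452336663303608462516898413369751284175511338787562350807128218201712855384802730212549604447411335716062709877277776883294247812341078534470077170904227787291317423107228547035294987002507012998249805508380327764120168171677513488171033736290589758223135029384804357880424542372917680478260220196333923268720111813910311952249903757239588091982342007180168545716324623225432905330497368319180990215231971937804512023583051087905013986185012778127706403687752036796807373315587168008238816103434704237869100598746509133960645512123581223744349789165586880331757929571905663199238773469711073506258978004875273047162887199108393376385257799364479735516588641803678930694838616524768157176076658614342158397424520419531488227613467430336050874677309663519498250584462752998086280543187606134649658873080095811525868980751349109679483458271492651151339343576968396790388788971327539888725120278954653066390848080245215333983159935324303124372068673910747424810124754131365741865376426451819261274013322814014587150174356298666323769821160961944434089404565073306464968174126977182252740412522056392760803472324655444571140174887475613307861327059523833990805682743926658157733581683402119239011095197614712671086596518199697868792081) = true := by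
  decide +kernel

lemma slab6 : okT (tree 16 2638827906662 2748779069440 K37 K39
  3482965718992950551052567472569967456536793106096768129743261055911676537905366949715126235791827567228439250648563562363789801658855169159544944266506034732021280262367070659696143541305767698151924031448725970173016276822287251730362040228409338538059673389088653787555700554681727756166191363702699612057161013795598816478970029704525235766684171151365052502395008829390564972662925550263545658455595614684413624261423874886860559916516650870181792027955127660996536343852416956891311717717233736379224022152052501423907121188379592641270848122005682186031715609060920260970287110102249968287773473962536094767881081563144308508072460406105335025022867230701816990029884161801744146146354518503982148877058339719225117082300736883977327022315486217341491359718309250055913419258022379311719525158876745292425397835074348211289331226394267603102946537779444737554265536199539677109137750052160329498556543959155195608184624649825588016386099099573166678106451429079241528677686428502462621200177262202932490066551199976204705191356791147920879329064596363245801207209713163109832982031364869191121141187454625172895291753407394874561418449097020949848833812980733496379552632851701358454045114132793817197356125295125443706639681919622838140321108688533040968360945114635331589759554846902269485953443907031797352698922639552141149910300890038520046532826962344085076963978600739867632454552159106267053181182529873727433151692428638415288963903934037468793744053138537075926037677852260668754547427618595102567914235091882961389063195053277509348266390395261772722032532304679799295396841622190984756869189301373961102559584572826233835640569465658159901079991627005466536277219871413347509141018778095047472827801399887438504845080274170476223730265865308782115815819101514040287503332195880413958398117047141146754844330474216782109880797977247876940830239539709688196306404476035139809048622443966996579308428188428463909976509079815407876742764446236505305122404342088350842089570934216494094377140895079997713)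 = true := by
  decide +kernel

lemma slab7 : okT (tree 16 2748779069440 2792759534551 K37 K39
  4210646326039768157609222911954257202812636287493594851732080815451529006917351424066033549213125207217714120857250697891590357985170929177439204815546902449307440395581861364636044743007291844544733073274911089175031989026838966804584837556412153866372071212428685106973601333308381426717381839121075418120308539614992263587857409320876937787160415190714276333988392902798085250449240497018074830859883593750124831978943773087388497129967887502886037779047208574364103293089394856871488410981333035390854160695660319307987093997587670538142931680310048130504743195255180199239859120162826674906455050717725771539216763528331220094975319314947310412716441287126620614940685582334326193444044660263625180812439770013032056774773713714487511801542526349145892770768405395973206044944142843991743024819989132078449537305257485020457249574658238915593624229742920207892889582420450003632692411539285361495028268655395064668517939007848077984927543718598262152216793681559668691204394141602629712165972631095202401752786075154194853219556968855260340461209100156390116624368872871503460047319662073896194321357037953041521450861066270096029857010360065204000316437482975850068488723673689281391388305761367926830998645827539165342392748383078880833827006851379643902346932421515517912621587342104607835333814609833724172898769971835995380311158106625080961796782725861902657197965166535181329992003546719144768744491113662816374472644265344134407278643003808158799417029074329777434284686363225079800087299156427239602405018485835119087621848185833849857388890645433552149944063819503841272166615909807770398853768042004611307608307892220364229962183054242563829746440840457108145178789672372241324617316762137797071797688098931472159901294894908410251182966090355465138183019617640784145978500761105378583803062318106565147834476173194385573531647797827411883024115694441009235704837824933118385003114768576277137094757517221718322506772617228481191534117898717366037433186337239614800691206177813618551002166040198107647959555262967958310428945)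 = true := by
  decide +kernel

lemma slab8 : okT (tree 16 2792759534551 2814749767107 K37 K39
  209371081274916731364176938906921534778827489677147491911752885140405017000398896943591276476613824904141172733306233067809494128591651310190591984088717183346184509889358353181868904186631130226670732446201231011556170081545498569807674989714260099149138143643944941134178513956097461728439091753165141091271112986964979144293277766725813094243623909906089364653037633803310622843487732139119902340560548624382831314986831036875913840382406738763060423086863957997497148530940523293333837250010189400598510959780732934459018044596472367248371757195223456509263494808945612518217658180408746640080060829134318576273806004698745819792162827191745801698616377210078841324174949006133728339971905130737574533833096172397478545583710252038402218806010210667987787839574440291226482458375585002718321056027541865738335879520049530657888416652811291068012089738875414921709403601422507858487953161810525873331740093016964273874483155392323180038387749780483741557555290151358692991247191859444295635871504576746467057857036337711835213389710691091130290823550135006960741436845541834908654873311988092650930283810507834855108885229253879878700266859268458248092106565726072732978993940919875923430417129929060138487084568440590815671535822739509464019906945268835748038993326888207831038753262158863825229426190866438712431348098667396854223950132005371540625170619845849583594914182816512487701933034505003627059301579988050783790360620621369187433415167647088097103078678426599867807375633) = true := by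
  decide +kernel

lemma slab9 : okT (tree 16 2814749767107 2836739999662 K37 K39
  7768535237710690278328871509218614286991324144139331863490474263817945112304833046212488486554157908824155492541654112561493614524667127567390765237963075685238408275624149261084313226106137229978047468302117573532541992724548621628552729401716262091924381472914147759944575083866282853071558592858779028589551447974175720624591855543678158058236529589580427800831680598307270991011238495297303006937079334514549186943750461202944271746147943902276623865811109288109814854429796361781881866687489470869245141367283585385532969811964463116162002461183492763622349210949028255799677846024078465978625458841286187344962076056176165163974545948370630909712712069377075953499603605636434655490932404807592013643080315466905679820288015647768418628372129711205460090128899822063795609149378769264241951359869648654851857972013565216817846483904940159195790847468191200475471735745755749437396429055167248808075620027522105435707911410849556615964093809711871320213083062312099596749317628051096697821872303200649325873941352105681937129237789820647917990241239593188490952273758981969975249422246402363786792066156837742405585183893786097765437525732052067331782311978945543368016767411997676151536846066508776615542522930383538370893650655470389492922388570056266969954381243335145560394954712933434603576323618854203291681457856385100902010143796219739914126742589991072787422729249674775175573304480088191907235125765236368351698097870563106660760061453846029749946171688638661351181633560156206378751639869202114085681672323710496794477546789308336875105867858885043636786730553280236308504800739616440453631635380844640827852701102981791289754411945351075960358732927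39459112805332881805467895939327182700566063370426852958827592597189432007025470513194871321511733380938579795336244249063103474900182162734543473369798350139124135963456200397108907411544480455401891512714545138291549184952313893866877478213144952436727171030244508659171727589749326632748737701025547972025208021584997456772197214812759784524818367423758579144907052432430077427756728989710352022838205299068441048677532589755248179249799232485451676449575686727440944831389523605685730235821885393453857822329477899730486982380001675058853534754691022414640158134686853479836883077632657921710192030280575294873324044787775233275840073547681260680208825265746788733564388726040520541448512847208593391730563641334708116110995748126911248890903278833120970969516679205335529162283711772237167903314370497869093297756137418019103846941472248609940050714763896513465779842613770456825796266941234290889533768341746408839538384371935186107214779660363328281922317344701981728559146672451993102206530923848779999556486572361366996889837841) = true := by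
  decide +kernel

lemma slab10 : okT (tree 16 2836739999662 2858730232218 K37 K39
  6206339821234826256791648991555185268936613250877118200268491113862143802199318670200012822079285486698551282673986690986289617936594345504478010746685401265619581036205331861395605813922736455154120545911220162137391658351318628027670224766744132635806544812055554918333667671702952651143863312415513657061262508269151324054656915336933063843861127533037338876886737164359770153140890556464786874209926674054240142899573239993338985069842142938263142294660477169796996479832682295774437482061745013013711115882941098326626952720291708741512027045567108919232595134081226797609758290153880924874777882391204884177987143079986714057114714262823933135551218333936967412202632646068708987430970124702873856742485139116907388238066910648286279977861304385355823909596059466241665683169965530275476801116522405397881980500944513782952112695148334646497734528327288532270224406965800259246316302883075606177701006748719934485345513397603332596415732652883996611400637099150951981094610094072374591835819486633447174413556675830017161500512828815948147592641888761831865857421902946789145051482784988474491092751392075252755407361578590248185710451190136120028432588471922355283115669650717224365093532073686191552367527310173628901845539480485574528957329555695094505426734150842183455580437483661232442437504843405526837332302092453233228742847466058436306305152084357361569407549065409515046919642526480166393687815075957252689716059545630941084156334816097742597798111962208911089059695232778335829073175084757530845762376094109529994068249955613181402044876839395601) = true := by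
  decide +kernel

lemma slab11 : okT (tree 16 2858730232218 2913705813606 K37 K39
  2893204045312543873911106178395629715237398205227219743189618821770833354271392454190337010337295581176708214017323566893228139213838271574499028980124840868934656041064568737983342518121045857284703192577049643168543531441040377880456927437048682271786017344102799122274723597160657504421514971910597820894531646177904241327591962607424127665920303236303828220429343138375930804888667053877392258879928113701544195675760277900010150484219314574960576983393606455242158783613818083947803164819360088865898877774379274206881051061705529833211221304345663897877696054705705100083355912028877628483832272507495794850159534259255997150101120226025834622350301399756458138516368863737450625373604397502391594122356481787197901210516235065297306384984707466907719591942776243310951353728796192527234819021694712724259334480611414425850770842520990239189032714462508241838220224619559080499475369235391477403821825129404994913720067851992014531064651327874304179201607023797179156146233221025687503473319819671128061285590696730443928333985941418989717411034618045687228100147120515499450387042110285527365536864959284860037502280596415206912564614162609847347899868370221174835110116380497125791018736290820908533903294233607252898276351720004014114116786788512704242265121188132806293413788977571432393233164871020068032717113676517286184936975546139958966467417868602622192630975173901280821664431232928235259030299122648071224033499184168834202524385444814654085469094984461573153465274890244421085551989477842571768447811091152018731956054728662039179304741201203648387160069941772216776257291383568541935386766007523151452510779092782106364619541886153296968488186249992601460980368323301922155202012772168314642378693424999829022831864307056518261327314972996954518727899369078742291308458820898117509768005841130797107842376886056685004570441736516963950192739899267607881040767083504885365095154118311438037134542057029206153146805303383682620913961199237651818844440955089686744861643130339093636624972638697751050634457198560061925943420320096807733956538947748185685619575420976555337529034372622521479855398540818901673815924036544698720812671249)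 = true := by
  decide +kernel

lemma slab12 : okT (tree 16 2913705813606 2968681394995 K37 K39
  29689577196605182976644472173815846400900064536076595741185889734313622855180482567776263273409428490745943404731364481013293710803949049966333594762852127372324481042948322004939339147274519591618526249232070259075820983383042744853191267619222132205126823928836293283736406341291367059066721118163146989853551390050559741234407510926892642692382972442438898577773201240455940334290800954540733430252648996585904417011149956521378211985583559972337370546313468166859786155218369324253646902734006192023230078914628984408643204222454408531852837455173684279022465914388596934776086149375624634844438818621162452400228524867894151822314250819684904411881420599298936590526716199454624831228801828625575299530500584674560192456788042887108809458296003752113180268358235079688372324903127218271423788183781698637843876533670510912635784650368759935197565530319030296960250473616183717496332711756050614478538370303727892149672118542685326466139763673413921058776823494553456037253428459653729827676613299295300199275842269803251980680110353) = true := by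
  decide +kernel

lemma slab13 : okT (tree 16 2968681394995 3078632557773 K37 K39
  20310155555956002307300847621572384857507553370844482643110635442351504194210410949466225104087425157261462647726463170440623284854702366534883932514439002073422563176027832886469124700400941211041109948251126128617023276229451765824995048066117302761266506246546393569701598898136219149139560528177561211470289261127758668959394537459559189264050194578698593431491314202491195071310652491145056729877965897738636935825540150963358239492350546875281528243523429139099758359402752729960230348628893020390393007582732851107336735864595288705045169276403853054503725318662834617186907856816548928727989448047572569276508505590236065687861008074203137771856200187461088917493570378606918631219170637851117897198230655424832539179444817861807210129083392563341743697070348888419041233575598239620822174395654483148725703438784331433640073897650025823068200281969135929653835129821768527712118634127238571059981409236093815055880074575511781396775365457187345953196342368369252381007808225084057299016915566729209271669895888303345203491401708415789650054703857568218022292559373487149619357154129211366090036350368397088669583578980210880401815899984719524391691857137999946001) = true := by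
  decide +kernel

lemma slab14 : okT (tree 16 3078632557773 3298534883328 K37 K39
  529128646081067834201719536177375814453563628894955239218693169092918448134475157261536136008924908531889273657338647882945801761599731111784244303883425343465205538175741190674793426281584503037295338464795134488081812257273447044804334154983670175468754368176231640969805207677861634301151588553466142559412956640883878908457275886042281007027124864722063119298431850179049828645684548578158969405211946702887650251526093124368076349431133874546920192341874529872497888283514309822323039153920080212449970639899445810712319138803689746633160447005265732642423074011972845270199542419192818355438652418497215311299035860543256725737339238127040756375867120178725565321946015743198605177915806062513449778453144324431640279211782876787626603790684957381669024373401842894670637796898997230841994363054046683049706101908416083929655738736231698532988419481494404199629454305138653532630560778166112892127408597282489845116880095381182407832188115527794773531419301546933147621037933437643524158354266463379905473237815258950804152775141193866369122504236816473765042183166222125847479085096795492595282931348933165458450248386551571101923719686740308852134577809337015789586663020742045022314570917053142228837604539894390661393) = true := by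
  decide +kernel

section
open Real

variable {p a1 a2 b c b2 c2 : ℝ}

/-! ### The region `2.01 ≤ p ≤ 3` -/

lemma okT_some {x : Option Nat} (h : okT x = true) : ∃ d, x = some d := by
  cases x with
  | none => exact absurd h (by simp [okT])
  | some d => exact ⟨d, rfl⟩

lemma Strict.c_half (hp : 1 < p) (h : Strict p a1 a2 b b2 c c2) : c ^ p < 1 / 2 := by
  obtain ⟨pa, pb, pc, pc2, pb2, pa1⟩ := h.pos
  have := rpow_lt' hp pc.le h.c_lt
  linarith [h.nc]

lemma Strict.kil_false (hp : 2 < p) (hp3 : p ≤ 3) (h : Strict p a1 a2 b b2 c c2)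
    (E : EqE p a1 a2 b b2 c c2) {τ : ℝ} (ht : IsTau p τ) (hd : a1 * b2 - a2 * b ≤ delta1 p τ)
    (hd0 : a1 * b2 - a2 * b ≤ delta0 p) : ¬ Kil p b c := by
  have hp1 : 1 < p := by linarith
  intro hk
  rcases hk with ⟨-, hk⟩ | ⟨d0, hd1, hk⟩ | hk
  · rw [h.PB hp1] at hk
    rcases hk with hk | hk | hk | hk | hk
    · rw [outB_disc] at hk
      linarith [h.c_half hp1]
    · exact hk (h.PE_zero E)
    · linarith [h.P2_le hp1 hd0]
    · linarith [h.P3_le hp1 ht hd]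
    · linarith [h.P4_le hp hp3 E]
  · linarith [h.PN_le hp.le E hd1]
  · linarith [h.PX_le hp1 ht hd]

lemma Strict.b_range (hp : 2 < p) (hp3 : p ≤ 3) (h : Strict p a1 a2 b b2 c c2) :
    1 / 8 ≤ b ∧ b ≤ 1 / 2 := by
  have hp1 : 1 < p := by linarith
  obtain ⟨pa, pb, pc, pc2, pb2, pa1⟩ := h.pos
  have l1 := h.lt_one hp1
  have e1 := h.a1_eq
  have k1 := h.b1_lt
  have k2 := h.a2_lt
  refine ⟨?_, by linarith⟩
  by_contra hb
  push Not at hb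
  have f1 : a2 ^ p ≤ a2 ^ (2:ℝ) := rpow_le_rpow_of_exponent_ge pa (by linarith) hp.le
  have f2 : a1 ^ p ≤ a1 ^ (1:ℝ) := rpow_le_rpow_of_exponent_ge pa1 l1.le hp1.le
  rw [rpow_one] at f2
  rw [rpow_two] at f1
  have f3 : a2 ^ 2 ≤ (1/8) ^ 2 := pow_le_pow_left₀ pa.le (by linarith) 2
  have f4 : (0.859 : ℝ) ≤ c := by linarith [h.na]
  have f5 : c ^ (3:ℝ) ≤ c ^ p := rpow_le_rpow_of_exponent_ge pc (by linarith) hp3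
  have f6 : (0.859 : ℝ) ^ 3 ≤ c ^ 3 := pow_le_pow_left₀ (by norm_num) f4 3
  have f7 : c ^ (3:ℝ) = c ^ 3 := by exact_mod_cast rpow_natCast c 3
  rw [f7] at f5
  have := h.c_half hp1
  norm_num at f6
  linarith

lemma Strict.region2 (hp : 2.01 ≤ p) (hp3 : p ≤ 3) (h : Strict p a1 a2 b b2 c c2)
    (E : EqE p a1 a2 b b2 c c2) {τ : ℝ} (ht : IsTau p τ) (hd : a1 * b2 - a2 * b ≤ delta1 p τ)
    (hd0 : a1 * b2 - a2 * b ≤ delta0 p) : False := by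
  have hp2 : 2 < p := by norm_num at hp; linarith
  have hp1 : 1 < p := by linarith
  obtain ⟨hb1, hb2⟩ := h.b_range hp2 hp3
  refine h.kil_false hp2 hp3 E ht hd hd0 ?_
  have pt := h.pt hp2.le
  have key : ∀ {pl ph d : ℕ}, okT (tree 16 pl ph K37 K39 d) = true →
      (pl : ℝ) ≤ p * K40 → p * K40 ≤ (ph : ℝ) → Kil p b c := by
    intro pl ph d hk g1 g2
    obtain ⟨d', hd'⟩ := okT_some hk
    exact tree_ok 16 hd' g1 g2 (by push_cast; linarith) (by push_cast; linarith) pt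
  have g0 : (2210018371829 : ℝ) ≤ p * K40 := by norm_num at hp; linarith
  rcases le_total (p * K40) (2221013488108) with t | t0
  · exact key slab0 (by exact_mod_cast g0) (by exact_mod_cast t)
  rcases le_total (p * K40) (2243003720663) with t | t1
  · exact key slab1 (by exact_mod_cast t0) (by exact_mod_cast t)
  rcases le_total (p * K40) (2308974418330) with t | t2
  · exact key slab2 (by exact_mod_cast t1) (by exact_mod_cast t)
  rcases le_total (p * K40) (2418925581107) with t | t3
  · exact key slab3 (by exact_mod_cast t2) (by exact_mod_cast t)
  rcases le_total (p * K40) (2528876743885) with t | t4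
  · exact key slab4 (by exact_mod_cast t3) (by exact_mod_cast t)
  rcases le_total (p * K40) (2638827906662) with t | t5
  · exact key slab5 (by exact_mod_cast t4) (by exact_mod_cast t)
  rcases le_total (p * K40) (2748779069440) with t | t6
  · exact key slab6 (by exact_mod_cast t5) (by exact_mod_cast t)
  rcases le_total (p * K40) (2792759534551) with t | t7
  · exact key slab7 (by exact_mod_cast t6) (by exact_mod_cast t)
  rcases le_total (p * K40) (2814749767107) with t | t8
  · exact key slab8 (by exact_mod_cast t7) (by exact_mod_cast t)
  rcases le_total (p * K40) (2836739999662) with t | t9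
  · exact key slab9 (by exact_mod_cast t8) (by exact_mod_cast t)
  rcases le_total (p * K40) (2858730232218) with t | t10
  · exact key slab10 (by exact_mod_cast t9) (by exact_mod_cast t)
  rcases le_total (p * K40) (2913705813606) with t | t11
  · exact key slab11 (by exact_mod_cast t10) (by exact_mod_cast t)
  rcases le_total (p * K40) (2968681394995) with t | t12
  · exact key slab12 (by exact_mod_cast t11) (by exact_mod_cast t)
  rcases le_total (p * K40) (3078632557773) with t | t13
  · exact key slab13 (by exact_mod_cast t12) (by exact_mod_cast t)
  · exact key slab14 (by exact_mod_cast t13) (by push_cast; linarith)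
end

section
open Real

variable {p a1 a2 b c b2 c2 : ℝ}

/-! ### The key inequality for `p ≥ 3` -/

lemma slope_pow {k x y : ℝ} (hk : 1 ≤ k) (hx : 0 < x) (hx1 : x < 1) (hy : 0 < y) (hy1 : y < 1) :
    (1 - x ^ k * y ^ k) * (1 - x) ≤ (1 - x ^ k) * (1 - x * y) := by
  have hxy : x * y < x := by nlinarith
  have h := (convexOn_rpow hk).secant_mono (a := 1) (x := x * y) (y := x)
    (by simp) (by simpa using (mul_pos hx hy).le) (by simpa using hx.le) (by linarith) (by linarith) hxy.le
  rw [one_rpow, mul_rpow hx.le hy.le] at h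
  have e1 : (x ^ k * y ^ k - 1) / (x * y - 1) = (1 - x ^ k * y ^ k) / (1 - x * y) := by
    rw [← neg_sub, ← neg_sub (1 : ℝ) (x * y), neg_div_neg_eq]
  have e2 : (x ^ k - 1) / (x - 1) = (1 - x ^ k) / (1 - x) := by
    rw [← neg_sub, ← neg_sub (1 : ℝ) x, neg_div_neg_eq]
  rw [e1, e2, div_le_div_iff₀ (by linarith) (by linarith)] at h
  exact h

/-- exponents `0 ≤ m ≤ 1`. -/
lemma hmono {m x y : ℝ} (hm0 : 0 ≤ m) (hm : m ≤ 1) (hx : 0 < x) (hxy : x < y) (hy1 : y < 1) :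
    x * (y ^ m - y) * (1 - x * x ^ m) ≤ y * (x ^ m - x) * (1 - y * y ^ m) := by
  have hy : 0 < y := hx.trans hxy
  have ly : log y < 0 := log_neg hy hy1
  have lx : log x ≤ log y := log_le_log hx hxy.le
  set r := log x / log y with hr
  have r1 : 1 ≤ r := by
    rw [hr, le_div_iff_of_neg ly]; linarith
  have ex : x = y ^ r := by
    rw [rpow_def_of_pos hy, hr, mul_div_cancel₀ _ ly.ne, exp_log hx]
  set Y := y ^ m with hY
  have Yp : 0 < Y := rpow_pos_of_pos hy m
  have Y1 : Y ≤ 1 := rpow_le_one hy.le hy1.le hm0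
  have Yy : y ≤ Y := by
    have := rpow_le_rpow_of_exponent_ge hy hy1.le hm
    rwa [rpow_one] at this
  have eX : x ^ m = Y ^ r := by
    rw [ex, hY, ← rpow_mul hy.le, ← rpow_mul hy.le, mul_comm]
  have b1 : 1 + r * (Y / y - 1) ≤ Y ^ r / y ^ r := by
    have := one_add_mul_self_le_rpow_one_add (s := Y / y - 1) (by
      have : 0 ≤ Y / y := by positivity
      linarith) r1
    rw [add_sub_cancel, div_rpow Yp.le hy.le] at this
    exact this
  have b2 : 1 + r * (y * Y - 1) ≤ (y * Y) ^ r := by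
    have := one_add_mul_self_le_rpow_one_add (s := y * Y - 1) (by
      have : 0 ≤ y * Y := by positivity
      linarith) r1
    rwa [add_sub_cancel] at this
  rw [mul_rpow hy.le Yp.le, ← ex, ← eX] at b2
  rw [← eX, ← ex, le_div_iff₀ hx] at b1
  set X := x ^ m
  have c1 : r * (Y - y) * x ≤ (X - x) * y := by
    have : (1 + r * (Y / y - 1)) * x * y = x * y + r * (Y - y) * x := by field_simp
    nlinarith [mul_le_mul_of_nonneg_right b1 hy.le]
  have yY : y * Y < 1 := by nlinarith
  have c2 : 1 - x * X ≤ r * (1 - y * Y) := by linarith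
  calc x * (Y - y) * (1 - x * X) ≤ x * (Y - y) * (r * (1 - y * Y)) :=
        mul_le_mul_of_nonneg_left c2 (mul_nonneg hx.le (by linarith))
    _ = (r * (Y - y) * x) * (1 - y * Y) := by ring
    _ ≤ ((X - x) * y) * (1 - y * Y) := mul_le_mul_of_nonneg_right c1 (by linarith)
    _ = _ := by ring

lemma pow_split {x k : ℝ} (hx : 0 < x) : x ^ k = x * x ^ (k - 1) := by
  rw [rpow_sub_one hx.ne']; field_simp

lemma Lprime_small {k x y φ : ℝ} (hk : 1 ≤ k) (hk2 : k ≤ 2) (hx : 0 < x) (hxy : x < y) (hy1 : y < 1)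
    (hφ : φ * (1 - x * y) ≤ 1 - x * y - x) (hφ0 : 0 ≤ φ) :
    (y - x) * (1 - x) * φ * (1 - x ^ k * y ^ k) * (1 - y ^ k) ≤
      y * (1 - x ^ 2 * x ^ k) * (1 - y ^ k) - x * (1 - y ^ 2 * y ^ k) * (1 - x ^ k) := by
  have hy : 0 < y := hx.trans hxy
  have h1 := slope_pow hk hx (hxy.trans hy1) hy hy1
  have h2 := hmono (m := k - 1) (by linarith) (by linarith) hx hxy hy1
  rw [pow_split hx (k := k), pow_split hy (k := k)] at *
  have X1 : x ^ (k-1) ≤ 1 := rpow_le_one hx.le (hxy.trans hy1).le (by linarith)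
  have Y1 : y ^ (k-1) ≤ 1 := rpow_le_one hy.le hy1.le (by linarith)
  have Xp : 0 < x ^ (k-1) := rpow_pos_of_pos hx _
  have Yp : 0 < y ^ (k-1) := rpow_pos_of_pos hy _
  generalize x ^ (k-1) = X at *
  generalize y ^ (k-1) = Y at *
  have u1 : 0 < 1 - x * X := by nlinarith
  have v1 : 0 < 1 - y * Y := by nlinarith
  have k1 : Y - y ≤ 1 - y * Y := by nlinarith
  have k2 : (y - x) * (1 - x * X) * (Y - y) ≤ (y - x) * (1 - x * X) * (1 - y * Y) :=
    mul_le_mul_of_nonneg_left k1 (mul_nonneg (by linarith) u1.le)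
  have k3 : (y - x) * (1 - x * X) * (1 - y * Y) * (1 - x * y - x) ≤
      y * (1 - x ^ 2 * (x * X)) * (1 - y * Y) - x * (1 - y ^ 2 * (y * Y)) * (1 - x * X) := by
    have e : y * (1 - x ^ 2 * (x * X)) * (1 - y * Y) - x * (1 - y ^ 2 * (y * Y)) * (1 - x * X) =
      (y - x) * (1 - x * X) * (1 - y * Y) * (1 - x * y) -
        x * (y * ((Y - y) * (1 - x * X) - (X - x) * (1 - y * Y))) := by ring
    rw [e]
    have : x * (y * ((Y - y) * (1 - x * X) - (X - x) * (1 - y * Y))) ≤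
        x * ((y - x) * (1 - x * X) * (1 - y * Y)) := by
      apply mul_le_mul_of_nonneg_left _ hx.le
      linarith
    linarith
  have k4 : (y - x) * (1 - x) * φ * (1 - x * X * (y * Y)) * (1 - y * Y) ≤
      (y - x) * φ * (1 - y * Y) * ((1 - x * X) * (1 - x * y)) := by
    have := mul_le_mul_of_nonneg_left h1 (mul_nonneg (mul_nonneg (sub_nonneg.2 hxy.le) hφ0) v1.le)
    linarith
  have k5 : (y - x) * (1 - x * X) * (1 - y * Y) * (φ * (1 - x * y)) ≤
      (y - x) * (1 - x * X) * (1 - y * Y) * (1 - x * y - x) :=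
    mul_le_mul_of_nonneg_left hφ (mul_nonneg (mul_nonneg (sub_nonneg.2 hxy.le) u1.le) v1.le)
  linarith

lemma pow_bd {t y : ℝ} (ht : 0 ≤ t) (hy : 0 < y) (hy1 : y ≤ 0.56) : (1 + t) * y ^ t ≤ 1.3 := by
  have h1 : y ^ t ≤ 0.56 ^ t := rpow_le_rpow hy.le hy1 ht
  have h2 : (0.56 : ℝ) ^ t = ((25/14 : ℝ) ^ t)⁻¹ := by
    rw [← inv_rpow (by norm_num)]; norm_num
  have h3 : 1 + t ≤ 1.3 * (25/14 : ℝ) ^ t := by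
    rcases le_total t 1 with h | h
    · have l2 := log_two_gt_d9
      have l3 := one_sub_inv_le_log_of_pos (show (0:ℝ) < 25/28 by norm_num)
      have l4 : log (25/14 : ℝ) = log 2 + log (25/28) := by
        rw [← log_mul (by norm_num) (by norm_num)]; norm_num
      have l5 : (0.57 : ℝ) ≤ log (25/14) := by rw [l4]; norm_num at l3 ⊢; linarith
      rw [rpow_def_of_pos (by norm_num)]
      have := add_one_le_exp (log (25/14 : ℝ) * t)
      nlinarith
    · have := one_add_mul_self_le_rpow_one_add (s := 11/14) (by norm_num) h
      rw [show (1 : ℝ) + 11/14 = 25/14 by norm_num] at this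
      linarith
  have h4 : (0:ℝ) < (25/14 : ℝ) ^ t := by positivity
  calc (1 + t) * y ^ t ≤ (1 + t) * 0.56 ^ t := by gcongr
    _ ≤ 1.3 := by rw [h2, ← div_eq_mul_inv, div_le_iff₀ h4]; exact h3

lemma pow_diff {m x y : ℝ} (hm : 1 ≤ m) (hx : 0 < x) (hxy : x < y) (hy1 : y ≤ 0.56) :
    y ^ m - x ^ m ≤ 1.3 * (y - x) := by
  have hy : 0 < y := hx.trans hxy
  rcases hm.eq_or_lt with h | h
  · rw [← h, rpow_one, rpow_one]; linarith
  · have h1 := tangent_le h hx.le hy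
    have h2 := pow_bd (t := m - 1) (by linarith) hy hy1
    rw [add_sub_cancel] at h2
    have := mul_le_mul_of_nonneg_right h2 (sub_nonneg.2 hxy.le)
    linarith

lemma Lprime_big {k x y : ℝ} (hk : 2 ≤ k) (hx : 0 < x) (hxy : x < y) (hy1 : y ≤ 0.56)
    (hxy1 : x + 1.44 * y ≤ 1) :
    (y - x) * (1 - x) * (1 - x ^ k * y ^ k) * (1 - y ^ k) ≤
      y * (1 - x ^ 2 * x ^ k) * (1 - y ^ k) - x * (1 - y ^ 2 * y ^ k) * (1 - x ^ k) := by
  have hy : 0 < y := hx.trans hxy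
  have h1 := pow_diff (m := k - 1) (by linarith) hx hxy hy1
  have X1 : x ^ (k-1) ≤ x ^ (1:ℝ) := rpow_le_rpow_of_exponent_ge hx (by linarith) (by linarith)
  have Y1 : y ^ (k-1) ≤ y ^ (1:ℝ) := rpow_le_rpow_of_exponent_ge hy (by linarith) (by linarith)
  rw [rpow_one] at X1 Y1
  rw [pow_split hx (k := k), pow_split hy (k := k)] at *
  have Xp : 0 < x ^ (k-1) := rpow_pos_of_pos hx _
  have Yp : 0 < y ^ (k-1) := rpow_pos_of_pos hy _
  generalize x ^ (k-1) = X at *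
  generalize y ^ (k-1) = Y at *
  have e : y * (1 - x ^ 2 * (x * X)) * (1 - y * Y) - x * (1 - y ^ 2 * (y * Y)) * (1 - x * X) =
      (y - x) * (1 - x * X) * (1 - y * Y) * (1 - x * y) +
        x * y * ((y - x) * (1 - X * Y) - (1 - x * y) * (Y - X)) := by ring
  rw [e]
  have xX : x * X ≤ x * x := mul_le_mul_of_nonneg_left X1 hx.le
  have yY : y * Y ≤ y * y := mul_le_mul_of_nonneg_left Y1 hy.le
  have y2 : y * y ≤ 0.3136 := by nlinarith
  have XY : X * Y ≤ x * y := mul_le_mul X1 Y1 Yp.le hx.le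
  have xy0 : 0 < x * y := mul_pos hx hy
  have hxy' : 0 < y - x := by linarith
  have v1 : 0.6864 ≤ 1 - y * Y := by linarith
  have oxy : 0 < 1 - x * y := by nlinarith
  have d1 : (y - x) * (1 - x * y) ≤ (y - x) * (1 - X * Y) :=
    mul_le_mul_of_nonneg_left (by linarith) hxy'.le
  have d2 : (1 - x * y) * (Y - X) ≤ (1 - x * y) * (1.3 * (y - x)) :=
    mul_le_mul_of_nonneg_left h1 oxy.le
  have d3 : x * y * (-(0.3 * ((y - x) * (1 - x * y)))) ≤
      x * y * ((y - x) * (1 - X * Y) - (1 - x * y) * (Y - X)) := by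
    apply mul_le_mul_of_nonneg_left _ xy0.le
    linarith
  have q0 : 0 < (y - x) * (1 - x * y) := mul_pos hxy' oxy
  have d4 : 0.3 * (x * y) * ((y - x) * (1 - x * y)) ≤
      0.44 * (x * y) * (1 - y * Y) * ((y - x) * (1 - x * y)) := by
    apply mul_le_mul_of_nonneg_right _ q0.le
    nlinarith
  have d5 : (y - x) * (1 - x * y) * (1 - y * Y) * (1 - x * X - 0.44 * (x * y)) ≤
      (y - x) * (1 - x * X) * (1 - y * Y) * (1 - x * y) +
        x * y * ((y - x) * (1 - X * Y) - (1 - x * y) * (Y - X)) := by linarith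
  refine le_trans ?_ d5
  have uv0 : 0 < x * X * (y * Y) := by positivity
  have d6 : (1 - x) * (1 - x * X * (y * Y)) ≤ (1 - x * y) * (1 - x * X - 0.44 * (x * y)) := by
    have : (1 - x) * (1 - x * X * (y * Y)) ≤ 1 - x := by nlinarith
    refine this.trans ?_
    nlinarith [mul_nonneg hx.le (sub_nonneg.2 hxy1), mul_pos xy0 xy0, mul_pos xy0 (mul_pos hx Xp)]
  have := mul_le_mul_of_nonneg_left d6 (mul_nonneg hxy'.le (by linarith : (0:ℝ) ≤ 1 - y * Y))
  linarith

/-- The key inequality. -/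
lemma Strict.KI (hp : 1 < p) (h : Strict p a1 a2 b b2 c c2) (E : EqE p a1 a2 b b2 c c2)
    {x y z W φ : ℝ} (hx : x = a2 / a1) (hy : y = b / b2) (hz : z = c2 / c)
    (hW : W = (1 - y ^ 2 * y ^ (p-2)) / (1 - y ^ (p-2))) (hp2 : 2 < p) (hφ0 : 0 ≤ φ)
    (hL : (y - x) * (1 - x) * φ * (1 - x ^ (p-2) * y ^ (p-2)) * (1 - y ^ (p-2)) ≤
      y * (1 - x ^ 2 * x ^ (p-2)) * (1 - y ^ (p-2)) - x * (1 - y ^ 2 * y ^ (p-2)) * (1 - x ^ (p-2))) :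
    (1 - y ^ (p-2) * z ^ (p-2)) * ((c2 - c) * (a1 - a2) * φ) ≤
      a2 * b2 * (W * (z ^ (p-2) - 1) + y * (z * z ^ (p-2) - 1 / z)) := by
  have hs := h.starA E hx hy hz
  obtain ⟨x0, xy, y1, z1, yz⟩ := h.xyz hp hx hy hz
  obtain ⟨pa, pb, pc, pc2, pb2, pa1⟩ := h.pos
  have y0 : 0 < y := x0.trans xy
  have z0 : 0 < z := by linarith
  have hk : 0 < p - 2 := by linarith
  have u1 : x ^ (p-2) < 1 := rpow_lt_one x0.le (xy.trans y1) hk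
  have v1 : y ^ (p-2) < 1 := rpow_lt_one y0.le y1 hk
  have vw : y ^ (p-2) * z ^ (p-2) < 1 := by
    rw [← mul_rpow y0.le z0.le]; exact rpow_lt_one (by positivity) yz hk
  have up : 0 < x ^ (p-2) := rpow_pos_of_pos x0 _
  have vp : 0 < y ^ (p-2) := rpow_pos_of_pos y0 _
  generalize x ^ (p-2) = u at *
  generalize y ^ (p-2) = v at *
  generalize z ^ (p-2) = w at *
  have v1' : 0 < 1 - v := by linarith
  have eW : W * (1 - v) = 1 - y ^ 2 * v := by rw [hW]; field_simp
  have uv : 0 < 1 - u * v := by nlinarith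
  set Br := W * (w - 1) + y * (z * w - 1 / z) with hBr
  have eB : (1 - u * v) * (1 - v) * (x * Br) =
      (1 - v * w) * (y * (1 - x ^ 2 * u) * (1 - v) - x * (1 - y ^ 2 * v) * (1 - u)) := by
    have : z * ((1 - u * v) * (1 - v) * (x * Br)) = z * ((1 - v * w) *
        (y * (1 - x ^ 2 * u) * (1 - v) - x * (1 - y ^ 2 * v) * (1 - u))) := by
      have e1 : z * ((1 - u * v) * (1 - v) * (x * Br)) = (1 - u * v) * (x * z * (W * (1 - v)) * (w - 1)
          + x * y * (z ^ 2 * w - 1) * (1 - v)) := by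
        rw [hBr]; field_simp
      rw [e1, eW, hs]; ring
    exact mul_left_cancel₀ z0.ne' this
  have k1 : (1 - v * w) * ((y - x) * (1 - x) * φ) ≤ x * Br := by
    have := mul_le_mul_of_nonneg_left hL (by linarith : (0:ℝ) ≤ 1 - v * w)
    rw [← eB] at this
    have q : (1 - u * v) * (1 - v) * ((1 - v * w) * ((y - x) * (1 - x) * φ)) ≤
      (1 - u * v) * (1 - v) * (x * Br) := by linarith
    exact le_of_mul_le_mul_left q (mul_pos uv v1')
  have k2 : c2 - c ≤ (y - x) * b2 := by
    have e2 : y * b2 = b := by rw [hy]; field_simp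
    have e3 : x * b2 ≤ a2 + (a1 - b2) := by
      have : x * a1 = a2 := by rw [hx]; field_simp
      have q := mul_le_mul_of_nonneg_left h.b2_lt.le x0.le
      linarith [h.b2_lt]
    have := h.a1_eq
    have := h.b2_eq
    linarith
  have ex : x * a1 = a2 := by rw [hx]; field_simp
  have k3 : (1 - v * w) * ((c2 - c) * (a1 - a2) * φ) ≤ (1 - v * w) * ((y - x) * b2 * (a1 - a2) * φ) := by
    apply mul_le_mul_of_nonneg_left _ (by linarith : (0:ℝ) ≤ 1 - v * w)
    apply mul_le_mul_of_nonneg_right _ hφ0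
    apply mul_le_mul_of_nonneg_right k2
    linarith [h.a2_lt, h.b1_lt, h.a1_eq]
  have k4 := mul_le_mul_of_nonneg_left k1 (mul_pos pa1 pb2).le
  have e5 : a1 * b2 * ((1 - v * w) * ((y - x) * (1 - x) * φ)) =
     (1 - v * w) * ((y - x) * b2 * (a1 - x * a1) * φ) := by ring
  have e6 : a1 * b2 * (x * Br) = (x * a1) * b2 * Br := by ring
  rw [e5, e6, ex] at k4
  linarith
end

section
open Real

/-! ### Cells for `3 ≤ p ≤ 8` -/

def B3 : List Ins :=
  [.cst K40, .inv 3, .sub 4 1, .sub 0 2, .cst 274877906944, .log 6, .mul 8 0, .mul 2 0,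
  .exp 0, .mul 0 0, .mul 0 0, .log 11, .mul 14 0, .exp 0, .sub 13 3, .sub 14 1, .log 1,
  .mul 15 0, .exp 0, .log 3, .mul 18 0, .exp 0, .sub 16 4, .sub 2 11, .exp 1, .exp 1, .mul 22 3,
  .mul 22 0, .exp 0, .mul 0 0, .mul 0 0, .mul 27 7, .exp 0, .mul 2 8, .mul 0 9, .mul 2 9,
  .sub 35 1, .sub 36 6, .inv 0, .mul 2 0, .add 41 40, .sub 22 19, .sub 1 0, .sub 17 42, .inv 18,
  .mul 20 19, .mul 49 0, .sub 46 50, .mul 0 6, .cst 1264438371942, .mul 1 0, .sub 50 0, .add 0 5,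
  .mul 10 0, .mul 35 35, .mul 36 55, .mul 57 34, .sub 1 0, .sub 22 13, .mul 34 0, .sub 27 59,
  .mul 0 21, .add 2 0, .mul 8 0]

def M3 : List Ins := [.mul 10 6, .mul 0 21, .mul 24 2, .sub 1 0]

def D3 : List Ins :=
  [.mul 10 6, .mul 67 32, .mul 41 0, .mul 34 22, .mul 64 0, .mul 0 29, .add 3 0, .mul 16 0,
  .mul 30 0, .sub 8 0]

def X3 : List Ins := [.mul 42 28, .add 65 0, .mul 12 0, .mul 0 23, .sub 0 4]

def leaf3 (H : Hs) (t : Nat) (l : List Fm) : Bool :=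
  match Nat.beq t 2 with
  | true => discT (lk l 50)
  | false => match Nat.beq t 3 with
    | true => posT H M3 l
    | false => match Nat.beq t 4 with
      | true => posT H D3 l
      | false => posT H X3 l

def cell3 (t : Nat) (pc hp bc hb s eta : Nat) : Bool :=
  inp ⟨hp, hb, eta⟩ (Int.ofNat pc) (Int.ofNat bc) (Int.subNatNat K40 (Nat.add bc eta))
    0 (-K40) [Fm.cst (Int.ofNat s)] fun l =>
  match run ⟨hp, hb, eta⟩ B3 l with
  | none => false
  | some l => leaf3 ⟨hp, hb, eta⟩ t l

def leafD3 (s eta t pl ph bl bh d : Nat) : Option Nat :=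
  frn (Nat.div (Nat.add pl ph) 2) fun pc => frn (Nat.sub ph pc) fun hp =>
  frn (Nat.div (Nat.add bl bh) 2) fun bc => frn (Nat.sub bh bc) fun hb =>
  match cell3 t pc hp bc hb s eta with
  | true => some d
  | false => none

def tree3 (s eta : Nat) : Nat → Nat → Nat → Nat → Nat → Nat → Option Nat
  | 0, _, _, _, _, _ => none
  | n + 1, pl, ph, bl, bh, d =>
    frn (Nat.mod d 16) fun t => frn (Nat.div d 16) fun d =>
    match Nat.beq t 0 with
    | true => frn (Nat.div (Nat.add pl ph) 2) fun m =>
      match tree3 s eta n pl m bl bh d with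
      | none => none
      | some d => tree3 s eta n m ph bl bh d
    | false => match Nat.beq t 1 with
      | true => frn (Nat.div (Nat.add bl bh) 2) fun m =>
        match tree3 s eta n pl ph bl m d with
        | none => none
        | some d => tree3 s eta n pl ph m bh d
      | false => leafD3 s eta t pl ph bl bh d

def Kil3 (s : Nat) (p b c : ℝ) : Prop := ∃ m : List ℝ,
  m = runR B3 [c, b, p, (s : ℝ) / K40] ∧
  (1 / 2 ≤ m.getD 50 0 ∨ 0 < val M3 m ∨ 0 < val D3 m ∨ 0 < val X3 m)

lemma leaf3_ok {H : Hs} {d0 d1 d2 : ℝ} (hH : HB H d0 d1 d2) {t : Nat} {F : List Fm}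
    {l m : List ℝ} (h : EncL d0 d1 d2 F l m) (ht : leaf3 H t F = true) :
    1 / 2 ≤ m.getD 50 0 ∨ 0 < val M3 m ∨ 0 < val D3 m ∨ 0 < val X3 m := by
  unfold leaf3 at ht
  cases e2 : Nat.beq t 2 with
  | true => rw [e2] at ht; exact Or.inl (discT_ok (h 50) ht)
  | false =>
    rw [e2] at ht
    cases e3 : Nat.beq t 3 with
    | true => rw [e3] at ht; exact Or.inr (Or.inl (posT_ok hH h ht).1)
    | false =>
      rw [e3] at ht
      cases e4 : Nat.beq t 4 with
      | true => rw [e4] at ht; exact Or.inr (Or.inr (Or.inl (posT_ok hH h ht).1))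
      | false => rw [e4] at ht; exact Or.inr (Or.inr (Or.inr (posT_ok hH h ht).1))

lemma cell3_ok {t pc hp bc hb s e : Nat} {p b c : ℝ}
    (ht : cell3 t pc hp bc hb s e = true)
    (hP : |p - (pc : ℝ) / K40| * K40 ≤ hp)
    (hB : |b - (bc : ℝ) / K40| * K40 ≤ hb)
    (h1 : b + c ≤ 1) (h2 : (1 - b - c) * K40 ≤ 2 * e) : Kil3 s p b c := by
  unfold cell3 at ht
  rw [inp_eq] at ht
  have hcc : (((Int.subNatNat K40 (Nat.add bc e) : ℤ)) : ℝ) = K40 - (bc + e) := by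
    rw [Int.subNatNat_eq_coe]; simp only [Nat.add_eq]; push_cast; ring
  have hd2 : |c - (1 - b - (e : ℝ) / K40)| * K40 ≤ e := by
    have q5 : (e : ℝ) / K40 * K40 = e := div_mul_cancel₀ _ (by norm_num)
    rcases abs_cases (c - (1 - b - (e : ℝ) / K40)) with h | h <;> rw [h.1] <;> linarith
  have hH : HB ⟨hp, hb, e⟩ (p - (pc : ℝ) / K40) (b - (bc : ℝ) / K40)
      (c - (1 - b - (e : ℝ) / K40)) := ⟨hP, hB, hd2⟩
  have hE := inp_enc (pc := Int.ofNat pc) (bc := Int.ofNat bc)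
      (cc := Int.subNatNat K40 (Nat.add bc e)) (k1 := 0) (k2 := -K40) hH
      (p := p) (b := b) (c := c) (by simp) (by simp) (by rw [hcc]; push_cast; ring)
      (EncL.cons (Enc.cst _ _ _ (Int.ofNat s)) (EncL.nil _ _ _))
  generalize hr : run _ B3 _ = r at ht
  cases r with
  | none => simp at ht
  | some F =>
    simp only at ht
    refine ⟨_, ?_, leaf3_ok hH (run_ok hH B3 hE hr) ht⟩
    simp

lemma tree3_ok {s e : Nat} (n : Nat) : ∀ {pl ph bl bh d d' : Nat} {p b c : ℝ},
    tree3 s e n pl ph bl bh d = some d' →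
    (pl : ℝ) ≤ p * K40 → p * K40 ≤ ph →
    (bl : ℝ) ≤ b * K40 → b * K40 ≤ bh →
    b + c ≤ 1 → (1 - b - c) * K40 ≤ 2 * e → Kil3 s p b c := by
  induction n with
  | zero => intro pl ph bl bh d d' p b c h; simp [tree3] at h
  | succ n ih =>
    intro pl ph bl bh d d' p b c ht hp1 hp2 hb1 hb2 k1 k2
    simp only [tree3, frn_eq] at ht
    cases e0 : Nat.beq (Nat.mod d 16) 0 with
    | true =>
      rw [e0] at ht
      simp only at ht
      split at ht
      case h_1 => exact absurd ht (by simp)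
      case h_2 d1 hd1 =>
        rcases le_total (p * K40) ((Nat.div (Nat.add pl ph) 2 : Nat) : ℝ) with h | h
        · exact ih hd1 hp1 h hb1 hb2 k1 k2
        · exact ih ht h hp2 hb1 hb2 k1 k2
    | false =>
      rw [e0] at ht
      simp only at ht
      cases e1 : Nat.beq (Nat.mod d 16) 1 with
      | true =>
        rw [e1] at ht
        simp only at ht
        split at ht
        case h_1 => exact absurd ht (by simp)
        case h_2 d1 hd1 =>
          rcases le_total (b * K40) ((Nat.div (Nat.add bl bh) 2 : Nat) : ℝ) with h | h
          · exact ih hd1 hp1 hp2 hb1 h k1 k2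
          · exact ih ht hp1 hp2 h hb2 k1 k2
      | false =>
        rw [e1] at ht
        simp only at ht
        unfold leafD3 at ht
        simp only [frn_eq] at ht
        generalize hx : cell3 _ _ _ _ _ _ _ = x at ht
        cases x with
        | false => simp at ht
        | true => exact cell3_ok hx (mid_ok hp1 hp2) (mid_ok hb1 hb2) k1 k2

lemma slabA : okT (tree3 0 1649267442 18 3298534883328 4398046511104 68719476736 K39
    50670873130292871772641269201006815446412795042853397520865510140230342935680419351896542902600019422593067748581149966375250213200795553211282914394417721522329413782651125057127708614266799193583529762416603261898427475783362006832699255432226753164033897042060303220931034579278320640273) = true := by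
  decide +kernel

lemma slabB : okT (tree3 K40 93458488 18 4398046511104 8796093022208 68719476736 K39
    6064963937361478351051438562633592773027926246078856606276749313578483549704564742817157219525162017324733330842558685968772451594243319221870118365185561141219255592855902053070413805200091447553) = true := by
  decide +kernel
end

section
open Real

variable {p a1 a2 b c b2 c2 : ℝ}

def pre3 (p b c s b2 c2 y z yk zk ly lz : ℝ) : List ℝ :=
  [zk, (p-1-1)*lz, yk, exp (1/4*((p-1-1)*ly)) * exp (1/4*((p-1-1)*ly)), exp (1/4*((p-1-1)*ly)),
    1/4*((p-1-1)*ly), (p-1-1)*ly, z, y, lz, ly, c2, p⁻¹ * log (1 - c^p), log (1 - c^p),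
    b2, p⁻¹ * log (1 - b^p), log (1 - b^p), 1 - c^p, 1 - b^p, c^p, p * log c, log c, b^p,
    exp (1/4*(p * log b)) * exp (1/4*(p * log b)), exp (1/4*(p * log b)), 1/4*(p * log b), p * log b,
    log b, 1/4, p-1-1, p-1, p⁻¹, 1, c, b, p, s]

def B3' : List Ins := B3.drop 33

lemma cst_qt : (((274877906944 : ℤ)) : ℝ) / K40 = 1 / 4 := by norm_num

lemma exp_quart (x : ℝ) : exp (1/4 * x) * exp (1/4 * x) * (exp (1/4 * x) * exp (1/4 * x)) = exp x := by
  rw [← exp_add, ← exp_add]; ring_nf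

lemma Strict.B3 (hp : 1 < p) (h : Strict p a1 a2 b b2 c c2) (s : ℝ) : ∃ ly lz,
    runR B3 [c, b, p, s] = runR B3' (pre3 p b c s b2 c2 (b / b2) (c2 / c) ((b / b2) ^ (p-1-1))
      ((c2 / c) ^ (p-1-1)) ly lz) := by
  obtain ⟨pa, pb, pc, pc2, pb2, pa1⟩ := h.pos
  have n1 : 0 < b2 ^ p := by positivity
  have n2 : 0 < c2 ^ p := by positivity
  have m1 : 0 < 1 - b ^ p := by linarith [h.nb]
  have m2 : 0 < 1 - c ^ p := by linarith [h.nc]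
  have r1 : exp (p⁻¹ * log (1 - b ^ p)) = b2 := by rw [exp_mul_log m1, h.b2_root hp]
  have r2 : exp (p⁻¹ * log (1 - c ^ p)) = c2 := by rw [exp_mul_log m2, h.c2_root hp]
  set ly := log b - p⁻¹ * log (1 - b ^ p) with hly
  set lz := p⁻¹ * log (1 - c ^ p) - log c with hlz
  have r3 : exp ly = b / b2 := by rw [hly, exp_sub, exp_log pb, r1]
  have r4 : exp lz = c2 / c := by rw [hlz, exp_sub, exp_log pc, r2]
  refine ⟨ly, lz, ?_⟩
  unfold Mk.B3
  refine runR_tr 1 (by exact cst_one) ?_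
  refine runR_tr p⁻¹ rfl ?_
  refine runR_tr (p-1) rfl ?_
  refine runR_tr (p-1-1) rfl ?_
  refine runR_tr (1/4) (by exact cst_qt) ?_
  refine runR_tr (log b) rfl ?_
  refine runR_tr (p * log b) rfl ?_
  refine runR_tr (1/4 * (p * log b)) rfl ?_
  refine runR_tr (exp (1/4 * (p * log b))) rfl ?_
  refine runR_tr (exp (1/4 * (p * log b)) * exp (1/4 * (p * log b))) rfl ?_
  refine runR_tr (b ^ p) (by exact (exp_quart _).trans (exp_mul_log pb p)) ?_
  refine runR_tr (log c) rfl ?_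
  refine runR_tr (p * log c) rfl ?_
  refine runR_tr (c ^ p) (by exact (exp_mul_log pc p)) ?_
  refine runR_tr (1 - b ^ p) rfl ?_
  refine runR_tr (1 - c ^ p) rfl ?_
  refine runR_tr (log (1 - b ^ p)) rfl ?_
  refine runR_tr (p⁻¹ * log (1 - b ^ p)) rfl ?_
  refine runR_tr b2 (by exact r1) ?_
  refine runR_tr (log (1 - c ^ p)) rfl ?_
  refine runR_tr (p⁻¹ * log (1 - c ^ p)) rfl ?_
  refine runR_tr c2 (by exact r2) ?_
  refine runR_tr ly rfl ?_
  refine runR_tr lz rfl ?_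
  refine runR_tr (b / b2) (by exact r3) ?_
  refine runR_tr (c2 / c) (by exact r4) ?_
  refine runR_tr ((p-1-1)*ly) rfl ?_
  refine runR_tr (1/4*((p-1-1)*ly)) rfl ?_
  refine runR_tr (exp (1/4*((p-1-1)*ly))) rfl ?_
  refine runR_tr (exp (1/4*((p-1-1)*ly)) * exp (1/4*((p-1-1)*ly))) rfl ?_
  refine runR_tr ((b / b2) ^ (p-1-1)) (by
    refine (exp_quart _).trans ?_
    rw [← r3, ← exp_mul, mul_comm]) ?_
  refine runR_tr ((p-1-1)*lz) rfl ?_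
  refine runR_tr ((c2 / c) ^ (p-1-1)) (by
    show exp ((p-1-1)*lz) = _
    rw [← r4, ← exp_mul, mul_comm]) ?_
  rfl

section
variable {s y z yk zk ly lz : ℝ}

def f3 (s y z a2 : ℝ) : ℝ :=
  1 - (1 - s) * a2 * ((((1264438371942 : ℤ)) : ℝ) / K40) + s * (y * z)

def W3 (y yk : ℝ) : ℝ := (1 - yk * y * y) * (1 - yk)⁻¹

lemma disc3 : (runR B3' (pre3 p b c s b2 c2 y z yk zk ly lz)).getD 50 0 = c ^ p := rfl

lemma M3_val : val M3 (runR B3' (pre3 p b c s b2 c2 y z yk zk ly lz)) =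
    (b + c - (b2 - c2)) * f3 s y z (b2 - c2) * (b2 * c - b * c2) * (z - 1) -
      (b2 - c2) * (b2 * b2 * (y * (zk * z - z⁻¹) + (zk - 1) * W3 y yk)) := rfl

lemma D3_val : val D3 (runR B3' (pre3 p b c s b2 c2 y z yk zk ly lz)) =
    (b + c - (b2 - c2)) * f3 s y z (b2 - c2) * (b2 * c - b * c2) -
      (b2 - c2) * (b2 * b2 * (y * (p * zk) + (p-1-1) * (zk * z⁻¹) * W3 y yk)) := rfl

lemma X3_val : val X3 (runR B3' (pre3 p b c s b2 c2 y z yk zk ly lz)) =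
    (b + c - (b2 - c2)) * f3 s y z (b2 - c2) * (c + c2 * (zk * z)) * (z - 1) -
      (b2 * b2 * (y * (zk * z - z⁻¹) + (zk - 1) * W3 y yk)) := rfl
end
end

section
open Real

variable {p a1 a2 b c b2 c2 : ℝ}

/-- Main inequality in the form used by the cells. -/
lemma Strict.main3 (hp : 3 ≤ p) (h : Strict p a1 a2 b b2 c c2) (E : EqE p a1 a2 b b2 c c2)
    {x y z f φ : ℝ} (hx : x = a2 / a1) (hy : y = b / b2) (hz : z = c2 / c) (hφ0 : 0 ≤ φ)
    (hL : (y - x) * (1 - x) * φ * (1 - x ^ (p-2) * y ^ (p-2)) * (1 - y ^ (p-2)) ≤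
      y * (1 - x ^ 2 * x ^ (p-2)) * (1 - y ^ (p-2)) - x * (1 - y ^ 2 * y ^ (p-2)) * (1 - x ^ (p-2)))
    (hf : (1 - y * z) * f ≤ (1 - y ^ (p-2) * z ^ (p-2)) * φ) :
    (a1 - a2) * f * (b2 * c - b * c2) * (z - 1) ≤
      a2 * (b2 * b2 * (y * (z ^ (p-2) * z - z⁻¹) + (z ^ (p-2) - 1) * W3 y (y ^ (p-2)))) := by
  have hp1 : 1 < p := by linarith
  have hW : W3 y (y ^ (p-2)) = (1 - y ^ 2 * y ^ (p-2)) / (1 - y ^ (p-2)) := by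
    unfold W3; rw [div_eq_mul_inv]; ring
  have K := h.KI hp1 E hx hy hz hW (by linarith) hφ0 hL
  obtain ⟨pa, pb, pc, pc2, pb2, pa1⟩ := h.pos
  obtain ⟨x0, xy, y1, z1, yz⟩ := h.xyz hp1 hx hy hz
  generalize y ^ (p-2) = v at *
  generalize z ^ (p-2) = w at *
  have e1 : b2 * c - b * c2 = b2 * c * (1 - y * z) := by rw [hy, hz]; field_simp
  have e2 : c2 - c = c * (z - 1) := by rw [hz]; field_simp
  rw [e2] at K
  rw [e1]
  have k1 := mul_le_mul_of_nonneg_left K pb2.le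
  have q : 0 ≤ b2 * (c * (z - 1) * (a1 - a2)) := by
    have : a2 < a1 := by linarith [h.a2_lt, h.b1_lt, h.a1_eq]
    exact mul_nonneg pb2.le (mul_nonneg (mul_nonneg pc.le (by linarith)) (by linarith))
  have k2 := mul_le_mul_of_nonneg_left hf q
  have e3 : y * (w * z - z⁻¹) + (w - 1) * W3 y v = W3 y v * (w - 1) + y * (z * w - 1 / z) := by
    rw [one_div]; ring
  rw [e3]
  linarith

lemma Strict.kil3_false (hp : 3 ≤ p) (h : Strict p a1 a2 b b2 c c2) {s : ℕ} {y z f : ℝ}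
    (hy : y = b / b2) (hz : z = c2 / c) (hf : f = f3 ((s : ℝ) / K40) y z a2) (hf0 : 0 ≤ f)
    (hm : (a1 - a2) * f * (b2 * c - b * c2) * (z - 1) ≤
      a2 * (b2 * b2 * (y * (z ^ (p-2) * z - z⁻¹) + (z ^ (p-2) - 1) * W3 y (y ^ (p-2))))) :
    ¬ Kil3 s p b c := by
  have hp1 : 1 < p := by linarith
  rintro ⟨m, hm1, hm2⟩
  obtain ⟨ly, lz, e⟩ := h.B3 hp1 ((s : ℝ) / K40)
  rw [hm1, e, disc3, M3_val, D3_val, X3_val] at hm2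
  obtain ⟨pa, pb, pc, pc2, pb2, pa1⟩ := h.pos
  obtain ⟨x0, xy, y1, z1, yz⟩ := h.xyz hp1 (x := a2 / a1) rfl hy hz
  have y0 := x0.trans xy
  have e1 : b + c = a1 := by linarith [h.a1_eq]
  have e2 : b2 - c2 = a2 := by linarith [h.b2_eq]
  have e3 : p - 1 - 1 = p - 2 := by ring
  rw [e1, e2, ← hy, ← hz, ← hf, e3] at hm2
  have z0 : 0 < z := by linarith
  have v1 : y ^ (p-2) < 1 := rpow_lt_one y0.le y1 (by linarith)
  have v0 : 0 < y ^ (p-2) := rpow_pos_of_pos y0 _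
  have W0 : 0 ≤ W3 y (y ^ (p-2)) := by
    unfold W3
    have : y ^ (p-2) * y * y < 1 := by nlinarith [mul_pos v0 y0]
    apply mul_nonneg (by linarith)
    rw [inv_nonneg]; linarith
  have a12 : 0 < a1 - a2 := by linarith [h.a2_lt, h.b1_lt, h.a1_eq]
  have w1 : 1 ≤ z ^ (p-2) := one_le_rpow z1.le (by linarith)
  rcases hm2 with hh | hh | hh | hh
  · linarith [h.c_half hp1]
  · linarith
  · -- derivative test
    have t1 : z ^ (p-2) * z - z⁻¹ ≤ p * z ^ (p-2) * (z - 1) := by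
      have t := tangent_le hp1 (x := 1) (y := z) zero_le_one z0
      rw [one_rpow] at t
      have c1 : z ^ p = z ^ (p-2) * z * z := by
        rw [← rpow_add_one z0.ne', ← rpow_add_one z0.ne']; ring_nf
      have c3 : z ^ (p-1) = z ^ (p-2) * z := by
        rw [← rpow_add_one z0.ne']; ring_nf
      rw [c1, c3] at t
      have : z * (z ^ (p-2) * z - z⁻¹) ≤ z * (p * z ^ (p-2) * (z - 1)) := by
        rw [mul_sub, mul_inv_cancel₀ z0.ne']; linarith
      exact le_of_mul_le_mul_left this z0
    have t2 : z ^ (p-2) - 1 ≤ (p-2) * (z ^ (p-2) * z⁻¹) * (z - 1) := by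
      have c3 : z ^ (p-2) * z⁻¹ = z ^ (p-2-1) := by rw [rpow_sub_one z0.ne']; rfl
      rw [c3]
      rcases (show 1 ≤ p - 2 by linarith).eq_or_lt with q | q
      · rw [← q]; simp
      · have t := tangent_le q (x := 1) (y := z) zero_le_one z0
        rw [one_rpow] at t; linarith
    generalize z ^ (p-2) = w at *
    generalize W3 y (y ^ (p-2)) = W at *
    have t3 : y * (w * z - z⁻¹) + (w - 1) * W ≤
        (y * (p * w) + (p-2) * (w * z⁻¹) * W) * (z - 1) := by
      have := mul_le_mul_of_nonneg_left t1 y0.le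
      have := mul_le_mul_of_nonneg_right t2 W0
      linarith
    have t4 := mul_le_mul_of_nonneg_left t3 (mul_nonneg pa.le (mul_pos pb2 pb2).le)
    have := mul_pos hh (sub_pos.2 z1)
    linarith
  · have k := h.a2_le hp1
    have k2 : a2 * (z ^ (p-2) * z) ≤ c - b := by
      have c3 : z ^ (p-2) * z = z ^ (p-1) := by
        rw [← rpow_add_one z0.ne']; ring_nf
      rw [c3, hz, div_rpow pc2.le pc.le]
      have : 0 < c ^ (p-1) := rpow_pos_of_pos pc _
      rw [← mul_div_assoc, div_le_iff₀ this]; linarith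
    generalize z ^ (p-2) = w at *
    generalize W3 y (y ^ (p-2)) = W at *
    have k3 : a2 * (c + c2 * (w * z)) ≤ b2 * c - b * c2 := by
      have := mul_le_mul_of_nonneg_left k2 pc2.le
      have e4 : b2 = a2 + c2 := h.b2_eq
      rw [e4]; linarith
    have k4 := mul_le_mul_of_nonneg_left k3 (mul_nonneg (mul_nonneg a12.le hf0) (sub_pos.2 z1).le)
    have := mul_pos pa hh
    linarith

/-- Crude bounds. -/
lemma Strict.bnds {n : ℕ} (hp : 1 < p) (hn : (n : ℝ) ≤ p) (h : Strict p a1 a2 b b2 c c2) {γ : ℝ}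
    (hγ0 : 0 ≤ γ) (hγ : γ ^ n ≤ 1 / 2) : γ < c2 ∧ a2 < 1 - γ ∧ 1 - a2 ^ n ≤ a1 ^ n ∧ 1 - (1/2) ^ n ≤ b2 ^ n := by
  obtain ⟨pa, pb, pc, pc2, pb2, pa1⟩ := h.pos
  have l1 := h.lt_one hp
  have c21 : c2 < 1 := by linarith [h.c2_lt, h.b2_lt]
  have q1 : c2 ^ p ≤ c2 ^ n := by
    rw [← rpow_natCast]; exact rpow_le_rpow_of_exponent_ge pc2 c21.le hn
  have q2 := h.c_half hp
  have q3 : γ ^ n < c2 ^ n := by linarith [h.nc]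
  have q4 : γ < c2 := lt_of_pow_lt_pow_left₀ n pc2.le q3
  have a21 : a2 < 1 := by linarith [h.a2_lt, h.b1_lt, h.a1_eq]
  have q5 : a2 ^ p ≤ a2 ^ n := by
    rw [← rpow_natCast]; exact rpow_le_rpow_of_exponent_ge pa a21.le hn
  have q6 : a1 ^ p ≤ a1 ^ n := by
    rw [← rpow_natCast]; exact rpow_le_rpow_of_exponent_ge pa1 l1.le hn
  have bh : b ≤ 1 / 2 := by linarith [h.b1_lt, h.a1_eq]
  have q7 : b ^ p ≤ (1/2) ^ n := by
    calc b ^ p ≤ b ^ n := by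
          rw [← rpow_natCast]; exact rpow_le_rpow_of_exponent_ge pb (by linarith) hn
      _ ≤ _ := pow_le_pow_left₀ pb.le bh n
  have q8 : b2 ^ p ≤ b2 ^ n := by
    rw [← rpow_natCast]; exact rpow_le_rpow_of_exponent_ge pb2 (by linarith [h.b2_lt]) hn
  refine ⟨q4, ?_, by linarith [h.na], by linarith [h.nb]⟩
  linarith [h.b2_eq, h.b2_lt]

lemma Strict.region3a (hp : 3 ≤ p) (hp4 : p ≤ 4) (h : Strict p a1 a2 b b2 c c2)
    (E : EqE p a1 a2 b b2 c c2) : False := by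
  have hp1 : 1 < p := by linarith
  obtain ⟨pa, pb, pc, pc2, pb2, pa1⟩ := h.pos
  have l1 := h.lt_one hp1
  obtain ⟨g1, g2, g3, g4⟩ := h.bnds (n := 3) hp1 (by exact_mod_cast hp) (γ := 0.793) (by norm_num) (by norm_num)
  have a1b : (0.997 : ℝ) < a1 := by
    have : a2 ^ 3 ≤ (0.207) ^ 3 := pow_le_pow_left₀ pa.le (by norm_num at g2 ⊢; linarith) 3
    refine lt_of_pow_lt_pow_left₀ 3 pa1.le ?_
    norm_num at this ⊢; linarith
  have b2b : (0.95 : ℝ) < b2 := by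
    refine lt_of_pow_lt_pow_left₀ 3 pb2.le ?_
    norm_num at g4 ⊢; linarith
  have bh : b < 1 / 2 := by linarith [h.b1_lt, h.a1_eq]
  have bl : 1 / 16 ≤ b := by
    by_contra hb
    push Not at hb
    have f4 : (0.9345 : ℝ) ≤ c := by norm_num at a1b ⊢; linarith [h.a1_eq]
    have f5 : c ^ (4:ℝ) ≤ c ^ p := rpow_le_rpow_of_exponent_ge pc (by linarith [h.c_lt, h.c2_lt, h.b2_lt]) hp4
    have f6 : (0.9345 : ℝ) ^ 4 ≤ c ^ 4 := pow_le_pow_left₀ (by norm_num) f4 4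
    have f7 : c ^ (4:ℝ) = c ^ 4 := by exact_mod_cast rpow_natCast c 4
    rw [f7] at f5
    have := h.c_half hp1
    norm_num at f6
    linarith
  obtain ⟨x0, xy, y1, z1, yz⟩ := h.xyz hp1 (x := a2 / a1) rfl (y := b / b2) rfl (z := c2 / c) rfl
  have hxb : a2 / a1 ≤ 1.004 * a2 := by
    rw [div_le_iff₀ pa1]; norm_num at a1b ⊢; nlinarith
  have hyb : b / b2 ≤ 0.527 := by
    rw [div_le_iff₀ pb2]; norm_num at b2b ⊢; linarith
  have g2' : a2 < 0.207 := by norm_num at g2 ⊢; linarith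
  have z0 : 0 < c2 / c := by linarith
  obtain ⟨d, hd⟩ := okT_some slabA
  have hk : Kil3 0 p b c := tree3_ok 18 hd (by push_cast; linarith) (by push_cast; linarith)
    (by push_cast; linarith) (by push_cast; linarith) (by linarith [h.a1_eq])
    (by push_cast; norm_num at a1b ⊢; linarith [h.a1_eq])
  have ef : (1 - 1264438371942 / K40 * a2) = f3 (((0 : ℕ) : ℝ) / K40) (b / b2) (c2 / c) a2 := by
    unfold f3; push_cast; ring
  have f0 : 0 ≤ 1 - 1264438371942 / K40 * a2 := by norm_num at g2' ⊢; linarith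
  refine h.kil3_false hp rfl rfl ef f0 ?_ hk
  refine h.main3 hp E rfl rfl rfl (φ := 1 - 1264438371942 / K40 * a2) f0 ?_ ?_
  · refine Lprime_small (by linarith) (by linarith) x0 xy y1 ?_ f0
    generalize a2 / a1 = x at *
    generalize b / b2 = y at *
    have xy1 : x * y ≤ 0.1096 := by
      have : x ≤ 0.20783 := by norm_num at g2' hxb ⊢; linarith
      calc x * y ≤ 0.20783 * 0.527 := mul_le_mul this hyb (by linarith) (by norm_num)
        _ ≤ _ := by norm_num
    have xy0 : 0 < x * y := by nlinarith
    have : a2 * (x * y) ≤ a2 * 0.1096 := mul_le_mul_of_nonneg_left xy1 pa.le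
    norm_num at this hxb ⊢; linarith
  · apply mul_le_mul_of_nonneg_right _ f0
    rw [← mul_rpow (x0.trans xy).le z0.le]
    have : (b / b2 * (c2 / c)) ^ (p-2) ≤ (b / b2 * (c2 / c)) ^ (1:ℝ) :=
      rpow_le_rpow_of_exponent_ge (mul_pos (x0.trans xy) z0) yz.le (by linarith)
    rw [rpow_one] at this; linarith

lemma Strict.region3b (hp : 4 ≤ p) (hp4 : p ≤ 8) (h : Strict p a1 a2 b b2 c c2)
    (E : EqE p a1 a2 b b2 c c2) : False := by
  have hp1 : 1 < p := by linarith
  obtain ⟨pa, pb, pc, pc2, pb2, pa1⟩ := h.pos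
  have l1 := h.lt_one hp1
  obtain ⟨g1, g2, g3, g4⟩ := h.bnds (n := 4) hp1 (by exact_mod_cast hp) (γ := 0.8408) (by norm_num) (by norm_num)
  have a1b : (0.999831 : ℝ) < a1 := by
    have : a2 ^ 4 ≤ (0.1592) ^ 4 := pow_le_pow_left₀ pa.le (by norm_num at g2 ⊢; linarith) 4
    refine lt_of_pow_lt_pow_left₀ 4 pa1.le ?_
    norm_num at this ⊢; linarith
  have b2b : (0.98 : ℝ) < b2 := by
    refine lt_of_pow_lt_pow_left₀ 4 pb2.le ?_
    norm_num at g4 ⊢; linarith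
  have bh : b < 1 / 2 := by linarith [h.b1_lt, h.a1_eq]
  have bl : 1 / 16 ≤ b := by
    by_contra hb
    push Not at hb
    have f4 : (0.937 : ℝ) ≤ c := by norm_num at a1b ⊢; linarith [h.a1_eq]
    have f5 : c ^ (8:ℝ) ≤ c ^ p := rpow_le_rpow_of_exponent_ge pc (by linarith [h.c_lt, h.c2_lt, h.b2_lt]) hp4
    have f6 : (0.937 : ℝ) ^ 8 ≤ c ^ 8 := pow_le_pow_left₀ (by norm_num) f4 8
    have f7 : c ^ (8:ℝ) = c ^ 8 := by exact_mod_cast rpow_natCast c 8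
    rw [f7] at f5
    have := h.c_half hp1
    norm_num at f6
    linarith
  obtain ⟨x0, xy, y1, z1, yz⟩ := h.xyz hp1 (x := a2 / a1) rfl (y := b / b2) rfl (z := c2 / c) rfl
  have hxb : a2 / a1 ≤ 0.16 := by
    rw [div_le_iff₀ pa1]; norm_num at a1b g2 ⊢; linarith
  have hyb : b / b2 ≤ 0.52 := by
    rw [div_le_iff₀ pb2]; norm_num at b2b ⊢; linarith
  have z0 : 0 < c2 / c := by linarith
  obtain ⟨d, hd⟩ := okT_some slabB
  have hk : Kil3 K40 p b c := tree3_ok 18 hd (by push_cast; linarith) (by push_cast; linarith)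
    (by push_cast; linarith) (by push_cast; linarith) (by linarith [h.a1_eq])
    (by push_cast; norm_num at a1b ⊢; linarith [h.a1_eq])
  have ef : (1 + b / b2 * (c2 / c)) =
      f3 (((K40 : ℕ) : ℝ) / K40) (b / b2) (c2 / c) a2 := by
    unfold f3; push_cast; rw [div_self (by norm_num)]; ring
  have s0 : 0 < b / b2 * (c2 / c) := mul_pos (x0.trans xy) z0
  refine h.kil3_false (by linarith) rfl rfl ef (by linarith) ?_ hk
  refine h.main3 (by linarith) E rfl rfl rfl (φ := 1) zero_le_one ?_ ?_
  · rw [mul_one]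
    refine Lprime_big (by linarith) x0 xy (by norm_num at hyb ⊢; linarith) (by norm_num at hyb hxb ⊢; linarith)
  · rw [← mul_rpow (x0.trans xy).le z0.le]
    have : (b / b2 * (c2 / c)) ^ (p-2) ≤ (b / b2 * (c2 / c)) ^ (2:ℝ) :=
      rpow_le_rpow_of_exponent_ge s0 yz.le (by linarith)
    rw [rpow_two] at this
    generalize b / b2 * (c2 / c) = t at *
    linarith
end

section
open Real

variable {p a1 a2 b c b2 c2 : ℝ}

lemma Strict.zlog (hp : 1 < p) (h : Strict p a1 a2 b b2 c c2) {z : ℝ} (hz : z = c2 / c) :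
    a2 * (z ^ p - 1) * p ≤ 2 * log 2 * (1 - 2 * c ^ p) ∧ 2 * (1 - 2 * c ^ p) ≤ p * (z - 1) := by
  obtain ⟨pa, pb, pc, pc2, pb2, pa1⟩ := h.pos
  have l1 := h.lt_one hp
  have z0 : 0 < z := by rw [hz]; positivity
  have z1 : 1 < z := by rw [hz, one_lt_div pc]; exact h.c_lt
  have g2 : c ^ p < 1 / 2 := by linarith [h.c_half hp]
  have g0 : 0 < c ^ p := rpow_pos_of_pos pc _
  have e1 : z ^ p * c ^ p = 1 - c ^ p := by
    rw [hz, div_rpow pc2.le pc.le, div_mul_cancel₀ _ g0.ne']; linarith [h.nc]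
  have e2 : c2 ^ p = 1 - c ^ p := by linarith [h.nc]
  generalize c ^ p = g at *
  have Z1 : 1 < z ^ p := one_lt_rpow z1 (by linarith)
  constructor
  · have k1 : ((1:ℝ)/2) ^ (2 * g) ≤ 1 - g := by
      have := rpow_one_add_le_one_add_mul_self (s := -(1/2)) (by norm_num) (p := 2 * g) (by linarith) (by linarith)
      norm_num at this ⊢; linarith
    have k2 := log_le_log (by positivity) k1
    rw [log_rpow (by norm_num), ← e2, log_rpow pc2, one_div, log_inv] at k2
    have k3 := log_le_sub_one_of_pos pc2
    have k4 : a2 ≤ 1 - c2 := by linarith [h.b2_eq, h.b2_lt]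
    have k5 : a2 * p ≤ 2 * g * log 2 := by
      have := mul_le_mul_of_nonneg_left k3 (show 0 ≤ p by linarith)
      have := mul_le_mul_of_nonneg_right k4 (show 0 ≤ p by linarith)
      linarith
    have k6 := mul_le_mul_of_nonneg_right k5 (show 0 ≤ z ^ p - 1 by linarith)
    have : 2 * g * log 2 * (z ^ p - 1) = 2 * log 2 * (1 - 2 * g) := by
      linear_combination 2 * log 2 * e1
    linarith
  · have k1 := le_log_one_add_of_nonneg (x := z ^ p - 1) (by linarith)
    rw [add_sub_cancel, log_rpow z0] at k1
    have k2 := mul_le_mul_of_nonneg_left (log_le_sub_one_of_pos z0) (show 0 ≤ p by linarith)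
    have k3 : 2 * (z ^ p - 1) / (z ^ p - 1 + 2) = 2 * (1 - 2 * g) := by
      rw [div_eq_iff (by linarith)]
      linear_combination 4 * e1
    linarith

set_option maxHeartbeats 800000 in
lemma Strict.region3c (hp : 8 ≤ p) (h : Strict p a1 a2 b b2 c c2)
    (E : EqE p a1 a2 b b2 c c2) : False := by
  have hp1 : 1 < p := by linarith
  obtain ⟨pa, pb, pc, pc2, pb2, pa1⟩ := h.pos
  have l1 := h.lt_one hp1
  obtain ⟨g1, g2, g3, g4⟩ := h.bnds (n := 8) hp1 (by exact_mod_cast hp) (γ := 0.917) (by norm_num) (by norm_num)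
  have a1b : (0.99999 : ℝ) < a1 := by
    have : a2 ^ 8 ≤ (0.083) ^ 8 := pow_le_pow_left₀ pa.le (by norm_num at g2 ⊢; linarith) 8
    refine lt_of_pow_lt_pow_left₀ 8 pa1.le ?_
    norm_num at this ⊢; linarith
  have b2b : (0.999 : ℝ) < b2 := by
    refine lt_of_pow_lt_pow_left₀ 8 pb2.le ?_
    norm_num at g4 ⊢; linarith
  have b21 : b2 < 1 := by linarith [h.b2_lt]
  have bh : b < 1 / 2 := by linarith [h.b1_lt, h.a1_eq]
  obtain ⟨x, hx⟩ : ∃ x, x = a2 / a1 := ⟨_, rfl⟩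
  obtain ⟨y, hy⟩ : ∃ x, x = b / b2 := ⟨_, rfl⟩
  obtain ⟨z, hz⟩ : ∃ x, x = c2 / c := ⟨_, rfl⟩
  obtain ⟨x0, xy, y1, z1, yz⟩ := h.xyz hp1 hx hy hz
  have hxb : x ≤ 0.09 := by
    rw [hx, div_le_iff₀ pa1]; norm_num at a1b g2 ⊢; linarith
  have hyb : y ≤ 0.5006 := by
    rw [hy, div_le_iff₀ pb2]; norm_num at b2b ⊢; linarith
  have y0 := x0.trans xy
  have z0 : 0 < z := by linarith
  have s0 : 0 < y * z := mul_pos y0 z0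
  have hL : (y - x) * (1 - x) * 1 * (1 - x ^ (p-2) * y ^ (p-2)) * (1 - y ^ (p-2)) ≤
      y * (1 - x ^ 2 * x ^ (p-2)) * (1 - y ^ (p-2)) - x * (1 - y ^ 2 * y ^ (p-2)) * (1 - x ^ (p-2)) := by
    rw [mul_one]
    exact Lprime_big (by linarith) x0 xy (by norm_num at hyb ⊢; linarith) (by norm_num at hyb hxb ⊢; linarith)
  have r6 : ∀ t : ℝ, 0 < t → t ≤ 1 → t ^ (p-2) ≤ t ^ 6 := by
    intro t t0 t1
    rw [← rpow_natCast]; exact rpow_le_rpow_of_exponent_ge t0 t1 (by push_cast; linarith)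
  have v0 : 0 < y ^ (p-2) := rpow_pos_of_pos y0 _
  have v1 : y ^ (p-2) ≤ 0.0158 := by
    have := pow_le_pow_left₀ y0.le hyb 6
    have := r6 y y0 y1.le
    norm_num at *; linarith
  have hW1 : (1 - y ^ 2 * y ^ (p-2)) / (1 - y ^ (p-2)) ≤ 1.0161 := by
    rw [div_le_iff₀ (by norm_num at v1 ⊢; linarith)]
    have := mul_pos (pow_pos y0 2) v0
    norm_num at v1 ⊢; linarith
  have hW0 : 0 < (1 - y ^ 2 * y ^ (p-2)) / (1 - y ^ (p-2)) := by
    apply div_pos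
    · have : y ^ 2 * y ^ (p-2) ≤ 1 * y ^ (p-2) :=
        mul_le_mul_of_nonneg_right (pow_le_one₀ y0.le y1.le) v0.le
      norm_num at v1; linarith
    · norm_num at v1; linarith
  have w1 : 1 ≤ z ^ (p-2) := one_le_rpow z1.le (by linarith)
  have hzp : z ^ p = z ^ (p-2) * z * z := by
    rw [← rpow_add_one z0.ne', ← rpow_add_one z0.ne']; ring_nf
  have hs6 : y ^ (p-2) * z ^ (p-2) ≤ (y * z) ^ 6 := by
    rw [← mul_rpow y0.le z0.le]; exact r6 _ s0 yz.le
  have e2 : c2 = c * z := by rw [hz]; field_simp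
  have e3 : b = b2 * y := by rw [hy]; field_simp
  rcases le_or_gt (y * z) 0.66 with hs | hs
  · have K := h.KI hp1 E hx hy hz rfl (by linarith) zero_le_one hL
    obtain ⟨q1, q2⟩ := h.zlog hp1 hz
    have hc : 0 < 1 - 2 * c ^ p := by linarith [h.c_half hp1]
    rw [hzp] at q1
    have s6 : (y * z) ^ 6 ≤ 0.0827 := by
      have := pow_le_pow_left₀ s0.le hs 6
      norm_num at this ⊢; linarith
    have hA : 0.9173 ≤ 1 - y ^ (p-2) * z ^ (p-2) := by norm_num at s6 ⊢; linarith
    have hD : 0.9169 ≤ a1 - a2 := by norm_num at a1b g2 ⊢; linarith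
    generalize 1 - 2 * c ^ p = G at *
    generalize y ^ (p-2) * z ^ (p-2) = t at *
    generalize (1 - y ^ 2 * y ^ (p-2)) / (1 - y ^ (p-2)) = W at *
    generalize z ^ (p-2) = w at *
    have hln := log_two_lt_d9
    have hl0 : 0 < log 2 := log_pos (by norm_num)
    have k1 : 0.9173 * 0.9169 ≤ (1 - t) * (a1 - a2) := mul_le_mul hA hD (by norm_num) (by norm_num at hA ⊢; linarith)
    have k2 : (2 * G) * c ≤ (p * (z - 1)) * c := mul_le_mul_of_nonneg_right q2 pc.le
    have k3 : 0.9173 * 0.9169 * (2 * G * c) ≤ (1 - t) * (a1 - a2) * (p * (z - 1) * c) :=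
      mul_le_mul k1 k2 (by positivity) (le_trans (by norm_num) k1)
    have k4 : z * z * (W * (w - 1) + y * (z * w - 1 / z)) ≤ (w * z * z - 1) * (W + y * z) := by
      have : z * z * (y * (z * w - 1 / z)) = (w * z * z - 1) * (y * z) := by field_simp
      have : W * 1 ≤ W * (z * z) := mul_le_mul_of_nonneg_left (by clear K; nlinarith) hW0.le
      linarith
    have k5 : p * (a2 * b2) * (z * z * (W * (w - 1) + y * (z * w - 1 / z))) ≤
        p * (a2 * b2) * ((w * z * z - 1) * (W + y * z)) := mul_le_mul_of_nonneg_left k4 (by positivity)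
    have k6 : a2 * (w * z * z - 1) * p * (b2 * (W + y * z)) ≤ 2 * log 2 * G * (b2 * (W + y * z)) :=
      mul_le_mul_of_nonneg_right q1 (by positivity)
    have k7 := mul_le_mul_of_nonneg_left K (show 0 ≤ p * (z * z) by positivity)
    have k8 := mul_le_mul_of_nonneg_left k3 (show 0 ≤ z * z by positivity)
    have k9 : (0.9173 * 0.9169 * c * (z * z)) * (2 * G) ≤ (log 2 * (b2 * (W + y * z))) * (2 * G) := by
      rw [e2] at k7
      linarith
    have k10 := le_of_mul_le_mul_right k9 (by positivity)
    have k11 := mul_le_mul_of_nonneg_left k10 pc.le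
    have e4 : c * (0.9173 * 0.9169 * c * (z * z)) = 0.9173 * 0.9169 * c2 ^ 2 := by rw [e2]; ring
    have e5 : c * (log 2 * (b2 * (W + y * z))) = log 2 * (b2 * c * W + b * c2) := by rw [e2, e3]; ring
    rw [e4, e5] at k11
    have m1 : b2 * c * W + b * c2 ≤ 1.0161 := by
      have : b2 * c * W ≤ 1 * c * 1.0161 :=
        mul_le_mul (mul_le_mul_of_nonneg_right b21.le pc.le) hW1 hW0.le (by linarith)
      have : b * c2 ≤ b * 1 := mul_le_mul_of_nonneg_left (by linarith [h.c2_lt]) pb.le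
      have : b + c ≤ 1 := by linarith [h.a1_eq]
      linarith
    have m2 : log 2 * (b2 * c * W + b * c2) ≤ 0.6931471808 * 1.0161 :=
      mul_le_mul hln.le m1 (by positivity) (by norm_num)
    have m3 : (0.917:ℝ) ^ 2 ≤ c2 ^ 2 := pow_le_pow_left₀ (by norm_num) g1.le 2
    norm_num at k11 m2 m3
    linarith
  · have M := h.main3 (by linarith) E hx hy hz zero_le_one hL
      (f := 1 + y*z + (y*z)^2 + (y*z)^3 + (y*z)^4 + (y*z)^5) (by linarith)
    have hf : 2.69 ≤ 1 + y*z + (y*z)^2 + (y*z)^3 + (y*z)^4 + (y*z)^5 := by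
      have n2 := pow_le_pow_left₀ (by norm_num) hs.le 2
      have n3 := pow_le_pow_left₀ (by norm_num) hs.le 3
      have n4 := pow_le_pow_left₀ (by norm_num) hs.le 4
      have n5 := pow_le_pow_left₀ (by norm_num) hs.le 5
      norm_num at n2 n3 n4 n5 hs ⊢
      linarith
    generalize 1 + y*z + (y*z)^2 + (y*z)^3 + (y*z)^4 + (y*z)^5 = f at *
    have hcu : c ≤ 0.603 := by
      have j1 : 0.66 * c ≤ b := by
        have : 0.66 * (c * b2) ≤ y * z * (c * b2) := mul_le_mul_of_nonneg_right hs.le (by positivity)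
        have e : y * z * (c * b2) = b * c2 := by rw [e2, e3]; ring
        have : b * c2 ≤ b * b2 := mul_le_mul_of_nonneg_left h.c2_lt.le pb.le
        have : (0.66 * c) * b2 ≤ b * b2 := by linarith
        exact le_of_mul_le_mul_right this pb2
      norm_num at j1 ⊢
      linarith [h.a1_eq]
    have hc2 : 0.99 ≤ c2 := by
      have i1 : c ^ p ≤ c ^ 8 := by
        rw [← rpow_natCast]
        exact rpow_le_rpow_of_exponent_ge pc (by norm_num at hcu; linarith) (by push_cast; linarith)
      have i2 : c2 ^ p ≤ c2 ^ 8 := by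
        rw [← rpow_natCast]
        exact rpow_le_rpow_of_exponent_ge pc2 (by linarith [h.c2_lt]) (by push_cast; linarith)
      have i3 := pow_le_pow_left₀ pc.le hcu 8
      refine (lt_of_pow_lt_pow_left₀ 8 pc2.le ?_).le
      have := h.nc
      norm_num at i3 ⊢; linarith
    have hz1 : 1.64 ≤ z := by
      rw [hz, le_div_iff₀ pc]; norm_num at hcu hc2 ⊢; linarith
    have hW3 : W3 y (y ^ (p-2)) = (1 - y ^ 2 * y ^ (p-2)) / (1 - y ^ (p-2)) := by
      unfold W3; rw [div_eq_mul_inv]; ring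
    rw [hW3] at M
    have k := h.a2_le hp1
    have k2 : a2 * (z ^ (p-2) * z) ≤ c - b := by
      have c3 : z ^ (p-2) * z = z ^ (p-1) := by
        rw [← rpow_add_one z0.ne']; ring_nf
      rw [c3, hz, div_rpow pc2.le pc.le]
      have : 0 < c ^ (p-1) := rpow_pos_of_pos pc _
      rw [← mul_div_assoc, div_le_iff₀ this]; linarith
    have hD : 0.9169 ≤ a1 - a2 := by norm_num at a1b g2 ⊢; linarith
    generalize (1 - y ^ 2 * y ^ (p-2)) / (1 - y ^ (p-2)) = W at *
    generalize z ^ (p-2) = w at *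
    have w0 : 0 < w := by linarith
    have k3 : a2 * (c2 * (w * z)) ≤ b2 * c - b * c2 := by
      have := mul_le_mul_of_nonneg_left k2 pc2.le
      have e4 : b2 = a2 + c2 := h.b2_eq
      have := mul_pos pa pc
      rw [e4]; linarith
    have k4 : 0.9169 * 2.69 * 0.64 ≤ (a1 - a2) * f * (z - 1) :=
      mul_le_mul (mul_le_mul hD hf (by norm_num) (by linarith)) (by linarith) (by norm_num)
        (mul_nonneg (by linarith) (by linarith))
    have k5 : 0.9169 * 2.69 * 0.64 * (a2 * (c2 * (w * z))) ≤ (a1 - a2) * f * (z - 1) * (b2 * c - b * c2) :=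
      mul_le_mul k4 k3 (by positivity) (le_trans (by norm_num) k4)
    have k6 : y * (w * z - z⁻¹) + (w - 1) * W ≤ 0.5006 * (w * z) + w * 1.0161 := by
      have : y * (w * z - z⁻¹) ≤ 0.5006 * (w * z) := by
        have : y * (w * z) ≤ 0.5006 * (w * z) := mul_le_mul_of_nonneg_right hyb (by positivity)
        have : 0 < y * z⁻¹ := by positivity
        linarith
      have : w * W ≤ w * 1.0161 := mul_le_mul_of_nonneg_left hW1 w0.le
      linarith
    have k7 : b2 * b2 * (y * (w * z - z⁻¹) + (w - 1) * W) ≤ 1 * (0.5006 * (w * z) + w * 1.0161) := by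
      have : b2 * b2 ≤ 1 := mul_le_one₀ b21.le pb2.le b21.le
      refine (mul_le_mul_of_nonneg_left k6 (by positivity)).trans (mul_le_mul_of_nonneg_right this (by positivity))
    have k8 := mul_le_mul_of_nonneg_left k7 pa.le
    have k9 : (0.9169 * 2.69 * 0.64 * (c2 * z)) * (a2 * w) ≤ (0.5006 * z + 1.0161) * (a2 * w) := by linarith
    have k10 := le_of_mul_le_mul_right k9 (by positivity)
    have k11 : 0.99 * z ≤ c2 * z := mul_le_mul_of_nonneg_right hc2 z0.le
    norm_num at k10 k11 hz1
    linarith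

lemma Strict.region3 (hp : 3 ≤ p) (h : Strict p a1 a2 b b2 c c2)
    (E : EqE p a1 a2 b b2 c c2) : False := by
  rcases le_total p 4 with h4 | h4
  · exact h.region3a hp h4 E
  rcases le_total p 8 with h8 | h8
  · exact h.region3b h4 h8 E
  · exact h.region3c h8 E
end

section
open Real

/-- The comparison function of the two candidate determinants. -/
def PT : List Ins :=
  [.cst K41, .log 0, .mul 2 0, .exp 0, .cst K40, .sub 1 0, .log 0, .add 5 5,
  .add 0 1, .inv 9, .mul 0 1, .sub 0 9, .exp 0, .add 0 8, .sub 1 9, .log 1, .mul 16 0, .exp 0,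
  .log 3, .mul 19 0, .exp 0, .add 3 0, .add 18 18, .sub 1 0]

/-- Its opposite. -/
def PU : List Ins := PT ++ [.sub 1 2]

def inG {α : Type} (H : Hs) (pc r : Nat) (k : List Fm → α) : α :=
  mkf (mkN H ⟨Int.ofNat pc, r⟩ ⟨K40, 0⟩ ⟨0, 0⟩ ⟨0, 0⟩) fun f => k [f]

/-- Bisection until the output is positive. -/
def bisT (is : List Ins) : Nat → Nat → Nat → Bool
  | 0, _, _ => false
  | n + 1, pl, ph => frn (Nat.div (Nat.add pl ph) 2) fun m => frn (Nat.sub ph m) fun h =>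
    match inG ⟨h, 0, 0⟩ m 0 (posT ⟨h, 0, 0⟩ is) with
    | true => true
    | false => match bisT is n pl m with
      | true => bisT is n m ph
      | false => false

/-- Is the slope positive? -/
def slopT (is : List Ins) (pc r h : Nat) : Bool :=
  inG ⟨h, 0, 0⟩ pc r fun l => match run ⟨h, 0, 0⟩ is l with
  | none => false
  | some l => Nat.blt (lk l 0).s0.r (lk l 0).s0.m.toNat

lemma slop1 : slopT PT K40 0 17179869184 = true := by decide +kernel
lemma slop2 : slopT PU K41 0 4294967296 = true := by decide +kernel
lemma slop3 : slopT PT 2828235964416 536870912 1073741824 = true := by decide +kernel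
lemma bis1 : bisT PT 12 1116691496960 2194728288256 = true := by decide +kernel
lemma bis2 : bisT PU 14 2203318222848 2827699093504 = true := by decide +kernel
lemma bis3 : bisT PT 14 2828772835328 4398046511104 = true := by decide +kernel

lemma inG_enc {h pc r : Nat} {u v : ℝ} (hu : |u * K40 - pc| ≤ r)
    (hv : |v - u| * K40 ≤ h) : HB ⟨h, 0, 0⟩ (v - u) 0 0 ∧
    EncL (v - u) 0 0 [mkN ⟨h, 0, 0⟩ ⟨Int.ofNat pc, r⟩ ⟨K40, 0⟩ ⟨0, 0⟩ ⟨0, 0⟩] [u] [v] := by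
  have hH : HB ⟨h, 0, 0⟩ (v - u) 0 0 := ⟨hv, by simp, by simp⟩
  have z : BE ⟨0, 0⟩ 0 := by simp [BE]
  have o : BE ⟨K40, 0⟩ 1 := by simp [BE]
  exact ⟨hH, EncL.cons (mkN_ok hH (by unfold BE; exact hu) o z z (by ring)) (EncL.nil _ _ _)⟩

lemma bisT_ok {is : List Ins} : ∀ {n pl ph : Nat} {p : ℝ}, bisT is n pl ph = true →
    (pl : ℝ) ≤ p * K40 → p * K40 ≤ ph → 0 < val is [p] := by
  intro n
  induction n with
  | zero => intro pl ph p h; simp [bisT] at h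
  | succ n ih =>
    intro pl ph p h h1 h2
    have hm := mid_ok h1 h2
    simp only [bisT, frn_eq, inG, mkf_eq] at h
    generalize Nat.div (Nat.add pl ph) 2 = m at *
    split at h
    · rename_i hc
      have hu : |(m : ℝ) / K40 * K40 - m| ≤ ((0 : ℕ) : ℝ) := by
        rw [div_mul_cancel₀ _ (by norm_num)]; simp
      obtain ⟨hH, hE⟩ := inG_enc hu hm
      exact (posT_ok hH hE hc).1
    · split at h
      · rename_i hc
        rcases le_total (p * K40) m with q | q
        · exact ih hc h1 q
        · exact ih h q h2
      · simp at h

lemma slopT_ok {is : List Ins} {pc r h : Nat} {u v : ℝ} (hs : slopT is pc r h = true)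
    (hu : |u * K40 - pc| ≤ r) (hv : |v - u| * K40 ≤ h) :
    ∃ s, 0 < s ∧ val is [v] - val is [u] = s * (v - u) := by
  obtain ⟨hH, hE⟩ := inG_enc hu hv
  simp only [slopT, inG, mkf_eq] at hs
  split at hs
  · simp at hs
  · rename_i l hr
    obtain ⟨s0, s1, s2, b0, -, -, e⟩ := (run_ok hH is hE hr 0).hs
    refine ⟨s0, ?_, ?_⟩
    · have h1 := blt_lt hs
      refine pos_of_be b0 ?_
      cases hc : Nat.ble (lk l 0).s0.m.toNat (lk l 0).s0.r with
      | false => rfl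
      | true => have := Nat.le_of_ble_eq_true hc; omega
    · unfold val; linarith

/-- The normalized determinant of the axis lattice. -/
lemma T0_eq {p : ℝ} (hp : 1 ≤ p) : 0 < delta0 p * 4 ^ p⁻¹ ∧ (delta0 p * 4 ^ p⁻¹) ^ p = 4 - 4 * (1/2) ^ p ∧
    1 < delta0 p * 4 ^ p⁻¹ := by
  have h2 : (2:ℝ) ≤ 2 ^ p := by
    have := rpow_le_rpow_of_exponent_le (x := 2) (by norm_num) hp
    simpa using this
  have h0 : 0 < delta0 p * 4 ^ p⁻¹ := by
    have : (0:ℝ) < (2:ℝ) ^ p - 1 := by linarith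
    unfold delta0; positivity
  have h3 : (0:ℝ) ≤ (2:ℝ) ^ p - 1 := by linarith
  have e : (delta0 p * 4 ^ p⁻¹) ^ p = 4 - 4 * (1/2) ^ p := by
    have hd : 0 ≤ delta0 p := by unfold delta0; positivity
    rw [mul_rpow hd (by positivity), ← rpow_mul (by norm_num), inv_mul_cancel₀ (by linarith), rpow_one,
      delta0, mul_rpow (by norm_num) (by positivity), ← rpow_mul h3,
      one_div_mul_cancel (by linarith), rpow_one, div_rpow (by norm_num) (by norm_num), one_rpow]
    field_simp
  refine ⟨h0, e, ?_⟩
  by_contra hc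
  push Not at hc
  have := rpow_le_one h0.le hc (by linarith : 0 ≤ p)
  have : ((1:ℝ)/2) ^ p ≤ 1 / 2 := by
    rw [one_div, inv_rpow (by norm_num)]
    exact inv_anti₀ (by norm_num) h2
  linarith

lemma PT_val {p : ℝ} (hp : 1 ≤ p) : val PT [p] = fT p (delta0 p) := by
  have h2 : (2:ℝ) ≤ 2 ^ p := by
    have := rpow_le_rpow_of_exponent_le (x := 2) (by norm_num) hp
    simpa using this
  refine Eq.trans ?_ (T_value (p := p) (one := (((K40 : ℤ)) : ℝ) / K40)
    (two := (((K41 : ℤ)) : ℝ) / K40) (k := p⁻¹) (D := delta0 p)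
    (T' := exp (p⁻¹ * ((log ((((K41 : ℤ)) : ℝ) / K40) +
      log ((((K41 : ℤ)) : ℝ) / K40)) +
      log (exp (p * log ((((K41 : ℤ)) : ℝ) / K40)) -
        (((K40 : ℤ)) : ℝ) / K40)) -
      log ((((K41 : ℤ)) : ℝ) / K40))) cst_one cst_two rfl ?_ (T0_eq hp).2.2)
  · rfl
  · rw [cst_one, cst_two, exp_mul_log (by norm_num), exp_sub, exp_log (by norm_num), mul_add, exp_add,
      delta0, exp_mul_log (by linarith), one_div p]
    ring

lemma PU_val {p : ℝ} (hp : 1 ≤ p) : val PU [p] = - fT p (delta0 p) := by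
  rw [← PT_val hp]
  have : val PU [p] = (runR PT [p]).getD 1 0 - (runR PT [p]).getD 2 0 := rfl
  have e2 : val PT [p] = (runR PT [p]).getD 2 0 - (runR PT [p]).getD 1 0 := rfl
  rw [this, e2]; ring

lemma fT_one : fT 1 (delta0 1) = 0 := by
  unfold fT delta0; norm_num

lemma fT_two : fT 2 (delta0 2) = 0 := by
  have e := (T0_eq (p := 2) (by norm_num)).2.1
  unfold fT
  generalize delta0 2 * 4 ^ (2:ℝ)⁻¹ = T at *
  norm_num at e ⊢
  linarith

lemma fT_cont {p : ℝ} (hp : 1 ≤ p) : ContinuousAt (fun p => fT p (delta0 p)) p := by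
  have h1 := (T0_eq hp).2.2
  have h2 : (2:ℝ) ≤ 2 ^ p := by
    have := rpow_le_rpow_of_exponent_le (x := 2) (by norm_num) hp
    simpa using this
  have k1 : ContinuousAt (fun p : ℝ => (2:ℝ) ^ p) p := continuousAt_const.rpow continuousAt_id (Or.inl (by norm_num))
  have k2 : ContinuousAt (fun p : ℝ => delta0 p) p := by
    unfold delta0
    refine continuousAt_const.mul ((k1.sub continuousAt_const).rpow ?_ (Or.inl (show (2:ℝ) ^ p - 1 ≠ 0 by linarith)))
    exact continuousAt_const.div continuousAt_id (by simp; linarith)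
  have k3 : ContinuousAt (fun p : ℝ => (4:ℝ) ^ p⁻¹) p :=
    continuousAt_const.rpow (continuousAt_id.inv₀ (by simp; linarith)) (Or.inl (by norm_num))
  unfold fT
  refine ((((k2.mul k3).add continuousAt_const).rpow continuousAt_id (Or.inl ?_)).add
    (((k2.mul k3).sub continuousAt_const).rpow continuousAt_id (Or.inl ?_))).sub (continuousAt_const.mul k1)
  · show delta0 p * 4 ^ p⁻¹ + 1 ≠ 0; linarith
  · show delta0 p * 4 ^ p⁻¹ - 1 ≠ 0; linarith

/-- Large exponents. -/
lemma fT_large {p : ℝ} (hp : 4 ≤ p) : 0 ≤ fT p (delta0 p) := by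
  obtain ⟨T0, e, T1⟩ := T0_eq (p := p) (by linarith)
  have L1 := log_two_gt_d9
  have L2 := log_two_lt_d9
  have hu : 1 + log 2 * p⁻¹ ≤ 2 ^ p⁻¹ := by
    rw [rpow_def_of_pos (by norm_num)]
    linarith [add_one_le_exp (log 2 * p⁻¹)]
  have hq : p ^ 2 ≤ 2 ^ p := by
    have h1 : p ≤ 2 ^ (p / 2) := by
      have : (2:ℝ) ^ (p/2) = 4 * 2 ^ ((p - 4) / 2) := by
        rw [show p / 2 = 2 + (p - 4) / 2 by ring, rpow_add (by norm_num)]; norm_num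
      rw [this, rpow_def_of_pos (by norm_num : (0:ℝ) < 2)]
      have h2 := add_one_le_exp (log 2 * ((p - 4) / 2))
      have h3 : 0.69 * ((p - 4) / 2) ≤ log 2 * ((p - 4) / 2) :=
        mul_le_mul_of_nonneg_right (by norm_num at L1 ⊢; linarith) (by linarith)
      norm_num at h3 ⊢
      linarith
    have := pow_le_pow_left₀ (by linarith) h1 2
    rwa [← rpow_mul_natCast (by norm_num), show p / 2 * ((2:ℕ):ℝ) = p by push_cast; ring] at this
  have hTu : 2 * 2 ^ p⁻¹ ≤ delta0 p * 4 ^ p⁻¹ + 1 := by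
    obtain ⟨u, hu'⟩ : ∃ u : ℝ, u = 2 ^ p⁻¹ := ⟨_, rfl⟩
    have u0 : 0 < u := by rw [hu']; positivity
    have e4 : (4:ℝ) ^ p⁻¹ = u * u := by
      rw [hu', ← mul_rpow (by norm_num) (by norm_num)]; norm_num
    have r1 : (2:ℝ) ^ p - 1 > 0 := by nlinarith
    have hr : 1 - (p * (2 ^ p - 1))⁻¹ ≤ delta0 p := by
      have d0 := delta0_pos (p := p) (by linarith)
      have s : (1 + ((2:ℝ) ^ p - 1)⁻¹) ^ p⁻¹ ≤ 1 + p⁻¹ * ((2:ℝ) ^ p - 1)⁻¹ :=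
        rpow_one_add_le_one_add_mul_self (by have := inv_pos.2 r1; linarith) (by positivity)
          (inv_le_one_of_one_le₀ (by linarith))
      have s2 : delta0 p * (1 + ((2:ℝ) ^ p - 1)⁻¹) ^ p⁻¹ = 1 := by
        have : 1 + ((2:ℝ) ^ p - 1)⁻¹ = 2 ^ p / (2 ^ p - 1) := by field_simp; ring
        rw [this, div_rpow (by positivity) r1.le, ← rpow_mul (by norm_num), mul_inv_cancel₀ (by linarith),
          delta0, one_div p]
        have : ((2:ℝ) ^ p - 1) ^ p⁻¹ ≠ 0 := by positivity
        field_simp; norm_num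
      rw [mul_inv]
      generalize p⁻¹ * ((2:ℝ) ^ p - 1)⁻¹ = t at *
      have s3 := mul_le_mul_of_nonneg_left s d0.le
      rw [s2] at s3
      rcases le_or_gt (delta0 p) 1 with q | q
      · have t0 : 0 ≤ t := by
          by_contra hc
          push Not at hc
          nlinarith
        have := mul_le_mul_of_nonneg_right q t0
        linarith
      · by_contra hc
        push Not at hc
        nlinarith
    rw [← hu', e4]
    rw [← hu'] at hu
    have m1 : (0.69 : ℝ) ≤ p * (u - 1) := by
      have : p * (log 2 * p⁻¹) = log 2 := by field_simp
      have := mul_le_mul_of_nonneg_left hu (show 0 ≤ p by linarith)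
      norm_num at L1 ⊢
      linarith
    have m2 : u ^ 2 ≤ (u - 1) ^ 2 * (p * (2 ^ p - 1)) := by
      obtain ⟨d, hd⟩ : ∃ d, d = p * (u - 1) := ⟨_, rfl⟩
      rw [← hd] at m1
      have f1 : u = 1 + d / p := by rw [hd]; field_simp; ring
      have f2 : p + d ≤ d * (p / 0.69 + 1) := by
        have := mul_le_mul_of_nonneg_right m1 (show 0 ≤ p by linarith)
        norm_num at this ⊢
        linarith
      have f3 : (p / 0.69 + 1) ^ 2 ≤ p * (p ^ 2 - 1) := by
        norm_num
        nlinarith [mul_nonneg (sub_nonneg.2 hp) (sub_nonneg.2 hp), mul_nonneg (mul_nonneg (sub_nonneg.2 hp) (sub_nonneg.2 hp)) (sub_nonneg.2 hp)]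
      have f4 : (p + d) ^ 2 ≤ d ^ 2 * (p * (2 ^ p - 1)) := by
        have d0 : 0 ≤ d := le_trans (by norm_num) m1
        calc (p + d) ^ 2 ≤ (d * (p / 0.69 + 1)) ^ 2 := pow_le_pow_left₀ (by linarith) f2 2
          _ = d ^ 2 * (p / 0.69 + 1) ^ 2 := by ring
          _ ≤ d ^ 2 * (p * (2 ^ p - 1)) := by
            refine mul_le_mul_of_nonneg_left (f3.trans ?_) (by positivity)
            exact mul_le_mul_of_nonneg_left (by linarith) (by linarith)
      have g1 : u ^ 2 = (p + d) ^ 2 / p ^ 2 := by rw [f1]; field_simp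
      have g2 : (u - 1) ^ 2 = d ^ 2 / p ^ 2 := by rw [f1]; field_simp; ring
      rw [g1, g2, div_mul_eq_mul_div]
      exact div_le_div_of_nonneg_right f4 (by positivity)
    have m3 : u ^ 2 * (p * (2 ^ p - 1))⁻¹ ≤ (u - 1) ^ 2 := by
      rw [← div_eq_mul_inv, div_le_iff₀ (mul_pos (by linarith) r1)]; exact m2
    have m4 := mul_le_mul_of_nonneg_right hr (mul_pos u0 u0).le
    linarith
  have k1 : 2 * 2 ^ p ≤ (delta0 p * 4 ^ p⁻¹ + 1) ^ p := by
    have : ((2:ℝ) * 2 ^ p⁻¹) ^ p = 2 * 2 ^ p := by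
      rw [mul_rpow (by norm_num) (by positivity), ← rpow_mul (by norm_num), inv_mul_cancel₀ (by linarith),
        rpow_one]; ring
    rw [← this]
    exact rpow_le_rpow (by positivity) hTu (by linarith)
  have k2 : 0 ≤ (delta0 p * 4 ^ p⁻¹ - 1) ^ p := rpow_nonneg (by linarith) _
  unfold fT
  linarith

/-- The comparison of the two candidates. -/
lemma exists_p0 : ∃ p₀ : ℝ, 2.57 < p₀ ∧ p₀ < 2.58 ∧ ∀ p, 1 < p →
    ((p ≤ 2 ∨ p₀ ≤ p) → 0 ≤ fT p (delta0 p)) ∧ (2 ≤ p → p ≤ p₀ → fT p (delta0 p) ≤ 0) := by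
  have A1 : ∀ p : ℝ, 1 ≤ p → p ≤ 65/64 → 0 ≤ fT p (delta0 p) := by
    intro p h1 h2
    obtain ⟨s, s0, e⟩ := slopT_ok slop1 (u := 1) (v := p) (by norm_num)
      (by rw [abs_of_nonneg (by linarith)]; push_cast; linarith)
    rw [PT_val h1, PT_val le_rfl, fT_one] at e
    have := mul_nonneg s0.le (sub_nonneg.2 h1)
    linarith
  have A2 : ∀ p : ℝ, 65/64 ≤ p → p ≤ 511/256 → 0 ≤ fT p (delta0 p) := by
    intro p h1 h2
    have := bisT_ok bis1 (p := p) (by push_cast; linarith) (by push_cast; linarith)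
    rw [PT_val (by linarith)] at this
    exact this.le
  have A3 : ∀ p : ℝ, |p - 2| ≤ 1/256 → ∃ s, 0 < s ∧ fT p (delta0 p) = - s * (p - 2) := by
    intro p h
    have h' := abs_le.1 h
    obtain ⟨s, s0, e⟩ := slopT_ok slop2 (u := 2) (v := p) (by norm_num) (by push_cast; linarith)
    rw [PU_val (by linarith), PU_val (by norm_num), fT_two] at e
    exact ⟨s, s0, by linarith⟩
  have A4 : ∀ p : ℝ, 513/256 ≤ p → p ≤ 5267/2048 → fT p (delta0 p) < 0 := by
    intro p h1 h2
    have := bisT_ok bis2 (p := p) (by push_cast; linarith) (by push_cast; linarith)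
    rw [PU_val (by linarith)] at this
    linarith
  have A5 : ∀ p : ℝ, 5269/2048 ≤ p → p ≤ 4 → 0 < fT p (delta0 p) := by
    intro p h1 h2
    have := bisT_ok bis3 (p := p) (by push_cast; linarith) (by push_cast; linarith)
    rwa [PT_val (by linarith)] at this
  obtain ⟨p₀, ⟨hl, hr⟩, h0⟩ : (0:ℝ) ∈ (fun p => fT p (delta0 p)) '' Set.Icc (5267/2048) (5269/2048) := by
    refine intermediate_value_Icc (by norm_num) (fun x hx => (fT_cont (by linarith [hx.1])).continuousWithinAt) ?_
    exact ⟨(A4 _ (by norm_num) le_rfl).le, (A5 _ le_rfl (by norm_num)).le⟩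
  have h0' : fT p₀ (delta0 p₀) = 0 := h0
  have A6 : ∀ p : ℝ, 5267/2048 ≤ p → p ≤ 5269/2048 → ∃ s, 0 < s ∧ fT p (delta0 p) = s * (p - p₀) := by
    intro p h1 h2
    obtain ⟨s, s0, e⟩ := slopT_ok slop3 (u := p₀) (v := p)
      (by push_cast; rw [abs_le]; constructor <;> linarith)
      (by
        have : |p - p₀| ≤ 1/1024 := by rw [abs_le]; constructor <;> linarith
        push_cast; linarith)
    rw [PT_val (by linarith), PT_val (by linarith), h0'] at e
    exact ⟨s, s0, by linarith⟩
  refine ⟨p₀, by norm_num; linarith, by norm_num; linarith, fun p hp => ⟨?_, ?_⟩⟩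
  · rintro (h | h)
    · rcases le_total p (65/64) with q | q
      · exact A1 p hp.le q
      rcases le_total p (511/256) with q2 | q2
      · exact A2 p q q2
      obtain ⟨s, s0, e⟩ := A3 p (by rw [abs_le]; constructor <;> linarith)
      have := mul_nonneg s0.le (sub_nonneg.2 h)
      linarith
    · rcases le_total p (5269/2048) with q | q
      · obtain ⟨s, s0, e⟩ := A6 p (by linarith) q
        have := mul_nonneg s0.le (sub_nonneg.2 h)
        linarith
      rcases le_total p 4 with q2 | q2
      · exact (A5 p q q2).le
      · exact fT_large q2
  · intro h1 h2
    rcases le_total p (513/256) with q | q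
    · obtain ⟨s, s0, e⟩ := A3 p (by rw [abs_le]; constructor <;> linarith)
      have := mul_nonneg s0.le (sub_nonneg.2 h1)
      linarith
    rcases le_total p (5267/2048) with q2 | q2
    · exact (A4 p q q2).le
    · obtain ⟨s, s0, e⟩ := A6 p q2 (by linarith)
      have := mul_nonneg s0.le (sub_nonneg.2 h2)
      linarith
end

section
open Real

lemma hex_min {p τ : ℝ} (hp : 1 < p) (ht : IsTau p τ) {a b : ℝ × ℝ} (h : Hex p a b)
    (h0 : 0 < det2 a b) : delta0 p ≤ det2 a b ∨ delta1 p τ ≤ det2 a b := by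
  obtain ⟨a1, a2, b1, b2, hc, hd, hm, E⟩ := exists_canon hp
  have hab := hm a b h h0
  suffices delta0 p ≤ a1 * b2 - a2 * b1 ∨ delta1 p τ ≤ a1 * b2 - a2 * b1 from
    this.imp (fun q => q.trans hab) (fun q => q.trans hab)
  rcases hc.a2_nonneg.eq_or_lt with z | z
  · exact Or.inl (hc.axis hp z.symm).ge
  rcases hc.a2_le.eq_or_lt with w | w
  · exact Or.inr (hc.diag hp w ht).ge
  by_cases hp2 : p = 2
  · subst hp2; exact Or.inl hc.two
  exfalso
  have hs := hc.strict hp z w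
  rcases le_total p 2.01 with q | q
  · exact Psi.of hp hp2 q hs (hs.hyp hp E)
  rcases le_total p 3 with q3 | q3
  · obtain ⟨x, y, k1, k2, k3⟩ := hex_axis hp
    obtain ⟨x', y', m1, m2, m3⟩ := hex_diag hp ht
    exact hs.region2 q q3 E ht (m3 ▸ hm x' y' m1 m2) (k3 ▸ hm x y k1 k2)
  · exact hs.region3 q3 E

lemma fT_smono {p D E : ℝ} (hp : 1 < p) (h1 : 1 ≤ D * 4 ^ p⁻¹) (h : D < E) : fT p D < fT p E := by
  unfold fT
  have h2 : D * 4 ^ p⁻¹ < E * 4 ^ p⁻¹ := mul_lt_mul_of_pos_right h (by positivity)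
  have h3 : (D * 4 ^ p⁻¹ + 1) ^ p < (E * 4 ^ p⁻¹ + 1) ^ p :=
    rpow_lt_rpow (by linarith) (by linarith) (by linarith)
  have h4 : (D * 4 ^ p⁻¹ - 1) ^ p < (E * 4 ^ p⁻¹ - 1) ^ p :=
    rpow_lt_rpow (by linarith) (by linarith) (by linarith)
  linarith

lemma delta1_ge {p τ : ℝ} (ht : IsTau p τ) : 1 ≤ delta1 p τ * 4 ^ p⁻¹ := by
  obtain ⟨t0, t1, -⟩ := ht
  have e : delta1 p τ * 4 ^ p⁻¹ = (1 + τ) / (1 - τ) := by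
    unfold delta1
    rw [neg_div, one_div, rpow_neg (by norm_num)]
    have : (0:ℝ) < 4 ^ p⁻¹ := by positivity
    field_simp
  rw [e, le_div_iff₀ (by linarith)]; linarith
end

end Mk

end

open Real

/-- there is `p₀ ∈ (2.57, 2.58)` such that the critical determinant of the
Minkowski ball `D_p` equals `4^(-1/p)·(1+τ_p)/(1-τ_p)` for `1 < p ≤ 2` or `p ≥ p₀`,
and equals `(1/2)·(2^p-1)^(1/p)` for `2 ≤ p ≤ p₀`, where `τ_p ∈ [0,1)` satisfies
`2(1-τ_p)^p = 1+τ_p^p`. -/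
theorem stmt_4 :
    ∃ p₀ : ℝ, 2.57 < p₀ ∧ p₀ < 2.58 ∧
      ∀ p τ : ℝ, 0 ≤ τ → τ < 1 → 2 * (1 - τ) ^ p = 1 + τ ^ p →
        (((1 < p ∧ p ≤ 2) ∨ p₀ ≤ p) →
          criticalDet (ballD p) =
            ENNReal.ofReal ((4 : ℝ) ^ (-1 / p) * (1 + τ) / (1 - τ))) ∧
        ((2 ≤ p ∧ p ≤ p₀) →
          criticalDet (ballD p) =
            ENNReal.ofReal ((1 / 2) * ((2 : ℝ) ^ p - 1) ^ (1 / p))) := by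
  obtain ⟨p₀, h1, h2, H⟩ := Mk.exists_p0
  refine ⟨p₀, h1, h2, fun p τ t0 t1 e => ⟨fun h => ?_, fun h => ?_⟩⟩
  · have hp : 1 < p := by
      rcases h with h | h
      · exact h.1
      · norm_num at h1; linarith
    have ht : Mk.IsTau p τ := ⟨t0, t1, e⟩
    have hf := (H p hp).1 (h.imp (fun q => q.2) id)
    have hle : Mk.delta1 p τ ≤ Mk.delta0 p := by
      by_contra hc
      push Not at hc
      have := Mk.fT_smono hp (Mk.T0_eq hp.le).2.2.le hc
      rw [Mk.fT_delta1 ht] at this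
      linarith
    refine Mk.criticalDet_eq hp (Mk.hex_diag hp ht) fun a b hx h0 => ?_
    rcases Mk.hex_min hp ht hx h0 with q | q
    · exact hle.trans q
    · exact q
  · have hp : 1 < p := by linarith [h.1]
    have ht : Mk.IsTau p τ := ⟨t0, t1, e⟩
    have hf := (H p hp).2 h.1 h.2
    have hle : Mk.delta0 p ≤ Mk.delta1 p τ := by
      by_contra hc
      push Not at hc
      have := Mk.fT_smono hp (Mk.delta1_ge ht) hc
      rw [Mk.fT_delta1 ht] at this
      linarith
    refine Mk.criticalDet_eq hp (Mk.hex_axis hp) fun a b hx h0 => ?_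
    rcases Mk.hex_min hp ht hx h0 with q | q
    · exact q
    · exact hle.trans q
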